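/- For every integer m ≥ 1, every list of total degrees d_1,…,d_m and every integer n ≥ 3, there exists a constant C = C(m, d_1,…,d_m, n) with the following property. Let q be a prime power of characteristic p, and let F_1,…,F_m ∈ F_q[t][x] be pairwise non-associate irreducible polynomials with deg F_i = d_i and deg_x F_i = r_i > 0, each monic in x, each separable over F_q(t) (i.e. F_i ∉ F_q[t][x^p]), and suppose n ≥ sl F_i for 1 ≤ i ≤ m. Set N_i = r_i n and let μ_i be the number of irreducible factors of F_i(t,x) over the algebraic closure of F_q. Then |#{f ∈ F_q[t] : deg f = n and F_i(t,f) ∈ F_q[t] is irreducible for all 1 ≤ i ≤ m} − (∏_{i=1}^m μ_i/N_i)·q^{n+1}| ≤ C·q^{n+1/2}. -/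

import Mathlib

open Polynomial

/-- The slope of `P(t,x) = Σ_{j=0}^r c_j(t) x^j ∈ K[t][x]` monic in `x` (with `x` the
outer variable): `sl P = max_{1 ≤ j ≤ r} deg c_{r-j}(t) / j`, where `deg 0 = ⊥`. -/
noncomputable def slopeX {K : Type} [Field K] (P : Polynomial (Polynomial K)) : WithBot ℚ :=
  (Finset.Icc 1 P.natDegree).sup fun j =>
    ((P.coeff (P.natDegree - j)).degree).map fun d : ℕ => (d : ℚ) / (j : ℚ)

/-- The total degree of a polynomial `P ∈ K[t][x]` (with `x` the outer variable). -/
noncomputable def totalDeg {K : Type} [Field K] (P : Polynomial (Polynomial K)) : ℕ :=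
  (Finset.range (P.natDegree + 1)).sup fun j => j + (P.coeff j).natDegree

set_option linter.all false

open Polynomial
namespace BH

section Filt
variable (k : Type*) {A : Type*} [Field k] [CommRing A] [Algebra k A]

/-- filtration by weighted degree -/
def filt (a θ : A) (d E : ℕ) : Submodule k A :=
  Submodule.span k {z | ∃ i l, i + d * l ≤ E ∧ z = a ^ i * θ ^ l}

variable {k} {a θ : A} {d : ℕ}

lemma filt_mono {E E' : ℕ} (h : E ≤ E') : filt k a θ d E ≤ filt k a θ d E' := by
  apply Submodule.span_mono
  rintro z ⟨i, l, h1, h2⟩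
  exact ⟨i, l, h1.trans h, h2⟩

lemma filt_gen {i l E : ℕ} (h : i + d * l ≤ E) : a ^ i * θ ^ l ∈ filt k a θ d E :=
  Submodule.subset_span ⟨i, l, h, rfl⟩

lemma filt_mul {E E' : ℕ} {x y : A} (hx : x ∈ filt k a θ d E) (hy : y ∈ filt k a θ d E') :
    x * y ∈ filt k a θ d (E + E') := by
  have := Submodule.mul_mem_mul hx hy
  unfold filt at this
  rw [Submodule.span_mul_span] at this
  refine Submodule.span_mono ?_ this
  rintro z ⟨_, ⟨i, l, h, rfl⟩, _, ⟨i', l', h', rfl⟩, rfl⟩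
  refine ⟨i + i', l + l', by rw [mul_add]; omega, by ring⟩

lemma filt_one (E : ℕ) : (1 : A) ∈ filt k a θ d E := by
  simpa using filt_gen (k := k) (a := a) (θ := θ) (d := d) (i := 0) (l := 0) (E := E) (by simp)

lemma filt_pow {E : ℕ} {x : A} (hx : x ∈ filt k a θ d E) (n : ℕ) :
    x ^ n ∈ filt k a θ d (n * E) := by
  induction n with
  | zero => simpa using filt_one 0
  | succ n ih => rw [pow_succ, add_mul, one_mul]; exact filt_mul ih hx

lemma filt_a {E : ℕ} (h : 1 ≤ E) : a ∈ filt k a θ d E := by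
  simpa using filt_gen (k := k) (a := a) (θ := θ) (d := d) (i := 1) (l := 0) (E := E) (by simpa)

lemma filt_θ {E : ℕ} (h : d ≤ E) : θ ∈ filt k a θ d E := by
  simpa using filt_gen (k := k) (a := a) (θ := θ) (d := d) (i := 0) (l := 1) (E := E) (by simpa)

/-- hypotheses on the coordinate ring of the curve -/
structure Curve (k : Type*) {A : Type*} [Field k] [CommRing A] [Algebra k A]
    (a θ : A) (d M : ℕ) : Prop where
  rel : ∃ c : ℕ → ℕ → k, θ ^ M =
    ∑ l ∈ Finset.range M, ∑ i ∈ Finset.range (d + 1), c i l • (a ^ i * θ ^ l)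
  indep : LinearIndependent k (fun x : ℕ × Fin M => a ^ x.1 * θ ^ (x.2 : ℕ))
  span : ∀ x : A, ∃ E, x ∈ filt k a θ d E

variable {M : ℕ}

lemma Curve.red (h : Curve k a θ d M) (E : ℕ) (l i : ℕ) (hl : i + d * l ≤ E) :
    a ^ i * θ ^ l ∈ Submodule.span k
      (Set.range (fun x : Fin (E + 1) × Fin M => a ^ (x.1 : ℕ) * θ ^ (x.2 : ℕ))) := by
  induction l using Nat.strong_induction_on generalizing i with
  | _ l ih =>
    by_cases hlM : l < M
    · exact Submodule.subset_span ⟨(⟨i, by omega⟩, ⟨l, hlM⟩), rfl⟩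
    · obtain ⟨c, hc⟩ := h.rel
      push Not at hlM
      obtain ⟨e, rfl⟩ := Nat.exists_eq_add_of_le hlM
      have : a ^ i * θ ^ (M + e) = ∑ l ∈ Finset.range M, ∑ i' ∈ Finset.range (d + 1),
          c i' l • (a ^ (i + i') * θ ^ (l + e)) := by
        rw [pow_add, hc, Finset.sum_mul, Finset.mul_sum]
        refine Finset.sum_congr rfl fun l _ => ?_
        rw [Finset.sum_mul, Finset.mul_sum]
        refine Finset.sum_congr rfl fun j _ => ?_
        simp only [Algebra.smul_def]
        ring
      rw [this]
      refine Submodule.sum_mem _ fun l hl' => Submodule.sum_mem _ fun j hj => ?_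
      refine Submodule.smul_mem _ _ (ih _ ?_ _ ?_)
      · simp at hl'; omega
      · simp at hl' hj
        have : d * (l + e + 1) ≤ d * (M + e) := Nat.mul_le_mul_left _ (by omega)
        rw [mul_add _ _ 1] at this
        omega

lemma Curve.filt_le (h : Curve k a θ d M) (E : ℕ) : filt k a θ d E ≤ Submodule.span k
      (Set.range (fun x : Fin (E + 1) × Fin M => a ^ (x.1 : ℕ) * θ ^ (x.2 : ℕ))) := by
  apply Submodule.span_le.2
  rintro z ⟨i, l, h1, rfl⟩
  exact h.red E l i h1

lemma Curve.fd (h : Curve k a θ d M) (E : ℕ) : FiniteDimensional k (filt k a θ d E) := by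
  haveI : FiniteDimensional k (Submodule.span k
      (Set.range (fun x : Fin (E + 1) × Fin M => a ^ (x.1 : ℕ) * θ ^ (x.2 : ℕ)))) :=
    FiniteDimensional.span_of_finite k (Set.finite_range _)
  exact Submodule.finiteDimensional_of_le (h.filt_le E)

lemma Curve.finrank_le (h : Curve k a θ d M) (E : ℕ) :
    Module.finrank k (filt k a θ d E) ≤ M * (E + 1) := by
  haveI : FiniteDimensional k (Submodule.span k
      (Set.range (fun x : Fin (E + 1) × Fin M => a ^ (x.1 : ℕ) * θ ^ (x.2 : ℕ)))) :=
    FiniteDimensional.span_of_finite k (Set.finite_range _)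
  refine (Submodule.finrank_mono (h.filt_le E)).trans ?_
  refine (finrank_range_le_card _).trans ?_
  simp [mul_comm]

lemma Curve.le_finrank (h : Curve k a θ d M) (E : ℕ) :
    M * (E + 1 - d * M) ≤ Module.finrank k (filt k a θ d E) := by
  haveI := h.fd E
  let v : Fin (E + 1 - d * M) × Fin M → filt k a θ d E := fun x =>
    ⟨a ^ (x.1 : ℕ) * θ ^ (x.2 : ℕ), filt_gen (by
      have := x.1.2
      have : d * (x.2 : ℕ) ≤ d * M := Nat.mul_le_mul_left _ x.2.2.le
      omega)⟩
  have hv : LinearIndependent k v := by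
    apply LinearIndependent.of_comp (filt k a θ d E).subtype
    have := h.indep.comp (fun x : Fin (E + 1 - d * M) × Fin M => ((x.1 : ℕ), x.2)) (by
      rintro ⟨x, y⟩ ⟨x', y'⟩ h
      simp [Fin.ext_iff] at h ⊢
      exact h)
    exact this
  have := hv.fintype_card_le_finrank
  simpa [mul_comm] using this

/-- order-of-vanishing bound -/
lemma Curve.zeros [IsDomain A] (h : Curve k a θ d M) {ι : Type*} [Fintype ι] (m : ℕ)
    (ψ : ι → A →ₐ[k] PowerSeries k)
    (hinj : Function.Injective fun s => (PowerSeries.constantCoeff (R := k)).comp (ψ s).toRingHom)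
    (hsurj : ∀ s g, ∃ x : A, (PowerSeries.X : PowerSeries k) ^ m ∣ ψ s x - g)
    {H : A} (hH : H ≠ 0) {E : ℕ} (hE : H ∈ filt k a θ d E)
    (hv : ∀ s, (PowerSeries.X : PowerSeries k) ^ m ∣ ψ s H) :
    Fintype.card ι * m ≤ M * (E + d * M) := by
  classical
  let T : A →ₗ[k] (ι × Fin m → k) := LinearMap.pi fun x =>
    (PowerSeries.coeff (R := k) (x.2 : ℕ)).comp (ψ x.1).toLinearMap
  have hT : Function.Surjective T := by
    let J : ι → Ideal A := fun s => RingHom.ker ((PowerSeries.constantCoeff (R := k)).comp (ψ s).toRingHom)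
    have hJ : ∀ s, (J s).IsMaximal := fun s => RingHom.ker_isMaximal_of_surjective _ (by
      intro c
      refine ⟨algebraMap k A c, ?_⟩
      simp)
    have hJne : ∀ s t, s ≠ t → J s ≠ J t := by
      intro s t hst heq
      apply hst
      apply hinj
      ext x
      have h1 : x - algebraMap k A (PowerSeries.constantCoeff (ψ s x)) ∈ J s := by
        simp [J, RingHom.mem_ker]
      rw [heq] at h1
      simp [J, RingHom.mem_ker] at h1
      have := sub_eq_zero.1 h1
      simp [this]
    let I : ι → Ideal A := fun s => (Ideal.span {(PowerSeries.X : PowerSeries k) ^ m}).comap (ψ s)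
    have hIJ : ∀ s, J s ^ m ≤ I s := by
      intro s
      have : J s ≤ (Ideal.span {(PowerSeries.X : PowerSeries k)}).comap (ψ s) := by
        intro x hx
        simp [J, RingHom.mem_ker] at hx
        simp [Ideal.mem_span_singleton, PowerSeries.X_dvd_iff, hx]
      refine (Ideal.pow_right_mono this m).trans ?_
      refine (Ideal.le_comap_pow _ m).trans ?_
      simp [I, Ideal.span_singleton_pow]
    have hco : Pairwise fun s t => IsCoprime (I s) (I t) := by
      intro s t hst
      have : IsCoprime (J s) (J t) := by
        rw [Ideal.isCoprime_iff_sup_eq]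
        exact (hJ s).coprime_of_ne (hJ t) (hJne s t hst)
      have := (this.pow (m := m) (n := m))
      rw [Ideal.isCoprime_iff_sup_eq] at this ⊢
      rw [eq_top_iff, ← this]
      exact sup_le_sup (hIJ s) (hIJ t)
    intro g
    choose y hy using fun s => hsurj s (PowerSeries.mk fun n => if hn : n < m then g (s, ⟨n, hn⟩) else 0)
    obtain ⟨x, hx⟩ := Ideal.exists_forall_sub_mem_ideal (I := I) hco y
    refine ⟨x, ?_⟩
    funext ⟨s, n⟩
    have h1 : (PowerSeries.X : PowerSeries k) ^ m ∣ ψ s (x - y s) := by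
      have := hx s
      simpa [I, Ideal.mem_span_singleton] using this
    have h2 := PowerSeries.X_pow_dvd_iff.1 (dvd_add h1 (hy s)) n n.2
    simp only [map_sub, sub_add_sub_cancel] at h2
    rw [PowerSeries.coeff_mk, sub_eq_zero] at h2
    simpa [T] using h2
  -- choose the auxiliary exponent large
  obtain ⟨E', hE'⟩ : ∃ E', ∀ x : ι × Fin m, ∃ y ∈ filt k a θ d (E + E'), T y = Pi.single x 1 := by
    choose y hy using fun x : ι × Fin m => hT (Pi.single x 1)
    choose e he using fun x => h.span (y x)
    refine ⟨(∑ x, e x) + d * M, fun x => ⟨y x, filt_mono ?_ (he x), hy x⟩⟩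
    have := Finset.single_le_sum (f := e) (fun i _ => Nat.zero_le _) (Finset.mem_univ x)
    omega
  have hE'' := hE'
  haveI := h.fd (E + (E' + d * M))
  haveI := h.fd (E' + d * M)
  let T' := T.domRestrict (filt k a θ d (E + (E' + d * M)))
  have hT' : Function.Surjective T' := by
    rw [← LinearMap.range_eq_top, eq_top_iff, ← (Pi.basisFun k (ι × Fin m)).span_eq]
    apply Submodule.span_le.2
    rintro _ ⟨x, rfl⟩
    obtain ⟨y, hy, hy'⟩ := hE' x
    exact ⟨⟨y, filt_mono (by omega) hy⟩, by simpa [T'] using hy'⟩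
  let mulH : filt k a θ d (E' + d * M) →ₗ[k] LinearMap.ker T' :=
    LinearMap.codRestrict _ (LinearMap.codRestrict _
      ((LinearMap.mulLeft k H).comp (Submodule.subtype _)) (fun x => filt_mul hE x.2)) (by
      intro x
      rw [LinearMap.mem_ker]
      funext ⟨s, n⟩
      have : (PowerSeries.X : PowerSeries k) ^ m ∣ ψ s (H * x) := by
        rw [map_mul]; exact (hv s).mul_right _
      exact PowerSeries.X_pow_dvd_iff.1 this n n.2)
  have hmul : Function.Injective mulH := by
    intro x y hxy
    have : H * (x : A) = H * (y : A) :=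
      congrArg (fun z : LinearMap.ker T' => ((z : filt k a θ d (E + (E' + d * M))) : A)) hxy
    exact Subtype.ext (mul_left_cancel₀ hH this)
  have h1 := LinearMap.finrank_le_finrank_of_injective hmul
  have h2 := LinearMap.finrank_range_add_finrank_ker T'
  rw [LinearMap.range_eq_top.2 hT', finrank_top] at h2
  have h3 := h.finrank_le (E + (E' + d * M))
  have h4 := h.le_finrank (E' + d * M)
  have h5 : E' + d * M + 1 - d * M = E' + 1 := by omega
  rw [h5] at h4
  simp at h2
  have h6 : M * (E + (E' + d * M) + 1) = M * (E + d * M) + M * (E' + 1) := by ring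
  omega

end Filt
end BH

open Polynomial
namespace BH

section Step
variable {k A : Type*} [Field k] [CommRing A] [Algebra k A] {a θ : A} {d M : ℕ}

lemma ps_pow_q {R : Type*} [CommRing R] {p e : ℕ} [ExpChar R p] (g : PowerSeries R) :
    (PowerSeries.X : PowerSeries R) ^ (p ^ e) ∣
      g ^ (p ^ e) - PowerSeries.C ((PowerSeries.constantCoeff g) ^ (p ^ e)) := by
  haveI : ExpChar (PowerSeries R) p := expChar_of_injective_ringHom
    (PowerSeries.C_injective (R := R)) p
  rw [map_pow, ← sub_pow_expChar_pow]
  apply pow_dvd_pow_of_dvd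
  rw [PowerSeries.X_dvd_iff]
  simp

lemma Curve.zeros_one [IsDomain A] (h : Curve k a θ d M) (m : ℕ)
    (φ : A →ₐ[k] PowerSeries k)
    (hsurj : ∀ g, ∃ x : A, (PowerSeries.X : PowerSeries k) ^ m ∣ φ x - g)
    {H : A} (hH : H ≠ 0) {E : ℕ} (hE : H ∈ filt k a θ d E)
    (hv : (PowerSeries.X : PowerSeries k) ^ m ∣ φ H) :
    m ≤ M * (E + d * M) := by
  have := h.zeros (ι := Unit) m (fun _ => φ) (fun _ _ _ => rfl) (fun _ => hsurj) hH hE (fun _ => hv)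
  simpa using this

lemma Curve.nonvan [IsDomain A] (h : Curve k a θ d M) {p e : ℕ} [ExpChar k p] [PerfectRing k p]
    (φ : A →ₐ[k] PowerSeries k)
    (hsurj : ∀ m g, ∃ x : A, (PowerSeries.X : PowerSeries k) ^ m ∣ φ x - g)
    {U : ℕ} (hU : M * (U + d * M) < p ^ e) {ι : Type*} [Fintype ι] (w : ι → A)
    (hw : LinearIndependent k w) (u : ι → A) (hu : ∀ j, u j ∈ filt k a θ d U)
    (h0 : ∑ j, u j * w j ^ (p ^ e) = 0) : ∀ j, u j = 0 := by
  classical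
  haveI := h.fd U
  haveI : ExpChar A p := expChar_of_injective_ringHom (algebraMap k A).injective p
  let b := Module.finBasis k (filt k a θ d U)
  have hroot : ∀ r : k, ∃ γ : k, γ ^ (p ^ e) = r := fun r =>
    ⟨(iterateFrobeniusEquiv k p e).symm r, by
      rw [← iterateFrobenius_def, ← coe_iterateFrobeniusEquiv]; simp⟩
  choose γ hγ using fun (i : Fin (Module.finrank k (filt k a θ d U))) (j : ι) =>
    hroot (b.repr ⟨u j, hu j⟩ i)
  have hub : ∀ j, u j = ∑ i, γ i j ^ (p ^ e) • (b i : A) := by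
    intro j
    have := congrArg (Subtype.val) (b.sum_repr ⟨u j, hu j⟩)
    simp only [Submodule.coe_sum, Submodule.coe_smul] at this
    simp only [hγ]
    exact this.symm
  let v : Fin (Module.finrank k (filt k a θ d U)) → A := fun i => ∑ j, γ i j • w j
  have hv0 : ∑ i, (b i : A) * v i ^ (p ^ e) = 0 := by
    rw [← h0]
    simp only [hub, v, sum_pow_char_pow, Finset.sum_mul, Finset.mul_sum]
    rw [Finset.sum_comm]
    refine Finset.sum_congr rfl fun j _ => Finset.sum_congr rfl fun i _ => ?_
    rw [_root_.smul_pow]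
    simp only [Algebra.smul_def]
    ring
  by_contra hcon
  push Not at hcon
  obtain ⟨j, hj⟩ := hcon
  have hvi : ∃ i, v i ≠ 0 := by
    by_contra hall
    push Not at hall
    apply hj
    rw [hub j]
    refine Finset.sum_eq_zero fun i _ => ?_
    have := Fintype.linearIndependent_iff.1 hw (γ i) (hall i) j
    rw [this, zero_pow (by have := expChar_pos k p; positivity), zero_smul]
  have hex : ∃ n, ∃ i, PowerSeries.coeff n (φ (v i)) ≠ 0 := by
    obtain ⟨i, hi⟩ := hvi
    obtain ⟨E, hE⟩ := h.span (v i)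
    by_contra hall
    push Not at hall
    have := h.zeros_one (M * (E + d * M) + 1) φ (hsurj _) hi hE
      (PowerSeries.X_pow_dvd_iff.2 fun n _ => hall n i)
    omega
  let n := Nat.find hex
  obtain ⟨i0, hi0⟩ := Nat.find_spec hex
  have hmin : ∀ i, (PowerSeries.X : PowerSeries k) ^ n ∣ φ (v i) := by
    intro i
    refine PowerSeries.X_pow_dvd_iff.2 fun t ht => ?_
    by_contra hne
    exact Nat.find_min hex ht ⟨i, hne⟩
  choose g hg using hmin
  have hκ : PowerSeries.constantCoeff (g i0) ≠ 0 := by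
    rw [hg] at hi0
    have : PowerSeries.coeff n (PowerSeries.X ^ n * g i0) = PowerSeries.coeff 0 (g i0) := by
      simpa using PowerSeries.coeff_X_pow_mul (g i0) n 0
    rw [← PowerSeries.coeff_zero_eq_constantCoeff_apply, ← this]
    exact hi0
  have hs : ∑ i, φ (b i : A) * g i ^ (p ^ e) = 0 := by
    have := congrArg φ hv0
    simp only [map_sum, map_mul, map_pow, hg, map_zero] at this
    have h2 : ((PowerSeries.X : PowerSeries k) ^ n) ^ (p ^ e) * ∑ i, φ (b i : A) * g i ^ (p ^ e) = 0 := by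
      rw [← this, Finset.mul_sum]
      refine Finset.sum_congr rfl fun i _ => ?_
      ring
    exact (mul_eq_zero.1 h2).resolve_left (pow_ne_zero _ (pow_ne_zero _ PowerSeries.X_ne_zero))
  let G : A := ∑ i, (PowerSeries.constantCoeff (g i)) ^ (p ^ e) • (b i : A)
  have hGdiv : (PowerSeries.X : PowerSeries k) ^ (p ^ e) ∣ φ G := by
    have : φ G = - ∑ i, φ (b i : A) * (g i ^ (p ^ e) -
        PowerSeries.C ((PowerSeries.constantCoeff (g i)) ^ (p ^ e))) := by
      simp only [mul_sub, Finset.sum_sub_distrib, hs, G, map_sum, map_smul]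
      simp only [zero_sub, neg_neg]
      refine Finset.sum_congr rfl fun i _ => ?_
      rw [PowerSeries.smul_eq_C_mul, mul_comm]
    rw [this]
    exact (Finset.dvd_sum fun i _ => (ps_pow_q (g i)).mul_left _).neg_right
  have hG0 : G ≠ 0 := by
    intro hG
    have hb : LinearIndependent k (fun i => (b i : A)) :=
      b.linearIndependent.map' (Submodule.subtype _) (Submodule.ker_subtype _)
    have := Fintype.linearIndependent_iff.1 hb _ hG i0
    exact hκ (pow_eq_zero_iff (by have := expChar_pos k p; positivity) |>.1 this)
  have hGU : G ∈ filt k a θ d U := Submodule.sum_mem _ fun i _ => Submodule.smul_mem _ _ (b i).2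
  have := h.zeros_one _ φ (hsurj _) hG0 hGU hGdiv
  omega

/-- The Stepanov inequality, abstractly. -/
lemma Curve.stepanov [IsDomain A] (h : Curve k a θ d M) {p e : ℕ} [ExpChar k p] [PerfectRing k p]
    (Θ : A →ₐ[k] PowerSeries A) {c : ℕ}
    (hΘ : ∀ E, ∀ x ∈ filt k a θ d E, ∀ i, PowerSeries.coeff i (Θ x) ∈ filt k a θ d (E + c * i))
    (hΘ0 : ∀ x, PowerSeries.constantCoeff (Θ x) = x) {D : A}
    (hΘa : Θ a = PowerSeries.C a + PowerSeries.C (D ^ 2) * PowerSeries.X)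
    {ι : Type*} [Fintype ι] (ψ : ι → A →ₐ[k] k) (hinj : Function.Injective ψ)
    (hD : ∀ s, ψ s D ≠ 0) (ha : ∀ s, (ψ s a) ^ (p ^ e) = ψ s a) {x : A}
    (hx : ∀ s, ψ s D * (ψ s θ) ^ (p ^ e) = ψ s x) {B : ℕ} (hDB : D ∈ filt k a θ d B)
    (hxB : x ∈ filt k a θ d B) (hM : 0 < M) (m1 U : ℕ) (h1 : M * (U + d * M) < p ^ e)
    (h2 : M * m1 ≤ p ^ e) (h3 : m1 * (c * (M * m1) + m1 + M * B + 1 + d * M) + d * M ≤ U) :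
    Fintype.card ι * (M * m1) ≤ M * (U + p ^ e * (m1 + d * M) + d * M) := by
  classical
  rcases isEmpty_or_nonempty ι with hemp | ⟨⟨s0⟩⟩
  · simp
  set q := p ^ e with hq
  set W := m1 with hW
  set m := M * m1 with hm
  haveI := h.fd U
  set E1 := U + c * m + W + M * B with hE1
  haveI := h.fd E1
  let Ψ : ι → A →ₐ[k] PowerSeries k := fun s => (PowerSeries.mapAlgHom (ψ s)).comp Θ
  have hΨ0 : ∀ s y, PowerSeries.constantCoeff (Ψ s y) = ψ s y := by
    intro s y
    have : PowerSeries.constantCoeff (Ψ s y) = ψ s (PowerSeries.constantCoeff (Θ y)) := by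
      change PowerSeries.constantCoeff (PowerSeries.map (ψ s : A →+* k) (Θ y)) = _
      rfl
    rw [this, hΘ0]
  have hΨa : ∀ s, Ψ s a = PowerSeries.C (ψ s a) + PowerSeries.C (ψ s D ^ 2) * PowerSeries.X := by
    intro s
    change PowerSeries.map (ψ s : A →+* k) (Θ a) = _
    simp [hΘa]
  have hsurj : ∀ s m g, ∃ y : A, (PowerSeries.X : PowerSeries k) ^ m ∣ Ψ s y - g := by
    intro s m g
    refine ⟨aeval (algebraMap k A ((ψ s D ^ 2)⁻¹) * (a - algebraMap k A (ψ s a)))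
      (PowerSeries.trunc m g), ?_⟩
    rw [← Polynomial.aeval_algHom_apply]
    have : Ψ s (algebraMap k A ((ψ s D ^ 2)⁻¹) * (a - algebraMap k A (ψ s a))) = PowerSeries.X := by
      rw [map_mul, map_sub, hΨa, AlgHom.commutes, AlgHom.commutes]
      simp only [PowerSeries.algebraMap_apply, Algebra.algebraMap_self, RingHom.id_apply]
      rw [add_sub_cancel_left, ← mul_assoc, ← map_mul, inv_mul_cancel₀ (pow_ne_zero _ (hD s)), map_one,
        one_mul]
    rw [this, PowerSeries.X_pow_dvd_iff]
    intro n hn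
    have h5 : aeval (PowerSeries.X : PowerSeries k) (PowerSeries.trunc m g) = (PowerSeries.trunc m g : PowerSeries k) := by
      have := Polynomial.aeval_algHom_apply (Polynomial.coeToPowerSeries.algHom (R := k) k) X
        (PowerSeries.trunc m g)
      simpa using this
    rw [h5, map_sub, Polynomial.coeff_coe, PowerSeries.coeff_trunc, if_pos hn, sub_self]
  -- the system
  let z : Fin (W + 1) × Fin M → A := fun j => a ^ (j.1 : ℕ) * D ^ (M - (j.2 : ℕ)) * x ^ (j.2 : ℕ)
  have hz : ∀ j, z j ∈ filt k a θ d (W + M * B) := by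
    intro j
    have e1 : a ^ (j.1 : ℕ) ∈ filt k a θ d W := by
      simpa using filt_gen (k := k) (a := a) (θ := θ) (d := d) (i := j.1) (l := 0) (E := W)
        (by have := j.1.2; simp; omega)
    have e2 := filt_mul (filt_mul e1 (filt_pow hDB (M - (j.2 : ℕ)))) (filt_pow hxB (j.2 : ℕ))
    refine filt_mono ?_ e2
    have : M = (M - (j.2 : ℕ)) + j.2 := by have := j.2.2; omega
    conv_rhs => rw [this, add_mul]
    omega
  let L : (Fin (W + 1) × Fin M → filt k a θ d U) →ₗ[k] (Fin m → filt k a θ d E1) :=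
    LinearMap.pi fun i => LinearMap.codRestrict _
      (∑ j, (LinearMap.mulRight k (z j)).comp
        (((PowerSeries.coeff (R := A) (i : ℕ)).restrictScalars k).comp
          (Θ.toLinearMap.comp ((Submodule.subtype _).comp (LinearMap.proj j))))) (by
      intro u
      rw [LinearMap.sum_apply]
      refine Submodule.sum_mem _ fun j _ => ?_
      have := filt_mul (hΘ U (u j) (u j).2 i) (hz j)
      refine filt_mono ?_ this
      have : c * (i : ℕ) ≤ c * m := Nat.mul_le_mul_left _ i.2.le
      omega)
  have hker : LinearMap.ker L ≠ ⊥ := by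
    apply LinearMap.ker_ne_bot_of_finrank_lt
    rw [Module.finrank_pi_fintype, Module.finrank_pi_fintype]
    simp only [Finset.sum_const, Finset.card_univ, Fintype.card_prod, Fintype.card_fin, smul_eq_mul]
    have f1 := h.le_finrank U
    have f2 := h.finrank_le E1
    obtain ⟨V, hV⟩ : ∃ V, U = V + d * M := ⟨U - d * M, by omega⟩
    have hV2 : U + 1 - d * M = V + 1 := by omega
    rw [hV2] at f1
    calc m * Module.finrank k (filt k a θ d E1) ≤ m * (M * (E1 + 1)) := Nat.mul_le_mul_left _ f2
      _ < (W + 1) * M * (M * (V + 1)) := by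
        have : m1 * (E1 + 1) < (W + 1) * (V + 1) := by
          have e3 : m1 * (E1 + 1) = m1 * V + m1 * (c * m + m1 + M * B + 1 + d * M) := by
            rw [hE1, hV, hW]; ring
          have h3' : m1 * (c * m + m1 + M * B + 1 + d * M) + d * M ≤ U := h3
          rw [e3]
          show _ < (m1 + 1) * (V + 1)
          have : (m1 + 1) * (V + 1) = m1 * V + V + m1 + 1 := by ring
          omega
        have h9 := Nat.mul_lt_mul_of_pos_left this (Nat.mul_pos hM hM)
        calc m * (M * (E1 + 1)) = M * M * (m1 * (E1 + 1)) := by rw [hm]; ring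
          _ < _ := h9
          _ = _ := by ring
      _ ≤ _ := Nat.mul_le_mul_left _ f1
  obtain ⟨u, hu, hu0⟩ := (Submodule.ne_bot_iff _).1 hker
  rw [LinearMap.mem_ker] at hu
  have hLi : ∀ i < m, ∑ j, PowerSeries.coeff i (Θ (u j : A)) * z j = 0 := by
    intro i hi
    have := congrArg (fun f : Fin m → filt k a θ d E1 => ((f ⟨i, hi⟩ : filt k a θ d E1) : A)) hu
    simpa [L] using this
  let w : Fin (W + 1) × Fin M → A := fun j => a ^ (j.1 : ℕ) * θ ^ (j.2 : ℕ)
  have hw : LinearIndependent k w := by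
    have := h.indep.comp (fun x : Fin (W + 1) × Fin M => ((x.1 : ℕ), x.2)) (by
      rintro ⟨x, y⟩ ⟨x', y'⟩ h
      simp [Fin.ext_iff] at h ⊢
      exact h)
    exact this
  let H : A := ∑ j, (u j : A) * w j ^ q
  have hH : H ≠ 0 := by
    intro hH
    apply hu0
    funext j
    have := h.nonvan (Ψ s0) (hsurj s0) h1 w hw (fun j => (u j : A)) (fun j => (u j).2) hH j
    exact Subtype.ext this
  have hHE : H ∈ filt k a θ d (U + q * (W + d * M)) := by
    refine Submodule.sum_mem _ fun j _ => filt_mul (u j).2 (filt_pow (filt_gen ?_) _)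
    have := j.1.2
    have : d * (j.2 : ℕ) ≤ d * M := Nat.mul_le_mul_left _ j.2.2.le
    omega
  have hHv : ∀ s, (PowerSeries.X : PowerSeries k) ^ m ∣ Ψ s H := by
    intro s
    have e1 : (PowerSeries.X : PowerSeries k) ^ m ∣ ∑ j, Ψ s (u j) * PowerSeries.C (ψ s (z j)) := by
      rw [PowerSeries.X_pow_dvd_iff]
      intro i hi
      have := congrArg (ψ s) (hLi i hi)
      rw [map_sum]
      simp only [PowerSeries.coeff_mul_C]
      rw [map_sum, map_zero] at this
      rw [← this]
      refine Finset.sum_congr rfl fun j _ => ?_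
      exact (map_mul (ψ s) _ (z j)).symm
    have e2 : (PowerSeries.X : PowerSeries k) ^ m ∣ ∑ j, PowerSeries.C (ψ s D ^ M) * Ψ s (u j) *
        (Ψ s (w j) ^ q - PowerSeries.C (ψ s (w j) ^ q)) := by
      refine Finset.dvd_sum fun j _ => Dvd.dvd.mul_left ?_ _
      rw [← hΨ0]
      exact (pow_dvd_pow _ h2).trans (ps_pow_q _)
    have e3 : PowerSeries.C (ψ s D ^ M) * Ψ s H = (∑ j, PowerSeries.C (ψ s D ^ M) * Ψ s (u j) *
        (Ψ s (w j) ^ q - PowerSeries.C (ψ s (w j) ^ q))) + ∑ j, Ψ s (u j) * PowerSeries.C (ψ s (z j)) := by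
      rw [← Finset.sum_add_distrib]
      simp only [H, map_sum, Finset.mul_sum]
      refine Finset.sum_congr rfl fun j _ => ?_
      have : ψ s (z j) = ψ s D ^ M * ψ s (w j) ^ q := by
        have hj : M = (M - (j.2 : ℕ)) + j.2 := by have := j.2.2; omega
        simp only [z, w, map_mul, map_pow]
        have hj2 : ψ s D ^ M = ψ s D ^ (M - (j.2 : ℕ)) * ψ s D ^ (j.2 : ℕ) := by
          rw [← pow_add, ← hj]
        rw [hj2, ← hx s, mul_pow, mul_pow, ← pow_mul _ _ q, mul_comm (j.1 : ℕ) q, pow_mul, ha s]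
        ring
      rw [this]
      simp only [map_mul, map_pow]
      ring
    have e4 : (PowerSeries.X : PowerSeries k) ^ m ∣ PowerSeries.C (ψ s D ^ M) * Ψ s H := by
      rw [e3]; exact dvd_add e2 e1
    have hu : IsUnit (PowerSeries.C (ψ s D ^ M)) :=
      (isUnit_iff_ne_zero.2 (pow_ne_zero _ (hD s))).map _
    exact (hu.dvd_mul_left).1 e4
  have := h.zeros m Ψ (by
    intro s t hst
    apply hinj
    ext y
    have := congrArg (fun f : A →+* k => f y) hst
    simpa [hΨ0] using this) (fun s => hsurj s m) hH hHE hHv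
  exact this

end Step
end BH

open Polynomial
namespace BH

section Taylor
variable {k A : Type*} [Field k] [CommRing A] [Algebra k A] {a θ : A} {d M : ℕ}

lemma ps_fix {R : Type*} [CommRing R] (Φ : PowerSeries R → PowerSeries R)
    (hΦ : ∀ n f g, (PowerSeries.X : PowerSeries R) ^ n ∣ f - g → PowerSeries.X ^ (n + 1) ∣ Φ f - Φ g)
    (T : ℕ → Set R) (h0 : ∀ n, (0 : R) ∈ T n)
    (hT : ∀ f : PowerSeries R, (∀ n, PowerSeries.coeff n f ∈ T n) → ∀ n, PowerSeries.coeff n (Φ f) ∈ T n) :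
    ∃ y : PowerSeries R, Φ y = y ∧ ∀ n, PowerSeries.coeff n y ∈ T n := by
  let Y : ℕ → PowerSeries R := fun n => Φ^[n] 0
  have hYs : ∀ n, Y (n + 1) = Φ (Y n) := fun n => Function.iterate_succ_apply' _ _ _
  have hY : ∀ n, (PowerSeries.X : PowerSeries R) ^ n ∣ Y (n + 1) - Y n := by
    intro n
    induction n with
    | zero => simp
    | succ n ih => rw [hYs (n + 1), hYs n]; rw [hYs n] at ih; exact hΦ _ _ _ ih
  have hYT : ∀ m n, PowerSeries.coeff n (Y m) ∈ T n := by
    intro m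
    induction m with
    | zero => intro n; simpa [Y] using h0 n
    | succ m ih => rw [hYs]; exact hT _ ih
  have hYm : ∀ n r, (PowerSeries.X : PowerSeries R) ^ n ∣ Y (n + r) - Y n := by
    intro n r
    induction r with
    | zero => simp
    | succ r ih =>
      have := dvd_add ((pow_dvd_pow _ (Nat.le_add_right n r)).trans (hY (n + r))) ih
      simpa [add_assoc] using this
  let y : PowerSeries R := PowerSeries.mk fun n => PowerSeries.coeff n (Y (n + 1))
  have hy : ∀ n, (PowerSeries.X : PowerSeries R) ^ n ∣ y - Y n := by
    intro n
    rw [PowerSeries.X_pow_dvd_iff]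
    intro m hm
    obtain ⟨r, rfl⟩ := Nat.exists_eq_add_of_le (Nat.succ_le_of_lt hm)
    have := PowerSeries.X_pow_dvd_iff.1 (hYm m.succ r) m (Nat.lt_succ_self m)
    rw [map_sub, sub_eq_zero] at this
    simp [y, this]
  refine ⟨y, ?_, fun n => by simpa [y] using hYT (n + 1) n⟩
  ext n
  have h1 := hΦ n _ _ (hy n)
  rw [← hYs] at h1
  have h2 := dvd_sub (hy (n + 1)) h1
  have := PowerSeries.X_pow_dvd_iff.1 h2 n (Nat.lt_succ_self n)
  simp only [sub_sub_sub_cancel_right, map_sub, sub_eq_zero] at this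
  exact this.symm

/-- coefficients of degree growth -/
def Gr (k : Type*) {A : Type*} [Field k] [CommRing A] [Algebra k A] (a θ : A) (d c E : ℕ)
    (f : PowerSeries A) : Prop := ∀ n, PowerSeries.coeff n f ∈ filt k a θ d (E + c * n)

lemma Gr.mul {c E E' : ℕ} {f g : PowerSeries A} (hf : Gr k a θ d c E f) (hg : Gr k a θ d c E' g) :
    Gr k a θ d c (E + E') (f * g) := by
  intro n
  rw [PowerSeries.coeff_mul]
  refine Submodule.sum_mem _ fun x hx => ?_
  have := filt_mul (hf x.1) (hg x.2)
  rw [Finset.HasAntidiagonal.mem_antidiagonal] at hx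
  rw [← hx]
  refine filt_mono ?_ this
  rw [mul_add]; omega

lemma Gr.C {c E : ℕ} {x : A} (hx : x ∈ filt k a θ d E) : Gr k a θ d c E (PowerSeries.C x) := by
  intro n
  rw [PowerSeries.coeff_C]
  split_ifs
  · exact filt_mono (by omega) hx
  · exact Submodule.zero_mem _

lemma Gr.pow {c E : ℕ} {f : PowerSeries A} (hf : Gr k a θ d c E f) (n : ℕ) :
    Gr k a θ d c (n * E) (f ^ n) := by
  induction n with
  | zero =>
    have := Gr.C (c := c) (filt_one (k := k) (a := a) (θ := θ) (d := d) 0)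
    simpa using this
  | succ n ih => rw [pow_succ, add_mul, one_mul]; exact ih.mul hf

lemma Gr.Xmul {c E i : ℕ} {f : PowerSeries A} (hf : Gr k a θ d c (E + c * i) f)  :
    Gr k a θ d c E (PowerSeries.X ^ i * f) := by
  intro n
  rw [PowerSeries.coeff_X_pow_mul']
  split_ifs with h
  · refine filt_mono ?_ (hf (n - i))
    obtain ⟨r, rfl⟩ := Nat.exists_eq_add_of_le h
    simp [mul_add, add_assoc]
  · exact Submodule.zero_mem _

lemma Gr.mono {c E E' : ℕ} {f : PowerSeries A} (hf : Gr k a θ d c E f) (h : E ≤ E') :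
    Gr k a θ d c E' f := fun n => filt_mono (by omega) (hf n)

lemma Gr.add {c E : ℕ} {f g : PowerSeries A} (hf : Gr k a θ d c E f) (hg : Gr k a θ d c E g) :
    Gr k a θ d c E (f + g) := fun n => by rw [map_add]; exact Submodule.add_mem _ (hf n) (hg n)

lemma taylor_exists (K : ℕ → ℕ → A) (hM : 1 ≤ M) (h00 : K 0 0 = 0) {c1 : ℕ}
    (hK : ∀ i j, i ≤ d → j ≤ M → K i j * K 0 1 ^ (2 * i + j - 2) ∈ filt k a θ d c1) :
    ∃ y : PowerSeries A, Gr k a θ d (2 * c1) c1 y ∧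
      ∑ i ∈ Finset.range (d + 1), ∑ j ∈ Finset.range (M + 1), PowerSeries.C (K i j) *
        (PowerSeries.C (K 0 1 ^ 2) * PowerSeries.X) ^ i *
        (PowerSeries.C (K 0 1) * PowerSeries.X * y) ^ j = 0 := by
  classical
  set D := K 0 1 with hD
  let t : ℕ → ℕ → PowerSeries A → PowerSeries A := fun i j y =>
    if 2 ≤ i + j then PowerSeries.X ^ (i + j - 1) * (PowerSeries.C (K i j * D ^ (2 * i + j - 2)) * y ^ j)
    else if i = 1 then PowerSeries.C (K 1 0) else 0
  obtain ⟨y, hy, hyT⟩ := ps_fix (R := A)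
    (fun y => - ∑ i ∈ Finset.range (d + 1), ∑ j ∈ Finset.range (M + 1), t i j y) (by
      intro n f g hfg
      simp only [neg_sub_neg, ← Finset.sum_sub_distrib]
      refine Finset.dvd_sum fun i _ => Finset.dvd_sum fun j _ => ?_
      by_cases h2 : 2 ≤ i + j
      · simp only [t, if_pos h2]
        rw [← mul_sub, ← mul_sub]
        obtain ⟨r, hr⟩ := Nat.exists_eq_add_of_le h2
        have h3 : i + j - 1 = r + 1 := by omega
        rw [h3, pow_succ', pow_succ', mul_assoc]
        refine mul_dvd_mul_left _ ?_
        refine Dvd.dvd.mul_left (Dvd.dvd.mul_left ?_ _) _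
        rw [dvd_sub_comm] at hfg
        exact hfg.trans (sub_dvd_pow_sub_pow _ _ _)
      · simp only [t, if_neg h2, sub_self, dvd_zero])
    (fun n => filt k a θ d (c1 + 2 * c1 * n)) (fun n => Submodule.zero_mem _) (by
      intro f hf n
      have hf' : Gr k a θ d (2 * c1) c1 f := hf
      simp only [map_neg, map_sum]
      refine Submodule.neg_mem _ (Submodule.sum_mem _ fun i hi => Submodule.sum_mem _ fun j hj => ?_)
      have hi' : i ≤ d := by simpa [Nat.lt_succ_iff] using hi
      have hj' : j ≤ M := by simpa [Nat.lt_succ_iff] using hj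
      suffices Gr k a θ d (2 * c1) c1 (t i j f) from this n
      by_cases h2 : 2 ≤ i + j
      · simp only [t, if_pos h2]
        apply Gr.Xmul
        refine ((Gr.C (hK i j hi' hj')).mul (hf'.pow j)).mono ?_
        have : j * c1 ≤ 2 * (i + j - 1) * c1 := Nat.mul_le_mul_right _ (by omega)
        have e : 2 * c1 * (i + j - 1) = 2 * (i + j - 1) * c1 := by ring
        rw [e]
        omega
      · simp only [t, if_neg h2]
        split_ifs with h1
        · apply Gr.C
          simpa using hK 1 0 (by omega) (by omega)
        · intro n; simp)
  refine ⟨y, hyT, ?_⟩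
  have key : ∀ i j, PowerSeries.C (K i j) * (PowerSeries.C (D ^ 2) * PowerSeries.X) ^ i *
        (PowerSeries.C D * PowerSeries.X * y) ^ j = PowerSeries.C (D ^ 2) * PowerSeries.X *
        (t i j y + if j = 1 then (if i = 0 then y else 0) else 0) := by
    intro i j
    by_cases h2 : 2 ≤ i + j
    · have : (if j = 1 then (if i = 0 then y else 0) else 0) = 0 := by
        split_ifs <;> first | rfl | omega
      rw [this, add_zero]
      simp only [t, if_pos h2]
      obtain ⟨r, hr⟩ : ∃ r, i + j = r + 2 := ⟨i + j - 2, by omega⟩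
      have e1 : i + j - 1 = r + 1 := by omega
      have e2 : 2 * i + j - 2 = i + r := by omega
      rw [e1, e2]
      simp only [map_mul, map_pow]
      have e3 : (PowerSeries.C D ^ 2 * PowerSeries.X) ^ i * (PowerSeries.C D * PowerSeries.X * y) ^ j
        = (PowerSeries.C D) ^ (i + (i + j)) * PowerSeries.X ^ (i + j) * y ^ j := by ring
      rw [mul_assoc, e3, hr]
      ring
    · simp only [t, if_neg h2]
      have : (i = 0 ∧ j = 0) ∨ (i = 1 ∧ j = 0) ∨ (i = 0 ∧ j = 1) := by omega
      rcases this with ⟨rfl, rfl⟩ | ⟨rfl, rfl⟩ | ⟨rfl, rfl⟩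
      · simp [h00]
      · simp; ring
      · simp [← hD]; ring
  simp only [key, ← Finset.mul_sum, Finset.sum_add_distrib]
  have h1 : ∑ i ∈ Finset.range (d + 1), ∑ j ∈ Finset.range (M + 1),
      (if j = 1 then (if i = 0 then y else 0) else 0) = y := by
    have : ∀ i, ∑ j ∈ Finset.range (M + 1), (if j = 1 then (if i = 0 then y else 0) else 0)
      = if i = 0 then y else 0 := by
      intro i
      rw [Finset.sum_ite_eq']
      simp; omega
    simp only [this]
    rw [Finset.sum_ite_eq']
    simp
  rw [h1]
  have := neg_eq_iff_eq_neg.1 hy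
  rw [this]
  ring

lemma aa_sum {R : Type*} [CommRing R] [Algebra k R] (χ : k[X][X]) (hd : ∀ m, (χ.coeff m).natDegree ≤ d)
    (hM : χ.natDegree ≤ M) (x y : R) : aevalAeval x y χ =
    ∑ m ∈ Finset.range (M + 1), ∑ l ∈ Finset.range (d + 1), (χ.coeff m).coeff l • (x ^ l * y ^ m) := by
  have h1 : aevalAeval x y χ = ∑ m ∈ Finset.range (M + 1), aeval x (χ.coeff m) * y ^ m := by
    conv_lhs => rw [Polynomial.as_sum_range' χ (M + 1) (by omega)]
    rw [map_sum]
    refine Finset.sum_congr rfl fun m _ => ?_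
    rw [← C_mul_X_pow_eq_monomial, map_mul, map_pow, aevalAeval_C, aevalAeval_Y]
  rw [h1]
  refine Finset.sum_congr rfl fun m _ => ?_
  rw [Polynomial.aeval_eq_sum_range' (n := d + 1) (by have := hd m; omega), Finset.sum_mul]
  refine Finset.sum_congr rfl fun l _ => ?_
  rw [smul_mul_assoc]

/-- divided partial derivatives -/
noncomputable def HK (χ : k[X][X]) (d M : ℕ) (x y : A) (i j : ℕ) : A :=
  ∑ m ∈ Finset.range (M + 1), ∑ l ∈ Finset.range (d + 1),
    (((χ.coeff m).coeff l) * (l.choose i : k) * (m.choose j : k)) • (x ^ (l - i) * y ^ (m - j))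

lemma add_pow_range {R : Type*} [CommRing R] (x s : R) {l n : ℕ} (h : l ≤ n) :
    (x + s) ^ l = ∑ i ∈ Finset.range (n + 1), s ^ i * x ^ (l - i) * (l.choose i : R) := by
  rw [add_comm, add_pow]
  apply Finset.sum_subset
  · intro i hi; simp at *; omega
  · intro i _ hi
    have : l < i := by simpa using hi
    simp [Nat.choose_eq_zero_of_lt this]

lemma taylor_expand {R : Type*} [CommRing R] [Algebra k R] (χ : k[X][X]) (hd : ∀ m, (χ.coeff m).natDegree ≤ d)
    (hM : χ.natDegree ≤ M) (x y s v : R) : aevalAeval (x + s) (y + v) χ =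
    ∑ i ∈ Finset.range (d + 1), ∑ j ∈ Finset.range (M + 1), HK χ d M x y i j * s ^ i * v ^ j := by
  rw [aa_sum χ hd hM]
  have : ∀ m ∈ Finset.range (M + 1), ∀ l ∈ Finset.range (d + 1),
      (χ.coeff m).coeff l • ((x + s) ^ l * (y + v) ^ m) =
      ∑ i ∈ Finset.range (d + 1), ∑ j ∈ Finset.range (M + 1),
        ((((χ.coeff m).coeff l) * (l.choose i : k) * (m.choose j : k)) • (x ^ (l - i) * y ^ (m - j)))
          * s ^ i * v ^ j := by
    intro m hm l hl
    rw [add_pow_range x s (n := d) (by simp at hl; omega), add_pow_range y v (n := M) (by simp at hm; omega),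
      Finset.sum_mul_sum, Finset.smul_sum]
    refine Finset.sum_congr rfl fun i _ => ?_
    rw [Finset.smul_sum]
    refine Finset.sum_congr rfl fun j _ => ?_
    simp only [Algebra.smul_def, map_mul, map_natCast]
    ring
  rw [Finset.sum_congr rfl fun m hm => Finset.sum_congr rfl fun l hl => this m hm l hl]
  simp only [HK, Finset.sum_mul]
  rw [Finset.sum_congr rfl fun m _ => Finset.sum_comm]
  rw [Finset.sum_comm]
  refine Finset.sum_congr rfl fun i _ => ?_
  rw [Finset.sum_congr rfl fun m _ => Finset.sum_comm]
  rw [Finset.sum_comm]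

lemma HK_mem (χ : k[X][X]) (i j : ℕ) : HK χ d M a θ i j ∈ filt k a θ d (d + d * M) := by
  refine Submodule.sum_mem _ fun m hm => Submodule.sum_mem _ fun l hl => Submodule.smul_mem _ _ (filt_gen ?_)
  simp at hm hl
  have : d * (m - j) ≤ d * M := Nat.mul_le_mul_left _ (by omega)
  omega

lemma HK_map {B : Type*} [CommRing B] [Algebra k B] (f : A →ₐ[k] B) (χ : k[X][X]) (x y : A) (i j : ℕ) :
    f (HK χ d M x y i j) = HK χ d M (f x) (f y) i j := by
  simp [HK]

lemma HK_zero (χ : k[X][X]) (hd : ∀ m, (χ.coeff m).natDegree ≤ d)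
    (hM : χ.natDegree ≤ M) (x y : A) : HK χ d M x y 0 0 = aevalAeval x y χ := by
  rw [aa_sum χ hd hM]; simp [HK]

lemma HK_one (χ : k[X][X]) (hd : ∀ m, (χ.coeff m).natDegree ≤ d)
    (hM : χ.natDegree ≤ M) (x y : A) : HK χ d M x y 0 1 = aevalAeval x y (derivative χ) := by
  rw [aa_sum (d := d) (M := M) (derivative χ) (fun m => by
    rw [coeff_derivative]
    refine (natDegree_mul_le).trans ?_
    have : ((m : k[X]) + 1).natDegree = 0 := by
      have : (m : k[X]) + 1 = ((m + 1 : ℕ) : k[X]) := by push_cast; rfl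
      rw [this, natDegree_natCast]
    rw [this]; simpa using hd _) ((natDegree_derivative_le χ).trans (by omega))]
  unfold HK
  rw [Finset.sum_range_succ', Finset.sum_range_succ (n := M)]
  have e1 : ∑ l ∈ Finset.range (d + 1), (((χ.coeff 0).coeff l) * (l.choose 0 : k) * ((0 : ℕ).choose 1 : k)) •
      (x ^ (l - 0) * y ^ (0 - 1)) = 0 := Finset.sum_eq_zero fun l _ => by simp
  have e2 : ∑ l ∈ Finset.range (d + 1), ((derivative χ).coeff M).coeff l • (x ^ l * y ^ M) = 0 :=
    Finset.sum_eq_zero fun l _ => by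
      rw [coeff_derivative, coeff_eq_zero_of_natDegree_lt (p := χ) (by omega)]; simp
  rw [e1, e2]
  congr 1
  refine Finset.sum_congr rfl fun m _ => Finset.sum_congr rfl fun l _ => ?_
  rw [coeff_derivative]
  have : ((m : k[X]) + 1) = C ((m : k) + 1) := by simp
  rw [this, coeff_mul_C]
  simp

end Taylor
end BH

open Polynomial
namespace BH

section Fin
variable {k : Type} [Field k] {d M : ℕ}

lemma aa_eval2 {R : Type*} [CommRing R] [Algebra k R] (x y : R) (g : k[X][X]) :
    aevalAeval x y g = eval₂ ((aeval x : k[X] →ₐ[k] R) : k[X] →+* R) y g := by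
  induction g using Polynomial.induction_on' with
  | add p q hp hq => rw [map_add, hp, hq, eval₂_add]
  | monomial n c =>
    rw [← C_mul_X_pow_eq_monomial, map_mul, map_pow, aevalAeval_C, aevalAeval_Y]
    simp

lemma mk_eq_aa (χ g : k[X][X]) :
    aevalAeval (AdjoinRoot.of χ X) (AdjoinRoot.root χ) g = AdjoinRoot.mk χ g := by
  induction g using Polynomial.induction_on' with
  | add p q hp hq => rw [map_add, hp, hq, map_add]
  | monomial n c =>
    rw [← C_mul_X_pow_eq_monomial, map_mul, map_pow, aevalAeval_C, aevalAeval_Y, map_mul, map_pow,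
      AdjoinRoot.mk_X, AdjoinRoot.mk_C]
    congr 1
    have := Polynomial.aeval_algHom_apply (IsScalarTower.toAlgHom k k[X] (AdjoinRoot χ)) X c
    simpa using this

lemma curve_adjoin (χ : k[X][X]) (hmon : χ.Monic) (hM : χ.natDegree = M)
    (hd : ∀ m, (χ.coeff m).natDegree ≤ d) :
    Curve k (AdjoinRoot.of χ X) (AdjoinRoot.root χ) d M := by
  set a := AdjoinRoot.of χ X
  set θ := AdjoinRoot.root χ
  refine ⟨⟨fun i l => - (χ.coeff l).coeff i, ?_⟩, ?_, ?_⟩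
  · have h1 : aevalAeval a θ χ = 0 := by rw [mk_eq_aa]; exact AdjoinRoot.mk_self
    rw [aa_sum χ hd hM.le, Finset.sum_range_succ] at h1
    have h2 : χ.coeff M = 1 := by rw [← hM]; exact hmon
    have h3 : ∑ l ∈ Finset.range (d + 1), (χ.coeff M).coeff l • (a ^ l * θ ^ M) = θ ^ M := by
      rw [h2, Finset.sum_eq_single 0]
      · simp
      · intro b _ hb; simp [coeff_one, hb]
      · intro h; simp at h
    rw [h3] at h1
    rw [eq_neg_of_add_eq_zero_right h1, ← Finset.sum_neg_distrib]
    simp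
  · subst hM
    have hb := ((Polynomial.basisMonomials k).smulTower (AdjoinRoot.powerBasisAux' hmon)).linearIndependent
    suffices e : (fun x : ℕ × Fin χ.natDegree => a ^ x.1 * θ ^ (x.2 : ℕ)) =
        ((Polynomial.basisMonomials k).smulTower (AdjoinRoot.powerBasisAux' hmon)) by
      rw [e]; exact hb
    funext x
    rw [Module.Basis.smulTower_apply]
    have h1 : AdjoinRoot.powerBasisAux' hmon x.2 = θ ^ (x.2 : ℕ) :=
      (AdjoinRoot.powerBasis' hmon).basis_eq_pow x.2
    have h2 : Polynomial.basisMonomials k x.1 = X ^ x.1 := by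
      simp [Polynomial.X_pow_eq_monomial]
    rw [h2]
    refine Eq.trans ?_ (congrArg (fun z => (X ^ x.1 : k[X]) • z) h1).symm
    simp only [Algebra.smul_def, map_pow]
    rfl
  · intro x
    obtain ⟨g, rfl⟩ := AdjoinRoot.mk_surjective x
    obtain ⟨N, hN⟩ : ∃ N, ∀ m, (g.coeff m).natDegree ≤ N := by
      refine ⟨g.support.sup fun m => (g.coeff m).natDegree, fun m => ?_⟩
      by_cases hm : m ∈ g.support
      · exact Finset.le_sup (f := fun m => (g.coeff m).natDegree) hm
      · rw [notMem_support_iff.1 hm]; simp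
    refine ⟨N + d * g.natDegree, ?_⟩
    rw [← mk_eq_aa, aa_sum g hN le_rfl]
    refine Submodule.sum_mem _ fun m hm => Submodule.sum_mem _ fun l hl => Submodule.smul_mem _ _ (filt_gen ?_)
    simp at hm hl
    have : d * m ≤ d * g.natDegree := Nat.mul_le_mul_left _ (by omega)
    omega

lemma mk_mem_filt (χ g : k[X][X]) {N B : ℕ} (hN : ∀ m, (g.coeff m).natDegree ≤ N) (hB : g.natDegree ≤ B) :
    AdjoinRoot.mk χ g ∈ filt k (AdjoinRoot.of χ X) (AdjoinRoot.root χ) d (N + d * B) := by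
  rw [← mk_eq_aa, aa_sum g hN hB]
  refine Submodule.sum_mem _ fun m hm => Submodule.sum_mem _ fun l hl => Submodule.smul_mem _ _ (filt_gen ?_)
  simp at hm hl
  have : d * m ≤ d * B := Nat.mul_le_mul_left _ (by omega)
  omega

/-- evaluation at a point -/
noncomputable def ptEval (χ : k[X][X]) (s : k × k) (hs : χ.evalEval s.1 s.2 = 0) : AdjoinRoot χ →ₐ[k] k :=
  AdjoinRoot.liftAlgHom χ (aeval s.1) s.2 (by
    rw [← hs, ← coe_aevalAeval_eq_evalEval, aa_eval2])

lemma ptEval_mk (χ : k[X][X]) (s : k × k) (hs : χ.evalEval s.1 s.2 = 0) (g : k[X][X]) :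
    ptEval χ s hs (AdjoinRoot.mk χ g) = g.evalEval s.1 s.2 := by
  rw [← coe_aevalAeval_eq_evalEval, aa_eval2]; rfl

lemma ptEval_a (χ : k[X][X]) (s : k × k) (hs : χ.evalEval s.1 s.2 = 0) :
    ptEval χ s hs (AdjoinRoot.of χ X) = s.1 := by
  simp [ptEval]

lemma ptEval_θ (χ : k[X][X]) (s : k × k) (hs : χ.evalEval s.1 s.2 = 0) :
    ptEval χ s hs (AdjoinRoot.root χ) = s.2 := by
  simp [ptEval]

lemma isDomain_adjoin (χ : k[X][X]) (hirr : Irreducible χ) : IsDomain (AdjoinRoot χ) :=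
  AdjoinRoot.isDomain_of_prime hirr.prime

lemma ptEval_inj (χ : k[X][X]) (S : Finset (k × k)) (hS : ∀ s ∈ S, χ.evalEval s.1 s.2 = 0) :
    Function.Injective (fun s : S => ptEval χ s.1 (hS s.1 s.2)) := by
  intro s t hst
  have h1 := congrArg (fun f : AdjoinRoot χ →ₐ[k] k => f (AdjoinRoot.of χ X)) hst
  have h2 := congrArg (fun f : AdjoinRoot χ →ₐ[k] k => f (AdjoinRoot.root χ)) hst
  simp only [ptEval_a, ptEval_θ] at h1 h2
  exact Subtype.ext (Prod.ext h1 h2)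

/-- number of zeros on an irreducible curve of a function that is not identically zero -/
theorem curve_zeros (χ : k[X][X]) (hmon : χ.Monic) (hM : χ.natDegree = M)
    (hd : ∀ m, (χ.coeff m).natDegree ≤ d) (hirr : Irreducible χ) (g : k[X][X])
    {N B : ℕ} (hN : ∀ m, (g.coeff m).natDegree ≤ N) (hB : g.natDegree ≤ B) (hg : ¬ χ ∣ g)
    (S : Finset (k × k)) (hS : ∀ s ∈ S, χ.evalEval s.1 s.2 = 0) (hSg : ∀ s ∈ S, g.evalEval s.1 s.2 = 0) :
    S.card ≤ M * (N + d * B + d * M) := by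
  haveI := isDomain_adjoin χ hirr
  have hc := curve_adjoin χ hmon hM hd
  have := hc.zeros (ι := S) 1
    (fun s => (Algebra.ofId k (PowerSeries k)).comp (ptEval χ s.1 (hS s.1 s.2))) (by
      intro s t hst
      apply ptEval_inj χ S hS
      refine AlgHom.ext fun x => ?_
      have := congrArg (fun f : AdjoinRoot χ →+* k => f x) hst
      simpa using this) (by
      intro s g
      refine ⟨algebraMap k _ (PowerSeries.constantCoeff g), ?_⟩
      rw [pow_one, PowerSeries.X_dvd_iff]
      simp [Algebra.ofId_apply])
    (H := AdjoinRoot.mk χ g) (by rwa [Ne, AdjoinRoot.mk_eq_zero])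
    (mk_mem_filt χ g hN hB) (by
      intro s
      rw [AlgHom.comp_apply, ptEval_mk, hSg s.1 s.2]
      simp)
  simpa using this

lemma theta_exists (χ : k[X][X]) (hmon : χ.Monic) (hM : χ.natDegree = M) (hM1 : 1 ≤ M)
    (hd : ∀ m, (χ.coeff m).natDegree ≤ d) :
    ∃ Θ : AdjoinRoot χ →ₐ[k] PowerSeries (AdjoinRoot χ),
      (∀ E, ∀ x ∈ filt k (AdjoinRoot.of χ X) (AdjoinRoot.root χ) d E, ∀ i,
        PowerSeries.coeff i (Θ x) ∈ filt k (AdjoinRoot.of χ X) (AdjoinRoot.root χ) d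
          (E + (2 * ((2 * d + M + 1) * (d + d * M)) + 2 * (d + d * M)) * i)) ∧
      (∀ x, PowerSeries.constantCoeff (Θ x) = x) ∧
      Θ (AdjoinRoot.of χ X) = PowerSeries.C (AdjoinRoot.of χ X) +
        PowerSeries.C ((AdjoinRoot.mk χ (derivative χ)) ^ 2) * PowerSeries.X := by
  set a := AdjoinRoot.of χ X with ha
  set θ := AdjoinRoot.root χ with hθ
  set B0 := d + d * M with hB0
  set c1 := (2 * d + M + 1) * B0 with hc1
  have h00 : HK χ d M a θ 0 0 = 0 := by
    rw [HK_zero χ hd hM.le, mk_eq_aa]; exact AdjoinRoot.mk_self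
  have h01 : HK χ d M a θ 0 1 = AdjoinRoot.mk χ (derivative χ) := by
    rw [HK_one χ hd hM.le, mk_eq_aa]
  obtain ⟨y, hy, hy0⟩ := taylor_exists (k := k) (a := a) (θ := θ) (d := d) (M := M) (c1 := c1)
    (HK χ d M a θ) hM1 h00 (by
      intro i j hi hj
      refine filt_mono ?_ (filt_mul (HK_mem χ i j) (filt_pow (HK_mem χ 0 1) _))
      have : (2 * i + j - 2 + 1) * B0 ≤ c1 := Nat.mul_le_mul_right _ (by omega)
      rw [add_mul, one_mul] at this
      change B0 + _ * B0 ≤ _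
      omega)
  set D := AdjoinRoot.mk χ (derivative χ) with hD
  rw [h01] at hy0
  have hDm : D ∈ filt k a θ d B0 := by rw [← h01]; exact HK_mem χ 0 1
  set a' := PowerSeries.C a + PowerSeries.C (D ^ 2) * PowerSeries.X with ha'
  set θ' := PowerSeries.C θ + PowerSeries.C D * PowerSeries.X * y with hθ'
  have hroot : aevalAeval a' θ' χ = 0 := by
    rw [ha', hθ', taylor_expand χ hd hM.le, ← hy0]
    refine Finset.sum_congr rfl fun i _ => Finset.sum_congr rfl fun j _ => ?_
    have := HK_map (d := d) (M := M) (IsScalarTower.toAlgHom k (AdjoinRoot χ) (PowerSeries (AdjoinRoot χ))) χ a θ i j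
    have e : HK χ d M (PowerSeries.C a) (PowerSeries.C θ) i j = PowerSeries.C (HK χ d M a θ i j) := this.symm
    rw [e]
  let Θ : AdjoinRoot χ →ₐ[k] PowerSeries (AdjoinRoot χ) := AdjoinRoot.liftAlgHom χ (aeval a') θ' (by rw [← aa_eval2]; exact hroot)
  have hΘa : Θ a = a' := by simp [Θ, ha]
  have hΘθ : Θ θ = θ' := by simp [Θ, hθ]
  have g1 : Gr k a θ d (2 * c1 + 2 * B0) 1 (Θ a) := by
    rw [hΘa, ha']
    refine Gr.add (Gr.C (filt_a le_rfl)) ?_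
    have := Gr.Xmul (i := 1) (c := 2 * c1 + 2 * B0) (E := 1)
      (Gr.C (filt_mono (k := k) (a := a) (θ := θ) (d := d) (E' := 1 + (2 * c1 + 2 * B0) * 1) (by omega) (filt_pow hDm 2)))
    rw [pow_one, mul_comm PowerSeries.X] at this
    exact this
  have g2 : Gr k a θ d (2 * c1 + 2 * B0) d (Θ θ) := by
    rw [hΘθ, hθ']
    refine Gr.add (Gr.C (filt_θ le_rfl)) ?_
    have hy' : Gr k a θ d (2 * c1 + 2 * B0) c1 y := fun n => filt_mono (by
      have : 2 * c1 * n ≤ (2 * c1 + 2 * B0) * n := Nat.mul_le_mul_right _ (by omega)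
      omega) (hy n)
    have := Gr.Xmul (i := 1) (c := 2 * c1 + 2 * B0) (E := d)
      (((Gr.C hDm).mul hy').mono (by omega))
    have e : (PowerSeries.X : PowerSeries (AdjoinRoot χ)) ^ 1 * (PowerSeries.C D * y) = PowerSeries.C D * PowerSeries.X * y := by ring
    rw [e] at this
    exact this
  refine ⟨Θ, ?_, ?_, hΘa⟩
  · intro E x hx i
    suffices Gr k a θ d (2 * c1 + 2 * B0) E (Θ x) from this i
    unfold filt at hx
    induction hx using Submodule.span_induction with
    | mem x hx =>
      obtain ⟨i, l, hil, rfl⟩ := hx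
      rw [map_mul, map_pow, map_pow]
      refine ((g1.pow i).mul (g2.pow l)).mono ?_
      rw [mul_comm l d]; omega
    | zero => intro n; simp
    | add x y _ _ hx hy => rw [map_add]; exact hx.add hy
    | smul c x _ hx =>
      intro n
      rw [map_smul]
      have : PowerSeries.coeff n (c • Θ x) = c • PowerSeries.coeff n (Θ x) := rfl
      rw [this]
      exact Submodule.smul_mem _ _ (hx n)
  · intro x
    let f : AdjoinRoot χ →ₐ[k] AdjoinRoot χ :=
      { (PowerSeries.constantCoeff (R := AdjoinRoot χ)).comp Θ.toRingHom with
        commutes' := fun r => by simp [PowerSeries.algebraMap_apply] }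
    obtain ⟨g, rfl⟩ := AdjoinRoot.mk_surjective x
    have h1 : f.comp (aevalAeval a θ) = aevalAeval a θ := by
      apply (aevalAevalEquiv k (AdjoinRoot χ)).symm.injective
      have e1 : f a = a := by
        change PowerSeries.constantCoeff (Θ a) = a
        rw [hΘa, ha']; simp
      have e2 : f θ = θ := by
        change PowerSeries.constantCoeff (Θ θ) = θ
        rw [hΘθ, hθ']; simp
      simp only [aevalAevalEquiv, Equiv.coe_fn_symm_mk, AlgHom.comp_apply]
      refine Prod.ext ?_ ?_
      · show f (aevalAeval a θ (C X)) = aevalAeval a θ (C X)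
        rw [aevalAeval_X, e1]
      · show f (aevalAeval a θ X) = aevalAeval a θ X
        rw [aevalAeval_Y, e2]
    have h2 := congrArg (fun F : k[X][X] →ₐ[k] AdjoinRoot χ => F g) h1
    simp only [AlgHom.comp_apply, ha, hθ, mk_eq_aa] at h2
    exact h2

set_option maxHeartbeats 1000000 in
theorem stepanov_final (M d B : ℕ) (hM1 : 1 ≤ M) : ∃ C : ℝ, 0 ≤ C ∧
    ∀ (k : Type) [Field k] [IsAlgClosed k] (p e : ℕ) [ExpChar k p]
      (χ x : k[X][X]), χ.Monic → χ.natDegree = M → (∀ m, (χ.coeff m).natDegree ≤ d) →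
      Irreducible χ → x.natDegree ≤ B → (∀ m, (x.coeff m).natDegree ≤ B) →
      ∀ S : Finset (k × k), (∀ s ∈ S, χ.evalEval s.1 s.2 = 0 ∧ (derivative χ).evalEval s.1 s.2 ≠ 0 ∧
        s.1 ^ (p ^ e) = s.1 ∧ (derivative χ).evalEval s.1 s.2 * s.2 ^ (p ^ e) = x.evalEval s.1 s.2) →
      1 < p ^ e →
      (S.card : ℝ) ≤ (p ^ e : ℕ) + C * Real.sqrt (p ^ e : ℕ) := by
  set c := 2 * ((2 * d + M + 1) * (d + d * M)) + 2 * (d + d * M) with hc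
  set B' := (B + d * B) + (d + d * M) with hB'
  set K2 := (c * M + 1) + (M * B' + 1 + d * M) + d * M with hK2
  set K3 := M * (K2 + d * M) + M + 1 with hK3
  refine ⟨((2 * K3 * (d * M) + K2 + d * M + M * (K3 + d * M) : ℕ) : ℝ), by positivity, ?_⟩
  intro k _ _ p e _ χ x hmon hM hd hirr hxB hxB' S hS hq1
  have hcur := curve_adjoin χ hmon hM hd
  haveI := isDomain_adjoin χ hirr
  set q := p ^ e with hq
  have hq0 : 0 < q := by omega
  have hsq : 1 ≤ Real.sqrt (q : ℝ) := by
    rw [Real.one_le_sqrt]; exact_mod_cast hq0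
  have hsq2 : Real.sqrt (q : ℝ) * Real.sqrt q = q := Real.mul_self_sqrt (by positivity)
  set m1 := Nat.sqrt (q / K3) with hm1
  have hK3pos : 0 < K3 := by omega
  by_cases hm0 : m1 = 0
  · have hqK : q < K3 := by
      have : q / K3 = 0 := by rw [hm0] at hm1; exact Nat.sqrt_eq_zero.1 hm1.symm
      exact (Nat.div_eq_zero_iff.1 this).resolve_left (by omega)
    have := curve_zeros (d := d) (N := q) (B := 0) χ hmon hM hd hirr (C (X ^ q - X)) (by
      intro m
      rw [coeff_C]
      split_ifs
      · refine (natDegree_sub_le _ _).trans ?_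
        simp; omega
      · simp) (by simp) (by
      intro hdiv
      have h3 : (C (X ^ q - X : k[X])) ≠ 0 := by
        rw [Ne, C_eq_zero]
        exact FiniteField.X_pow_card_sub_X_ne_zero k hq1
      have := natDegree_le_of_dvd hdiv h3
      simp at this; omega) S (fun s hs => (hS s hs).1) (by
      intro s hs
      simp [evalEval, (hS s hs).2.2.1])
    have h2 : S.card ≤ M * (K3 + d * M) := this.trans (Nat.mul_le_mul_left _ (by omega))
    have h3 : (S.card : ℝ) ≤ ((M * (K3 + d * M) : ℕ) : ℝ) := by exact_mod_cast h2
    push_cast at h3 ⊢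
    have h4 : (M * (K3 + d * M) : ℝ) ≤ (2 * K3 * (d * M) + K2 + d * M + M * (K3 + d * M)) * Real.sqrt q := by
      have : (0:ℝ) ≤ 2 * K3 * (d * M) + K2 + d * M := by positivity
      have : (0:ℝ) ≤ M * (K3 + d * M) := by positivity
      nlinarith
    have : (0:ℝ) ≤ q := by positivity
    linarith
  · have hm1pos : 1 ≤ m1 := Nat.pos_of_ne_zero hm0
    have hKm : K3 * (m1 * m1) ≤ q := by
      have := Nat.sqrt_le (q / K3)
      exact (Nat.mul_le_mul_left _ this).trans (Nat.mul_div_le q K3)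
    have hKm2 : q < 4 * K3 * (m1 * m1) := by
      have h1 := Nat.lt_succ_sqrt (q / K3)
      have h2 : q < K3 * ((m1 + 1) * (m1 + 1)) := by
        rw [mul_comm]; exact (Nat.div_lt_iff_lt_mul hK3pos).1 h1
      have : (m1 + 1) * (m1 + 1) ≤ 4 * (m1 * m1) := by nlinarith
      nlinarith
    obtain ⟨Θ, hΘ, hΘ0, hΘa⟩ := theta_exists χ hmon hM hM1 hd
    have hmm : m1 ≤ m1 * m1 := Nat.le_mul_self m1
    have key := hcur.stepanov (p := p) (e := e) Θ hΘ hΘ0 hΘa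
      (ι := S) (fun s => ptEval χ s.1 (hS s.1 s.2).1) (ptEval_inj χ S (fun s hs => (hS s hs).1))
      (by intro s; rw [ptEval_mk]; exact (hS s.1 s.2).2.1)
      (by intro s; rw [ptEval_a]; exact (hS s.1 s.2).2.2.1)
      (x := AdjoinRoot.mk χ x) (by
        intro s; rw [ptEval_mk, ptEval_mk, ptEval_θ]; exact (hS s.1 s.2).2.2.2)
      (B := B') (by
        have : HK χ d M (AdjoinRoot.of χ X) (AdjoinRoot.root χ) 0 1 = AdjoinRoot.mk χ (derivative χ) := by
          rw [HK_one χ hd hM.le, mk_eq_aa]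
        rw [← this]
        exact filt_mono (by omega) (HK_mem χ 0 1))
      (filt_mono (by omega) (mk_mem_filt χ x hxB' hxB)) (by omega) m1 (K2 * (m1 * m1))
      (by
        rw [← hq]
        refine lt_of_lt_of_le ?_ hKm
        have : M * (K2 * (m1 * m1) + d * M) ≤ M * ((K2 + d * M) * (m1 * m1)) := by
          apply Nat.mul_le_mul_left
          have : d * M * 1 ≤ d * M * (m1 * m1) := Nat.mul_le_mul_left _ (by omega)
          nlinarith
        refine lt_of_le_of_lt this ?_
        rw [← mul_assoc]
        apply Nat.mul_lt_mul_of_pos_right _ (by positivity)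
        omega)
      (by
        rw [← hq]
        refine le_trans ?_ hKm
        calc M * m1 ≤ M * (m1 * m1) := Nat.mul_le_mul_left _ hmm
          _ ≤ _ := Nat.mul_le_mul_right _ (by omega))
      (by
        have e1 : m1 * (M * B' + 1 + d * M) ≤ (m1 * m1) * (M * B' + 1 + d * M) := Nat.mul_le_mul_right _ hmm
        have e2 : 1 * (d * M) ≤ (m1 * m1) * (d * M) := Nat.mul_le_mul_right _ (by omega)
        have e3 : m1 * (c * (M * m1) + m1 + M * B' + 1 + d * M) = (m1 * m1) * (c * M + 1) + m1 * (M * B' + 1 + d * M) := by ring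
        have e4 : K2 * (m1 * m1) = (m1 * m1) * (c * M + 1) + (m1 * m1) * (M * B' + 1 + d * M) + (m1 * m1) * (d * M) := by
          rw [hK2]; ring
        rw [← hc, e3, e4]
        omega)
    rw [Fintype.card_coe, ← hq] at key
    have key2 : S.card * m1 ≤ K2 * (m1 * m1) + q * (m1 + d * M) + d * M := by
      have : M * (S.card * m1) ≤ M * (K2 * (m1 * m1) + q * (m1 + d * M) + d * M) := by
        calc _ = S.card * (M * m1) := by ring
          _ ≤ _ := key
      exact Nat.le_of_mul_le_mul_left this (by omega)
    have key3 : (S.card : ℝ) * m1 ≤ K2 * (m1 * m1) + q * (m1 + d * M) + d * M := by exact_mod_cast key2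
    have hm1R : (1 : ℝ) ≤ m1 := by exact_mod_cast hm1pos
    have hKmR : (K3 : ℝ) * (m1 * m1) ≤ q := by exact_mod_cast hKm
    have hKm2R : (q : ℝ) ≤ 4 * K3 * (m1 * m1) := by exact_mod_cast hKm2.le
    have hK3R : (1 : ℝ) ≤ K3 := by exact_mod_cast hK3pos
    have hs1 : Real.sqrt q ≤ 2 * K3 * m1 := by
      rw [Real.sqrt_le_left (by positivity)]
      nlinarith [mul_nonneg (mul_nonneg (by positivity : (0:ℝ) ≤ 4 * K3) (by linarith : (0:ℝ) ≤ K3 - 1)) (by positivity : (0:ℝ) ≤ (m1:ℝ) * m1)]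
    have hs2 : (m1 : ℝ) ≤ Real.sqrt q := by
      apply Real.le_sqrt_of_sq_le
      nlinarith [mul_nonneg (by linarith : (0:ℝ) ≤ K3 - 1) (by positivity : (0:ℝ) ≤ (m1:ℝ) * m1)]
    have hq2 : (q : ℝ) ≤ 2 * K3 * Real.sqrt q * m1 := by
      nlinarith
    have hdM : (0 : ℝ) ≤ d * M := by positivity
    have fin : (S.card : ℝ) * m1 ≤ (q + (2 * K3 * (d * M) + K2 + d * M) * Real.sqrt q) * m1 := by
      have f1 : (K2 : ℝ) * (m1 * m1) ≤ K2 * Real.sqrt q * m1 := by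
        have : (0:ℝ) ≤ K2 * m1 := by positivity
        nlinarith
      have f2 : (q : ℝ) * (d * M) ≤ 2 * K3 * Real.sqrt q * m1 * (d * M) := mul_le_mul_of_nonneg_right hq2 hdM
      have f3 : (d : ℝ) * M ≤ d * M * (Real.sqrt q * m1) := by
        have : (1:ℝ) ≤ Real.sqrt q * m1 := by nlinarith
        nlinarith
      linarith
    have fin2 := le_of_mul_le_mul_right fin (by linarith)
    push_cast
    have : (0:ℝ) ≤ M * (K3 + d * M) * Real.sqrt q := by positivity
    linarith

end Fin
end BH

open Polynomial
namespace BH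

section Wd
variable {R : Type*} [CommRing R]

/-- weighted homogenisation -/
noncomputable def wmap (n : ℕ) : R[X][X] →+* R[X][X] :=
  eval₂RingHom (mapRingHom C) (C X * X ^ n)

lemma wmap_coeff (n : ℕ) (P : R[X][X]) (N j : ℕ) :
    ((wmap n P).coeff N).coeff j = if n * j ≤ N then (P.coeff j).coeff (N - n * j) else 0 := by
  induction P using Polynomial.induction_on' with
  | add p q hp hq => rw [map_add]; simp only [coeff_add, hp, hq]; split_ifs <;> simp
  | monomial l c =>
    have : wmap n (monomial l c) = (c.map C * C (X ^ l)) * X ^ (n * l) := by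
      simp only [wmap, coe_eval₂RingHom, eval₂_monomial, coe_mapRingHom, mul_pow, ← pow_mul, C_pow]
      ring
    rw [this, coeff_mul_X_pow']
    by_cases hjl : j = l
    · subst hjl
      split_ifs with h
      · rw [coeff_mul_C, coeff_map, coeff_C_mul, coeff_X_pow]
        simp
      · simp
    · rw [coeff_monomial, if_neg (Ne.symm hjl)]
      have h0 : ∀ a, ((map C c * C (X ^ l)).coeff a).coeff j = (0:R) := by
        intro a
        rw [coeff_mul_C, coeff_map, coeff_C_mul, coeff_X_pow, if_neg hjl, mul_zero]
      split_ifs with h h' <;> first | exact h0 _ | simp [h0]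

/-- weighted degree bound -/
def WB (n D : ℕ) (P : R[X][X]) : Prop := ∀ j i, (P.coeff j).coeff i ≠ 0 → i + n * j ≤ D

lemma WB_iff (n D : ℕ) (P : R[X][X]) : WB n D P ↔ (wmap n P).natDegree ≤ D := by
  constructor
  · intro h
    rw [natDegree_le_iff_coeff_eq_zero]
    intro N hN
    ext j
    rw [wmap_coeff, coeff_zero]
    split_ifs with h1
    · by_contra h2
      have := h j _ h2
      omega
    · rfl
  · intro h j i hij
    by_contra h1
    apply hij
    have h2 : (wmap n P).coeff (i + n * j) = 0 := coeff_eq_zero_of_natDegree_lt (by omega)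
    have h3 := wmap_coeff n P (i + n * j) j
    rw [h2] at h3
    simpa using h3.symm

lemma WB_zero_iff (d : ℕ) (P : R[X][X]) : WB 0 d P ↔ ∀ m, (P.coeff m).natDegree ≤ d := by
  constructor
  · intro h m
    rw [natDegree_le_iff_coeff_eq_zero]
    intro N hN
    by_contra h1
    have := h m N h1
    omega
  · intro h j i hij
    have := le_natDegree_of_ne_zero hij
    have := h j
    omega

lemma wmap_injective (n : ℕ) : Function.Injective (wmap (R := R) n) := by
  rw [injective_iff_map_eq_zero]
  intro P hP
  ext j i
  have h3 := wmap_coeff n P (i + n * j) j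
  rw [hP] at h3
  simpa using h3.symm

lemma WB_monic_le [Nontrivial R] {n D : ℕ} {P : R[X][X]} (hP : P.Monic) (h : WB n D P) :
    n * P.natDegree ≤ D := by
  have := h P.natDegree 0 (by rw [show P.coeff P.natDegree = 1 from hP]; simp)
  omega

lemma WB_add {n D : ℕ} {P Q : R[X][X]} (hP : WB n D P) (hQ : WB n D Q) : WB n D (P + Q) := by
  rw [WB_iff] at *; rw [map_add]; exact (natDegree_add_le _ _).trans (max_le hP hQ)

lemma WB_mul {n D E : ℕ} {P Q : R[X][X]} (hP : WB n D P) (hQ : WB n E Q) :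
    WB n (D + E) (P * Q) := by
  rw [WB_iff] at *; rw [map_mul]; exact natDegree_mul_le.trans (add_le_add hP hQ)

variable [IsDomain R]

lemma WB_of_mul_zero {d : ℕ} {P Q : R[X][X]} (hPQ : P * Q ≠ 0) (h : WB 0 d (P * Q)) :
    WB 0 d P ∧ WB 0 d Q := by
  rw [WB_iff] at *; rw [WB_iff]
  have h1 : wmap 0 P ≠ 0 := by
    rw [Ne, map_eq_zero_iff _ (wmap_injective 0)]; rintro rfl; simp at hPQ
  have h2 : wmap 0 Q ≠ 0 := by
    rw [Ne, map_eq_zero_iff _ (wmap_injective 0)]; rintro rfl; simp at hPQ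
  rw [map_mul, natDegree_mul h1 h2] at h
  omega

lemma WB_of_mul {n : ℕ} {P Q : R[X][X]} (hP : P.Monic) (hQ : Q.Monic)
    (h : WB n (n * (P * Q).natDegree) (P * Q)) :
    WB n (n * P.natDegree) P := by
  rw [hP.natDegree_mul hQ] at h
  have e1 := WB_monic_le hQ ((WB_iff n _ Q).2 le_rfl)
  rw [WB_iff] at *
  have h1 : wmap n P ≠ 0 := by
    rw [Ne, map_eq_zero_iff _ (wmap_injective n)]; exact hP.ne_zero
  have h2 : wmap n Q ≠ 0 := by
    rw [Ne, map_eq_zero_iff _ (wmap_injective n)]; exact hQ.ne_zero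
  rw [map_mul, natDegree_mul h1 h2, mul_add] at h
  omega

end Wd

section mp
variable {B : Type*} [CommRing B] {B' : Type*} [CommRing B']

/-- universal monic bivariate polynomial -/
noncomputable def mp {M d : ℕ} (c : Fin M × Fin (d+1) → B) : B[X][X] :=
  X ^ M + ∑ m : Fin M, C (∑ l : Fin (d+1), C (c (m, l)) * X ^ (l : ℕ)) * X ^ (m : ℕ)

lemma mp_map {M d : ℕ} (c : Fin M × Fin (d+1) → B) (f : B →+* B') :
    (mp c).map (mapRingHom f) = mp (fun i => f (c i)) := by
  simp [mp, Polynomial.map_sum, Polynomial.map_add]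

lemma mp_aux {M d : ℕ} (c : Fin M × Fin (d+1) → B) :
    (∑ m : Fin M, C (∑ l : Fin (d+1), C (c (m, l)) * X ^ (l : ℕ)) * X ^ (m : ℕ)).degree < (M : WithBot ℕ) := by
  exact Polynomial.degree_sum_fin_lt _

lemma mp_monic {M d : ℕ} (c : Fin M × Fin (d+1) → B) : (mp c).Monic :=
  monic_X_pow_add (mp_aux c)

lemma mp_natDegree [Nontrivial B] {M d : ℕ} (c : Fin M × Fin (d+1) → B) : (mp c).natDegree = M := by
  rw [mp, natDegree_add_eq_left_of_degree_lt, natDegree_X_pow]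
  rw [degree_X_pow]; exact mp_aux c

lemma mp_coeff {M d : ℕ} (c : Fin M × Fin (d+1) → B) (m : Fin M) :
    (mp c).coeff m = ∑ l : Fin (d+1), C (c (m, l)) * X ^ (l : ℕ) := by
  rw [mp, coeff_add, coeff_X_pow, if_neg m.2.ne, zero_add, finset_sum_coeff, Finset.sum_eq_single m]
  · rw [coeff_C_mul, coeff_X_pow, if_pos rfl, mul_one]
  · intro b _ hb
    rw [coeff_C_mul, coeff_X_pow, if_neg (fun h => hb (Fin.ext h.symm)), mul_zero]
  · simp

lemma mp_coeff_coeff {M d : ℕ} (c : Fin M × Fin (d+1) → B) (m : Fin M) (l : Fin (d+1)) :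
    ((mp c).coeff m).coeff l = c (m, l) := by
  rw [mp_coeff, finset_sum_coeff, Finset.sum_eq_single l]
  · simp
  · intro b _ hb
    rw [coeff_C_mul, coeff_X_pow, if_neg (fun h => hb (Fin.ext h.symm)), mul_zero]
  · simp

lemma mp_deg {M d : ℕ} (c : Fin M × Fin (d+1) → B) (m : ℕ) : ((mp c).coeff m).natDegree ≤ d := by
  nontriviality B
  rcases lt_trichotomy m M with h | h | h
  · have := mp_coeff c ⟨m, h⟩
    simp only at this
    rw [this]
    apply natDegree_sum_le_of_forall_le
    intro l _
    exact (natDegree_C_mul_X_pow_le _ _).trans (by omega)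
  · have h1 : (mp c).coeff M = 1 := by
      have h2 := mp_monic c
      rwa [Monic, leadingCoeff, mp_natDegree] at h2
    rw [h, h1]; simp
  · rw [coeff_eq_zero_of_natDegree_lt (by rw [mp_natDegree]; exact h)]; simp

lemma eq_mp {M d : ℕ} (P : B[X][X]) (hP : P.Monic) (hM : P.natDegree = M)
    (hd : ∀ m, (P.coeff m).natDegree ≤ d) :
    P = mp (fun i : Fin M × Fin (d+1) => (P.coeff i.1).coeff i.2) := by
  nontriviality B
  have hc : ∀ m, P.coeff m = ∑ l : Fin (d+1), C ((P.coeff m).coeff l) * X ^ (l:ℕ) := by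
    intro m
    rw [Fin.sum_univ_eq_sum_range (fun l => C ((P.coeff m).coeff l) * X ^ l)]
    exact (P.coeff m).as_sum_range_C_mul_X_pow' (by have := hd m; omega)
  conv_lhs => rw [hP.as_sum, hM]
  rw [mp, ← Fin.sum_univ_eq_sum_range (fun i => C (P.coeff i) * X ^ i)]
  congr 1
  apply Finset.sum_congr rfl
  intro m _
  congr 2
  exact hc m

end mp
end BH

open Polynomial
namespace BH

section Ir

lemma lift_of_integral_dom {A R κ : Type*} [CommRing A] [IsDomain A] [CommRing R] [IsDomain R]
    [Algebra A R] [Algebra.IsIntegral A R] [Field κ] [IsAlgClosed κ] (ev : A →+* κ)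
    (hA : Function.Injective (algebraMap A R)) (hev : Function.Injective ev) :
    ∃ g : R →+* κ, ∀ a, g (algebraMap A R a) = ev a := by
  letI : Algebra A κ := ev.toAlgebra
  haveI : Module.IsTorsionFree A R := Module.isTorsionFree_iff_algebraMap_injective.2 hA
  haveI : Module.IsTorsionFree A κ := Module.isTorsionFree_iff_algebraMap_injective.2 hev
  let L : R →ₐ[A] κ := IsAlgClosed.lift
  exact ⟨L, fun a => L.commutes a⟩

/-- extending a point along an integral extension -/
lemma lift_of_integral {A R κ : Type*} [CommRing A] [CommRing R] [Algebra A R]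
    [Algebra.IsIntegral A R] [Field κ] [IsAlgClosed κ] (ev : A →+* κ)
    (hJ : RingHom.ker (algebraMap A R) ≤ RingHom.ker ev) :
    ∃ g : R →+* κ, ∀ a, g (algebraMap A R a) = ev a := by
  have hP : (RingHom.ker ev).IsPrime := RingHom.ker_isPrime _
  obtain ⟨Q, -, hQ, hQP⟩ := Ideal.exists_ideal_over_prime_of_isIntegral (S := R)
    (RingHom.ker ev) ⊥ (by rwa [← RingHom.ker_eq_comap_bot])
  let P := Q.comap (algebraMap A R)
  let evP : A ⧸ P →+* κ := Ideal.Quotient.lift P ev (fun a ha => by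
    have : a ∈ RingHom.ker ev := by rw [← hQP]; exact ha
    exact this)
  have evPinj : Function.Injective evP := by
    apply RingHom.lift_injective_of_ker_le_ideal
    exact hQP.symm.le
  letI : Algebra (A ⧸ P) (R ⧸ Q) := Ideal.quotientAlgebra
  haveI : P.IsPrime := by change (Q.comap _).IsPrime; infer_instance
  haveI : IsDomain (A ⧸ P) := Ideal.Quotient.isDomain P
  haveI : IsDomain (R ⧸ Q) := Ideal.Quotient.isDomain Q
  haveI : Algebra.IsIntegral (A ⧸ P) (R ⧸ Q) := by
    constructor
    intro x
    obtain ⟨r, rfl⟩ := Ideal.Quotient.mk_surjective x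
    obtain ⟨p, hp, hpr⟩ := Algebra.IsIntegral.isIntegral (R := A) r
    refine ⟨p.map (Ideal.Quotient.mk P), hp.map _, ?_⟩
    rw [eval₂_map]
    have := congrArg (Ideal.Quotient.mk Q) hpr
    rw [hom_eval₂, map_zero] at this
    exact this
  obtain ⟨L, hL⟩ := lift_of_integral_dom (R := R ⧸ Q) evP Ideal.algebraMap_quotient_injective evPinj
  exact ⟨L.comp (Ideal.Quotient.mk Q), fun a => hL (Ideal.Quotient.mk P a)⟩

attribute [local instance] Polynomial.algebra in
lemma int_coeff {A R : Type*} [CommRing A] [CommRing R] [Algebra A R] (P : A[X][X]) (q : R[X][X])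
    (hP : P.Monic) (hq : q.Monic) (hd : q ∣ P.map (mapRingHom (algebraMap A R))) (i j : ℕ) :
    IsIntegral A ((q.coeff i).coeff j) := by
  have h1 : IsIntegral A[X] (q.coeff i) :=
    isIntegral_coeff_of_dvd P q hP hq hd i
  exact (Polynomial.isIntegral_iff_isIntegral_coeff.1 h1) j

lemma fact_ring {A : Type} [CommRing A] (M M1 M2 d : ℕ) (cA : Fin M × Fin (d+1) → A) :
    ∃ (R : Type) (_ : CommRing R) (_ : Algebra A R), Algebra.IsIntegral A R ∧
      (∃ (u : Fin M1 × Fin (d+1) → R) (v : Fin M2 × Fin (d+1) → R),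
        mp u * mp v = mp (fun i => algebraMap A R (cA i))) ∧
      ∀ (κ : Type) [CommRing κ] (ev : A →+* κ) (u : Fin M1 × Fin (d+1) → κ)
        (v : Fin M2 × Fin (d+1) → κ), mp u * mp v = mp (fun i => ev (cA i)) →
        ∃ h : R →+* κ, ∀ a, h (algebraMap A R a) = ev a := by
  let uB : Fin M1 × Fin (d+1) →
    MvPolynomial ((Fin M1 × Fin (d+1)) ⊕ (Fin M2 × Fin (d+1))) A := fun i => MvPolynomial.X (Sum.inl i)
  let vB : Fin M2 × Fin (d+1) →
    MvPolynomial ((Fin M1 × Fin (d+1)) ⊕ (Fin M2 × Fin (d+1))) A := fun i => MvPolynomial.X (Sum.inr i)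
  let E : (MvPolynomial ((Fin M1 × Fin (d+1)) ⊕ (Fin M2 × Fin (d+1))) A)[X][X] :=
    mp uB * mp vB - mp (fun i => algebraMap A _ (cA i))
  let I : Ideal (MvPolynomial ((Fin M1 × Fin (d+1)) ⊕ (Fin M2 × Fin (d+1))) A) :=
    Ideal.span (Set.range fun x : ℕ × ℕ => (E.coeff x.1).coeff x.2)
  have hE : E.map (mapRingHom (Ideal.Quotient.mk I)) = 0 := by
    ext i j
    simp only [coeff_map, coe_mapRingHom, coeff_zero]
    exact Ideal.Quotient.eq_zero_iff_mem.2 (Ideal.subset_span ⟨(i, j), rfl⟩)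
  have hfac : mp (fun i => Ideal.Quotient.mk I (uB i)) * mp (fun i => Ideal.Quotient.mk I (vB i)) =
      mp (fun i => algebraMap A (_ ⧸ I) (cA i)) := by
    have h1 : E.map (mapRingHom (Ideal.Quotient.mk I)) =
      mp (fun i => Ideal.Quotient.mk I (uB i)) * mp (fun i => Ideal.Quotient.mk I (vB i)) -
      mp (fun i => algebraMap A (_ ⧸ I) (cA i)) := by
      change (mp uB * mp vB - mp (fun i => algebraMap A _ (cA i))).map (mapRingHom (Ideal.Quotient.mk I)) = _
      rw [Polynomial.map_sub, Polynomial.map_mul, mp_map, mp_map, mp_map]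
      rfl
    rw [h1] at hE
    exact sub_eq_zero.1 hE
  have hintg : Algebra.IsIntegral A (_ ⧸ I) := by
    have key : ∀ q : (_ ⧸ I)[X][X], q.Monic → q ∣ mp (fun i => algebraMap A (_ ⧸ I) (cA i)) →
        ∀ i j, IsIntegral A ((q.coeff i).coeff j) := by
      intro q hq hd i j
      rw [← mp_map] at hd
      exact int_coeff (mp cA) q (mp_monic _) hq hd i j
    have hX : ∀ w, IsIntegral A (Ideal.Quotient.mk I (MvPolynomial.X w)) := by
      rintro (w | w)
      · have := key _ (mp_monic (fun i => Ideal.Quotient.mk I (uB i))) ⟨_, hfac.symm⟩ w.1 w.2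
        rwa [mp_coeff_coeff] at this
      · have := key _ (mp_monic (fun i => Ideal.Quotient.mk I (vB i)))
          ⟨mp (fun i => Ideal.Quotient.mk I (uB i)), hfac.symm.trans (mul_comm _ _)⟩ w.1 w.2
        rwa [mp_coeff_coeff] at this
    constructor
    intro x
    obtain ⟨b, rfl⟩ := Ideal.Quotient.mk_surjective x
    induction b using MvPolynomial.induction_on with
    | C a => exact isIntegral_algebraMap (R := A) (A := _ ⧸ I) (x := a)
    | add p q hp hq => rw [map_add]; exact hp.add hq
    | mul_X p i hp => rw [map_mul]; exact hp.mul (hX i)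
  refine ⟨_ ⧸ I, inferInstance, inferInstance, hintg, ⟨_, _, hfac⟩, ?_⟩
  intro κ _ ev u v huv
  let evB : MvPolynomial ((Fin M1 × Fin (d+1)) ⊕ (Fin M2 × Fin (d+1))) A →+* κ :=
    MvPolynomial.eval₂Hom ev (Sum.elim u v)
  have hevB : ∀ a : A, evB (algebraMap A _ a) = ev a := fun a => by
    exact MvPolynomial.eval₂Hom_C _ _ _
  have hEv : E.map (mapRingHom evB) = 0 := by
    change (mp uB * mp vB - mp (fun i => algebraMap A _ (cA i))).map (mapRingHom evB) = _
    rw [Polynomial.map_sub, Polynomial.map_mul, mp_map, mp_map, mp_map]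
    simp only [hevB]
    rw [sub_eq_zero]
    convert huv using 3
    · funext i; exact MvPolynomial.eval₂Hom_X' _ _ _
    · funext i; exact MvPolynomial.eval₂Hom_X' _ _ _
  have hI : ∀ b ∈ I, evB b = 0 := by
    have : I ≤ RingHom.ker evB := by
      apply Ideal.span_le.2
      rintro _ ⟨x, rfl⟩
      change evB _ = 0
      have := congrArg (fun p : κ[X][X] => (p.coeff x.1).coeff x.2) hEv
      simpa using this
    exact this
  exact ⟨Ideal.Quotient.lift I evB hI, fun a => hevB a⟩

lemma fact_ideal (M M1 M2 d : ℕ) : ∃ J : Ideal (MvPolynomial (Fin M × Fin (d+1)) ℤ),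
    ∀ (κ : Type) [Field κ] [IsAlgClosed κ] (c : Fin M × Fin (d+1) → κ),
      J ≤ RingHom.ker (MvPolynomial.eval₂Hom (Int.castRingHom κ) c) ↔
      ∃ (u : Fin M1 × Fin (d+1) → κ) (v : Fin M2 × Fin (d+1) → κ), mp u * mp v = mp c := by
  obtain ⟨R, _, _, hintg, ⟨u, v, huv⟩, hu⟩ := fact_ring M M1 M2 d
    (fun i => (MvPolynomial.X i : MvPolynomial (Fin M × Fin (d+1)) ℤ))
  refine ⟨RingHom.ker (algebraMap _ R), ?_⟩
  intro κ _ _ c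
  have evX : ∀ i, MvPolynomial.eval₂Hom (Int.castRingHom κ) c (MvPolynomial.X i) = c i :=
    fun i => MvPolynomial.eval₂Hom_X' _ _ _
  constructor
  · intro hJ
    obtain ⟨g, hg⟩ := lift_of_integral _ hJ
    refine ⟨fun i => g (u i), fun i => g (v i), ?_⟩
    have h2 := congrArg (Polynomial.map (mapRingHom g)) huv
    rw [Polynomial.map_mul, mp_map, mp_map, mp_map] at h2
    rw [h2]
    congr 1
    funext i
    rw [hg, evX]
  · rintro ⟨u', v', huv'⟩
    obtain ⟨g, hg⟩ := hu κ (MvPolynomial.eval₂Hom (Int.castRingHom κ) c) u' v' (by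
      simp only [evX]; exact huv')
    intro a ha
    have h4 : algebraMap _ R a = 0 := ha
    have h3 := hg a
    rw [h4, map_zero] at h3
    exact h3.symm

lemma not_irr_iff {κ : Type} [Field κ] {M d : ℕ} (hM : 1 ≤ M) (c : Fin M × Fin (d+1) → κ) :
    ¬ Irreducible (mp c) ↔ ∃ M1 : Fin M, 1 ≤ (M1:ℕ) ∧
      ∃ (u : Fin M1 × Fin (d+1) → κ) (v : Fin (M - M1) × Fin (d+1) → κ), mp u * mp v = mp c := by
  have hm := mp_monic c
  have hne : mp c ≠ 1 := by
    intro h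
    have := mp_natDegree c
    rw [h, natDegree_one] at this
    omega
  rw [hm.irreducible_iff_natDegree]
  push Not
  constructor
  · intro h
    obtain ⟨f, g, hf, hg, hfg, h1, h2⟩ := h hne
    have hdeg : f.natDegree + g.natDegree = M := by
      rw [← hf.natDegree_mul hg, hfg, mp_natDegree]
    have hW : WB 0 d (f * g) := by
      rw [hfg, WB_zero_iff]; exact mp_deg c
    have := WB_of_mul_zero (by rw [hfg]; exact hm.ne_zero) hW
    rw [WB_zero_iff, WB_zero_iff] at this
    refine ⟨⟨f.natDegree, by omega⟩, by simp only; omega,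
      (fun i => (f.coeff i.1).coeff i.2), (fun i => (g.coeff i.1).coeff i.2), ?_⟩
    rw [← eq_mp f hf rfl this.1, ← eq_mp g hg (by simp only; omega) this.2, hfg]
  · rintro ⟨M1, h1, u, v, huv⟩ _
    refine ⟨_, _, mp_monic u, mp_monic v, huv, ?_, ?_⟩
    · rw [mp_natDegree]; omega
    · rw [mp_natDegree]; omega

theorem irr_forms (M d : ℕ) (hM : 1 ≤ M) :
    ∃ T : Finset (MvPolynomial (Fin M × Fin (d+1)) ℤ),
    ∀ (κ : Type) [Field κ] [IsAlgClosed κ] (c : Fin M × Fin (d+1) → κ),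
      (Irreducible (mp c) ∧ derivative (mp c) ≠ 0) ↔
        ∃ ν ∈ T, MvPolynomial.eval₂Hom (Int.castRingHom κ) c ν ≠ 0 := by
  choose J hJ using fun M1 : Fin M => fact_ideal M M1 (M - M1) d
  obtain ⟨Js, hJs⟩ : ∃ Js : Ideal (MvPolynomial (Fin M × Fin (d+1)) ℤ),
    ∀ (κ : Type) [Field κ] (c : Fin M × Fin (d+1) → κ),
      Js ≤ RingHom.ker (MvPolynomial.eval₂Hom (Int.castRingHom κ) c) ↔ derivative (mp c) = 0 := by
    refine ⟨Ideal.span (Set.range fun x : ℕ × ℕ => ((derivative (mp (fun i =>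
      (MvPolynomial.X i : MvPolynomial (Fin M × Fin (d+1)) ℤ)))).coeff x.1).coeff x.2), ?_⟩
    intro κ _ c
    have h4 : derivative (mp c) = (derivative (mp (fun i =>
      (MvPolynomial.X i : MvPolynomial (Fin M × Fin (d+1)) ℤ)))).map
        (mapRingHom (MvPolynomial.eval₂Hom (Int.castRingHom κ) c)) := by
      rw [← derivative_map, mp_map]
      have : c = fun i => MvPolynomial.eval₂Hom (Int.castRingHom κ) c (MvPolynomial.X i) := by
        funext i; exact (MvPolynomial.eval₂Hom_X' _ _ _).symm
      exact congrArg (fun z => derivative (mp z)) this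
    rw [h4, Ideal.span_le]
    constructor
    · intro h
      ext i j
      have := h ⟨(i, j), rfl⟩
      rw [coeff_map, coe_mapRingHom, coeff_map]
      exact this
    · rintro h _ ⟨x, rfl⟩
      have := congrArg (fun p : κ[X][X] => (p.coeff x.1).coeff x.2) h
      simp only [coeff_map, coe_mapRingHom, coeff_zero] at this
      exact this
  obtain ⟨T, hT⟩ := (IsNoetherian.noetherian
    (Js * ∏ M1 ∈ Finset.univ.filter (fun M1 : Fin M => 1 ≤ (M1:ℕ)), J M1))
  refine ⟨T, ?_⟩
  intro κ _ _ c
  have hP : (RingHom.ker (MvPolynomial.eval₂Hom (Int.castRingHom κ) c)).IsPrime :=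
    RingHom.ker_isPrime _
  have h1 : (∃ ν ∈ T, MvPolynomial.eval₂Hom (Int.castRingHom κ) c ν ≠ 0) ↔
      ¬ (Js * ∏ M1 ∈ Finset.univ.filter (fun M1 : Fin M => 1 ≤ (M1:ℕ)), J M1) ≤
        RingHom.ker (MvPolynomial.eval₂Hom (Int.castRingHom κ) c) := by
    rw [← hT, Submodule.span_le, Set.not_subset]
    rfl
  rw [h1, hP.mul_le, hP.prod_le, not_or]
  have h2 : (∃ i ∈ Finset.univ.filter (fun M1 : Fin M => 1 ≤ (M1:ℕ)),
      J i ≤ RingHom.ker (MvPolynomial.eval₂Hom (Int.castRingHom κ) c)) ↔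
      ¬ Irreducible (mp c) := by
    rw [not_irr_iff hM]
    simp only [Finset.mem_filter, Finset.mem_univ, true_and]
    exact exists_congr fun i => and_congr_right fun _ => hJ i κ c
  rw [h2, hJs, not_not]
  tauto

/-- irreducibility over an algebraically closed field is geometric -/
theorem irr_geom {k K : Type} [Field k] [IsAlgClosed k] [Field K] [IsAlgClosed K] (f : k →+* K)
    (G : k[X][X]) (hG : G.Monic) (hirr : Irreducible G) (hsep : derivative G ≠ 0) :
    Irreducible (G.map (mapRingHom f)) := by
  obtain ⟨d, hd⟩ : ∃ d, ∀ m, (G.coeff m).natDegree ≤ d := by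
    refine ⟨(wmap 0 G).natDegree, ?_⟩
    rw [← WB_zero_iff, WB_iff]
  have hM : 1 ≤ G.natDegree := by
    by_contra h
    have : G.natDegree = 0 := by omega
    rw [hG.natDegree_eq_zero] at this
    exact hirr.not_isUnit (this ▸ isUnit_one)
  obtain ⟨T, hT⟩ := irr_forms G.natDegree d hM
  have e := eq_mp G hG rfl hd
  rw [e] at hirr hsep ⊢
  obtain ⟨ν, hν, h0⟩ := (hT k _).1 ⟨hirr, hsep⟩
  rw [mp_map]
  refine ((hT K _).2 ⟨ν, hν, ?_⟩).1
  intro h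
  apply h0
  apply f.injective
  rw [map_zero, ← h]
  change f (MvPolynomial.eval₂ _ _ ν) = MvPolynomial.eval₂ _ _ ν
  rw [MvPolynomial.hom_eval₂]
  congr 1
  exact RingHom.ext_int _ _
end Ir
end BH

open Polynomial
namespace BH

/-- evaluation of an integral multivariate polynomial -/
noncomputable abbrev zev {V : Type*} {B : Type*} [CommRing B] (v : V → B) : MvPolynomial V ℤ →+* B :=
  MvPolynomial.eval₂Hom (Int.castRingHom B) v

lemma zev_X {V B : Type*} [CommRing B] (v : V → B) (i : V) : zev v (MvPolynomial.X i) = v i :=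
  MvPolynomial.eval₂Hom_X' _ _ _

lemma zev_map {V B B' : Type*} [CommRing B] [CommRing B'] (f : B →+* B') (v : V → B)
    (p : MvPolynomial V ℤ) : f (zev v p) = zev (fun i => f (v i)) p := by
  change f (MvPolynomial.eval₂ _ _ p) = MvPolynomial.eval₂ _ _ p
  rw [MvPolynomial.hom_eval₂]
  congr 1
  exact RingHom.ext_int _ _

lemma zev_rename {V W B : Type*} [CommRing B] (v : W → B) (e : V → W) (p : MvPolynomial V ℤ) :
    zev v (MvPolynomial.rename e p) = zev (fun i => v (e i)) p := by
  change MvPolynomial.eval₂ _ _ _ = MvPolynomial.eval₂ _ _ p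
  rw [MvPolynomial.eval₂_rename]; rfl

/-- `c` are the (lower) coefficients of `∏ (X - τ j)` -/
def Lab {B : Type*} [CommRing B] {N : ℕ} (c τ : Fin N → B) : Prop :=
  ∀ i : Fin N, (∏ j, (X - C (τ j))).coeff i = c i

lemma Lab.map {B B' : Type*} [CommRing B] [CommRing B'] {N : ℕ} {c τ : Fin N → B} (h : Lab c τ)
    (f : B →+* B') : Lab (fun i => f (c i)) (fun i => f (τ i)) := by
  intro i
  show _ = f (c i)
  rw [← h i]
  have : (∏ j, (X - C (f (τ j)))) = (∏ j, (X - C (τ j))).map f := by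
    simp [Polynomial.map_prod]
  rw [this, coeff_map]

lemma Lab.perm {B : Type*} [CommRing B] {N : ℕ} {c τ : Fin N → B} (h : Lab c τ)
    (ρ : Equiv.Perm (Fin N)) : Lab c (fun i => τ (ρ i)) := by
  intro i
  rw [← h i]
  congr 1
  exact Equiv.prod_comp ρ (fun j => X - C (τ j))

lemma Lab.esymm {B : Type*} [CommRing B] {N : ℕ} {c τ : Fin N → B} (h : Lab c τ) (i : Fin N) :
    (Finset.univ.val.map τ).esymm (i + 1) = (-1) ^ ((i:ℕ) + 1) * c (Fin.rev i) := by
  have h1 := Multiset.prod_X_sub_C_coeff (Finset.univ.val.map τ) (k := (Fin.rev i : ℕ)) (by simp)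
  rw [Multiset.map_map] at h1
  have h2 : (Multiset.map ((fun t => X - C t) ∘ τ) Finset.univ.val).prod = ∏ j, (X - C (τ j)) := rfl
  rw [h2, h] at h1
  have h3 : Multiset.card (Finset.univ.val.map τ) - (Fin.rev i : ℕ) = i + 1 := by
    simp [Fin.val_rev]; omega
  rw [h3] at h1
  rw [h1, ← mul_assoc, ← mul_pow]; simp

/-- norm over one block of variables -/
lemma norm_block0 (N : ℕ) {J : Type} (p : MvPolynomial (Fin N ⊕ J) ℤ) :
    ∃ q : MvPolynomial (Fin N ⊕ J) ℤ, ∀ (B : Type) [CommRing B] (τ c : Fin N → B) (j : J → B),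
      Lab c τ → zev (Sum.elim c j) q = ∏ ρ : Equiv.Perm (Fin N), zev (Sum.elim (fun i => τ (ρ i)) j) p := by
  let p' : MvPolynomial (Fin N) (MvPolynomial J ℤ) := MvPolynomial.sumAlgEquiv ℤ (Fin N) J p
  let P : MvPolynomial (Fin N) (MvPolynomial J ℤ) := ∏ ρ : Equiv.Perm (Fin N), MvPolynomial.rename ρ p'
  have hev : ∀ (B : Type) [CommRing B] (τ : Fin N → B) (j : J → B),
      zev (Sum.elim τ j) p = MvPolynomial.eval₂Hom (zev j) τ p' := by
    intro B _ τ j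
    have : (zev (Sum.elim τ j)) = (MvPolynomial.eval₂Hom (zev j) τ).comp
        ((MvPolynomial.sumAlgEquiv ℤ (Fin N) J : _ →+* _)) := by
      apply MvPolynomial.ringHom_ext'
      · exact RingHom.ext_int _ _
      · rintro (i | i)
        · simp [zev_X]
        · simp [zev_X]
    rw [this]; rfl
  have hP : P.IsSymmetric := by
    intro e
    simp only [P, map_prod, MvPolynomial.rename_rename]
    exact Fintype.prod_equiv (Equiv.mulLeft e) _ _ (fun ρ => rfl)
  obtain ⟨Q, hQ⟩ := MvPolynomial.esymmAlgHom_surjective (σ := Fin N) (n := N) (MvPolynomial J ℤ)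
    (by simp) ⟨P, hP⟩
  have hQ' : MvPolynomial.aeval (fun i : Fin N => MvPolynomial.esymm (Fin N) (MvPolynomial J ℤ) (i + 1)) Q = P := by
    have := congrArg Subtype.val hQ
    rwa [MvPolynomial.esymmAlgHom_apply] at this
  -- substitute signs
  let s : MvPolynomial (Fin N) (MvPolynomial J ℤ) →+* MvPolynomial (Fin N ⊕ J) ℤ :=
    MvPolynomial.eval₂Hom (MvPolynomial.rename Sum.inr : MvPolynomial J ℤ →ₐ[ℤ] MvPolynomial (Fin N ⊕ J) ℤ).toRingHom
      (fun i => (-1) ^ ((i:ℕ) + 1) * MvPolynomial.X (Sum.inl (Fin.rev i)))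
  refine ⟨s Q, ?_⟩
  intro B _ τ c j h
  have h1 : zev (Sum.elim c j) (s Q) = MvPolynomial.eval₂Hom (zev j)
      (fun i : Fin N => (-1) ^ ((i:ℕ) + 1) * c (Fin.rev i)) Q := by
    have : (zev (Sum.elim c j)).comp s = MvPolynomial.eval₂Hom (zev j)
      (fun i : Fin N => (-1) ^ ((i:ℕ) + 1) * c (Fin.rev i)) := by
      apply MvPolynomial.ringHom_ext
      · intro r
        simp only [RingHom.comp_apply, s, MvPolynomial.eval₂Hom_C]
        exact zev_rename _ _ _
      · intro i
        simp only [RingHom.comp_apply, s, MvPolynomial.eval₂Hom_X', map_mul, map_pow, map_neg, map_one]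
        simp
    rw [← this]; rfl
  have h2 : MvPolynomial.eval₂Hom (zev j) τ P = MvPolynomial.eval₂Hom (zev j)
      (fun i : Fin N => (-1) ^ ((i:ℕ) + 1) * c (Fin.rev i)) Q := by
    rw [← hQ']
    have : ((MvPolynomial.eval₂Hom (zev j) τ).comp ((MvPolynomial.aeval
      (fun i : Fin N => MvPolynomial.esymm (Fin N) (MvPolynomial J ℤ) (i + 1)) :
        MvPolynomial (Fin N) (MvPolynomial J ℤ) →ₐ[MvPolynomial J ℤ] _) : _ →+* _)) =
       MvPolynomial.eval₂Hom (zev j)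
      (fun i : Fin N => (-1) ^ ((i:ℕ) + 1) * c (Fin.rev i)) := by
      apply MvPolynomial.ringHom_ext
      · intro r
        simp
      · intro i
        simp only [RingHom.comp_apply, RingHom.coe_coe, MvPolynomial.aeval_X, MvPolynomial.eval₂Hom_X']
        rw [← h.esymm i]
        letI : Algebra (MvPolynomial J ℤ) B := (zev j).toAlgebra
        exact MvPolynomial.aeval_esymm_eq_multiset_esymm (Fin N) (MvPolynomial J ℤ) _ τ
    rw [← this]; rfl
  rw [h1, ← h2, map_prod]
  apply Finset.prod_congr rfl
  intro ρ _
  rw [hev]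
  simp only [MvPolynomial.coe_eval₂Hom, MvPolynomial.eval₂_rename]
  rfl

/-- norm over one block, with the block embedded in a set of variables -/
lemma norm_block {V : Type} [DecidableEq V] (N : ℕ) (e : Fin N → V) (he : Function.Injective e)
    (p : MvPolynomial V ℤ) :
    ∃ q : MvPolynomial V ℤ, ∀ (B : Type) [CommRing B] (v w : V → B),
      Lab (fun i => w (e i)) (fun i => v (e i)) → (∀ x, (∀ i, x ≠ e i) → w x = v x) →
      ∀ V' : Equiv.Perm (Fin N) → V → B, (∀ ρ i, V' ρ (e i) = v (e (ρ i))) →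
        (∀ ρ x, (∀ i, x ≠ e i) → V' ρ x = v x) →
      zev w q = ∏ ρ : Equiv.Perm (Fin N), zev (V' ρ) p := by
  classical
  let f : V → Fin N ⊕ V := fun x => if h : ∃ i, e i = x then Sum.inl h.choose else Sum.inr x
  have f1 : ∀ i, f (e i) = Sum.inl i := by
    intro i
    have h : ∃ i', e i' = e i := ⟨i, rfl⟩
    simp only [f, dif_pos h]
    congr 1
    exact he h.choose_spec
  have f2 : ∀ x, (∀ i, x ≠ e i) → f x = Sum.inr x := by
    intro x hx
    have h : ¬ ∃ i', e i' = x := fun ⟨i, hi⟩ => hx i hi.symm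
    simp only [f, dif_neg h]
  obtain ⟨q, hq⟩ := norm_block0 N (MvPolynomial.rename f p)
  refine ⟨MvPolynomial.rename (Sum.elim e id) q, ?_⟩
  intro B _ v w hL hw V' h1 h2
  rw [zev_rename]
  have h3 : (fun i => w (Sum.elim e id i)) = Sum.elim (fun i => w (e i)) w := by
    funext i; rcases i with i | i <;> rfl
  rw [h3, hq B (fun i => v (e i)) (fun i => w (e i)) w hL]
  apply Finset.prod_congr rfl
  intro ρ _
  rw [zev_rename]
  congr 2
  funext x
  by_cases hx : ∃ i, e i = x
  · obtain ⟨i, rfl⟩ := hx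
    rw [f1, h1]; rfl
  · have hx' : ∀ i, x ≠ e i := fun i hi => hx ⟨i, hi.symm⟩
    rw [f2 x hx', h2 ρ x hx', ← hw x hx']; rfl

end BH

open Polynomial
namespace BH

section blocks
variable {K : Type} [Fintype K] [DecidableEq K] (N : K → ℕ)

/-- labels -/
abbrev Lb (N : K → ℕ) := Σ kk : K, Fin (N kk)
/-- block permutations -/
abbrev Gp (N : K → ℕ) := ∀ kk : K, Equiv.Perm (Fin (N kk))
/-- action on labels -/
def act {N : K → ℕ} (σ : Gp N) (ι : Lb N) : Lb N := ⟨ι.1, σ ι.1 ι.2⟩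

/-- block-wise labelling -/
def Labs {N : K → ℕ} {B : Type} [CommRing B] (c τ : Lb N → B) : Prop :=
  ∀ kk, Lab (fun i => c ⟨kk, i⟩) (fun i => τ ⟨kk, i⟩)

lemma norm_blocks {J : Type} [DecidableEq J] (p : MvPolynomial (Lb N ⊕ J) ℤ) (s : Finset K) :
    ∃ q : MvPolynomial (Lb N ⊕ J) ℤ, ∀ (B : Type) [CommRing B] (τ c : Lb N → B) (j : J → B),
      (∀ kk ∈ s, Lab (fun i => c ⟨kk, i⟩) (fun i => τ ⟨kk, i⟩)) →
      zev (Sum.elim (fun ι => if ι.1 ∈ s then c ι else τ ι) j) q =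
        ∏ σ ∈ Fintype.piFinset (fun kk => if kk ∈ s then (Finset.univ : Finset (Equiv.Perm (Fin (N kk)))) else {1}),
          zev (Sum.elim (fun ι => τ (act σ ι)) j) p := by
  classical
  induction s using Finset.induction_on with
  | empty =>
    refine ⟨p, ?_⟩
    intro B _ τ c j _
    have : Fintype.piFinset (fun kk : K => if kk ∈ (∅ : Finset K) then (Finset.univ : Finset (Equiv.Perm (Fin (N kk)))) else {1}) = {1} := by
      ext σ
      simp only [Fintype.mem_piFinset, Finset.notMem_empty, if_false, Finset.mem_singleton]
      exact ⟨fun h => funext h, fun h => by rw [h]; intro; rfl⟩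
    rw [this, Finset.prod_singleton]
    simp [act]
  | insert a s ha ih =>
    obtain ⟨q, hq⟩ := ih
    obtain ⟨q', hq'⟩ := norm_block (N a) (fun i => (Sum.inl ⟨a, i⟩ : Lb N ⊕ J))
      (by intro i j h; simpa using h) q
    refine ⟨q', ?_⟩
    intro B _ τ c j hL
    let ta : Equiv.Perm (Fin (N a)) → Lb N → B := fun ρ ι => τ (act (Function.update 1 a ρ) ι)
    have ta1 : ∀ ρ i, ta ρ ⟨a, i⟩ = τ ⟨a, ρ i⟩ := by intro ρ i; simp [ta, act]
    have ta2 : ∀ ρ (ι : Lb N), ι.1 ≠ a → ta ρ ι = τ ι := by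
      intro ρ ι h
      simp [ta, act, Function.update_of_ne h]
    rw [hq' B (Sum.elim (fun ι => if ι.1 ∈ s then c ι else τ ι) j) _ ?_ ?_
      (fun ρ => Sum.elim (fun ι => if ι.1 ∈ s then c ι else ta ρ ι) j) ?_ ?_]
    · have h3 : ∀ ρ, zev (Sum.elim (fun ι => if ι.1 ∈ s then c ι else ta ρ ι) j) q = _ :=
        fun ρ => hq B (ta ρ) c j (by
          intro kk hk
          have hka : kk ≠ a := fun h => ha (h ▸ hk)
          have := hL kk (Finset.mem_insert_of_mem hk)
          have h4 : (fun i => ta ρ ⟨kk, i⟩) = fun i => τ ⟨kk, i⟩ := by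
            funext i; exact ta2 ρ ⟨kk, i⟩ hka
          rw [h4]; exact this)
      rw [Finset.prod_congr rfl (fun ρ _ => h3 ρ), ← Finset.prod_product']
      refine Finset.prod_bij' (fun x _ => Function.update x.2 a x.1) (fun σ _ => (σ a, Function.update σ a 1)) ?_ ?_ ?_ ?_ ?_
      · rintro ⟨ρ, σ⟩ h
        simp only [Finset.mem_product, Finset.mem_univ, true_and, Fintype.mem_piFinset] at h ⊢
        intro kk
        by_cases hk : kk = a
        · subst hk; simp
        · rw [Function.update_of_ne hk]
          have := h kk
          simpa [Finset.mem_insert, hk] using this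
      · intro σ h
        simp only [Finset.mem_product, Finset.mem_univ, true_and, Fintype.mem_piFinset] at h ⊢
        intro kk
        by_cases hk : kk = a
        · subst hk; simp [ha]
        · rw [Function.update_of_ne hk]
          have := h kk
          simpa [Finset.mem_insert, hk] using this
      · rintro ⟨ρ, σ⟩ h
        simp only [Finset.mem_product, Finset.mem_univ, true_and, Fintype.mem_piFinset] at h
        have := h a
        simp only [ha, if_false, Finset.mem_singleton] at this
        simp [← this]
      · intro σ h
        simp
      · rintro ⟨ρ, σ⟩ h
        simp only [Finset.mem_product, Finset.mem_univ, true_and, Fintype.mem_piFinset] at h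
        have hsa := h a
        simp only [ha, if_false, Finset.mem_singleton] at hsa
        congr 2
        funext x
        rcases x with ⟨kk, i⟩ | x
        · simp only [Sum.elim_inl]
          by_cases hk : kk = a
          · subst hk; simp [ta, act, hsa]
          · simp [ta, act, Function.update_of_ne hk]
        · rfl
    · have := hL a (Finset.mem_insert_self _ _)
      simpa [ha] using this
    · rintro (⟨kk, i⟩ | x) h
      · have hk : kk ≠ a := by
          rintro rfl; exact h i rfl
        simp [hk]
      · rfl
    · intro ρ i
      simp [ha, ta1]
    · rintro ρ (⟨kk, i⟩ | x) h
      · have hk : kk ≠ a := by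
          rintro rfl; exact h i rfl
        simp [ta2 ρ ⟨kk, i⟩ hk]
      · rfl

lemma rsq_exists : ∃ q : MvPolynomial (Lb N ⊕ (Lb N ⊕ Unit)) ℤ, ∀ (B : Type) [CommRing B]
    (τ c : Lb N → B) (u : Lb N → B) (y : B), Labs c τ →
    zev (Sum.elim c (Sum.elim u (fun _ => y))) q = ∏ σ : Gp N, (y - ∑ ι, u ι * τ (act σ ι)) := by
  obtain ⟨q, hq⟩ := norm_blocks N (J := Lb N ⊕ Unit) (MvPolynomial.X (Sum.inr (Sum.inr ())) -
    ∑ ι, MvPolynomial.X (Sum.inr (Sum.inl ι)) * MvPolynomial.X (Sum.inl ι)) Finset.univ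
  refine ⟨q, ?_⟩
  intro B _ τ c u y h
  have := hq B τ c (Sum.elim u (fun _ => y)) (fun kk _ => h kk)
  simp only [Finset.mem_univ, if_true, Fintype.piFinset_univ] at this
  rw [this]
  apply Finset.prod_congr rfl
  intro σ _
  simp [map_sub, map_sum, zev_X]

/-- the universal resolvent -/
noncomputable def rsq : MvPolynomial (Lb N ⊕ (Lb N ⊕ Unit)) ℤ := (rsq_exists N).choose

variable {N}
/-- the resolvent of coefficients `c` with weights `u` -/
noncomputable def resv {B : Type} [CommRing B] (c u : Lb N → B) : B[X] :=
  zev (Sum.elim (fun i => C (c i)) (Sum.elim (fun i => C (u i)) (fun _ => X))) (rsq N)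

lemma Labs.map {B B' : Type} [CommRing B] [CommRing B'] {c τ : Lb N → B} (h : Labs c τ)
    (f : B →+* B') : Labs (fun i => f (c i)) (fun i => f (τ i)) := fun kk => (h kk).map f

lemma resv_eq {B : Type} [CommRing B] {c τ : Lb N → B} (u : Lb N → B) (h : Labs c τ) :
    resv c u = ∏ σ : Gp N, (X - C (∑ ι, u ι * τ (act σ ι))) := by
  have := (rsq_exists N).choose_spec B[X] _ _ (fun i => C (u i)) X (h.map C)
  rw [resv]
  refine this.trans ?_
  simp

lemma resv_map {B B' : Type} [CommRing B] [CommRing B'] (f : B →+* B') (c u : Lb N → B) :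
    (resv c u).map f = resv (fun i => f (c i)) (fun i => f (u i)) := by
  have := zev_map (mapRingHom f) (Sum.elim (fun i => C (c i)) (Sum.elim (fun i => C (u i)) (fun _ => X))) (rsq N)
  rw [resv, resv, ← coe_mapRingHom, this]
  congr 2
  funext x
  rcases x with x | x | x <;> simp

lemma exists_prod_X_sub {k : Type*} [Field k] {N : ℕ} (p : k[X]) (hm : p.Monic) (hs : p.Splits) (hp : p.natDegree = N) :
    ∃ τ : Fin N → k, ∏ j, (X - C (τ j)) = p := by
  have hc : Multiset.card p.roots = N := by rw [← hp]; exact hs.natDegree_eq_card_roots.symm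
  obtain ⟨l, hl⟩ : ∃ l : List k, (l : Multiset k) = p.roots := Quot.exists_rep _
  have hlen : l.length = N := by rw [← hc, ← hl]; rfl
  subst hlen
  refine ⟨fun i => l[i.1], ?_⟩
  rw [Fin.prod_univ_fun_getElem l (fun a => X - C a)]
  conv_rhs => rw [hs.eq_prod_roots_of_monic hm, ← hl, Multiset.map_coe, Multiset.prod_coe]

lemma lab_of_prod {B : Type*} [CommRing B] {N : ℕ} {p : B[X]} {τ c : Fin N → B}
    (h : ∏ j, (X - C (τ j)) = p) (hc : ∀ i : Fin N, c i = p.coeff i) : Lab c τ := by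
  intro i; rw [h, hc]

lemma exists_lab {k : Type*} [Field k] [IsAlgClosed k] {N : ℕ} (c : Fin N → k) : ∃ τ : Fin N → k, Lab c τ := by
  let p : k[X] := X ^ N + ∑ i : Fin N, C (c i) * X ^ (i : ℕ)
  have hd : (∑ i : Fin N, C (c i) * X ^ (i : ℕ)).degree < (N : WithBot ℕ) := by
    refine (degree_sum_le _ _).trans_lt ?_
    refine (Finset.sup_lt_iff (WithBot.bot_lt_coe N)).2 ?_
    intro i _
    exact (degree_C_mul_X_pow_le _ _).trans_lt (WithBot.coe_lt_coe.2 i.2)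
  have hm : p.Monic := monic_X_pow_add hd
  have hp : p.natDegree = N := by
    apply natDegree_eq_of_degree_eq_some
    rw [degree_add_eq_left_of_degree_lt, degree_X_pow]
    rwa [degree_X_pow]
  obtain ⟨τ, hτ⟩ := exists_prod_X_sub p hm (IsAlgClosed.splits p) hp
  refine ⟨τ, lab_of_prod hτ ?_⟩
  intro i
  simp only [p, coeff_add, coeff_X_pow, finset_sum_coeff, coeff_C_mul]
  rw [if_neg (by have := i.2; omega), zero_add, Finset.sum_eq_single i]
  · simp
  · intro b _ hb
    rw [if_neg (fun h => hb (Fin.ext h.symm)), mul_zero]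
  · simp

lemma exists_labs {k : Type} [Field k] [IsAlgClosed k] (c : Lb N → k) : ∃ τ : Lb N → k, Labs c τ := by
  choose τ hτ using fun kk => exists_lab (fun i => c ⟨kk, i⟩)
  exact ⟨fun ι => τ ι.1 ι.2, hτ⟩

lemma resv_monic {B : Type} [CommRing B] [IsDomain B] (c u : Lb N → B) :
    (resv c u).Monic ∧ (resv c u).natDegree = Fintype.card (Gp N) := by
  let f : B →+* AlgebraicClosure (FractionRing B) :=
    (algebraMap (FractionRing B) (AlgebraicClosure (FractionRing B))).comp (algebraMap B (FractionRing B))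
  have hf : Function.Injective f :=
    (algebraMap (FractionRing B) (AlgebraicClosure (FractionRing B))).injective.comp
      (IsFractionRing.injective B (FractionRing B))
  obtain ⟨τ, hτ⟩ := exists_labs (fun i => f (c i))
  have h := resv_eq (fun i => f (u i)) hτ
  rw [← resv_map] at h
  have hm : ((resv c u).map f).Monic := by
    rw [h]; exact monic_prod_of_monic _ _ (fun σ _ => monic_X_sub_C _)
  refine ⟨monic_of_injective hf hm, ?_⟩
  rw [← natDegree_map_eq_of_injective hf, h, natDegree_prod_of_monic _ _ (fun σ _ => monic_X_sub_C _)]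
  simp only [natDegree_X_sub_C, Finset.sum_const, smul_eq_mul, mul_one, Finset.card_univ]

/-- coefficient of `w` -/
noncomputable def c1 {B : Type} [CommRing B] (P : B[X][X]) : B[X] := (wmap 0 P).coeff 1

lemma c1_coeff {B : Type} [CommRing B] (P : B[X][X]) (j : ℕ) : (c1 P).coeff j = (P.coeff j).coeff 1 := by
  rw [c1, wmap_coeff]; simp

lemma c1_map {B B' : Type} [CommRing B] [CommRing B'] (f : B →+* B') (P : B[X][X]) :
    (c1 P).map f = c1 (P.map (mapRingHom f)) := by
  ext j; simp [c1_coeff]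

lemma c1_add {B : Type} [CommRing B] (P Q : B[X][X]) : c1 (P + Q) = c1 P + c1 Q := by
  ext j; simp [c1_coeff]

lemma c1_formula {B : Type} [CommRing B] (P : B[X][X]) (θ θ' : B) :
    (P.eval (C θ + X * C θ')).coeff 1 = (c1 P).eval θ + θ' * (derivative (P.map (evalRingHom 0))).eval θ := by
  induction P using Polynomial.induction_on' with
  | add p q hp hq =>
    rw [eval_add, coeff_add, hp, hq, c1_add, Polynomial.map_add, derivative_add, eval_add, eval_add]; ring
  | monomial l c =>
    have h1 : ∀ p : B[X], p.coeff 1 = (derivative p).eval 0 := by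
      intro p; rw [← coeff_zero_eq_eval_zero, coeff_derivative]; simp
    have h2 : c1 (monomial l c) = monomial l (c.coeff 1) := by
      ext j; rw [c1_coeff, coeff_monomial, coeff_monomial]; split_ifs <;> simp
    rw [h2, h1, h1, eval_monomial]
    simp [derivative_mul, derivative_pow, derivative_monomial]
    ring

/-- the polynomial `x` -/
noncomputable def xpol {B : Type} [CommRing B] (c u u' : Lb N → B) : B[X] :=
  - c1 (resv (fun i => C (c i)) (fun i => C (u i) + X * C (u' i)))

lemma xpol_map {B B' : Type} [CommRing B] [CommRing B'] (f : B →+* B') (c u u' : Lb N → B) :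
    (xpol c u u').map f = xpol (fun i => f (c i)) (fun i => f (u i)) (fun i => f (u' i)) := by
  rw [xpol, xpol, Polynomial.map_neg, c1_map, resv_map]
  simp

lemma xpol_eval {B : Type} [CommRing B] {c τ : Lb N → B} (u u' : Lb N → B) (h : Labs c τ) :
    (xpol c u u').eval (∑ ι, u ι * τ ι) =
      (derivative (resv c u)).eval (∑ ι, u ι * τ ι) * ∑ ι, u' ι * τ ι := by
  set P : B[X][X] := resv (fun i => C (c i)) (fun i => C (u i) + X * C (u' i)) with hP
  have h0 : P.map (evalRingHom 0) = resv c u := by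
    rw [hP, resv_map]; simp
  have h1 := c1_formula P (∑ ι, u ι * τ ι) (∑ ι, u' ι * τ ι)
  have h2 : P.eval (C (∑ ι, u ι * τ ι) + X * C (∑ ι, u' ι * τ ι)) = 0 := by
    rw [hP, resv_eq _ (h.map C), eval_prod]
    apply Finset.prod_eq_zero (Finset.mem_univ (1 : Gp N))
    have : ∀ ι : Lb N, act (1 : Gp N) ι = ι := fun ι => rfl
    simp only [this, eval_sub, eval_X, eval_C, sub_eq_zero]
    simp only [map_sum, C_mul, Finset.mul_sum, ← Finset.sum_add_distrib]
    apply Finset.sum_congr rfl; intro ι _; ring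
  rw [h2, coeff_zero, h0] at h1
  rw [xpol, eval_neg, ← hP]
  linear_combination h1
end blocks

/-- a (multiplicative) filtration -/
structure IsFil {A : Type*} [CommRing A] (Fil : ℕ → A → Prop) : Prop where
  mono : ∀ {D E a}, D ≤ E → Fil D a → Fil E a
  add : ∀ {D a b}, Fil D a → Fil D b → Fil D (a + b)
  mul : ∀ {D E a b}, Fil D a → Fil E b → Fil (D + E) (a * b)
  int : ∀ z : ℤ, Fil 0 (z : A)

namespace IsFil
variable {A : Type*} [CommRing A] {Fil : ℕ → A → Prop}

lemma zero (h : IsFil Fil) (D : ℕ) : Fil D 0 := by have := h.int 0; exact h.mono (Nat.zero_le _) (by simpa using this)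
lemma one (h : IsFil Fil) (D : ℕ) : Fil D 1 := by have := h.int 1; exact h.mono (Nat.zero_le _) (by simpa using this)

lemma sum (h : IsFil Fil) {β : Type*} (s : Finset β) (f : β → A) (D : ℕ) (hf : ∀ i ∈ s, Fil D (f i)) : Fil D (∑ i ∈ s, f i) := by
  classical
  induction s using Finset.induction_on with
  | empty => simpa using h.zero D
  | insert a s ha ih =>
    rw [Finset.sum_insert ha]
    exact h.add (hf a (by simp)) (ih (fun i hi => hf i (by simp [hi])))

lemma prod (h : IsFil Fil) {β : Type*} (s : Finset β) (f : β → A) (D : β → ℕ) (hf : ∀ i ∈ s, Fil (D i) (f i)) :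
    Fil (∑ i ∈ s, D i) (∏ i ∈ s, f i) := by
  classical
  induction s using Finset.induction_on with
  | empty => simpa using h.one 0
  | insert a s ha ih =>
    rw [Finset.sum_insert ha, Finset.prod_insert ha]
    exact h.mul (hf a (by simp)) (ih (fun i hi => hf i (by simp [hi])))

lemma pow (h : IsFil Fil) {D a} (ha : Fil D a) (n : ℕ) : Fil (n * D) (a ^ n) := by
  induction n with
  | zero => simpa using h.one 0
  | succ n ih => rw [pow_succ, Nat.succ_mul]; exact h.mul ih ha

lemma zev (h : IsFil Fil) {V : Type*} (q : MvPolynomial V ℤ) (v : V → A) (D : ℕ) (hv : ∀ i, Fil D (v i)) :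
    Fil (q.totalDegree * D) (zev v q) := by
  change Fil _ (MvPolynomial.eval₂ _ _ q)
  rw [MvPolynomial.eval₂_eq]
  apply h.sum
  intro m hm
  have h1 : Fil (∑ i ∈ m.support, m i * D) (∏ i ∈ m.support, v i ^ m i) :=
    h.prod _ _ _ (fun i _ => h.pow (hv i) _)
  have h2 := h.mul (h.int (MvPolynomial.coeff m q)) h1
  refine h.mono ?_ h2
  rw [zero_add, ← Finset.sum_mul]
  exact Nat.mul_le_mul_right _ (MvPolynomial.le_totalDegree hm)
end IsFil

/-- filtration on polynomials -/
def FilX {A : Type*} [CommRing A] (Fil : ℕ → A → Prop) (D : ℕ) (p : A[X]) : Prop :=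
  p.natDegree ≤ D ∧ ∀ m, Fil D (p.coeff m)

lemma IsFil.X {A : Type*} [CommRing A] {Fil : ℕ → A → Prop} (h : IsFil Fil) : IsFil (FilX Fil) where
  mono hDE hp := ⟨hp.1.trans hDE, fun m => h.mono hDE (hp.2 m)⟩
  add hp hq := ⟨(natDegree_add_le _ _).trans (max_le hp.1 hq.1), fun m => by
    rw [coeff_add]; exact h.add (hp.2 m) (hq.2 m)⟩
  mul hp hq := ⟨natDegree_mul_le.trans (Nat.add_le_add hp.1 hq.1), fun m => by
    rw [coeff_mul]; exact h.sum _ _ _ (fun i _ => h.mul (hp.2 _) (hq.2 _))⟩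
  int z := ⟨by simp, fun m => by
    have : ((z : A[X])) = C (z : A) := by simp
    rw [this, coeff_C]; split_ifs
    · exact h.int z
    · exact h.zero 0⟩

lemma isFil_true (A : Type*) [CommRing A] : IsFil (fun (_ : ℕ) (_ : A) => True) :=
  ⟨fun _ _ => trivial, fun _ _ => trivial, fun _ _ => trivial, fun _ => trivial⟩

lemma isFil_td (σ k : Type*) [CommRing k] : IsFil (fun (D : ℕ) (p : MvPolynomial σ k) => p.totalDegree ≤ D) where
  mono := fun hDE hp => hp.trans hDE
  add := fun hp hq => (MvPolynomial.totalDegree_add _ _).trans (max_le hp hq)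
  mul := fun hp hq => (MvPolynomial.totalDegree_mul _ _).trans (Nat.add_le_add hp hq)
  int := fun z => by
    have : ((z : MvPolynomial σ k)) = MvPolynomial.C (z : k) := by simp
    rw [this, MvPolynomial.totalDegree_C]

lemma FilX.C {A : Type*} [CommRing A] {Fil : ℕ → A → Prop} (h : IsFil Fil) {D : ℕ} {a : A} (ha : Fil D a) :
    FilX Fil D (Polynomial.C a) :=
  ⟨by simp, fun m => by rw [coeff_C]; split_ifs; exacts [ha, h.zero D]⟩

lemma FilX.X {A : Type*} [CommRing A] {Fil : ℕ → A → Prop} (h : IsFil Fil) {D : ℕ} (hD : 1 ≤ D) :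
    FilX Fil D (Polynomial.X : A[X]) :=
  ⟨natDegree_X_le.trans hD, fun m => by rw [coeff_X]; split_ifs; exacts [h.one D, h.zero D]⟩

section
variable {K : Type} [Fintype K] [DecidableEq K] {N : K → ℕ}

lemma resv_fil {A : Type} [CommRing A] {Fil : ℕ → A → Prop} (h : IsFil Fil) {D : ℕ} (hD : 1 ≤ D)
    (c u : Lb N → A) (hc : ∀ i, Fil D (c i)) (hu : ∀ i, Fil D (u i)) :
    FilX Fil ((rsq N).totalDegree * D) (resv c u) := by
  apply h.X.zev
  rintro (i | i | i)
  · exact FilX.C h (hc i)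
  · exact FilX.C h (hu i)
  · exact FilX.X h hD

lemma xpol_fil {A : Type} [CommRing A] {Fil : ℕ → A → Prop} (h : IsFil Fil) {D : ℕ} (hD : 1 ≤ D)
    (c u u' : Lb N → A) (hc : ∀ i, Fil D (c i)) (hu : ∀ i, Fil D (u i)) (hu' : ∀ i, Fil D (u' i)) :
    FilX Fil ((rsq N).totalDegree * (D + D)) (xpol c u u') := by
  have h1 := resv_fil h.X (D := D + D) (by omega) (fun i => C (c i)) (fun i => C (u i) + X * C (u' i))
    (fun i => FilX.C h (h.mono (by omega) (hc i)))
    (fun i => h.X.add (FilX.C h (h.mono (by omega) (hu i))) (h.X.mul (FilX.X h hD) (FilX.C h (hu' i))))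
  have h2 : FilX Fil ((rsq N).totalDegree * (D + D)) (c1 (resv (fun i => C (c i)) (fun i => C (u i) + X * C (u' i)))) := by
    refine ⟨?_, fun m => ?_⟩
    · rw [natDegree_le_iff_coeff_eq_zero]
      intro j hj
      rw [c1_coeff, coeff_eq_zero_of_natDegree_lt (h1.1.trans_lt hj), coeff_zero]
    · rw [c1_coeff]; exact (h1.2 m).2 1
  have h3 := h.X.mul (h.X.int (-1)) h2
  rw [zero_add] at h3
  simpa [xpol] using h3
end
end BH

open Polynomial
namespace BH

/-- extension of isomorphisms along plane curves -/
lemma curve_iso {F L L' : Type} [Field F] [Field L] [Field L'] [IsAlgClosed L] [IsAlgClosed L']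
    (i : F →+* L) (i' : F →+* L') (G : F[X][X]) (hG : G.Monic) (hirr : Irreducible G)
    (t x : L) (t' x' : L')
    (ht : Function.Injective (eval₂RingHom i t)) (ht' : Function.Injective (eval₂RingHom i' t'))
    (hx : G.eval₂ (eval₂RingHom i t) x = 0) (hx' : G.eval₂ (eval₂RingHom i' t') x' = 0)
    (hL : ∀ z : L, ∃ p : F[X][X], p ≠ 0 ∧ p.eval₂ (eval₂RingHom i t) z = 0)
    (hL' : ∀ z : L', ∃ p : F[X][X], p ≠ 0 ∧ p.eval₂ (eval₂RingHom i' t') z = 0) :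
    ∃ ρ : L ≃+* L', (∀ c, ρ (i c) = i' c) ∧ ρ t = t' ∧ ρ x = x' := by
  haveI : Fact (Irreducible G) := ⟨hirr⟩
  haveI : IsDomain (AdjoinRoot G) := AdjoinRoot.isDomain_of_prime hirr.prime
  let e : AdjoinRoot G →+* L := AdjoinRoot.lift (eval₂RingHom i t) x hx
  let e' : AdjoinRoot G →+* L' := AdjoinRoot.lift (eval₂RingHom i' t') x' hx'
  have hintg : Algebra.IsIntegral F[X] (AdjoinRoot G) := by
    haveI := hG.finite_adjoinRoot
    exact Algebra.IsIntegral.of_finite _ _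
  have hof : Function.Injective (AdjoinRoot.of G) := by
    have : Function.Injective (e.comp (AdjoinRoot.of G)) := by
      have : e.comp (AdjoinRoot.of G) = eval₂RingHom i t := AdjoinRoot.lift_comp_of _
      rw [this]; exact ht
    exact Function.Injective.of_comp (f := e) this
  have inj : ∀ {L : Type} [Field L] (f : AdjoinRoot G →+* L), Function.Injective (f.comp (AdjoinRoot.of G)) → Function.Injective f := by
    intro L _ f hf
    rw [RingHom.injective_iff_ker_eq_bot]
    apply Ideal.eq_bot_of_comap_eq_bot (R := F[X])
    rw [eq_bot_iff]
    intro r hr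
    have : f (AdjoinRoot.of G r) = 0 := hr
    exact hf (by simpa using this)
  have he : Function.Injective e := inj e (by
      have : e.comp (AdjoinRoot.of G) = eval₂RingHom i t := AdjoinRoot.lift_comp_of _
      rw [this]; exact ht)
  have he' : Function.Injective e' := inj e' (by
      have : e'.comp (AdjoinRoot.of G) = eval₂RingHom i' t' := AdjoinRoot.lift_comp_of _
      rw [this]; exact ht')
  letI : Algebra (AdjoinRoot G) L := e.toAlgebra
  letI : Algebra (AdjoinRoot G) L' := e'.toAlgebra
  haveI : Module.IsTorsionFree (AdjoinRoot G) L := Module.isTorsionFree_iff_algebraMap_injective.2 he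
  haveI : Module.IsTorsionFree (AdjoinRoot G) L' := Module.isTorsionFree_iff_algebraMap_injective.2 he'
  haveI : IsAlgClosure (AdjoinRoot G) L := ⟨inferInstance, ⟨fun z => by
    obtain ⟨p, hp, hz⟩ := hL z
    refine ⟨p.map (AdjoinRoot.of G), (Polynomial.map_ne_zero_iff hof).2 hp, ?_⟩
    rw [aeval_def, eval₂_map]
    have : (algebraMap (AdjoinRoot G) L).comp (AdjoinRoot.of G) = eval₂RingHom i t := AdjoinRoot.lift_comp_of _
    rw [this]; exact hz⟩⟩
  haveI : IsAlgClosure (AdjoinRoot G) L' := ⟨inferInstance, ⟨fun z => by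
    obtain ⟨p, hp, hz⟩ := hL' z
    refine ⟨p.map (AdjoinRoot.of G), (Polynomial.map_ne_zero_iff hof).2 hp, ?_⟩
    rw [aeval_def, eval₂_map]
    have : (algebraMap (AdjoinRoot G) L').comp (AdjoinRoot.of G) = eval₂RingHom i' t' := AdjoinRoot.lift_comp_of _
    rw [this]; exact hz⟩⟩
  let ρ := IsAlgClosure.equiv (AdjoinRoot G) L L'
  have hρ : ∀ z, ρ (e z) = e' z := fun z => ρ.commutes z
  have e1 : ∀ r, e (AdjoinRoot.of G r) = eval₂RingHom i t r := fun r => AdjoinRoot.lift_of _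
  have e1' : ∀ r, e' (AdjoinRoot.of G r) = eval₂RingHom i' t' r := fun r => AdjoinRoot.lift_of _
  refine ⟨ρ.toRingEquiv, ?_, ?_, ?_⟩
  · intro c
    have := hρ (AdjoinRoot.of G (C c))
    rw [e1, e1'] at this
    simpa using this
  · have := hρ (AdjoinRoot.of G X)
    rw [e1, e1'] at this
    simpa using this
  · have := hρ (AdjoinRoot.root G)
    have h1 : e (AdjoinRoot.root G) = x := AdjoinRoot.lift_root _
    have h2 : e' (AdjoinRoot.root G) = x' := AdjoinRoot.lift_root _
    rw [h1, h2] at this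
    exact this

section cl
variable (k : Type) {L : Type} [Field k] [Field L] [Algebra k L]

/-- relative algebraic closure of the field generated by a set -/
noncomputable def cl (S : Set L) : IntermediateField k L :=
  (algebraicClosure (IntermediateField.adjoin k S) L).restrictScalars k

variable {k}
open scoped IntermediateField.algebraAdjoinAdjoin in
lemma mem_cl {S : Set L} {x : L} : x ∈ cl k S ↔ IsAlgebraic (Algebra.adjoin k S) x := by
  rw [cl, IntermediateField.mem_restrictScalars, mem_algebraicClosure_iff]
  exact (IsFractionRing.isAlgebraic_iff (Algebra.adjoin k S) (IntermediateField.adjoin k S) L).symm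

lemma mem_cl' {S : Set L} {x : L} : x ∈ cl k S ↔ x ∈ (AlgebraicIndependent.matroid k L).closure S := by
  rw [mem_cl, AlgebraicIndependent.matroid_closure_eq]; rfl

lemma coe_cl (S : Set L) : (cl k S : Set L) = (AlgebraicIndependent.matroid k L).closure S := by
  ext x; exact mem_cl'

lemma subset_cl (S : Set L) : S ⊆ cl k S := by
  rw [coe_cl]; exact Matroid.subset_closure _ _ (by simp)

lemma cl_le {S T : Set L} (h : S ⊆ cl k T) : cl k S ≤ cl k T := by
  intro x hx
  rw [coe_cl] at h
  rw [mem_cl'] at hx ⊢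
  exact Matroid.closure_subset_closure_of_subset_closure h hx

lemma cl_mono {S T : Set L} (h : S ⊆ T) : cl k S ≤ cl k T := cl_le (h.trans (subset_cl T))

instance [IsAlgClosed L] (S : Set L) : IsAlgClosed (cl k S) := by
  have := (algebraicClosure.isAlgClosure (F := IntermediateField.adjoin k S) (E := L)).isAlgClosed
  exact this

lemma mem_cl_of_root {S : Set L} {p : L[X]} (hp : p ≠ 0) (hc : ∀ m, p.coeff m ∈ cl k S) {z : L}
    (hz : p.eval z = 0) : z ∈ cl k S := by
  have hp1 : ∃ q : (cl k S)[X], q.map (algebraMap (cl k S) L) = p := by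
    rw [← mem_lifts, lifts_iff_coeff_lifts]
    intro m; exact ⟨⟨_, hc m⟩, rfl⟩
  obtain ⟨q, rfl⟩ := hp1
  have hq : q ≠ 0 := by rintro rfl; simp at hp
  have h1 : IsAlgebraic (cl k S) z := ⟨q, hq, by rwa [aeval_def, eval₂_eq_eval_map]⟩
  have h2 : IsAlgebraic (algebraicClosure (IntermediateField.adjoin k S) L) z := h1
  have h3 : IsAlgebraic (IntermediateField.adjoin k S) z := h2.restrictScalars _
  exact mem_algebraicClosure_iff.2 h3

lemma cl_rank {m : ℕ} {a : Fin (m+1) → L} (ha : AlgebraicIndependent k a) {T : Set L} (hT : T.encard ≤ m) :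
    ¬ (∀ i, a i ∈ cl k T) := by
  intro h
  have h1 : (AlgebraicIndependent.matroid k L).Indep (Set.range a) := by
    rw [AlgebraicIndependent.matroid_indep_iff]
    exact ha.coe_range
  have h2 : Set.range a ⊆ (AlgebraicIndependent.matroid k L).closure T := by
    rintro _ ⟨i, rfl⟩; exact mem_cl'.1 (h i)
  have h3 := h1.encard_le_eRk_of_subset h2
  rw [Matroid.eRk_closure_eq] at h3
  have h4 := (Matroid.eRk_le_encard (AlgebraicIndependent.matroid k L) T)
  have h5 : (Set.range a).encard = m + 1 := by
    rw [← Set.image_univ, Function.Injective.encard_image ha.injective, Set.encard_univ]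
    simp
  rw [h5] at h3
  have := h3.trans (h4.trans hT)
  have h6 : m + 1 ≤ m := by exact_mod_cast this
  omega

/-- exchange -/
lemma cl_exchange {S : Set L} {x y : L} (hx : x ∈ cl k (insert y S)) (hx' : x ∉ cl k S) : y ∈ cl k (insert x S) := by
  rw [mem_cl'] at *
  exact (Matroid.mem_closure_insert (M := AlgebraicIndependent.matroid k L) hx' hx)

/-- every element of `cl (insert t S)` satisfies an equation over `cl S [t]` -/
lemma cl_alg {S : Set L} {t z : L} (hz : z ∈ cl k (insert t S)) :
    ∃ p : (cl k S)[X][X], p ≠ 0 ∧ p.eval₂ (eval₂RingHom (algebraMap (cl k S) L) t) z = 0 := by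
  rw [mem_cl] at hz
  obtain ⟨p, hp, hz⟩ := hz
  have hc : ∀ c : Algebra.adjoin k (insert t S), (c : L) ∈ (eval₂RingHom (algebraMap (cl k S) L) t).range := by
    intro c
    have : Algebra.adjoin k (insert t S) ≤ (aeval (R := cl k S) t).range.restrictScalars k := by
      apply Algebra.adjoin_le
      rintro y (rfl | hy)
      · exact ⟨X, by simp⟩
      · exact ⟨C ⟨y, subset_cl S hy⟩, by simp⟩
    obtain ⟨r, hr⟩ := this c.2
    exact ⟨r, hr⟩
  have hl : ∃ q : (cl k S)[X][X], q.map (eval₂RingHom (algebraMap (cl k S) L) t) = p.map (algebraMap _ L) := by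
    rw [← mem_lifts, lifts_iff_coeff_lifts]
    intro m; rw [coeff_map]; exact hc _
  obtain ⟨q, hq⟩ := hl
  refine ⟨q, ?_, ?_⟩
  · rintro rfl
    rw [Polynomial.map_zero] at hq
    exact hp ((Polynomial.map_eq_zero_iff (FaithfulSMul.algebraMap_injective _ L)).1 hq.symm)
  · rw [eval₂_eq_eval_map, hq, ← eval₂_eq_eval_map]; exact hz

lemma cl_trans {S : Set L} {t : L} (ht : t ∉ cl k S) :
    Function.Injective (eval₂RingHom (algebraMap (cl k S) L) t) := by
  rw [injective_iff_map_eq_zero]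
  intro p hp
  by_contra h
  apply ht
  apply mem_cl_of_root (p := p.map (algebraMap (cl k S) L))
  · rwa [Polynomial.map_ne_zero_iff (FaithfulSMul.algebraMap_injective _ L)]
  · intro m; rw [coeff_map]; exact (p.coeff m).2
  · rw [← eval₂_eq_eval_map]; exact hp
end cl
end BH

open Polynomial
namespace BH

lemma enc2 {L : Type} (a b : L) : ({a, b} : Set L).encard ≤ ((2:ℕ):ℕ∞) := by
  refine (Set.encard_insert_le _ _).trans ?_
  rw [Set.encard_singleton]; norm_num
lemma enc3 {L : Type} (a b c : L) : ({a, b, c} : Set L).encard ≤ ((3:ℕ):ℕ∞) := by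
  refine (Set.encard_insert_le _ _).trans ?_
  refine (add_le_add (enc2 b c) le_rfl).trans ?_
  norm_num

/-- value of `G(t,x)` -/
noncomputable def gv {F L : Type} [CommRing F] [CommRing L] (i : F →+* L) (G : F[X][X]) (t x : L) : L :=
  G.eval₂ (eval₂RingHom i t) x

/-- `G(t,f(t))` -/
noncomputable def Pf {F L : Type} [CommRing F] [CommRing L] (i : F →+* L) (G : F[X][X]) (f : L[X]) : L[X] :=
  G.eval₂ (mapRingHom i) f

/-- shifted base -/
noncomputable def tay {F L : Type} [CommRing F] [CommRing L] (i : F →+* L) (t : L) : F[X] →+* L[X] :=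
  eval₂RingHom (C.comp i) (X + C t)

section
variable {F L L' : Type} [CommRing F] [CommRing L] [CommRing L'] (i : F →+* L) (j : L →+* L')

lemma gv_map (G : F[X][X]) (t x : L) : j (gv i G t x) = gv (j.comp i) G (j t) (j x) := by
  rw [gv, gv, hom_eval₂]
  congr 1
  ext <;> simp

lemma Pf_map (G : F[X][X]) (f : L[X]) : (Pf i G f).map j = Pf (j.comp i) G (f.map j) := by
  rw [Pf, Pf, ← coe_mapRingHom, hom_eval₂]
  congr 1
  ext <;> simp

lemma Pf_eval (G : F[X][X]) (f : L[X]) (t : L) : (Pf i G f).eval t = gv i G t (f.eval t) := by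
  rw [Pf, gv, ← coe_evalRingHom, hom_eval₂]
  congr 1
  ext <;> simp

lemma tay_map (t : L) : (mapRingHom j).comp (tay i t) = tay (j.comp i) (j t) := by
  ext <;> simp [tay]

lemma Pf_comp (G : F[X][X]) (f : L[X]) (t : L) :
    (Pf i G f).comp (X + C t) = G.eval₂ (tay i t) (f.comp (X + C t)) := by
  change compRingHom (X + C t) (G.eval₂ (mapRingHom i) f) = G.eval₂ (tay i t) (compRingHom (X + C t) f)
  rw [hom_eval₂]
  congr 1
  ext <;> simp [tay]

lemma tay_coeff_zero (G : F[X][X]) (h : L[X]) (t : L) : (G.eval₂ (tay i t) h).coeff 0 = gv i G t (h.coeff 0) := by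
  rw [coeff_zero_eq_eval_zero, ← coe_evalRingHom, hom_eval₂, gv, coeff_zero_eq_eval_zero]
  congr 1
  ext <;> simp [tay]

/-- expansion to first order in the last variable -/
lemma tay_expand (G : F[X][X]) (t : L) (g h : L[X]) : ∃ K : L[X],
    G.eval₂ (tay i t) (g + h) = G.eval₂ (tay i t) g + (derivative G).eval₂ (tay i t) g * h + K * h ^ 2 := by
  simp only [eval₂_eq_eval_map, ← derivative_map]
  obtain ⟨K, hK⟩ := Polynomial.binomExpansion (G.map (tay i t)) g h
  exact ⟨K, hK⟩

lemma tay_coeff_one (G : F[X][X]) (t x : L) (h : L[X]) :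
    (G.eval₂ (tay i t) (C x + X * h)).coeff 1 =
      (G.eval₂ (tay i t) (C x)).coeff 1 + gv i (derivative G) t x * h.coeff 0 := by
  obtain ⟨K, hK⟩ := tay_expand i G t (C x) (X * h)
  rw [hK]
  have h1 : (derivative G).eval₂ (tay i t) (C x) * (X * h) = X * ((derivative G).eval₂ (tay i t) (C x) * h) := by ring
  have h2 : K * (X * h) ^ 2 = X ^ 2 * (K * h ^ 2) := by ring
  rw [h1, h2, coeff_add, coeff_add, coeff_X_mul, mul_coeff_zero, tay_coeff_zero, coeff_X_pow_mul']
  simp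

lemma tay_coeff_two (G : F[X][X]) (t x m : L) (h : L[X]) :
    (G.eval₂ (tay i t) (C x + C m * X + X ^ 2 * h)).coeff 2 =
      (G.eval₂ (tay i t) (C x + C m * X)).coeff 2 + gv i (derivative G) t x * h.coeff 0 := by
  obtain ⟨K, hK⟩ := tay_expand i G t (C x + C m * X) (X ^ 2 * h)
  rw [hK]
  have h1 : (derivative G).eval₂ (tay i t) (C x + C m * X) * (X ^ 2 * h) = X ^ 2 * ((derivative G).eval₂ (tay i t) (C x + C m * X) * h) := by ring
  have h2 : K * (X ^ 2 * h) ^ 2 = X ^ 4 * (K * h ^ 2) := by ring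
  rw [h1, h2, coeff_add, coeff_add, coeff_X_pow_mul', coeff_X_pow_mul']
  simp [mul_coeff_zero, tay_coeff_zero]
end

section fields
variable {k L : Type} [Field k] [Field L] [Algebra k L]

local notation "ι" => algebraMap k L

lemma gv_mem {S : Set L} (G : k[X][X]) {t x : L} (ht : t ∈ cl k S) (hx : x ∈ cl k S) : gv ι G t x ∈ cl k S := by
  have := gv_map (algebraMap k (cl k S)) (algebraMap (cl k S) L) G ⟨t, ht⟩ ⟨x, hx⟩
  have h2 : (algebraMap (cl k S) L).comp (algebraMap k (cl k S)) = ι := rfl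
  rw [h2] at this
  change _ = gv ι G t x at this
  rw [← this]
  exact Subtype.property _

lemma tay_mem {S : Set L} (G : k[X][X]) {t x m : L} (ht : t ∈ cl k S) (hx : x ∈ cl k S) (hm : m ∈ cl k S) (j : ℕ) :
    (G.eval₂ (tay ι t) (C x + C m * X)).coeff j ∈ cl k S := by
  have h1 := hom_eval₂ G (tay (algebraMap k (cl k S)) ⟨t, ht⟩) (mapRingHom (algebraMap (cl k S) L))
    (C ⟨x, hx⟩ + C ⟨m, hm⟩ * X)
  rw [tay_map] at h1
  have h2 : (algebraMap (cl k S) L).comp (algebraMap k (cl k S)) = ι := rfl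
  rw [h2] at h1
  simp only [coe_mapRingHom, Polynomial.map_add, Polynomial.map_mul, map_C, map_X] at h1
  change _ = eval₂ (tay ι t) (C x + C m * X) G at h1
  rw [← h1, coeff_map]
  exact Subtype.property _

lemma gv_root_mem {S : Set L} {G : k[X][X]} (hG : G.Monic) {t x : L} (ht : t ∈ cl k S) (h : gv ι G t x = 0) :
    x ∈ cl k S := by
  apply mem_cl_of_root (p := G.map (eval₂RingHom ι t)) (hG.map _).ne_zero
  · intro m
    rw [coeff_map]
    have : (eval₂RingHom ι t) (G.coeff m) = aeval t (G.coeff m) := rfl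
    rw [this]
    have h2 : t ∈ (cl k S).toSubalgebra := ht
    exact aeval_mem_adjoin_singleton k t |> fun h3 => (Algebra.adjoin_le (by simpa using h2) : Algebra.adjoin k {t} ≤ (cl k S).toSubalgebra) h3
  · rw [← eval₂_eq_eval_map]; exact h

lemma gv_dvd {G H : k[X][X]} (hG : G.Monic) (hirr : Irreducible G) {t x : L} (ht : t ∉ cl k (∅ : Set L))
    (h1 : gv ι G t x = 0) (h2 : gv ι H t x = 0) : G ∣ H := by
  haveI : IsDomain (AdjoinRoot G) := AdjoinRoot.isDomain_of_prime hirr.prime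
  let e : AdjoinRoot G →+* L := AdjoinRoot.lift (eval₂RingHom ι t) x h1
  have hintg : Algebra.IsIntegral k[X] (AdjoinRoot G) := by
    haveI := hG.finite_adjoinRoot
    exact Algebra.IsIntegral.of_finite _ _
  have he : Function.Injective e := by
    rw [RingHom.injective_iff_ker_eq_bot]
    apply Ideal.eq_bot_of_comap_eq_bot (R := k[X])
    rw [eq_bot_iff]
    intro r hr
    have h3 : e (AdjoinRoot.of G r) = 0 := hr
    have h4 : e (AdjoinRoot.of G r) = eval₂RingHom ι t r := AdjoinRoot.lift_of _
    rw [h4] at h3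
    by_contra hr0
    apply ht
    apply mem_cl_of_root (p := r.map ι)
    · exact (Polynomial.map_ne_zero_iff (algebraMap k L).injective).2 hr0
    · intro m; rw [coeff_map]; exact (cl k ∅).algebraMap_mem _
    · rw [← eval₂_eq_eval_map]; exact h3
  rw [← AdjoinRoot.mk_eq_zero]
  apply he
  rw [map_zero]
  exact (AdjoinRoot.lift_mk _ _).trans h2

lemma gx_zero {G : k[X][X]} (hG : G.Monic) (hirr : Irreducible G) (hd : derivative G ≠ 0) {t x : L}
    (h1 : gv ι G t x = 0) (h2 : gv ι (derivative G) t x = 0) (S : Set L) : t ∈ cl k S ∧ x ∈ cl k S := by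
  have ht : t ∈ cl k (∅ : Set L) := by
    by_contra ht
    have := gv_dvd hG hirr ht h1 h2
    have h3 := Polynomial.degree_le_of_dvd this hd
    exact absurd h3 (not_le.2 (degree_derivative_lt hG.ne_zero))
  have h := cl_mono (k := k) (Set.empty_subset S)
  exact ⟨h ht, h (gv_root_mem hG ht h1)⟩

/-- double root of `G(t,f(t))` -/
def Dbl (G : k[X][X]) (f : L[X]) (t : L) : Prop :=
  ((Pf ι G f).comp (X + C t)).coeff 0 = 0 ∧ ((Pf ι G f).comp (X + C t)).coeff 1 = 0

lemma shift_decomp (f : L[X]) (t : L) : ∃ h : L[X], f.comp (X + C t) = C (f.eval t) + X * h ∧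
    h.coeff 0 = (derivative f).eval t := by
  refine ⟨(f.comp (X + C t)).divX, ?_, ?_⟩
  · conv_lhs => rw [← X_mul_divX_add (f.comp (X + C t))]
    rw [coeff_zero_eq_eval_zero, eval_comp]
    simp [add_comm]
  · rw [coeff_divX]
    have h1 : ∀ p : L[X], p.coeff 1 = (derivative p).eval 0 := by
      intro p; rw [← coeff_zero_eq_eval_zero, coeff_derivative]; simp
    rw [zero_add, h1, derivative_comp]
    simp

lemma shift_decomp2 (f : L[X]) (t : L) : ∃ h : L[X], f.comp (X + C t) = C (f.eval t) + C ((derivative f).eval t) * X + X ^ 2 * h := by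
  obtain ⟨h, h1, h2⟩ := shift_decomp f t
  refine ⟨h.divX, ?_⟩
  rw [h1, ← h2]
  conv_lhs => rw [← X_mul_divX_add h]
  ring

/-- the slope -/
lemma dbl_iff {G : k[X][X]} {f : L[X]} {t : L} : Dbl G f t ↔ gv ι G t (f.eval t) = 0 ∧
    (G.eval₂ (tay ι t) (C (f.eval t))).coeff 1 + gv ι (derivative G) t (f.eval t) * (derivative f).eval t = 0 := by
  obtain ⟨h, h1, h2⟩ := shift_decomp f t
  rw [Dbl, Pf_comp, h1, tay_coeff_one, tay_coeff_zero, h2]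
  simp

lemma dbl_cases {G : k[X][X]} (hG : G.Monic) (hirr : Irreducible G) (hd : derivative G ≠ 0) {f : L[X]} {t : L}
    (h : Dbl G f t) : (gv ι (derivative G) t (f.eval t) = 0 ∧ ∀ S : Set L, t ∈ cl k S ∧ f.eval t ∈ cl k S) ∨
      (gv ι (derivative G) t (f.eval t) ≠ 0 ∧ ∀ S : Set L, t ∈ cl k S → f.eval t ∈ cl k S ∧ (derivative f).eval t ∈ cl k S) := by
  obtain ⟨h1, h2⟩ := dbl_iff.1 h
  by_cases h0 : gv ι (derivative G) t (f.eval t) = 0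
  · exact Or.inl ⟨h0, fun S => gx_zero hG hirr hd h1 h0 S⟩
  · right
    refine ⟨h0, fun S ht => ?_⟩
    have hx := gv_root_mem hG ht h1
    refine ⟨hx, ?_⟩
    have h3 := tay_mem G ht hx (zero_mem (cl k S)) 1
    rw [C_0, zero_mul, add_zero] at h3
    have h4 := gv_mem (derivative G) ht hx
    have h5 : (derivative f).eval t = - (G.eval₂ (tay ι t) (C (f.eval t))).coeff 1 / gv ι (derivative G) t (f.eval t) := by
      field_simp; linear_combination h2
    rw [h5]
    exact div_mem (neg_mem h3) h4

/-- the quartic test polynomial -/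
noncomputable def fq (n : ℕ) (c : k) (a0 a1 a2 a3 : L) : L[X] :=
  C a0 + C a1 * X + C a2 * X ^ 2 + C a3 * X ^ 3 + C (ι c) * X ^ n

lemma fq_eval (n : ℕ) (c : k) (a0 a1 a2 a3 t : L) : (fq n c a0 a1 a2 a3).eval t =
    a0 + a1 * t + a2 * t ^ 2 + a3 * t ^ 3 + ι c * t ^ n := by simp [fq]

lemma fq_deriv (n : ℕ) (c : k) (a0 a1 a2 a3 t : L) : (derivative (fq n c a0 a1 a2 a3)).eval t =
    a1 + 2 * a2 * t + 3 * a3 * t ^ 2 + ι c * n * t ^ (n - 1) := by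
  simp [fq, derivative_X_pow]; ring

lemma cst_mem (S : Set L) (c : k) : ι c ∈ cl k S := (cl k S).algebraMap_mem c
lemma nat_mem (S : Set L) (n : ℕ) : (n : L) ∈ cl k S := natCast_mem _ n

lemma pow_term_mem {S : Set L} {t : L} (ht : t ∈ cl k S) (c : k) (n : ℕ) : ι c * t ^ n ∈ cl k S :=
  mul_mem (cst_mem S c) (pow_mem ht n)
lemma pow_term_mem' {S : Set L} {t : L} (ht : t ∈ cl k S) (c : k) (n : ℕ) : ι c * n * t ^ (n-1) ∈ cl k S :=
  mul_mem (mul_mem (cst_mem S c) (nat_mem S n)) (pow_mem ht _)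

/-- generic separability -/
lemma generic_sep {G : k[X][X]} (hG : G.Monic) (hirr : Irreducible G) (hd : derivative G ≠ 0) (n : ℕ) (c : k)
    {a0 a1 a2 a3 : L} (hind : AlgebraicIndependent k ![a0, a1, a2, a3]) (t : L) : ¬ Dbl G (fq n c a0 a1 a2 a3) t := by
  intro h
  rcases dbl_cases hG hirr hd h with ⟨_, h1⟩ | ⟨_, h1⟩
  · apply cl_rank (m := 3) hind (T := {a1, a2, a3}) (enc3 _ _ _)
    obtain ⟨ht, hx⟩ := h1 {a1, a2, a3}
    have m1 : a1 ∈ cl k ({a1, a2, a3} : Set L) := subset_cl _ (by simp)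
    have m2 : a2 ∈ cl k ({a1, a2, a3} : Set L) := subset_cl _ (by simp)
    have m3 : a3 ∈ cl k ({a1, a2, a3} : Set L) := subset_cl _ (by simp)
    have m0 : a0 ∈ cl k ({a1, a2, a3} : Set L) := by
      have : a0 = (fq n c a0 a1 a2 a3).eval t - a1 * t - a2 * t ^ 2 - a3 * t ^ 3 - ι c * t ^ n := by
        rw [fq_eval]; ring
      rw [this]
      exact sub_mem (sub_mem (sub_mem (sub_mem hx (mul_mem m1 ht)) (mul_mem m2 (pow_mem ht _))) (mul_mem m3 (pow_mem ht _))) (pow_term_mem ht _ _)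
    intro i; fin_cases i <;> assumption
  · apply cl_rank (m := 3) hind (T := {t, a2, a3}) (enc3 _ _ _)
    have ht : t ∈ cl k ({t, a2, a3} : Set L) := subset_cl _ (by simp)
    obtain ⟨hx, hm⟩ := h1 {t, a2, a3} ht
    have m2 : a2 ∈ cl k ({t, a2, a3} : Set L) := subset_cl _ (by simp)
    have m3 : a3 ∈ cl k ({t, a2, a3} : Set L) := subset_cl _ (by simp)
    have m1 : a1 ∈ cl k ({t, a2, a3} : Set L) := by
      have : a1 = (derivative (fq n c a0 a1 a2 a3)).eval t - (2:ℕ) * a2 * t - (3:ℕ) * a3 * t ^ 2 - ι c * n * t ^ (n-1) := by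
        rw [fq_deriv]; push_cast; ring
      rw [this]
      exact sub_mem (sub_mem (sub_mem hm (mul_mem (mul_mem (nat_mem _ _) m2) ht)) (mul_mem (mul_mem (nat_mem _ _) m3) (pow_mem ht _))) (pow_term_mem' ht _ _)
    have m0 : a0 ∈ cl k ({t, a2, a3} : Set L) := by
      have : a0 = (fq n c a0 a1 a2 a3).eval t - a1 * t - a2 * t ^ 2 - a3 * t ^ 3 - ι c * t ^ n := by
        rw [fq_eval]; ring
      rw [this]
      exact sub_mem (sub_mem (sub_mem (sub_mem hx (mul_mem m1 ht)) (mul_mem m2 (pow_mem ht _))) (mul_mem m3 (pow_mem ht _))) (pow_term_mem ht _ _)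
    intro i; fin_cases i <;> assumption
end fields
end BH

open Polynomial
namespace BH

section
variable {k L L' : Type} [Field k] [Field L] [Field L'] [Algebra k L] [Algebra k L']

lemma cl_map (ρ : L →+* L') (hρ : ∀ c : k, ρ (algebraMap k L c) = algebraMap k L' c) {S : Set L} {T : Set L'} {z : L}
    (hz : z ∈ cl k S) (h : ∀ s ∈ S, ρ s ∈ cl k T) : ρ z ∈ cl k T := by
  rw [mem_cl] at hz
  obtain ⟨p, hp, hz⟩ := hz
  let r : L →ₐ[k] L' := { ρ with commutes' := hρ }
  have hS : Algebra.adjoin k S ≤ (cl k T).toSubalgebra.comap r := Algebra.adjoin_le h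
  apply mem_cl_of_root (p := (p.map (algebraMap (Algebra.adjoin k S) L)).map ρ)
  · rw [Polynomial.map_ne_zero_iff ρ.injective, Polynomial.map_ne_zero_iff (FaithfulSMul.algebraMap_injective _ L)]
    exact hp
  · intro m
    rw [coeff_map, coeff_map]
    exact hS (p.coeff m).2
  · rw [eval_map, eval₂_hom, eval_map]
    rw [aeval_def] at hz
    rw [hz, map_zero]

variable [IsAlgClosed L]

lemma cl_iso1 {S : Set L} {a b : L} (ha : a ∉ cl k S) (hb : b ∉ cl k S)
    (hLa : ∀ z, z ∈ cl k (insert a S)) (hLb : ∀ z, z ∈ cl k (insert b S)) :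
    ∃ ρ : L ≃+* L, (∀ c ∈ cl k S, ρ c = c) ∧ ρ a = b := by
  obtain ⟨ρ, h1, h2, -⟩ := curve_iso (algebraMap (cl k S) L) (algebraMap (cl k S) L) X monic_X irreducible_X
    a 0 b 0 (cl_trans ha) (cl_trans hb) (by simp) (by simp) (fun z => cl_alg (hLa z)) (fun z => cl_alg (hLb z))
  exact ⟨ρ, fun c hc => h1 ⟨c, hc⟩, h2⟩
end

section tangent
variable {k L : Type} [Field k] [Field L] [Algebra k L] [IsAlgClosed L]
local notation "ι" => algebraMap k L

lemma rank3 {a1 a2 a3 : L} (hind : AlgebraicIndependent k ![a1, a2, a3]) (x y : L)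
    (h1 : a1 ∈ cl k {x, y}) (h2 : a2 ∈ cl k {x, y}) (h3 : a3 ∈ cl k {x, y}) : False := by
  apply cl_rank (m := 2) hind (enc2 x y)
  intro i; fin_cases i <;> assumption

lemma tay_coeff_map (ρ : L →+* L) (hρ : ∀ c : k, ρ (ι c) = ι c) (G : k[X][X]) (t x : L) (j : ℕ) :
    ρ ((G.eval₂ (tay ι t) (C x)).coeff j) = (G.eval₂ (tay ι (ρ t)) (C (ρ x))).coeff j := by
  rw [← coeff_map, ← coe_mapRingHom, hom_eval₂, tay_map]
  have : ρ.comp ι = ι := by ext c; exact hρ c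
  rw [this]; simp

lemma tangent_exists {G : k[X][X]} (hG : G.Monic) (hirr : Irreducible G) (hd : derivative G ≠ 0) (n : ℕ) (c : k)
    {a1 a2 a3 : L} (hind : AlgebraicIndependent k ![a1, a2, a3]) (hL : ∀ z : L, z ∈ cl k ({a1, a2, a3} : Set L)) :
    ∃ a0 t0 : L, Dbl G (fq n c a0 a1 a2 a3) t0 ∧ gv ι (derivative G) t0 ((fq n c a0 a1 a2 a3).eval t0) ≠ 0 ∧
      t0 ∉ cl k ({a2, a3} : Set L) := by
  have n1 : a1 ∉ cl k ({a2, a3} : Set L) := fun h => rank3 hind a2 a3 h (subset_cl _ (by simp)) (subset_cl _ (by simp))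
  have n2 : a2 ∉ cl k ({a1, a3} : Set L) := fun h => rank3 hind a1 a3 (subset_cl _ (by simp)) h (subset_cl _ (by simp))
  have n3 : a3 ∉ cl k ({a1, a2} : Set L) := fun h => rank3 hind a1 a2 (subset_cl _ (by simp)) (subset_cl _ (by simp)) h
  have hdeg : (G.map (eval₂RingHom ι a1)).degree ≠ 0 := by
    rw [hG.degree_map]
    intro h0
    have := (hG.degree_le_zero_iff_eq_one).1 h0.le
    rw [this] at hirr; exact not_irreducible_one hirr
  obtain ⟨x, hx⟩ := IsAlgClosed.exists_root _ hdeg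
  have hx : gv ι G a1 x = 0 := by rw [gv, eval₂_eq_eval_map]; exact hx
  have hgx : gv ι (derivative G) a1 x ≠ 0 := fun h => n1 (gx_zero hG hirr hd hx h _).1
  obtain ⟨m, hm⟩ : ∃ m, m = - (G.eval₂ (tay ι a1) (C x)).coeff 1 / gv ι (derivative G) a1 x := ⟨_, rfl⟩
  have hm' : (G.eval₂ (tay ι a1) (C x)).coeff 1 + gv ι (derivative G) a1 x * m = 0 := by
    rw [hm]; field_simp; ring
  have hmem : ∀ S : Set L, a1 ∈ S → a1 ∈ cl k S ∧ m ∈ cl k S := by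
    intro S hS
    have h1 : a1 ∈ cl k S := subset_cl _ hS
    have h2 := gv_root_mem hG h1 hx
    refine ⟨h1, ?_⟩
    rw [hm]
    have h3 := tay_mem G h1 h2 (zero_mem (cl k S)) 1
    rw [C_0, zero_mul, add_zero] at h3
    exact div_mem (neg_mem h3) (gv_mem _ h1 h2)
  obtain ⟨b, hb⟩ : ∃ b, b = m - 2 * a2 * a1 - 3 * a3 * a1 ^ 2 - ι c * n * a1 ^ (n-1) := ⟨_, rfl⟩
  have hbn : b ∉ cl k ({a2, a3} : Set L) := by
    intro hbm
    by_cases h2 : (2:L) = 0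
    · have hsh : ∀ z : L, z ∈ cl k (insert (a3+1) ({a1, a2} : Set L)) := by
        intro z
        refine cl_le ?_ (hL z)
        rintro y (rfl | rfl | rfl)
        · exact subset_cl _ (by simp)
        · exact subset_cl _ (by simp)
        · have : (y + 1 : L) ∈ cl k (insert (y+1) ({a1, a2} : Set L)) := subset_cl _ (by simp)
          have h := sub_mem this (one_mem _)
          simpa using h
      have hsn : a3 + 1 ∉ cl k ({a1, a2} : Set L) := fun h => n3 (by simpa using sub_mem h (one_mem _))
      obtain ⟨σ, s1, s2⟩ := cl_iso1 n3 hsn (fun z => cl_mono (by intro y; simp; tauto) (hL z)) hsh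
      have hσk : ∀ c : k, (σ : L →+* L) (ι c) = ι c := fun c => s1 _ (cst_mem _ c)
      have hσb : (σ : L →+* L) b ∈ cl k ({a2, a3} : Set L) := by
        refine cl_map (σ : L →+* L) hσk hbm ?_
        rintro s (rfl | rfl)
        · change σ s ∈ _
          rw [s1 s (subset_cl _ (by simp))]; exact subset_cl _ (by simp)
        · change σ s ∈ _
          rw [s2]; exact add_mem (subset_cl _ (by simp)) (one_mem _)
      have e1 : σ a1 = a1 := s1 _ (subset_cl _ (by simp))
      have e2 : σ a2 = a2 := s1 _ (subset_cl _ (by simp))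
      have e3 : σ m = m := s1 _ (hmem _ (by simp)).2
      have e4 : σ (ι c) = ι c := hσk c
      have e5 : (σ : L →+* L) b = b - 3 * a1 ^ 2 := by
        change σ b = _
        rw [hb]; simp only [map_sub, map_mul, map_pow, e1, e2, e3, e4, s2, map_ofNat, map_natCast]; ring
      have e6 : a1 ^ 2 ∈ cl k ({a2, a3} : Set L) := by
        have : a1 ^ 2 = b - (σ : L →+* L) b := by rw [e5]; linear_combination (-a1^2) * h2
        rw [this]; exact sub_mem hbm hσb
      apply n1
      apply mem_cl_of_root (p := X ^ 2 - C (a1 ^ 2)) (monic_X_pow_sub_C _ two_ne_zero).ne_zero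
      · intro j
        rw [coeff_sub, coeff_X_pow, coeff_C]
        apply sub_mem
        · split_ifs; exacts [one_mem _, zero_mem _]
        · split_ifs; exacts [e6, zero_mem _]
      · simp
    · have hsh : ∀ z : L, z ∈ cl k (insert (a2+1) ({a1, a3} : Set L)) := by
        intro z
        refine cl_le ?_ (hL z)
        rintro y (rfl | rfl | rfl)
        · exact subset_cl _ (by simp)
        · have : (y + 1 : L) ∈ cl k (insert (y+1) ({a1, a3} : Set L)) := subset_cl _ (by simp)
          have h := sub_mem this (one_mem _)
          simpa using h
        · exact subset_cl _ (by simp)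
      have hsn : a2 + 1 ∉ cl k ({a1, a3} : Set L) := fun h => n2 (by simpa using sub_mem h (one_mem _))
      obtain ⟨σ, s1, s2⟩ := cl_iso1 n2 hsn (fun z => cl_mono (by intro y; simp; tauto) (hL z)) hsh
      have hσk : ∀ c : k, (σ : L →+* L) (ι c) = ι c := fun c => s1 _ (cst_mem _ c)
      have hσb : (σ : L →+* L) b ∈ cl k ({a2, a3} : Set L) := by
        refine cl_map (σ : L →+* L) hσk hbm ?_
        rintro s (rfl | rfl)
        · change σ s ∈ _
          rw [s2]; exact add_mem (subset_cl _ (by simp)) (one_mem _)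
        · change σ s ∈ _
          rw [s1 s (subset_cl _ (by simp))]; exact subset_cl _ (by simp)
      have e1 : σ a1 = a1 := s1 _ (subset_cl _ (by simp))
      have e2 : σ a3 = a3 := s1 _ (subset_cl _ (by simp))
      have e3 : σ m = m := s1 _ (hmem _ (by simp)).2
      have e4 : σ (ι c) = ι c := hσk c
      have e5 : (σ : L →+* L) b = b - 2 * a1 := by
        change σ b = _
        rw [hb]; simp only [map_sub, map_mul, map_pow, e1, e2, e3, e4, s2, map_ofNat, map_natCast]; ring
      apply n1
      have : a1 = (b - (σ : L →+* L) b) / ((2:ℕ):L) := by rw [e5]; push_cast; field_simp; ring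
      rw [this]; exact div_mem (sub_mem hbm hσb) (nat_mem _ _)
  have ha1 : a1 ∈ cl k (insert b ({a2, a3} : Set L)) := cl_exchange (hL b) hbn
  have hLb : ∀ z, z ∈ cl k (insert b ({a2, a3} : Set L)) := by
    intro z
    refine cl_le ?_ (hL z)
    rintro y (rfl | rfl | rfl)
    · exact ha1
    · exact subset_cl _ (by simp)
    · exact subset_cl _ (by simp)
  obtain ⟨ρ, r1, r2⟩ := cl_iso1 hbn n1 hLb hL
  have hρk : ∀ c : k, (ρ : L →+* L) (ι c) = ι c := fun c => r1 _ (cst_mem _ c)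
  have hcomp : (ρ : L →+* L).comp ι = ι := by ext c; exact hρk c
  have e2 : ρ a2 = a2 := r1 _ (subset_cl _ (by simp))
  have e3 : ρ a3 = a3 := r1 _ (subset_cl _ (by simp))
  have e4 : ρ (ι c) = ι c := hρk c
  refine ⟨ρ x - a1 * ρ a1 - a2 * ρ a1 ^ 2 - a3 * ρ a1 ^ 3 - ι c * ρ a1 ^ n, ρ a1, ?_⟩
  have hev : (fq n c (ρ x - a1 * ρ a1 - a2 * ρ a1 ^ 2 - a3 * ρ a1 ^ 3 - ι c * ρ a1 ^ n) a1 a2 a3).eval (ρ a1) = ρ x := by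
    rw [fq_eval]; ring
  have hder : (derivative (fq n c (ρ x - a1 * ρ a1 - a2 * ρ a1 ^ 2 - a3 * ρ a1 ^ 3 - ι c * ρ a1 ^ n) a1 a2 a3)).eval (ρ a1) = ρ m := by
    have : m = b + 2 * a2 * a1 + 3 * a3 * a1 ^ 2 + ι c * n * a1 ^ (n-1) := by rw [hb]; ring
    rw [fq_deriv, this]
    simp only [map_add, map_mul, map_pow, e2, e3, e4, r2, map_ofNat, map_natCast]
  have hgxρ : gv ι (derivative G) (ρ a1) (ρ x) = ρ (gv ι (derivative G) a1 x) := by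
    have := gv_map ι (ρ : L →+* L) (derivative G) a1 x
    rw [hcomp] at this; exact this.symm
  refine ⟨?_, ?_, ?_⟩
  · rw [dbl_iff, hev, hder]
    constructor
    · have := gv_map ι (ρ : L →+* L) G a1 x
      rw [hcomp, hx] at this; rw [map_zero] at this; exact this.symm
    · have h1 := tay_coeff_map (ρ : L →+* L) hρk G a1 x 1
      have h2 := congrArg ρ hm'
      rw [map_add, map_mul, map_zero] at h2
      rw [hgxρ]
      rw [← h2]; congr 1; exact h1.symm
  · rw [hev, hgxρ]
    exact (map_ne_zero ρ).2 hgx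
  · intro h
    apply n1
    have := r1 _ h
    rw [ρ.injective this] at h
    exact h

/-- uniqueness of the double root -/
lemma tangent_unique {G H : k[X][X]} (hG : G.Monic) (hirr : Irreducible G) (hd : derivative G ≠ 0)
    (hH : H.Monic) (hirrH : Irreducible H) (hdH : derivative H ≠ 0) (n : ℕ) (c : k)
    {a0 a1 a2 a3 t0 t1 : L} (hind : AlgebraicIndependent k ![a1, a2, a3])
    (h0 : Dbl G (fq n c a0 a1 a2 a3) t0) (hgx : gv ι (derivative G) t0 ((fq n c a0 a1 a2 a3).eval t0) ≠ 0)
    (ht0 : t0 ∉ cl k ({a2, a3} : Set L)) (h1 : Dbl H (fq n c a0 a1 a2 a3) t1) : t1 = t0 ∧ G ∣ H := by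
  have h0m : ∀ S : Set L, t0 ∈ S → t0 ∈ cl k S ∧ (fq n c a0 a1 a2 a3).eval t0 ∈ cl k S ∧ (derivative (fq n c a0 a1 a2 a3)).eval t0 ∈ cl k S := by
    intro S hS
    have ht : t0 ∈ cl k S := subset_cl _ hS
    rcases dbl_cases hG hirr hd h0 with ⟨h, _⟩ | ⟨_, h⟩
    · exact absurd h hgx
    · exact ⟨ht, h S ht⟩
  have key : t1 = t0 := by
    by_contra hne
    have hne' : t0 - t1 ≠ 0 := fun h => hne (sub_eq_zero.1 h).symm
    rcases dbl_cases hH hirrH hdH h1 with ⟨_, h⟩ | ⟨_, h⟩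
    · obtain ⟨m0, mx, mm⟩ := h0m {t0, a3} (by simp)
      obtain ⟨m1, mx1⟩ := h {t0, a3}
      have m3 : a3 ∈ cl k ({t0, a3} : Set L) := subset_cl _ (by simp)
      have E0 := sub_mem (sub_mem mx (mul_mem m3 (pow_mem m0 3))) (pow_term_mem m0 c n)
      have E1 := sub_mem (sub_mem mx1 (mul_mem m3 (pow_mem m1 3))) (pow_term_mem m1 c n)
      have D0 := sub_mem (sub_mem mm (mul_mem (mul_mem (nat_mem _ 3) m3) (pow_mem m0 2))) (pow_term_mem' m0 c n)
      have m2 : a2 ∈ cl k ({t0, a3} : Set L) := by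
        have hh := div_mem (sub_mem (mul_mem D0 (sub_mem m0 m1)) (sub_mem E0 E1)) (pow_mem (sub_mem m0 m1) 2)
        convert hh using 1
        rw [fq_eval, fq_eval, fq_deriv, eq_div_iff (pow_ne_zero 2 hne')]
        push_cast; ring
      have m1' : a1 ∈ cl k ({t0, a3} : Set L) := by
        have hh := sub_mem D0 (mul_mem (mul_mem (nat_mem _ 2) m2) m0)
        convert hh using 1
        rw [fq_deriv]; push_cast; ring
      exact rank3 hind _ _ m1' m2 m3
    · obtain ⟨m0, mx, mm⟩ := h0m {t0, t1} (by simp)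
      have m1 : t1 ∈ cl k ({t0, t1} : Set L) := subset_cl _ (by simp)
      obtain ⟨mx1, mm1⟩ := h {t0, t1} m1
      have E0 := sub_mem mx (pow_term_mem m0 c n)
      have E1 := sub_mem mx1 (pow_term_mem m1 c n)
      have D0 := sub_mem mm (pow_term_mem' m0 c n)
      have D1 := sub_mem mm1 (pow_term_mem' m1 c n)
      have m3 : a3 ∈ cl k ({t0, t1} : Set L) := by
        have hh := div_mem (sub_mem (mul_mem (add_mem D0 D1) (sub_mem m0 m1)) (mul_mem (nat_mem _ 2) (sub_mem E0 E1))) (pow_mem (sub_mem m0 m1) 3)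
        convert hh using 1
        rw [fq_eval, fq_eval, fq_deriv, fq_deriv, eq_div_iff (pow_ne_zero 3 hne')]
        push_cast; ring
      have E0 := sub_mem E0 (mul_mem m3 (pow_mem m0 3))
      have E1 := sub_mem E1 (mul_mem m3 (pow_mem m1 3))
      have D0 := sub_mem D0 (mul_mem (mul_mem (nat_mem _ 3) m3) (pow_mem m0 2))
      have m2 : a2 ∈ cl k ({t0, t1} : Set L) := by
        have hh := div_mem (sub_mem (mul_mem D0 (sub_mem m0 m1)) (sub_mem E0 E1)) (pow_mem (sub_mem m0 m1) 2)
        convert hh using 1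
        rw [fq_eval, fq_eval, fq_deriv, eq_div_iff (pow_ne_zero 2 hne')]
        push_cast; ring
      have m1' : a1 ∈ cl k ({t0, t1} : Set L) := by
        have hh := sub_mem D0 (mul_mem (mul_mem (nat_mem _ 2) m2) m0)
        convert hh using 1
        rw [fq_deriv]; push_cast; ring
      exact rank3 hind _ _ m1' m2 m3
  refine ⟨key, ?_⟩
  subst key
  refine gv_dvd hG hirr (fun h => ht0 (cl_mono (Set.empty_subset _) h)) (dbl_iff.1 h0).1 (dbl_iff.1 h1).1

/-- the double root has multiplicity exactly two -/
lemma tangent_mult {G : k[X][X]} (hG : G.Monic) (hirr : Irreducible G) (hd : derivative G ≠ 0) (n : ℕ) (c : k)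
    {a0 a1 a2 a3 t0 : L} (hind : AlgebraicIndependent k ![a1, a2, a3])
    (h0 : Dbl G (fq n c a0 a1 a2 a3) t0) (hgx : gv ι (derivative G) t0 ((fq n c a0 a1 a2 a3).eval t0) ≠ 0) :
    ((Pf ι G (fq n c a0 a1 a2 a3)).comp (X + C t0)).coeff 2 ≠ 0 := by
  intro hz
  have ht : t0 ∈ cl k ({t0, a3} : Set L) := subset_cl _ (by simp)
  have m3 : a3 ∈ cl k ({t0, a3} : Set L) := subset_cl _ (by simp)
  obtain ⟨mx, mm⟩ : (fq n c a0 a1 a2 a3).eval t0 ∈ cl k ({t0, a3} : Set L) ∧ (derivative (fq n c a0 a1 a2 a3)).eval t0 ∈ cl k ({t0, a3} : Set L) := by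
    rcases dbl_cases hG hirr hd h0 with ⟨h, _⟩ | ⟨_, h⟩
    · exact absurd h hgx
    · exact h _ ht
  obtain ⟨h, hh⟩ := shift_decomp2 (fq n c a0 a1 a2 a3) t0
  have hc : h.coeff 0 = a2 + 3 * a3 * t0 + ι c * n.choose 2 * t0 ^ (n-2) := by
    have h1 := congrArg (fun p => coeff p 2) hh
    simp only [coeff_add, coeff_X_pow_mul'] at h1
    have h2 : (C ((fq n c a0 a1 a2 a3).eval t0)).coeff 2 = 0 := by simp [coeff_C]
    have h3 : (C ((derivative (fq n c a0 a1 a2 a3)).eval t0) * X).coeff 2 = 0 := by simp [coeff_X]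
    rw [h2, h3] at h1
    simp only [le_refl, if_true, zero_add, Nat.sub_self] at h1
    rw [← h1]
    simp only [fq, add_comp, mul_comp, C_comp, X_comp, pow_comp, coeff_add, coeff_C_mul, coeff_X_add_C_pow]
    simp [coeff_C, coeff_X]
    norm_num [Nat.choose]
    ring
  rw [Pf_comp, hh, tay_coeff_two] at hz
  have h4 := tay_mem G ht mx mm 2
  have h5 := gv_mem (derivative G) ht mx
  have h6 : h.coeff 0 ∈ cl k ({t0, a3} : Set L) := by
    have : h.coeff 0 = - (G.eval₂ (tay ι t0) (C ((fq n c a0 a1 a2 a3).eval t0) + C ((derivative (fq n c a0 a1 a2 a3)).eval t0) * X)).coeff 2 / gv ι (derivative G) t0 ((fq n c a0 a1 a2 a3).eval t0) := by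
      rw [eq_div_iff hgx]; linear_combination hz
    rw [this]; exact div_mem (neg_mem h4) h5
  have m2 : a2 ∈ cl k ({t0, a3} : Set L) := by
    have := sub_mem (sub_mem h6 (mul_mem (mul_mem (nat_mem _ 3) m3) ht)) (mul_mem (mul_mem (cst_mem _ c) (nat_mem _ (n.choose 2))) (pow_mem ht (n-2)))
    convert this using 1
    rw [hc]; push_cast; ring
  have m1 : a1 ∈ cl k ({t0, a3} : Set L) := by
    have := sub_mem (sub_mem (sub_mem mm (mul_mem (mul_mem (nat_mem _ 3) m3) (pow_mem ht 2))) (pow_term_mem' ht c n)) (mul_mem (mul_mem (nat_mem _ 2) m2) ht)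
    convert this using 1
    rw [fq_deriv]; push_cast; ring
  exact rank3 hind _ _ m1 m2 m3
end tangent
end BH

open Polynomial
namespace BH

section
variable {κ : Type} [Field κ] [IsAlgClosed κ]

lemma ps_hensel (p : (PowerSeries κ)[X]) (hp : p.Monic) (r : κ)
    (h0 : (p.map PowerSeries.constantCoeff).eval r = 0)
    (h1 : (derivative (p.map PowerSeries.constantCoeff)).eval r ≠ 0) :
    ∃ z : PowerSeries κ, p.eval z = 0 ∧ PowerSeries.constantCoeff z = r := by
  have hmem : ∀ w : PowerSeries κ, w ∈ Ideal.span {(PowerSeries.X : PowerSeries κ)} ↔ PowerSeries.constantCoeff w = 0 := by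
    intro w; rw [Ideal.mem_span_singleton, PowerSeries.X_dvd_iff]
  have hev : ∀ q : (PowerSeries κ)[X], PowerSeries.constantCoeff (q.eval (PowerSeries.C r)) = (q.map PowerSeries.constantCoeff).eval r := by
    intro q; rw [eval_map, ← eval₂_hom]; simp
  haveI : HenselianRing (PowerSeries κ) (Ideal.span {(PowerSeries.X : PowerSeries κ)}) := inferInstance
  obtain ⟨a, ha, ha'⟩ := HenselianRing.is_henselian (I := Ideal.span {(PowerSeries.X : PowerSeries κ)}) p hp (PowerSeries.C r)
    (by rw [hmem, hev, h0]) (by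
      apply IsUnit.map
      rw [PowerSeries.isUnit_iff_constantCoeff, hev, ← derivative_map]
      exact isUnit_iff_ne_zero.2 h1)
  refine ⟨a, ha, ?_⟩
  rw [hmem] at ha'
  simpa [sub_eq_zero] using ha'

lemma hensel_split : ∀ (d : ℕ) (p : (PowerSeries κ)[X]) (D q : κ[X]), p.Monic → D.Monic → q.Monic → q.natDegree = d →
    p.map PowerSeries.constantCoeff = D * q → (∀ r, q.eval r = 0 → (derivative q).eval r ≠ 0 ∧ D.eval r ≠ 0) →
    ∃ (Q : (PowerSeries κ)[X]) (s : Multiset (PowerSeries κ)), Q.Monic ∧ p = Q * (s.map (fun r => X - C r)).prod ∧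
      Q.map PowerSeries.constantCoeff = D := by
  intro d
  induction d with
  | zero =>
    intro p D q hp hD hq hd h hs
    refine ⟨p, 0, hp, by simp, ?_⟩
    rw [h, hq.natDegree_eq_zero.1 hd, mul_one]
  | succ d ih =>
    intro p D q hp hD hq hd h hs
    obtain ⟨r, hr⟩ := IsAlgClosed.exists_root q (by
      intro h0; rw [degree_eq_natDegree hq.ne_zero, hd] at h0; exact absurd h0 (by exact_mod_cast Nat.succ_ne_zero d))
    obtain ⟨q', rfl⟩ := dvd_iff_isRoot.2 hr
    obtain ⟨hr1, hr2⟩ := hs r hr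
    have hq' : q'.Monic := (monic_X_sub_C r).of_mul_monic_left hq
    have hd' : q'.natDegree = d := by
      rw [(monic_X_sub_C r).natDegree_mul hq', natDegree_X_sub_C] at hd; omega
    have hq'r : q'.eval r ≠ 0 := by
      simpa [derivative_mul] using hr1
    obtain ⟨z, hz, hz'⟩ := ps_hensel p hp r (by rw [h]; simp) (by
      rw [h]; simp [derivative_mul]; exact ⟨hr2, hq'r⟩)
    obtain ⟨p', rfl⟩ := dvd_iff_isRoot.2 hz
    have hp' : p'.Monic := (monic_X_sub_C z).of_mul_monic_left hp
    have hmap : p'.map PowerSeries.constantCoeff = D * q' := by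
      rw [Polynomial.map_mul, Polynomial.map_sub, map_X, map_C, hz'] at h
      apply mul_left_cancel₀ (monic_X_sub_C r).ne_zero
      rw [h]; ring
    obtain ⟨Q, s, h1, h2, h3⟩ := ih p' D q' hp' hD hq' hd' hmap (by
      intro w hw
      obtain ⟨w1, w2⟩ := hs w (by simp [hw])
      refine ⟨?_, w2⟩
      simp [derivative_mul, hw] at w1
      exact w1.2)
    refine ⟨Q, z ::ₘ s, h1, ?_, h3⟩
    rw [Multiset.map_cons, Multiset.prod_cons]
    conv_lhs => rw [h2]
    ring

variable {L : Type} [Field L] [Algebra (LaurentSeries κ) L] [IsAlgClosed L] [Normal (LaurentSeries κ) L]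

lemma laurent_swap {K : Type} (P : K → (PowerSeries κ)[X]) (hP : ∀ j, (P j).Monic) (kk : K) (t0 : κ)
    (h1 : ∀ j, j ≠ kk → ∀ r, ((P j).map PowerSeries.constantCoeff).eval r = 0 → (derivative ((P j).map PowerSeries.constantCoeff)).eval r ≠ 0)
    (q : κ[X]) (hq : (P kk).map PowerSeries.constantCoeff = (X - C t0) ^ 2 * q) (hq0 : q.eval t0 ≠ 0)
    (h2 : ∀ r, r ≠ t0 → ((P kk).map PowerSeries.constantCoeff).eval r = 0 → (derivative ((P kk).map PowerSeries.constantCoeff)).eval r ≠ 0)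
    (h3 : PowerSeries.coeff 1 ((P kk).eval (PowerSeries.C t0)) ≠ 0)
    (e : PowerSeries κ →+* L) (he : e = (algebraMap (LaurentSeries κ) L).comp (algebraMap (PowerSeries κ) (LaurentSeries κ)))
    (h4 : ∀ z : L, ((P kk).map e).eval z = 0 → (derivative ((P kk).map e)).eval z ≠ 0) :
    ∃ (h : L ≃ₐ[LaurentSeries κ] L) (ρ1 ρ2 : L), ρ1 ≠ ρ2 ∧ ((P kk).map e).eval ρ1 = 0 ∧ ((P kk).map e).eval ρ2 = 0 ∧
      h ρ1 = ρ2 ∧ h ρ2 = ρ1 ∧ (∀ z, ((P kk).map e).eval z = 0 → z ≠ ρ1 → z ≠ ρ2 → h z = z) ∧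
      (∀ j, j ≠ kk → ∀ z, ((P j).map e).eval z = 0 → h z = z) := by
  have hfix : ∀ (h : L ≃ₐ[LaurentSeries κ] L) (r : PowerSeries κ), h (e r) = e r := by
    intro h r; rw [he]; exact h.commutes _
  have hprod : ∀ (s : Multiset (PowerSeries κ)) (z : L), (((s.map (fun r => X - C r)).prod).map e).eval z = 0 → ∃ r, z = e r := by
    intro s z hz
    rw [Polynomial.map_multiset_prod, eval_multiset_prod, Multiset.prod_eq_zero_iff] at hz
    simp only [Multiset.mem_map, Multiset.map_map] at hz
    obtain ⟨r, _, hr⟩ := hz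
    refine ⟨r, ?_⟩
    simpa [sub_eq_zero] using hr
  have hqm : q.Monic := ((monic_X_sub_C t0).pow 2).of_mul_monic_left (by rw [← hq]; exact (hP kk).map _)
  obtain ⟨Q, s, Qm, Qp, Qb⟩ := hensel_split _ (P kk) ((X - C t0) ^ 2) q (hP kk) ((monic_X_sub_C t0).pow 2) hqm rfl hq (by
    intro r hr
    have hne : r ≠ t0 := by rintro rfl; exact hq0 hr
    have := h2 r hne (by rw [hq]; simp [hr])
    rw [hq] at this
    have hne' : r - t0 ≠ 0 := sub_ne_zero.2 hne
    refine ⟨?_, by simpa using hne'⟩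
    simp [derivative_mul, hr] at this
    exact this.2)
  have Qdeg : Q.natDegree = 2 := by
    rw [← Qm.natDegree_map PowerSeries.constantCoeff, Qb, natDegree_pow, natDegree_X_sub_C]
  -- no root in the Laurent series field
  have noroot : ∀ z : LaurentSeries κ, (Q.map (algebraMap (PowerSeries κ) (LaurentSeries κ))).eval z ≠ 0 := by
    intro z hz
    have hintg : IsIntegral (PowerSeries κ) z := ⟨Q, Qm, by rw [eval₂_eq_eval_map]; exact hz⟩
    obtain ⟨w, rfl⟩ := (IsIntegrallyClosed.isIntegral_iff).1 hintg
    rw [eval_map, eval₂_hom] at hz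
    have hw : Q.eval w = 0 := by
      apply IsFractionRing.injective (PowerSeries κ) (LaurentSeries κ); rw [hz, map_zero]
    obtain ⟨Q', hQ'⟩ := dvd_iff_isRoot.2 hw
    have hQ'm : Q'.Monic := (monic_X_sub_C w).of_mul_monic_left (by rw [← hQ']; exact Qm)
    have hQ'd : Q'.natDegree = 1 := by
      have := Qdeg
      rw [hQ', (monic_X_sub_C w).natDegree_mul hQ'm, natDegree_X_sub_C] at this; omega
    have hQ'e := hQ'm.eq_X_add_C hQ'd
    have hw0 : PowerSeries.constantCoeff w = t0 := by
      have h := congrArg (fun p => (p.map PowerSeries.constantCoeff).eval (PowerSeries.constantCoeff w)) hQ'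
      simp only [Qb, Polynomial.map_mul, Polynomial.map_sub, map_X, map_C, eval_mul, eval_sub, eval_X, eval_C, sub_self, zero_mul, eval_pow] at h
      exact sub_eq_zero.1 (pow_eq_zero_iff two_ne_zero |>.1 h)
    have hb : (X - C t0) * (X + C (PowerSeries.constantCoeff (Q'.coeff 0))) = (X - C t0) * (X - C t0) := by
      have h := congrArg (fun p => p.map PowerSeries.constantCoeff) hQ'
      simp only [Qb] at h
      rw [hQ'e] at h
      simp only [Polynomial.map_mul, Polynomial.map_sub, Polynomial.map_add, map_X, map_C, hw0] at h
      rw [← h]; ring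
    have hb' := congrArg (fun p => coeff p 0) (mul_left_cancel₀ (monic_X_sub_C t0).ne_zero hb)
    simp at hb'
    apply h3
    have d1 : PowerSeries.X ∣ PowerSeries.C t0 - w := by
      rw [PowerSeries.X_dvd_iff]; simp [hw0]
    have d2 : PowerSeries.X ∣ PowerSeries.C t0 + Q'.coeff 0 := by
      rw [PowerSeries.X_dvd_iff]; rw [map_add, PowerSeries.constantCoeff_C, PowerSeries.coeff_zero_eq_constantCoeff_apply .. |>.symm]; simp [hb']
    have d3 : (PowerSeries.X : PowerSeries κ) ^ 2 ∣ (P kk).eval (PowerSeries.C t0) := by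
      rw [Qp, eval_mul, hQ', hQ'e]
      apply Dvd.dvd.mul_right
      rw [pow_two, eval_mul]
      apply mul_dvd_mul
      · simpa using d1
      · simpa using d2
    exact PowerSeries.X_pow_dvd_iff.1 d3 1 (by norm_num)
  -- hence irreducible
  obtain ⟨QL, hQL⟩ : ∃ QL, QL = Q.map (algebraMap (PowerSeries κ) (LaurentSeries κ)) := ⟨_, rfl⟩
  have QLm : QL.Monic := by rw [hQL]; exact Qm.map _
  have QLd : QL.natDegree = 2 := by rw [hQL, Qm.natDegree_map, Qdeg]
  have QLirr : Irreducible QL := by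
    rw [irreducible_iff_roots_eq_zero_of_degree_le_three (by omega) (by omega)]
    apply Multiset.eq_zero_of_forall_notMem
    intro z hz
    rw [mem_roots QLm.ne_zero, hQL] at hz
    exact noroot z hz
  have QLe : QL.map (algebraMap (LaurentSeries κ) L) = Q.map e := by rw [hQL, map_map, he]
  have hsp : (P kk).map e = Q.map e * ((s.map (fun r => X - C r)).prod).map e := by
    conv_lhs => rw [Qp]
    rw [Polynomial.map_mul]
  obtain ⟨ρ1, r1⟩ := IsAlgClosed.exists_root (Q.map e) (by
    rw [Qm.degree_map, degree_eq_natDegree Qm.ne_zero, Qdeg]; norm_num)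
  obtain ⟨U, hU⟩ := dvd_iff_isRoot.2 r1
  have Um : U.Monic := (monic_X_sub_C ρ1).of_mul_monic_left (by rw [← hU]; exact Qm.map _)
  have Ud : U.natDegree = 1 := by
    have : (Q.map e).natDegree = 2 := by rw [Qm.natDegree_map, Qdeg]
    rw [hU, (monic_X_sub_C ρ1).natDegree_mul Um, natDegree_X_sub_C] at this; omega
  have Ue := Um.eq_X_add_C Ud
  obtain ⟨ρ2, hρ2⟩ : ∃ ρ2, ρ2 = - U.coeff 0 := ⟨_, rfl⟩
  have Ue : U = X - C ρ2 := by rw [Ue, hρ2]; simp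
  rw [Ue] at hU
  have r1P : ((P kk).map e).eval ρ1 = 0 := by rw [hsp, hU]; simp
  have r2P : ((P kk).map e).eval ρ2 = 0 := by rw [hsp, hU]; simp
  have hne : ρ1 ≠ ρ2 := by
    intro h
    apply h4 ρ1 r1P
    rw [hsp, hU, ← h]; simp [derivative_mul]
  have mp1 : minpoly (LaurentSeries κ) ρ1 = QL := by
    refine (minpoly.eq_of_irreducible_of_monic QLirr ?_ QLm).symm
    rw [aeval_def, eval₂_eq_eval_map, QLe]; exact r1
  have mp2 : minpoly (LaurentSeries κ) ρ2 = QL := by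
    refine (minpoly.eq_of_irreducible_of_monic QLirr ?_ QLm).symm
    rw [aeval_def, eval₂_eq_eval_map, QLe, hU]; simp
  obtain ⟨h, hh⟩ := IsConjRoot.exists_algEquiv (show IsConjRoot (LaurentSeries κ) ρ2 ρ1 from mp2.trans mp1.symm)
  refine ⟨h, ρ1, ρ2, hne, r1P, r2P, hh, ?_, ?_, ?_⟩
  · have h5 : (Q.map e).eval (h ρ2) = 0 := by
      have : aeval ρ2 QL = 0 := by rw [← mp2]; exact minpoly.aeval _ _
      have h6 := congrArg h this
      rw [map_zero, ← AlgEquiv.coe_algHom, ← aeval_algHom_apply, aeval_def, eval₂_eq_eval_map, QLe] at h6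
      exact h6
    rw [hU] at h5
    simp [sub_eq_zero] at h5
    rcases h5 with h5 | h5
    · exact h5
    · exfalso; apply hne; apply h.injective; rw [hh, h5]
  · intro z hz z1 z2
    rw [hsp, eval_mul, hU] at hz
    rcases mul_eq_zero.1 hz with hz | hz
    · simp [sub_eq_zero] at hz; tauto
    · obtain ⟨r, rfl⟩ := hprod s z hz; exact hfix h r
  · intro j hj z hz
    obtain ⟨Q, s, Qm, Qp, Qb⟩ := hensel_split _ (P j) 1 ((P j).map PowerSeries.constantCoeff) (hP j) monic_one ((hP j).map _) rfl (by simp) (by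
      intro r hr; exact ⟨h1 j hj r hr, by simp⟩)
    have Q1 : Q = 1 := by
      apply Qm.natDegree_eq_zero.1
      rw [← Qm.natDegree_map PowerSeries.constantCoeff, Qb, natDegree_one]
    rw [Qp, Q1, one_mul] at hz
    obtain ⟨r, rfl⟩ := hprod s z hz; exact hfix h r
end
end BH

open Polynomial
namespace BH

section lam
variable {F L : Type} [CommRing F] [CommRing L]

/-- leading form in the last variable -/
noncomputable def Lam (n : ℕ) (G : F[X][X]) : F[X] := (wmap n G).coeff (n * G.natDegree)

lemma Lam_coeff (n : ℕ) (hn : 0 < n) (G : F[X][X]) (j : ℕ) : (Lam n G).coeff j =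
    if j ≤ G.natDegree then (G.coeff j).coeff (n * G.natDegree - n * j) else 0 := by
  rw [Lam, wmap_coeff]
  have : n * j ≤ n * G.natDegree ↔ j ≤ G.natDegree := Nat.mul_le_mul_left_iff hn
  simp only [this]

lemma Lam_natDegree (n : ℕ) (hn : 0 < n) (G : F[X][X]) : (Lam n G).natDegree ≤ G.natDegree := by
  rw [natDegree_le_iff_coeff_eq_zero]
  intro j hj
  rw [Lam_coeff n hn, if_neg (by omega)]

lemma Lam_monic (n : ℕ) (hn : 0 < n) (G : F[X][X]) (hG : G.Monic) : (Lam n G).Monic := by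
  apply monic_of_natDegree_le_of_coeff_eq_one G.natDegree (Lam_natDegree n hn G)
  rw [Lam_coeff n hn, if_pos le_rfl, hG.coeff_natDegree]; simp

lemma Pf_top (i : F →+* L) (n : ℕ) (hn : 0 < n) (G : F[X][X]) (hW : WB n (n * G.natDegree) G) (f : L[X]) (hf : f.natDegree ≤ n) :
    (Pf i G f).natDegree ≤ n * G.natDegree ∧ (Pf i G f).coeff (n * G.natDegree) = (Lam n G).eval₂ i (f.coeff n) := by
  have hc : ∀ j ≤ G.natDegree, ((G.coeff j).map i).natDegree ≤ n * G.natDegree - n * j := by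
    intro j hj
    refine natDegree_map_le.trans ?_
    rw [natDegree_le_iff_coeff_eq_zero]
    intro N hN
    by_contra h
    have := hW j N h
    omega
  have hp : ∀ j, (f ^ j).natDegree ≤ j * n := fun j => natDegree_pow_le_of_le j hf
  have hsum : Pf i G f = ∑ j ∈ Finset.range (G.natDegree + 1), (G.coeff j).map i * f ^ j := by
    rw [Pf, eval₂_eq_sum_range]; rfl
  have hle : ∀ j ≤ G.natDegree, n * G.natDegree - n * j + j * n = n * G.natDegree := by
    intro j hj
    have : n * j ≤ n * G.natDegree := Nat.mul_le_mul_left n hj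
    rw [mul_comm j n]; omega
  constructor
  · rw [hsum]
    apply natDegree_sum_le_of_forall_le
    intro j hj
    have hj' : j ≤ G.natDegree := by simpa [Nat.lt_succ_iff] using hj
    refine natDegree_mul_le.trans ?_
    rw [← hle j hj']
    exact add_le_add (hc j hj') (hp j)
  · rw [hsum, finset_sum_coeff, eval₂_eq_sum_range' i (Nat.lt_succ_of_le (Lam_natDegree n hn G))]
    apply Finset.sum_congr rfl
    intro j hj
    have hj' : j ≤ G.natDegree := by simpa [Nat.lt_succ_iff] using hj
    conv_lhs => rw [← hle j hj']
    rw [coeff_mul_add_eq_of_natDegree_le (hc j hj') (hp j), coeff_pow_of_natDegree_le hf, coeff_map, Lam_coeff n hn, if_pos hj']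

lemma Pf_monic (i : F →+* L) (n : ℕ) (hn : 0 < n) (G : F[X][X]) (hW : WB n (n * G.natDegree) G) (f : L[X]) (hf : f.natDegree ≤ n)
    (v : L) (hv : v * (Lam n G).eval₂ i (f.coeff n) = 1) : (C v * Pf i G f).Monic := by
  obtain ⟨h1, h2⟩ := Pf_top i n hn G hW f hf
  apply monic_of_natDegree_le_of_coeff_eq_one (n * G.natDegree)
  · exact (natDegree_C_mul_le _ _).trans h1
  · rw [coeff_C_mul, h2, hv]
end lam

section
variable {k L : Type} [Field k] [Field L] [Algebra k L]

lemma fq_natDegree (n : ℕ) (hn : 3 ≤ n) (c : k) (a0 a1 a2 a3 : L) : (fq n c a0 a1 a2 a3).natDegree ≤ n := by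
  unfold fq
  have h1 : (C a0 + C a1 * X + C a2 * X ^ 2 + C a3 * X ^ 3).natDegree ≤ 3 := by compute_degree
  refine (natDegree_add_le _ _).trans (max_le (h1.trans hn) (natDegree_C_mul_X_pow_le _ _))

lemma fq_coeff (n : ℕ) (hn : 3 ≤ n) (c : k) (a0 a1 a2 a3 : L) : (fq n c a0 a1 a2 a3).coeff n = (if n = 3 then a3 else 0) + algebraMap k L c := by
  unfold fq
  simp only [coeff_add, coeff_C_mul, coeff_X_pow, coeff_C, coeff_X]
  have : n ≠ 0 ∧ n ≠ 1 ∧ n ≠ 2 := by omega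
  simp [this, Ne.symm this.2.1]

lemma dbl_iff' {G : k[X][X]} {f : L[X]} {t : L} : Dbl G f t ↔ (Pf (algebraMap k L) G f).eval t = 0 ∧ (derivative (Pf (algebraMap k L) G f)).eval t = 0 := by
  obtain ⟨h, h1, h2⟩ := shift_decomp (Pf (algebraMap k L) G f) t
  rw [Dbl, h1, ← h2]; simp

lemma cl_sub {S : Set L} {T : Set (cl k S)} {z : cl k S} (h : (z : L) ∈ cl k (Subtype.val '' T)) : z ∈ cl k T := by
  rw [mem_cl] at h
  obtain ⟨p, hp, hz⟩ := h
  have hc : ∀ c : Algebra.adjoin k (Subtype.val '' T), ∃ d ∈ Algebra.adjoin k T, ((d : cl k S) : L) = c := by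
    intro c
    have : Algebra.adjoin k (Subtype.val '' T) = (Algebra.adjoin k T).map (cl k S).val := by
      rw [AlgHom.map_adjoin]; rfl
    exact this.le c.2
  obtain ⟨q, hq⟩ : ∃ q : (cl k S)[X], q.map (algebraMap (cl k S) L) = p.map (algebraMap _ L) := by
    rw [← mem_lifts, lifts_iff_coeff_lifts]
    intro m; rw [coeff_map]
    obtain ⟨d, _, hd⟩ := hc (p.coeff m)
    exact ⟨d, hd⟩
  apply mem_cl_of_root (p := q)
  · rintro rfl
    rw [Polynomial.map_zero] at hq
    exact hp ((Polynomial.map_eq_zero_iff (FaithfulSMul.algebraMap_injective _ L)).1 hq.symm)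
  · intro m
    obtain ⟨d, hd1, hd⟩ := hc (p.coeff m)
    have : q.coeff m = d := by
      apply Subtype.ext
      have := congrArg (fun p => coeff p m) hq
      simp only [coeff_map] at this
      rw [hd]; exact this
    rw [this]
    exact (Algebra.adjoin_le (subset_cl T) : Algebra.adjoin k T ≤ (cl k T).toSubalgebra) hd1
  · apply Subtype.ext
    have : algebraMap (cl k S) L (q.eval z) = 0 := by
      rw [← eval₂_hom, eval₂_eq_eval_map, hq, ← eval₂_eq_eval_map]; exact hz
    exact this

lemma cl_alg0 {t z : L} (hz : z ∈ cl k {t}) :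
    ∃ p : k[X][X], p ≠ 0 ∧ p.eval₂ (eval₂RingHom (algebraMap k L) t) z = 0 := by
  rw [mem_cl] at hz
  obtain ⟨p, hp, hz⟩ := hz
  have hc : ∀ c : Algebra.adjoin k {t}, (c : L) ∈ (eval₂RingHom (algebraMap k L) t).range := by
    intro c
    have : Algebra.adjoin k {t} ≤ (aeval (R := k) t).range := by
      apply Algebra.adjoin_le
      rintro y rfl
      exact ⟨X, by simp⟩
    obtain ⟨r, hr⟩ := this c.2
    exact ⟨r, hr⟩
  have hl : ∃ q : k[X][X], q.map (eval₂RingHom (algebraMap k L) t) = p.map (algebraMap _ L) := by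
    rw [← mem_lifts, lifts_iff_coeff_lifts]
    intro m; rw [coeff_map]; exact hc _
  obtain ⟨q, hq⟩ := hl
  refine ⟨q, ?_, ?_⟩
  · rintro rfl
    rw [Polynomial.map_zero] at hq
    exact hp ((Polynomial.map_eq_zero_iff (FaithfulSMul.algebraMap_injective _ L)).1 hq.symm)
  · rw [eval₂_eq_eval_map, hq, ← eval₂_eq_eval_map]; exact hz

lemma fq_map {L' : Type} [Field L'] [Algebra k L'] (ρ : L →+* L') (hρ : ∀ c : k, ρ (algebraMap k L c) = algebraMap k L' c)
    (n : ℕ) (c : k) (a0 a1 a2 a3 : L) : (fq n c a0 a1 a2 a3).map ρ = fq n c (ρ a0) (ρ a1) (ρ a2) (ρ a3) := by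
  simp [fq, hρ]

lemma root_lift [IsAlgClosed L] {L' : Type} [Field L'] (ρ : L →+* L') {p : L[X]} (hp : p ≠ 0) {y : L'} (hy : (p.map ρ).eval y = 0) :
    ∃ z, ρ z = y ∧ p.eval z = 0 := by
  have h1 : y ∈ (p.map ρ).roots := by
    rw [mem_roots ((Polynomial.map_ne_zero_iff ρ.injective).2 hp)]; exact hy
  rw [(IsAlgClosed.splits p).roots_map, Multiset.mem_map] at h1
  obtain ⟨z, hz, hzy⟩ := h1
  exact ⟨z, hzy, (mem_roots hp).1 hz⟩
end
end BH

open Polynomial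
namespace BH

section
variable {k κ : Type} [Field k] [Field κ] [Algebra k κ]

/-- first order coefficient of `G(t0, x0 + s)` -/
lemma gv_coeff_one (G : k[X][X]) (t0 x0 : κ) :
    PowerSeries.coeff 1 (gv ((PowerSeries.C (R := κ)).comp (algebraMap k κ)) G (PowerSeries.C t0) (PowerSeries.C x0 + PowerSeries.X))
      = gv (algebraMap k κ) (derivative G) t0 x0 := by
  obtain ⟨K, hK⟩ := Polynomial.binomExpansion (G.map (eval₂RingHom ((PowerSeries.C (R := κ)).comp (algebraMap k κ)) (PowerSeries.C t0)))
    (PowerSeries.C x0) (PowerSeries.X)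
  rw [gv, eval₂_eq_eval_map, hK, derivative_map, ← eval₂_eq_eval_map, ← eval₂_eq_eval_map]
  have h1 : ∀ H : k[X][X], eval₂ (eval₂RingHom ((PowerSeries.C (R := κ)).comp (algebraMap k κ)) (PowerSeries.C t0)) (PowerSeries.C x0) H = PowerSeries.C (gv (algebraMap k κ) H t0 x0) := by
    intro H; exact (gv_map _ _ _ _ _).symm
  rw [h1, h1]
  have h2 : PowerSeries.coeff 1 (K * (PowerSeries.X : PowerSeries κ) ^ 2) = 0 := by
    rw [PowerSeries.coeff_mul_X_pow', if_neg (by norm_num)]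
  have h3 : PowerSeries.coeff 1 (PowerSeries.C (gv (algebraMap k κ) (derivative G) t0 x0) * (PowerSeries.X : PowerSeries κ)) = gv (algebraMap k κ) (derivative G) t0 x0 := by
    rw [PowerSeries.coeff_C_mul, PowerSeries.coeff_one_X, mul_one]
  have h4 : PowerSeries.coeff 1 (PowerSeries.C (gv (algebraMap k κ) G t0 x0)) = 0 := by
    rw [PowerSeries.coeff_C]; simp
  rw [map_add, map_add, h2, h3, h4]; simp

lemma ps_trans (α : κ) : Function.Injective (eval₂RingHom (PowerSeries.C (R := κ)) (PowerSeries.C α + PowerSeries.X)) := by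
  have : eval₂RingHom (PowerSeries.C (R := κ)) (PowerSeries.C α + PowerSeries.X) =
      (Polynomial.coeToPowerSeries.ringHom (R := κ)).comp (compRingHom (X + C α)) := by
    ext <;> simp [add_comm]
  rw [this]
  intro p q h
  have h1 : p.comp (X + C α) = q.comp (X + C α) := Polynomial.coe_injective κ h
  have h2 := congrArg (fun r => r.comp (X - C α)) h1
  simpa [comp_assoc] using h2
end

section
variable {k Ω : Type} [Field k] [Field Ω] [Algebra k Ω] [IsAlgClosed Ω]

lemma transp_aux {a0 a1 a2 a3 : Ω} {K : Type} (G : K → k[X][X]) (hG : ∀ j, (G j).Monic) (hirr : ∀ j, Irreducible (G j))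
    (hd : ∀ j, derivative (G j) ≠ 0) (hnd : ∀ i j, G i ∣ G j → i = j)
    (hind : AlgebraicIndependent k ![a0, a1, a2, a3]) (hΩ : ∀ z : Ω, z ∈ cl k ({a0, a1, a2, a3} : Set Ω))
    (n : ℕ) (hn : 3 ≤ n) (c : k) (hW : ∀ j, WB n (n * (G j).natDegree) (G j))
    (hlam : ∀ j, (Lam n (G j)).eval₂ (algebraMap k Ω) ((fq n c a0 a1 a2 a3).coeff n) ≠ 0) (kk : K)
    (κ : IntermediateField k Ω) (hκ : κ = cl k ({a1, a2, a3} : Set Ω)) [IsAlgClosed κ]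
    {L : Type} [Field L] [Algebra (LaurentSeries κ) L] [IsAlgClosed L]
    [Normal (LaurentSeries κ) L] [Algebra κ L] [Algebra k L]
    (e : PowerSeries κ →+* L)
    (he : e = (algebraMap (LaurentSeries κ) L).comp (algebraMap (PowerSeries κ) (LaurentSeries κ)))
    (hκL : algebraMap κ L = e.comp (PowerSeries.C))
    (hkL : algebraMap k L = (e.comp (PowerSeries.C)).comp (algebraMap k κ)) :
    ∃ (g : Ω ≃+* Ω) (z1 z2 : Ω), (∀ z ∈ κ, g z = z) ∧ g a0 = a0 ∧ z1 ≠ z2 ∧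
      (Pf (algebraMap k Ω) (G kk) (fq n c a0 a1 a2 a3)).eval z1 = 0 ∧ (Pf (algebraMap k Ω) (G kk) (fq n c a0 a1 a2 a3)).eval z2 = 0 ∧
      g z1 = z2 ∧ g z2 = z1 ∧
      (∀ z, (Pf (algebraMap k Ω) (G kk) (fq n c a0 a1 a2 a3)).eval z = 0 → z ≠ z1 → z ≠ z2 → g z = z) ∧
      (∀ j, j ≠ kk → ∀ z, (Pf (algebraMap k Ω) (G j) (fq n c a0 a1 a2 a3)).eval z = 0 → g z = z) := by
  have hn0 : 0 < n := by omega
  have m1 : a1 ∈ κ := by rw [hκ]; exact subset_cl _ (by simp)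
  have m2 : a2 ∈ κ := by rw [hκ]; exact subset_cl _ (by simp)
  have m3 : a3 ∈ κ := by rw [hκ]; exact subset_cl _ (by simp)
  have m0 : a0 ∉ κ := by
    rw [hκ] at *
    intro h
    apply cl_rank (m := 3) hind (enc3 a1 a2 a3)
    intro i; fin_cases i <;> assumption
  have ht : Function.Injective (eval₂RingHom (algebraMap κ Ω) a0) := by subst hκ; exact cl_trans m0
  have hLΩ : ∀ z : Ω, ∃ p : κ[X][X], p ≠ 0 ∧ p.eval₂ (eval₂RingHom (algebraMap κ Ω) a0) z = 0 := by
    intro z; subst hκ; exact cl_alg (hΩ z)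
  obtain ⟨b1, hb1⟩ : ∃ b1 : κ, b1 = ⟨a1, m1⟩ := ⟨_, rfl⟩
  obtain ⟨b2, hb2⟩ : ∃ b2 : κ, b2 = ⟨a2, m2⟩ := ⟨_, rfl⟩
  obtain ⟨b3, hb3⟩ : ∃ b3 : κ, b3 = ⟨a3, m3⟩ := ⟨_, rfl⟩
  have c1 : (b1 : Ω) = a1 := by rw [hb1]
  have c2 : (b2 : Ω) = a2 := by rw [hb2]
  have c3 : (b3 : Ω) = a3 := by rw [hb3]
  have hindκ : AlgebraicIndependent k ![b1, b2, b3] := by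
    apply AlgebraicIndependent.of_comp κ.val
    have h := hind.comp Fin.succ (Fin.succ_injective 3)
    convert h using 1
    funext i; fin_cases i <;> simp [c1, c2, c3]
  have hκall : ∀ z : κ, z ∈ cl k ({b1, b2, b3} : Set κ) := by
    intro z
    subst hκ
    apply cl_sub
    have : (Subtype.val '' ({b1, b2, b3} : Set (cl k ({a1, a2, a3} : Set Ω)))) = {a1, a2, a3} := by
      simp [Set.image_insert_eq, c1, c2, c3]
    rw [this]; exact z.2
  obtain ⟨α, t0, hD, hgx, ht0⟩ := tangent_exists (hG kk) (hirr kk) (hd kk) n c hindκ hκall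
  have huniq := fun (j : K) (t1 : κ) (h1 : Dbl (G j) (fq n c α b1 b2 b3) t1) =>
    tangent_unique (hG kk) (hirr kk) (hd kk) (hG j) (hirr j) (hd j) n c hindκ hD hgx ht0 h1
  have hmult := tangent_mult (hG kk) (hirr kk) (hd kk) n c hindκ hD hgx
  -- leading coefficients
  obtain ⟨lam, hlamdef⟩ : ∃ lam : K → κ, lam = fun j => (Lam n (G j)).eval₂ (algebraMap k κ) ((fq n c α b1 b2 b3).coeff n) := ⟨_, rfl⟩
  have hlam0 : ∀ j, lam j ≠ 0 := by
    intro j h0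
    apply hlam j
    have h1 := congrArg (algebraMap κ Ω) h0
    rw [hlamdef] at h1
    simp only [map_zero, hom_eval₂, fq_coeff n hn] at h1
    rw [fq_coeff n hn]
    refine Eq.trans ?_ h1
    congr 1
    split_ifs
    · rw [map_add, ← c3]; rfl
    · rw [map_add, map_zero]; rfl
  -- power series family
  obtain ⟨Fs, hFs⟩ : ∃ Fs : (PowerSeries κ)[X], Fs = (fq n c α b1 b2 b3).map PowerSeries.C + C PowerSeries.X := ⟨_, rfl⟩
  obtain ⟨PR, hPR⟩ : ∃ PR : K → (PowerSeries κ)[X], PR = fun j => Pf ((PowerSeries.C (R := κ)).comp (algebraMap k κ)) (G j) Fs := ⟨_, rfl⟩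
  obtain ⟨P, hP⟩ : ∃ P : K → (PowerSeries κ)[X], P = fun j => C (PowerSeries.C (lam j)⁻¹) * PR j := ⟨_, rfl⟩
  have hFdeg : Fs.natDegree ≤ n := by
    rw [hFs]
    refine (natDegree_add_le _ _).trans (max_le (natDegree_map_le.trans (fq_natDegree n hn c α b1 b2 b3)) ?_)
    rw [natDegree_C]; omega
  have hFn : Fs.coeff n = PowerSeries.C ((fq n c α b1 b2 b3).coeff n) := by
    rw [hFs, coeff_add, coeff_map, coeff_C, if_neg (by omega), add_zero]
  have hPm : ∀ j, (P j).Monic := by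
    intro j
    rw [hP, hPR]
    apply Pf_monic _ n hn0 (G j) (hW j) Fs hFdeg
    rw [hFn, ← hom_eval₂, ← map_mul]
    rw [hlamdef]; simp only
    rw [inv_mul_cancel₀, map_one]
    have := hlam0 j; rw [hlamdef] at this; exact this
  have hPc : ∀ j, (P j).map PowerSeries.constantCoeff = C (lam j)⁻¹ * Pf (algebraMap k κ) (G j) (fq n c α b1 b2 b3) := by
    intro j
    rw [hP, hPR]
    simp only [Polynomial.map_mul, map_C, PowerSeries.constantCoeff_C, Pf_map]
    congr 2
    rw [hFs, Polynomial.map_add, map_map, map_C, PowerSeries.constantCoeff_X, C_0, add_zero]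
    have : (PowerSeries.constantCoeff (R := κ)).comp PowerSeries.C = RingHom.id κ := by ext x; simp
    rw [this, map_id]
  have hdbl : ∀ j r, ((P j).map PowerSeries.constantCoeff).eval r = 0 → (derivative ((P j).map PowerSeries.constantCoeff)).eval r = 0 → Dbl (G j) (fq n c α b1 b2 b3) r := by
    intro j r h1 h2
    rw [hPc] at h1 h2
    rw [dbl_iff']
    have := inv_ne_zero (hlam0 j)
    constructor
    · simpa [hlam0 j] using h1
    · simpa [hlam0 j] using h2
  -- the quadratic factor
  obtain ⟨w, hw⟩ : X ^ 2 ∣ (Pf (algebraMap k κ) (G kk) (fq n c α b1 b2 b3)).comp (X + C t0) := by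
    rw [X_pow_dvd_iff]
    intro d hd'
    interval_cases d
    · exact hD.1
    · exact hD.2
  have hw0 : w.coeff 0 ≠ 0 := by
    rw [hw] at hmult
    simpa [coeff_X_pow_mul'] using hmult
  have hq : (P kk).map PowerSeries.constantCoeff = (X - C t0) ^ 2 * (C (lam kk)⁻¹ * w.comp (X - C t0)) := by
    rw [hPc]
    have h1 := congrArg (fun r => r.comp (X - C t0)) hw
    simp only [comp_assoc, add_comp, X_comp, C_comp, sub_add_cancel, comp_X, mul_comp, pow_comp] at h1
    rw [h1]; ring
  -- embedding of Ω
  obtain ⟨t', ht'⟩ : ∃ t' : L, t' = e (PowerSeries.C α + PowerSeries.X) := ⟨_, rfl⟩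
  have hmt : t' ∈ cl κ ({t'} : Set L) := subset_cl _ (by simp)
  have heinj : Function.Injective e := by
    rw [he]
    exact (algebraMap (LaurentSeries κ) L).injective.comp (IsFractionRing.injective (PowerSeries κ) (LaurentSeries κ))
  have hcomp : (algebraMap (cl κ ({t'} : Set L)) L).comp (eval₂RingHom (algebraMap κ (cl κ ({t'} : Set L))) ⟨t', hmt⟩) =
      eval₂RingHom (algebraMap κ L) t' := by
    ext <;> simp
  have htr : Function.Injective (eval₂RingHom (algebraMap κ (cl κ ({t'} : Set L))) ⟨t', hmt⟩) := by
    have h1 : Function.Injective (eval₂RingHom (algebraMap κ L) t') := by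
      have : eval₂RingHom (algebraMap κ L) t' = e.comp (eval₂RingHom (PowerSeries.C (R := κ)) (PowerSeries.C α + PowerSeries.X)) := by
        ext <;> simp [hκL, ht']
      rw [this]
      exact heinj.comp (ps_trans α)
    rw [← hcomp, RingHom.coe_comp] at h1
    exact Function.Injective.of_comp h1
  obtain ⟨ρ, ρ1, ρ2, -⟩ := curve_iso (algebraMap κ Ω) (algebraMap κ (cl κ ({t'} : Set L))) X monic_X irreducible_X
    a0 0 ⟨t', hmt⟩ 0 ht htr (by simp) (by simp) hLΩ (by
      intro z
      obtain ⟨p, hp, hpz⟩ := cl_alg0 z.2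
      refine ⟨p, hp, ?_⟩
      apply (algebraMap (cl κ ({t'} : Set L)) L).injective
      rw [hom_eval₂, hcomp, map_zero]
      exact hpz)
  obtain ⟨r, hr⟩ : ∃ r : Ω →+* L, r = (algebraMap (cl κ ({t'} : Set L)) L).comp (ρ : Ω →+* cl κ ({t'} : Set L)) := ⟨_, rfl⟩
  have hrv : ∀ z, r z = (ρ z : L) := by intro z; rw [hr]; rfl
  have hrκ : ∀ x : κ, r x = e (PowerSeries.C x) := by
    intro x
    rw [hrv]
    have h1 : ρ (x : Ω) = algebraMap κ (cl κ ({t'} : Set L)) x := ρ1 x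
    rw [h1]
    exact congrArg (fun h => h x) hκL
  have hra0 : r a0 = t' := by rw [hrv, ρ2]
  have hrk : ∀ x : k, r (algebraMap k Ω x) = algebraMap k L x := by
    intro x
    have := hrκ (algebraMap k κ x)
    rw [hkL]; exact this
  have hrcomp : r.comp (algebraMap k Ω) = algebraMap k L := by ext x; exact hrk x
  have hfL : (fq n c a0 a1 a2 a3).map r = Fs.map e := by
    rw [fq_map r hrk, hra0, ← c1, ← c2, ← c3, hrκ, hrκ, hrκ, hFs, ht', fq]
    simp only [fq, Polynomial.map_add, Polynomial.map_mul, Polynomial.map_pow, map_X, map_C, hkL, RingHom.comp_apply, map_add]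
    ring
  have hPRe : ∀ j, (PR j).map e = (Pf (algebraMap k Ω) (G j) (fq n c a0 a1 a2 a3)).map r := by
    intro j
    rw [Pf_map (algebraMap k Ω) r, hrcomp, hfL, hPR]
    simp only
    rw [Pf_map, hkL]; rfl
  have hlame : ∀ j, e (PowerSeries.C (lam j)⁻¹) ≠ 0 := by
    intro j h0
    have h1 := heinj (h0.trans (map_zero e).symm)
    rw [← map_zero PowerSeries.C] at h1
    exact inv_ne_zero (hlam0 j) (PowerSeries.C_injective h1)
  have hPe : ∀ j, (P j).map e = C (e (PowerSeries.C (lam j)⁻¹)) * (Pf (algebraMap k Ω) (G j) (fq n c a0 a1 a2 a3)).map r := by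
    intro j
    rw [← hPRe, hP]; simp
  have hroot : ∀ j y, ((P j).map e).eval y = 0 ↔ ((Pf (algebraMap k Ω) (G j) (fq n c a0 a1 a2 a3)).map r).eval y = 0 := by
    intro j y
    rw [hPe, eval_mul, eval_C, mul_eq_zero]
    exact or_iff_right (hlame j)
  have hPfne : ∀ j, Pf (algebraMap k Ω) (G j) (fq n c a0 a1 a2 a3) ≠ 0 := by
    intro j h0
    have h1 := hPe j
    rw [h0, Polynomial.map_zero, mul_zero] at h1
    exact ((hPm j).map e).ne_zero h1
  have hrd : ∀ z, r z = r z := fun _ => rfl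
  have h4 : ∀ z : L, ((P kk).map e).eval z = 0 → (derivative ((P kk).map e)).eval z ≠ 0 := by
    intro y hy hy'
    rw [hPe, Polynomial.derivative_C_mul, eval_mul, eval_C, mul_eq_zero, or_iff_right (hlame kk), derivative_map] at hy'
    obtain ⟨z, rfl, hz⟩ := root_lift r (hPfne kk) ((hroot kk y).1 hy)
    rw [eval_map, eval₂_hom] at hy'
    have hz' := r.injective (hy'.trans (map_zero r).symm)
    exact generic_sep (hG kk) (hirr kk) (hd kk) n c hind z (dbl_iff'.2 ⟨hz, hz'⟩)
  obtain ⟨h, y1, y2, hne, hy1, hy2, hh1, hh2, hh3, hh4⟩ := laurent_swap P hPm kk t0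
    (by
      intro j hj r hr1 hr2
      exact hj (hnd _ _ (huniq j r (hdbl j r hr1 hr2)).2).symm)
    (C (lam kk)⁻¹ * w.comp (X - C t0)) hq
    (by
      rw [eval_mul, eval_C, eval_comp]
      simp only [eval_sub, eval_X, eval_C, sub_self]
      rw [← coeff_zero_eq_eval_zero]
      exact mul_ne_zero (inv_ne_zero (hlam0 kk)) hw0)
    (by
      intro r hr hr1 hr2
      exact hr (huniq kk r (hdbl kk r hr1 hr2)).1)
    (by
      have h5 : (PR kk).eval (PowerSeries.C t0) = gv ((PowerSeries.C (R := κ)).comp (algebraMap k κ)) (G kk) (PowerSeries.C t0) (PowerSeries.C ((fq n c α b1 b2 b3).eval t0) + PowerSeries.X) := by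
        rw [hPR]; simp only
        rw [Pf_eval]
        congr 1
        rw [hFs, eval_add, eval_C, eval_map, eval₂_hom]
      rw [hP]; simp only
      rw [eval_mul, eval_C, h5, PowerSeries.coeff_C_mul, gv_coeff_one]
      exact mul_ne_zero (inv_ne_zero (hlam0 kk)) hgx)
    e he h4
  have hek : ∀ x : PowerSeries κ, h (e x) = e x := by intro x; rw [he]; exact h.commutes _
  have hek' : ∀ x : PowerSeries κ, h.symm (e x) = e x := by intro x; rw [he]; exact h.symm.commutes _
  have hm1 : ∀ z ∈ cl κ ({t'} : Set L), h z ∈ cl κ ({t'} : Set L) := by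
    intro z hz
    refine cl_map (k := κ) (h : L →+* L) (fun x => ?_) hz ?_
    · rw [hκL]; exact hek _
    · rintro s rfl
      have : h s = s := by rw [ht']; exact hek _
      change h s ∈ _
      rw [this]; exact hmt
  have hm2 : ∀ z ∈ cl κ ({t'} : Set L), h.symm z ∈ cl κ ({t'} : Set L) := by
    intro z hz
    refine cl_map (k := κ) (h.symm : L →+* L) (fun x => ?_) hz ?_
    · rw [hκL]; exact hek' _
    · rintro s rfl
      have : h.symm s = s := by rw [ht']; exact hek' _
      change h.symm s ∈ _
      rw [this]; exact hmt
  let H : cl κ ({t'} : Set L) ≃+* cl κ ({t'} : Set L) :=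
    { toFun := fun z => ⟨h z, hm1 z z.2⟩
      invFun := fun z => ⟨h.symm z, hm2 z z.2⟩
      left_inv := fun z => Subtype.ext (h.symm_apply_apply z)
      right_inv := fun z => Subtype.ext (h.apply_symm_apply z)
      map_mul' := fun x y => Subtype.ext (map_mul h (x:L) (y:L))
      map_add' := fun x y => Subtype.ext (map_add h (x:L) (y:L)) }
  have hg : ∀ z w : Ω, h (r z) = r w → ((ρ.trans H).trans ρ.symm) z = w := by
    intro z w' hzw
    rw [hrv, hrv] at hzw
    have : H (ρ z) = ρ w' := Subtype.ext hzw
    change ρ.symm (H (ρ z)) = w'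
    rw [this, RingEquiv.symm_apply_apply]
  obtain ⟨z1, rfl, hz1⟩ := root_lift r (hPfne kk) ((hroot kk y1).1 hy1)
  obtain ⟨z2, rfl, hz2⟩ := root_lift r (hPfne kk) ((hroot kk y2).1 hy2)
  refine ⟨(ρ.trans H).trans ρ.symm, z1, z2, ?_, ?_, ?_, hz1, hz2, hg _ _ hh1, hg _ _ hh2, ?_, ?_⟩
  · intro z hz
    apply hg
    have := hrκ ⟨z, hz⟩
    rw [show r z = e (PowerSeries.C ⟨z, hz⟩) from this]; exact hek _
  · apply hg; rw [hra0, ht']; exact hek _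
  · intro h; exact hne (by rw [h])
  · intro z hz n1 n2
    apply hg
    apply hh3
    · rw [hroot, eval_map, eval₂_hom, hz, map_zero]
    · exact fun h => n1 (r.injective h)
    · exact fun h => n2 (r.injective h)
  · intro j hj z hz
    apply hg
    apply hh4 j hj
    rw [hroot, eval_map, eval₂_hom, hz, map_zero]

lemma transp {a0 a1 a2 a3 : Ω} {K : Type} (G : K → k[X][X]) (hG : ∀ j, (G j).Monic) (hirr : ∀ j, Irreducible (G j))
    (hd : ∀ j, derivative (G j) ≠ 0) (hnd : ∀ i j, G i ∣ G j → i = j)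
    (hind : AlgebraicIndependent k ![a0, a1, a2, a3]) (hΩ : ∀ z : Ω, z ∈ cl k ({a0, a1, a2, a3} : Set Ω))
    (n : ℕ) (hn : 3 ≤ n) (c : k) (hW : ∀ j, WB n (n * (G j).natDegree) (G j))
    (hlam : ∀ j, (Lam n (G j)).eval₂ (algebraMap k Ω) ((fq n c a0 a1 a2 a3).coeff n) ≠ 0) (kk : K) :
    ∃ (g : Ω ≃+* Ω) (z1 z2 : Ω), (∀ z ∈ cl k ({a1, a2, a3} : Set Ω), g z = z) ∧ g a0 = a0 ∧ z1 ≠ z2 ∧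
      (Pf (algebraMap k Ω) (G kk) (fq n c a0 a1 a2 a3)).eval z1 = 0 ∧ (Pf (algebraMap k Ω) (G kk) (fq n c a0 a1 a2 a3)).eval z2 = 0 ∧
      g z1 = z2 ∧ g z2 = z1 ∧
      (∀ z, (Pf (algebraMap k Ω) (G kk) (fq n c a0 a1 a2 a3)).eval z = 0 → z ≠ z1 → z ≠ z2 → g z = z) ∧
      (∀ j, j ≠ kk → ∀ z, (Pf (algebraMap k Ω) (G j) (fq n c a0 a1 a2 a3)).eval z = 0 → g z = z) := by
  obtain ⟨κ, hκ⟩ : ∃ κ, κ = cl k ({a1, a2, a3} : Set Ω) := ⟨_, rfl⟩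
  haveI : IsAlgClosed κ := by rw [hκ]; infer_instance
  rw [← hκ]
  let e : PowerSeries κ →+* AlgebraicClosure (LaurentSeries κ) :=
    (algebraMap (LaurentSeries κ) _).comp (algebraMap (PowerSeries κ) (LaurentSeries κ))
  letI i1 : Algebra κ (AlgebraicClosure (LaurentSeries κ)) := (e.comp (PowerSeries.C)).toAlgebra
  letI i2 : Algebra k (AlgebraicClosure (LaurentSeries κ)) := ((e.comp (PowerSeries.C)).comp (algebraMap k κ)).toAlgebra
  haveI : Normal (LaurentSeries κ) (AlgebraicClosure (LaurentSeries κ)) := IsAlgClosure.normal _ _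
  exact transp_aux G hG hirr hd hnd hind hΩ n hn c hW hlam kk κ hκ e rfl rfl rfl
end
end BH

open Polynomial
namespace BH
section
variable {k Ω : Type} [Field k] [IsAlgClosed k] [Field Ω] [Algebra k Ω] [IsAlgClosed Ω]

lemma gv_eval_map {F L : Type} [CommRing F] [CommRing L] {k : Type} [CommRing k] (j : k →+* F) (i : F →+* L) (G : k[X][X]) (t x : L) :
    (G.map (mapRingHom j)).eval₂ (eval₂RingHom i t) x = gv (i.comp j) G t x := by
  rw [gv, eval₂_map]
  congr 1
  ext <;> simp

lemma incl_data0 {E F : IntermediateField k Ω} (hle : E ≤ F) : ∃ i : E →+* F, (algebraMap F Ω).comp i = algebraMap E Ω ∧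
    i.comp (algebraMap k E) = algebraMap k F :=
  ⟨(IntermediateField.inclusion hle : E →+* F),
    RingHom.ext fun x => IntermediateField.coe_inclusion hle x, (IntermediateField.inclusion hle).comp_algebraMap⟩

lemma incl_data {S : Set Ω} {G : k[X][X]} (hG : G.Monic) (t x : Ω) (mt : t ∈ cl k (insert t S)) (mx : x ∈ cl k (insert t S)) (ht : t ∉ cl k S) (hx : gv (algebraMap k Ω) G t x = 0) :
     ∃ i : cl k S →+* cl k (insert t S), (∀ z : cl k S, ((i z : cl k (insert t S)) : Ω) = (z : Ω)) ∧ Function.Injective (eval₂RingHom i ⟨t, mt⟩) ∧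
     ((G.map (mapRingHom (algebraMap k (cl k S)))).eval₂ (eval₂RingHom i ⟨t, mt⟩) ⟨x, mx⟩ = 0) ∧
     (∀ z : cl k (insert t S), ∃ p : (cl k S)[X][X], p ≠ 0 ∧ p.eval₂ (eval₂RingHom i ⟨t, mt⟩) z = 0) := by
  have hle : cl k S ≤ cl k (insert t S) := cl_mono (Set.subset_insert _ _)
  obtain ⟨i, hi, hik⟩ := incl_data0 hle
  obtain ⟨t₀, ht₀⟩ : ∃ t₀ : cl k (insert t S), t₀ = ⟨t, mt⟩ := ⟨_, rfl⟩
  obtain ⟨x₀, hx₀⟩ : ∃ x₀ : cl k (insert t S), x₀ = ⟨x, mx⟩ := ⟨_, rfl⟩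
  have et : algebraMap (cl k (insert t S)) Ω t₀ = t := by rw [ht₀]; rfl
  have ex : algebraMap (cl k (insert t S)) Ω x₀ = x := by rw [hx₀]; rfl
  have hcomp : eval₂RingHom (algebraMap (cl k S) Ω) t = (algebraMap (cl k (insert t S)) Ω).comp (eval₂RingHom i t₀) := by
    apply Polynomial.ringHom_ext
    · intro a
      rw [RingHom.comp_apply, coe_eval₂RingHom, coe_eval₂RingHom, eval₂_C, eval₂_C, ← hi]; rfl
    · rw [RingHom.comp_apply, coe_eval₂RingHom, coe_eval₂RingHom, eval₂_X, eval₂_X, et]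
  rw [← ht₀, ← hx₀]
  refine ⟨i, fun z => congrArg (fun f => f z) hi, ?_, ?_, ?_⟩
  · have h1 := cl_trans ht
    rw [hcomp, RingHom.coe_comp] at h1
    exact Function.Injective.of_comp h1
  · rw [gv_eval_map, hik]
    apply (algebraMap (cl k (insert t S)) Ω).injective
    rw [gv_map, map_zero, et, ex]
    exact hx
  · intro z
    obtain ⟨p, hp, hz⟩ := cl_alg z.2
    refine ⟨p, hp, ?_⟩
    apply (algebraMap (cl k (insert t S)) Ω).injective
    rw [hom_eval₂, map_zero, ← hcomp]
    exact hz

lemma curve_iso_cl {S : Set Ω} {G : k[X][X]} (hG : G.Monic) (hirr : Irreducible G) (hd : derivative G ≠ 0)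
    {t x t' x' : Ω} (ht : t ∉ cl k S) (ht' : t' ∉ cl k S) (hx : gv (algebraMap k Ω) G t x = 0)
    (hx' : gv (algebraMap k Ω) G t' x' = 0) :
    ∃ ρ : cl k (insert t S) ≃+* cl k (insert t' S), (∀ z (hz : z ∈ cl k (insert t S)), z ∈ cl k S → ((ρ ⟨z, hz⟩ : cl k (insert t' S)) : Ω) = z) ∧
      (∀ h, ((ρ ⟨t, h⟩ : cl k (insert t' S)) : Ω) = t') ∧ (∀ h, ((ρ ⟨x, h⟩ : cl k (insert t' S)) : Ω) = x') := by
  have mt : t ∈ cl k (insert t S) := subset_cl _ (by simp)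
  have mt' : t' ∈ cl k (insert t' S) := subset_cl _ (by simp)
  have mx : x ∈ cl k (insert t S) := gv_root_mem hG mt hx
  have mx' : x' ∈ cl k (insert t' S) := gv_root_mem hG mt' hx'
  obtain ⟨i, i1, i2, i3, i4⟩ := incl_data hG t x mt mx ht hx
  obtain ⟨i', j1, j2, j3, j4⟩ := incl_data hG t' x' mt' mx' ht' hx'
  obtain ⟨ρ, r1, r2, r3⟩ := curve_iso i i' (G.map (mapRingHom (algebraMap k (cl k S)))) (hG.map _) (irr_geom _ G hG hirr hd)
    ⟨t, mt⟩ ⟨x, mx⟩ ⟨t', mt'⟩ ⟨x', mx'⟩ i2 j2 i3 j3 i4 j4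
  refine ⟨ρ, ?_, ?_, ?_⟩
  · intro z hz hz'
    have h1 := r1 ⟨z, hz'⟩
    have h2 : (⟨z, hz⟩ : cl k (insert t S)) = i ⟨z, hz'⟩ := Subtype.ext (i1 ⟨z, hz'⟩).symm
    rw [h2, h1, j1]
  · intro h; rw [r2]
  · intro h; rw [r3]

lemma curve_iso_ext {S S' : Set Ω} {G : k[X][X]} (hG : G.Monic) (hirr : Irreducible G) (hd : derivative G ≠ 0)
    {t x t' x' : Ω} (ht : t ∉ cl k S) (ht' : t' ∉ cl k S') (hx : gv (algebraMap k Ω) G t x = 0)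
    (hx' : gv (algebraMap k Ω) G t' x' = 0) (ρ0 : cl k S ≃+* cl k S') (hρ : ∀ c : k, (ρ0 (algebraMap k _ c)) = algebraMap k _ c)
    (hS : ∀ z, z ∈ cl k (insert t S)) (hS' : ∀ z, z ∈ cl k (insert t' S')) :
    ∃ ρ : Ω ≃+* Ω, (∀ z : cl k S, ρ z = ρ0 z) ∧ ρ t = t' ∧ ρ x = x' := by
  have e1 : (algebraMap (cl k S) Ω).comp (algebraMap k (cl k S)) = algebraMap k Ω := rfl
  have e3 : eval₂RingHom ((algebraMap (cl k S') Ω).comp (ρ0 : cl k S →+* cl k S')) t' =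
    (eval₂RingHom (algebraMap (cl k S') Ω) t').comp (mapRingHom (ρ0 : cl k S →+* cl k S')) := by
    ext <;> simp
  obtain ⟨ρ, r1, r2, r3⟩ := curve_iso (algebraMap (cl k S) Ω) ((algebraMap (cl k S') Ω).comp (ρ0 : cl k S →+* cl k S'))
    (G.map (mapRingHom (algebraMap k (cl k S)))) (hG.map _) (irr_geom _ G hG hirr hd) t x t' x' (cl_trans ht)
    (by
      rw [e3, RingHom.coe_comp]
      exact (cl_trans ht').comp (map_injective _ ρ0.injective))
    (by rw [gv_eval_map]; exact hx)
    (by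
      rw [gv_eval_map]
      rw [← hx']; congr 1
      ext c
      change ((ρ0 (algebraMap k _ c) : cl k S') : Ω) = _
      rw [hρ]; rfl)
    (fun z => cl_alg (hS z))
    (fun z => by
      obtain ⟨p, hp, hz⟩ := cl_alg (hS' z)
      refine ⟨p.map (mapRingHom (ρ0.symm : cl k S' →+* cl k S)), ?_, ?_⟩
      · exact (Polynomial.map_ne_zero_iff (map_injective _ ρ0.symm.injective)).2 hp
      · rw [eval₂_map, ← hz]
        congr 1
        ext <;> simp)
  exact ⟨ρ, r1, r2, r3⟩

lemma interp {t1 t2 a0 a1 a2 a3 x1 x2 : Ω} (n : ℕ) (c : k) (hne : t1 ≠ t2) (h1 : (fq n c a0 a1 a2 a3).eval t1 = x1)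
    (h2 : (fq n c a0 a1 a2 a3).eval t2 = x2) :
    a1 = ((x1 - a2 * t1 ^ 2 - a3 * t1 ^ 3 - algebraMap k Ω c * t1 ^ n) - (x2 - a2 * t2 ^ 2 - a3 * t2 ^ 3 - algebraMap k Ω c * t2 ^ n)) / (t1 - t2)
    ∧ a0 = x1 - a1 * t1 - a2 * t1 ^ 2 - a3 * t1 ^ 3 - algebraMap k Ω c * t1 ^ n := by
  have := sub_ne_zero.2 hne
  rw [fq_eval] at h1 h2
  constructor
  · rw [eq_div_iff this, ← h1, ← h2]; ring
  · rw [← h1]; ring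

lemma two_trans {G : k[X][X]} (hG : G.Monic) (hirr : Irreducible G) (hd : derivative G ≠ 0) (n : ℕ) (c : k)
    {a0 a1 a2 a3 : Ω} (hind : AlgebraicIndependent k ![a0, a1, a2, a3]) (hΩ : ∀ z : Ω, z ∈ cl k ({a0, a1, a2, a3} : Set Ω))
    {t1 t2 t1' t2' : Ω} (hne : t1 ≠ t2) (hne' : t1' ≠ t2')
    (h1 : (Pf (algebraMap k Ω) G (fq n c a0 a1 a2 a3)).eval t1 = 0) (h2 : (Pf (algebraMap k Ω) G (fq n c a0 a1 a2 a3)).eval t2 = 0)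
    (h1' : (Pf (algebraMap k Ω) G (fq n c a0 a1 a2 a3)).eval t1' = 0) (h2' : (Pf (algebraMap k Ω) G (fq n c a0 a1 a2 a3)).eval t2' = 0) :
    ∃ ρ : Ω ≃+* Ω, (∀ z : k, ρ (algebraMap k Ω z) = algebraMap k Ω z) ∧ ρ a0 = a0 ∧ ρ a1 = a1 ∧ ρ a2 = a2 ∧ ρ a3 = a3 ∧
      ρ t1 = t1' ∧ ρ t2 = t2' := by
  rw [Pf_eval] at h1 h2 h1' h2'
  have gen : ∀ (S : Set Ω) (s1 s2 : Ω), s1 ≠ s2 → gv (algebraMap k Ω) G s1 ((fq n c a0 a1 a2 a3).eval s1) = 0 →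
      gv (algebraMap k Ω) G s2 ((fq n c a0 a1 a2 a3).eval s2) = 0 → s1 ∈ cl k S → s2 ∈ cl k S → a2 ∈ cl k S → a3 ∈ cl k S →
      a0 ∈ cl k S ∧ a1 ∈ cl k S := by
    intro S s1 s2 hs e1 e2 m1 m2 m3 m4
    have x1 := gv_root_mem hG m1 e1
    have x2 := gv_root_mem hG m2 e2
    obtain ⟨r1, r2⟩ := interp (k := k) n c hs rfl rfl (a0 := a0) (a1 := a1) (a2 := a2) (a3 := a3)
    have q1 : a1 ∈ cl k S := by
      rw [r1]
      refine div_mem (sub_mem ?_ ?_) (sub_mem m1 m2)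
      · exact sub_mem (sub_mem (sub_mem x1 (mul_mem m3 (pow_mem m1 _))) (mul_mem m4 (pow_mem m1 _))) (pow_term_mem m1 c n)
      · exact sub_mem (sub_mem (sub_mem x2 (mul_mem m3 (pow_mem m2 _))) (mul_mem m4 (pow_mem m2 _))) (pow_term_mem m2 c n)
    refine ⟨?_, q1⟩
    rw [r2]
    exact sub_mem (sub_mem (sub_mem (sub_mem x1 (mul_mem q1 m1)) (mul_mem m3 (pow_mem m1 _))) (mul_mem m4 (pow_mem m1 _))) (pow_term_mem m1 c n)
  have indep : ∀ s1 s2 : Ω, s1 ≠ s2 → gv (algebraMap k Ω) G s1 ((fq n c a0 a1 a2 a3).eval s1) = 0 →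
      gv (algebraMap k Ω) G s2 ((fq n c a0 a1 a2 a3).eval s2) = 0 → s1 ∉ cl k ({s2, a2, a3} : Set Ω) := by
    intro s1 s2 hs e1 e2 hm
    have m2 : a2 ∈ cl k ({s2, a2, a3} : Set Ω) := subset_cl _ (by simp)
    have m3 : a3 ∈ cl k ({s2, a2, a3} : Set Ω) := subset_cl _ (by simp)
    have := gen _ s1 s2 hs e1 e2 hm (subset_cl _ (by simp)) m2 m3
    apply cl_rank (m := 3) hind (enc3 s2 a2 a3)
    intro i; fin_cases i
    exacts [this.1, this.2, m2, m3]
  have all : ∀ s1 s2 : Ω, s1 ≠ s2 → gv (algebraMap k Ω) G s1 ((fq n c a0 a1 a2 a3).eval s1) = 0 →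
      gv (algebraMap k Ω) G s2 ((fq n c a0 a1 a2 a3).eval s2) = 0 → ∀ z, z ∈ cl k (insert s1 ({s2, a2, a3} : Set Ω)) := by
    intro s1 s2 hs e1 e2 z
    refine cl_le ?_ (hΩ z)
    have m2 : a2 ∈ cl k ({s1, s2, a2, a3} : Set Ω) := subset_cl _ (by simp)
    have m3 : a3 ∈ cl k ({s1, s2, a2, a3} : Set Ω) := subset_cl _ (by simp)
    have := gen ({s1, s2, a2, a3} : Set Ω) s1 s2 hs e1 e2 (subset_cl _ (by simp)) (subset_cl _ (by simp)) m2 m3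
    rintro y (rfl | rfl | rfl | rfl)
    exacts [this.1, this.2, m2, m3]
  have ht2 : t2 ∉ cl k ({a2, a3} : Set Ω) := fun h => indep t2 t1 hne.symm h2 h1 (cl_mono (by intro y; simp; tauto) h)
  have ht2' : t2' ∉ cl k ({a2, a3} : Set Ω) := fun h => indep t2' t1' hne'.symm h2' h1' (cl_mono (by intro y; simp; tauto) h)
  obtain ⟨ρ0, p1, p2, p3⟩ := curve_iso_cl hG hirr hd ht2 ht2' h2 h2'
  have hρk : ∀ c : k, (ρ0 (algebraMap k _ c)) = algebraMap k _ c := fun c => Subtype.ext (p1 _ _ (cst_mem _ c))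
  obtain ⟨ρ, q1, q2, q3⟩ := curve_iso_ext hG hirr hd (indep t1 t2 hne h1 h2) (indep t1' t2' hne' h1' h2') h1 h1' ρ0 hρk
    (all t1 t2 hne h1 h2) (all t1' t2' hne' h1' h2')
  have hmt2 : t2 ∈ cl k ({t2, a2, a3} : Set Ω) := subset_cl _ (by simp)
  have hk : ∀ z : k, ρ (algebraMap k Ω z) = algebraMap k Ω z := by
    intro z
    have h := q1 (algebraMap k _ z)
    rw [hρk] at h
    exact h
  have f2 : ρ a2 = a2 := by
    rw [show a2 = ((⟨a2, subset_cl _ (by simp)⟩ : cl k ({t2, a2, a3} : Set Ω)) : Ω) from rfl, q1]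
    exact p1 _ _ (subset_cl _ (by simp))
  have f3 : ρ a3 = a3 := by
    rw [show a3 = ((⟨a3, subset_cl _ (by simp)⟩ : cl k ({t2, a2, a3} : Set Ω)) : Ω) from rfl, q1]
    exact p1 _ _ (subset_cl _ (by simp))
  have ft2 : ρ t2 = t2' := by
    have := q1 ⟨t2, hmt2⟩
    rw [p2] at this; exact this
  have fx2 : ρ ((fq n c a0 a1 a2 a3).eval t2) = (fq n c a0 a1 a2 a3).eval t2' := by
    have := q1 ⟨_, gv_root_mem hG hmt2 h2⟩
    rw [p3] at this; exact this
  obtain ⟨r1, r2⟩ := interp (k := k) n c hne rfl rfl (a0 := a0) (a1 := a1) (a2 := a2) (a3 := a3)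
  obtain ⟨r1', r2'⟩ := interp (k := k) n c hne' rfl rfl (a0 := a0) (a1 := a1) (a2 := a2) (a3 := a3)
  have f1 : ρ a1 = a1 := by
    have := congrArg ρ r1
    simp only [map_div₀, map_sub, map_mul, map_pow, q2, q3, ft2, fx2, f2, f3, hk] at this
    rw [this, ← r1']
  have f0 : ρ a0 = a0 := by
    have := congrArg ρ r2
    simp only [map_div₀, map_sub, map_mul, map_pow, q2, q3, ft2, fx2, f1, f2, f3, hk] at this
    rw [this, ← r2']
  exact ⟨ρ, hk, f0, f1, f2, f3, q2, ft2⟩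
end
end BH

open Polynomial
namespace BH
section
variable {k Ω : Type} [Field k] [IsAlgClosed k] [Field Ω] [Algebra k Ω] [IsAlgClosed Ω]
variable {K : Type} [Fintype K] [DecidableEq K] {N : K → ℕ}

lemma act_mul (σ π : Gp N) (ι : Lb N) : act (σ * π) ι = act σ (act π ι) := rfl
lemma act_one (ι : Lb N) : act (1 : Gp N) ι = ι := rfl
lemma act_inv (σ : Gp N) (ι : Lb N) : act σ (act σ⁻¹ ι) = ι := by
  rw [← act_mul, mul_inv_cancel, act_one]

/-- realizable permutations -/
def Hgrp (A : Set Ω) (τ : Lb N → Ω) : Subgroup (Gp N) where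
  carrier := {σ | ∃ h : Ω ≃+* Ω, (∀ z ∈ A, h z = z) ∧ ∀ ι, h (τ ι) = τ (act σ ι)}
  one_mem' := ⟨RingEquiv.refl Ω, fun _ _ => rfl, fun _ => rfl⟩
  mul_mem' := by
    rintro σ π ⟨h, h1, h2⟩ ⟨g, g1, g2⟩
    refine ⟨g.trans h, fun z hz => ?_, fun ι => ?_⟩
    · rw [RingEquiv.trans_apply, g1 z hz, h1 z hz]
    · rw [RingEquiv.trans_apply, g2, h2, act_mul]
  inv_mem' := by
    rintro σ ⟨h, h1, h2⟩
    refine ⟨h.symm, fun z hz => ?_, fun ι => ?_⟩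
    · rw [RingEquiv.symm_apply_eq, h1 z hz]
    · rw [RingEquiv.symm_apply_eq, h2, act_inv]

lemma mem_Hgrp {A : Set Ω} {τ : Lb N → Ω} {σ : Gp N} : σ ∈ Hgrp A τ ↔ ∃ h : Ω ≃+* Ω, (∀ z ∈ A, h z = z) ∧ ∀ ι, h (τ ι) = τ (act σ ι) := Iff.rfl

lemma Hgrp_conj {A : Set Ω} {τ : Lb N → Ω} {σ π : Gp N} (hσ : σ ∈ Hgrp A τ) (ρ : Ω ≃+* Ω) (hA : ∀ z ∈ A, ρ.symm z ∈ A)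
    (hρ : ∀ ι, ρ (τ ι) = τ (act π ι)) : π * σ * π⁻¹ ∈ Hgrp A τ := by
  obtain ⟨h, h1, h2⟩ := hσ
  refine ⟨(ρ.symm.trans h).trans ρ, fun z hz => ?_, fun ι => ?_⟩
  · change ρ (h (ρ.symm z)) = z
    rw [h1 _ (hA z hz), RingEquiv.apply_symm_apply]
  · change ρ (h (ρ.symm (τ ι))) = _
    have : ρ.symm (τ ι) = τ (act π⁻¹ ι) := by rw [RingEquiv.symm_apply_eq, hρ, act_inv]
    rw [this, h2, hρ]; rfl

lemma perm_of_aut {P : K → Polynomial Ω} {τ : Lb N → Ω} (hinj : ∀ kk, Function.Injective fun i => τ ⟨kk, i⟩)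
    (hroot : ∀ kk z, (P kk).eval z = 0 ↔ ∃ i, τ ⟨kk, i⟩ = z) (ρ : Ω ≃+* Ω) (hρ : ∀ kk, (P kk).map (ρ : Ω →+* Ω) = P kk) :
    ∃ π : Gp N, ∀ ι, ρ (τ ι) = τ (act π ι) := by
  have h1 : ∀ kk (i : Fin (N kk)), ∃ j : Fin (N kk), τ ⟨kk, j⟩ = ρ (τ ⟨kk, i⟩) := by
    intro kk i
    rw [← hroot, ← hρ, eval_map]
    change eval₂ (ρ : Ω →+* Ω) ((ρ : Ω →+* Ω) _) _ = 0
    rw [eval₂_hom, (hroot kk _).2 ⟨i, rfl⟩, map_zero]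
  choose f hf using h1
  have hfi : ∀ kk, Function.Injective (f kk) := by
    intro kk i j hij
    apply hinj kk
    apply ρ.injective
    simp only
    rw [← hf, ← hf, hij]
  refine ⟨fun kk => Equiv.ofBijective (f kk) (Finite.injective_iff_bijective.1 (hfi kk)), ?_⟩
  rintro ⟨kk, i⟩
  exact (hf kk i).symm

lemma full_group {a0 a1 a2 a3 : Ω} (G : K → k[X][X]) (hG : ∀ j, (G j).Monic) (hirr : ∀ j, Irreducible (G j))
    (hd : ∀ j, derivative (G j) ≠ 0) (hnd : ∀ i j, G i ∣ G j → i = j)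
    (hind : AlgebraicIndependent k ![a0, a1, a2, a3]) (hΩ : ∀ z : Ω, z ∈ cl k ({a0, a1, a2, a3} : Set Ω))
    (n : ℕ) (hn : 3 ≤ n) (c : k) (hW : ∀ j, WB n (n * (G j).natDegree) (G j))
    (hlam : ∀ j, (Lam n (G j)).eval₂ (algebraMap k Ω) ((fq n c a0 a1 a2 a3).coeff n) ≠ 0)
    (τ : Lb N → Ω) (hinj : ∀ kk, Function.Injective fun i => τ ⟨kk, i⟩)
    (hroot : ∀ kk z, (Pf (algebraMap k Ω) (G kk) (fq n c a0 a1 a2 a3)).eval z = 0 ↔ ∃ i, τ ⟨kk, i⟩ = z) (σ : Gp N) :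
    ∃ h : Ω ≃+* Ω, (∀ z ∈ cl k ({a1, a2, a3} : Set Ω), h z = z) ∧ h a0 = a0 ∧ ∀ ι, h (τ ι) = τ (act σ ι) := by
  obtain ⟨A, hA⟩ : ∃ A : Set Ω, A = {z | z ∈ cl k ({a1, a2, a3} : Set Ω)} ∪ {a0} := ⟨_, rfl⟩
  suffices H : σ ∈ Hgrp A τ by
    obtain ⟨h, h1, h2⟩ := H
    exact ⟨h, fun z hz => h1 z (by rw [hA]; exact Or.inl hz), h1 _ (by rw [hA]; exact Or.inr rfl), h2⟩
  have hsw : ∀ kk (i j : Fin (N kk)), i ≠ j → Pi.mulSingle kk (Equiv.swap i j) ∈ Hgrp A τ := by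
    intro kk i j hij
    obtain ⟨g, z1, z2, g1, g0, hne, e1, e2, s1, s2, f1, f2⟩ := transp G hG hirr hd hnd hind hΩ n hn c hW hlam kk
    obtain ⟨i1, rfl⟩ := (hroot kk z1).1 e1
    obtain ⟨i2, rfl⟩ := (hroot kk z2).1 e2
    have hm : Pi.mulSingle kk (Equiv.swap i1 i2) ∈ Hgrp A τ := by
      refine ⟨g, ?_, ?_⟩
      · rw [hA]; rintro z (hz | rfl)
        exacts [g1 z hz, g0]
      · rintro ⟨j, l⟩
        by_cases hj : j = kk
        · subst hj
          simp only [act, Pi.mulSingle_eq_same]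
          by_cases h1 : l = i1
          · subst h1; rw [Equiv.swap_apply_left, s1]
          by_cases h2 : l = i2
          · subst h2; rw [Equiv.swap_apply_right, s2]
          rw [Equiv.swap_apply_of_ne_of_ne h1 h2]
          refine f1 _ ((hroot _ _).2 ⟨l, rfl⟩) ?_ ?_
          · exact fun h => h1 (hinj _ h)
          · exact fun h => h2 (hinj _ h)
        · simp only [act, Pi.mulSingle_eq_of_ne hj, Equiv.Perm.one_apply]
          exact f2 j hj _ ((hroot _ _).2 ⟨l, rfl⟩)
    obtain ⟨ρ, rk, r0, r1, r2, r3, q1, q2⟩ := two_trans (hG kk) (hirr kk) (hd kk) n c hind hΩ hne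
      (fun h => hij (hinj kk h) : τ ⟨kk, i⟩ ≠ τ ⟨kk, j⟩) e1 e2 ((hroot _ _).2 ⟨i, rfl⟩) ((hroot _ _).2 ⟨j, rfl⟩)
    obtain ⟨π, hπ⟩ := perm_of_aut hinj hroot ρ (by
      intro kk
      rw [Pf_map, fq_map (ρ : Ω →+* Ω) rk]
      have : (ρ : Ω →+* Ω).comp (algebraMap k Ω) = algebraMap k Ω := RingHom.ext rk
      rw [this]
      simp only [RingEquiv.coe_toRingHom, r0, r1, r2, r3])
    have hc := Hgrp_conj hm ρ (by
      rw [hA]; rintro z (hz | rfl)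
      · refine Or.inl ?_
        refine cl_map (ρ.symm : Ω →+* Ω) (fun c => ?_) hz ?_
        · change ρ.symm _ = _
          rw [RingEquiv.symm_apply_eq, rk]
        · rintro s (rfl | rfl | rfl)
          · change ρ.symm s ∈ _
            rw [show ρ.symm s = s from by rw [RingEquiv.symm_apply_eq, r1]]; exact subset_cl _ (by simp)
          · change ρ.symm s ∈ _
            rw [show ρ.symm s = s from by rw [RingEquiv.symm_apply_eq, r2]]; exact subset_cl _ (by simp)
          · change ρ.symm s ∈ _
            rw [show ρ.symm s = s from by rw [RingEquiv.symm_apply_eq, r3]]; exact subset_cl _ (by simp)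
      · refine Or.inr ?_
        rw [Set.mem_singleton_iff, RingEquiv.symm_apply_eq, r0]) hπ
    have p1 : π kk i1 = i := hinj kk ((hπ ⟨kk, i1⟩).symm.trans q1)
    have p2 : π kk i2 = j := hinj kk ((hπ ⟨kk, i2⟩).symm.trans q2)
    convert hc using 1
    funext j'
    by_cases hj : j' = kk
    · subst hj
      simp only [Pi.mul_apply, Pi.inv_apply, Pi.mulSingle_eq_same]
      rw [← p1, ← p2, Equiv.swap_apply_apply]
    · simp only [Pi.mul_apply, Pi.inv_apply, Pi.mulSingle_eq_of_ne hj, mul_one, mul_inv_cancel]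
  apply Subgroup.pi_mem_of_mulSingle_mem
  intro kk
  have h1 : (⊤ : Subgroup (Equiv.Perm (Fin (N kk)))) ≤ (Hgrp A τ).comap (MonoidHom.mulSingle (fun kk => Equiv.Perm (Fin (N kk))) kk) := by
    rw [← Equiv.Perm.closure_isSwap, Subgroup.closure_le]
    rintro s ⟨i, j, hij, rfl⟩
    exact hsw kk i j hij
  exact h1 (Subgroup.mem_top (σ kk))
end
end BH

open Polynomial
namespace BH
section
variable {K : Type} [Fintype K] [DecidableEq K]

/-- leading coefficients -/
noncomputable def lmb {k B : Type} [CommRing k] [CommRing B] (i : k →+* B) (n : ℕ) (G : K → k[X][X]) (f : B[X]) (kk : K) : B :=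
  (Lam n (G kk)).eval₂ i (f.coeff n)

/-- coefficients of the monic modification of the block polynomials -/
noncomputable def cc {k B : Type} [CommRing k] [CommRing B] (i : k →+* B) (n : ℕ) (N : K → ℕ) (G : K → k[X][X]) (f : B[X]) : Lb N → B :=
  fun ι => (lmb i n G f ι.1) ^ (N ι.1 - 1 - ι.2) * (Pf i (G ι.1) f).coeff ι.2

/-- the pencil `X + g` -/
noncomputable def pen {n : ℕ} {B : Type} [CommRing B] (g : Fin n → B) : B[X][X] :=
  C X + ∑ j : Fin n, C (C (g j)) * X ^ ((j : ℕ) + 1)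

noncomputable def chi {k B : Type} [CommRing k] [CommRing B] {n : ℕ} (i : k →+* B) (N : K → ℕ) (G : K → k[X][X]) (g : Fin n → B) (u : Lb N → B) : B[X][X] :=
  resv (cc (C.comp i) n N G (pen g)) (fun ι => C (u ι))

lemma lmb_map {k B B' : Type} [CommRing k] [CommRing B] [CommRing B'] (i : k →+* B) (r : B →+* B') (n : ℕ) (G : K → k[X][X]) (f : B[X]) (kk : K) :
    r (lmb i n G f kk) = lmb (r.comp i) n G (f.map r) kk := by
  rw [lmb, lmb, hom_eval₂, coeff_map]

lemma cc_map {k B B' : Type} [CommRing k] [CommRing B] [CommRing B'] (i : k →+* B) (r : B →+* B') (n : ℕ) (N : K → ℕ) (G : K → k[X][X]) (f : B[X]) (ι : Lb N) :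
    r (cc i n N G f ι) = cc (r.comp i) n N G (f.map r) ι := by
  rw [cc, cc, map_mul, map_pow, lmb_map, ← coeff_map, Pf_map]

lemma pen_map {n : ℕ} {B B' : Type} [CommRing B] [CommRing B'] (r : B →+* B') (g : Fin n → B) :
    (pen g).map (mapRingHom r) = pen (fun j => r (g j)) := by
  simp [pen, Polynomial.map_sum]

lemma chi_map {k B B' : Type} [CommRing k] [CommRing B] [CommRing B'] {n : ℕ} (i : k →+* B) (r : B →+* B') (N : K → ℕ) (G : K → k[X][X]) (g : Fin n → B) (u : Lb N → B) :
    (chi i N G g u).map (mapRingHom r) = chi (r.comp i) N G (fun j => r (g j)) (fun ι => r (u ι)) := by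
  rw [chi, chi, resv_map]
  congr 1
  · funext ι
    rw [cc_map, pen_map]
    congr 1
    ext x; simp
  · funext ι
    simp

lemma pen_ev {n : ℕ} {B B' : Type} [CommRing B] [CommRing B'] (r : B →+* B') (α : B') (g : Fin n → B) :
    (pen g).map (eval₂RingHom r α) = C α + ∑ j : Fin n, C (r (g j)) * X ^ ((j : ℕ) + 1) := by
  simp [pen, Polynomial.map_sum]

lemma chi_ev {k B B' : Type} [CommRing k] [CommRing B] [CommRing B'] {n : ℕ} (i : k →+* B) (r : B →+* B') (α : B') (N : K → ℕ) (G : K → k[X][X]) (g : Fin n → B) (u : Lb N → B) :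
    (chi i N G g u).map (eval₂RingHom r α) = resv (cc (r.comp i) n N G (C α + ∑ j : Fin n, C (r (g j)) * X ^ ((j : ℕ) + 1))) (fun ι => r (u ι)) := by
  rw [chi, resv_map]
  congr 1
  · funext ι
    rw [cc_map, pen_ev]
    congr 1
    ext x; simp
  · funext ι
    simp

lemma lab_scale {F : Type} [Field F] {N : ℕ} (l : F) (hl : l ≠ 0) (P : F[X]) (hP : P.natDegree ≤ N) (hP' : P.coeff N = l) (t : Fin N → F) :
    Lab (fun j : Fin N => l ^ (N - 1 - (j : ℕ)) * P.coeff j) (fun j => l * t j) ↔ P = C l * ∏ j, (X - C (t j)) := by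
  have h1 : (∏ j, (X - C (l * t j))).comp (C l * X) = C (l ^ N) * ∏ j, (X - C (t j)) := by
    rw [prod_comp]
    have : ∀ j, (X - C (l * t j)).comp (C l * X) = C l * (X - C (t j)) := by
      intro j; simp [mul_sub]
    rw [Finset.prod_congr rfl (fun j _ => this j), Finset.prod_mul_distrib]; simp
  have h2 : ∀ j, (∏ j, (X - C (l * t j))).coeff j * l ^ j = l ^ N * (∏ j, (X - C (t j))).coeff j := by
    intro j
    rw [← comp_C_mul_X_coeff, h1, coeff_C_mul]
  have hdeg : (∏ j, (X - C (t j))).natDegree = N := by simp [natDegree_finset_prod_X_sub_C_eq_card]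
  have hmon : (∏ j, (X - C (t j))).Monic := monic_prod_X_sub_C _ _
  constructor
  · intro h
    ext j
    rcases lt_trichotomy j N with hj | hj | hj
    · have h3 := h ⟨j, hj⟩
      have h4 := h2 j
      simp only at h3
      rw [h3] at h4
      rw [coeff_C_mul]
      have h5 : l ^ N = l ^ (N - 1 - j) * l * l ^ j := by
        rw [← pow_succ, ← pow_add]; congr 1; omega
      rw [h5] at h4
      have h6 := pow_ne_zero (N - 1 - j) hl
      have h7 := pow_ne_zero j hl
      apply mul_left_cancel₀ (mul_ne_zero h6 h7)
      linear_combination h4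
    · subst hj
      rw [hP', coeff_C_mul]
      have := hmon.coeff_natDegree
      rw [hdeg] at this
      rw [this, mul_one]
    · rw [coeff_eq_zero_of_natDegree_lt (by omega), coeff_C_mul, coeff_eq_zero_of_natDegree_lt (by omega), mul_zero]
  · rintro h ⟨j, hj⟩
    simp only
    rw [h, coeff_C_mul]
    have h4 := h2 j
    have h5 : l ^ N = l ^ (N - 1 - j) * l * l ^ j := by
      rw [← pow_succ, ← pow_add]; congr 1; omega
    rw [h5] at h4
    have h7 := pow_ne_zero j hl
    apply mul_right_cancel₀ h7
    rw [h4]; ring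

/-- labellings = factorizations -/
lemma labs_scale {k F : Type} [Field k] [Field F] (i : k →+* F) (n : ℕ) (hn : 1 ≤ n) (N : K → ℕ) (G : K → k[X][X])
    (hW : ∀ kk, WB n (n * (G kk).natDegree) (G kk)) (hN : ∀ kk, N kk = n * (G kk).natDegree) (f : F[X]) (hf : f.natDegree ≤ n)
    (hl : ∀ kk, lmb i n G f kk ≠ 0) (t : Lb N → F) :
    Labs (cc i n N G f) (fun ι => lmb i n G f ι.1 * t ι) ↔ ∀ kk, Pf i (G kk) f = C (lmb i n G f kk) * ∏ j, (X - C (t ⟨kk, j⟩)) := by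
  refine forall_congr' fun kk => ?_
  have := Pf_top i n hn (G kk) (hW kk) f hf
  rw [← hN] at this
  exact lab_scale (lmb i n G f kk) (hl kk) _ this.1 this.2 _
end
end BH

open Polynomial
namespace BH
section
variable {K : Type} [Fintype K] [DecidableEq K] {N : K → ℕ}

lemma sep_u {κ Ω : Type} [Field κ] [Infinite κ] [Field Ω] (i : κ →+* Ω) (τ : Lb N → Ω) (hinj : ∀ kk, Function.Injective fun j => τ ⟨kk, j⟩) :
    ∃ u : Lb N → κ, Function.Injective fun σ : Gp N => ∑ ι, i (u ι) * τ (act σ ι) := by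
  classical
  let ε := Fintype.equivFin (Lb N)
  let p : Gp N → Gp N → Polynomial Ω := fun σ σ' => ∑ ι, C (τ (act σ ι) - τ (act σ' ι)) * X ^ (ε ι : ℕ)
  have hp : ∀ σ σ', σ ≠ σ' → p σ σ' ≠ 0 := by
    intro σ σ' hne h0
    apply hne
    funext kk
    ext1 j
    have h1 := congrArg (fun r => r.coeff (ε ⟨kk, j⟩ : ℕ)) h0
    simp only [p, finset_sum_coeff, coeff_C_mul, coeff_X_pow, coeff_zero] at h1
    rw [Finset.sum_eq_single (⟨kk, j⟩ : Lb N)] at h1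
    · rw [if_pos rfl, mul_one, sub_eq_zero] at h1
      exact hinj kk h1
    · intro b _ hb
      rw [if_neg, mul_zero]
      intro h
      exact hb (ε.injective (Fin.ext h)).symm
    · simp
  let q : Polynomial Ω := ∏ x ∈ (Finset.univ : Finset (Gp N × Gp N)).filter (fun x => x.1 ≠ x.2), p x.1 x.2
  have hq : q ≠ 0 := by
    rw [Finset.prod_ne_zero_iff]
    intro x hx
    exact hp _ _ (Finset.mem_filter.1 hx).2
  have : ∃ x : κ, q.eval (i x) ≠ 0 := by
    by_contra hcon
    push Not at hcon
    apply hq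
    apply Polynomial.eq_zero_of_infinite_isRoot
    refine Set.Infinite.mono ?_ (Set.infinite_range_of_injective i.injective)
    rintro _ ⟨x, rfl⟩
    exact hcon x
  obtain ⟨x, hx⟩ := this
  refine ⟨fun ι => x ^ (ε ι : ℕ), ?_⟩
  intro σ σ' h
  by_contra hne
  simp only [q, eval_prod] at hx
  rw [Finset.prod_ne_zero_iff] at hx
  apply hx (σ, σ') (by simp [hne])
  simp only [p, eval_finset_sum, eval_mul, eval_C, eval_pow, eval_X]
  simp only [map_pow] at h
  simp only [sub_mul, Finset.sum_sub_distrib]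
  rw [sub_eq_zero]
  simp only [mul_comm (τ _)]
  exact h

lemma res_irr_abs {κ Ω : Type} [Field κ] [Infinite κ] [Field Ω] (e : κ[X] →+* Ω) (he : Function.Injective e)
    (c : Lb N → κ[X]) (τ : Lb N → Ω) (hL : Labs (fun ι => e (c ι)) τ) (hinj : ∀ kk, Function.Injective fun j => τ ⟨kk, j⟩)
    (hgrp : ∀ σ : Gp N, ∃ h : Ω ≃+* Ω, (∀ z, h (e z) = e z) ∧ ∀ ι, h (τ ι) = τ (act σ ι)) :
    ∃ u : Lb N → κ, Irreducible (resv c (fun ι => C (u ι))) ∧ derivative (resv c (fun ι => C (u ι))) ≠ 0 := by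
  classical
  obtain ⟨u, hu⟩ := sep_u (e.comp C) τ hinj
  refine ⟨u, ?_⟩
  obtain ⟨χ, hχ⟩ : ∃ χ, χ = resv c (fun ι => C (u ι)) := ⟨_, rfl⟩
  rw [← hχ]
  obtain ⟨hmon, hdeg⟩ := resv_monic c (fun ι => C (u ι))
  rw [← hχ] at hmon hdeg
  obtain ⟨θ, hθ⟩ : ∃ θ : Gp N → Ω, θ = fun σ => ∑ ι, (e.comp C) (u ι) * τ (act σ ι) := ⟨_, rfl⟩
  rw [← hθ] at hu
  have hmap : χ.map e = ∏ σ : Gp N, (X - C (θ σ)) := by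
    rw [hχ, resv_map]
    have := resv_eq (fun ι => e (C (u ι))) hL
    rw [hθ]
    exact this
  have hcard : 0 < Fintype.card (Gp N) := Fintype.card_pos
  constructor
  · rw [hmon.irreducible_iff_natDegree]
    refine ⟨?_, ?_⟩
    · intro h1
      rw [h1, natDegree_one] at hdeg
      omega
    · intro A B hA hB hAB
      have key : ∀ A B : κ[X][X], A.Monic → B.Monic → A * B = χ → (A.map e).eval (θ 1) = 0 → B.natDegree = 0 := by
        intro A B hA hB hAB h1
        have h2 : ∀ σ, (A.map e).eval (θ σ) = 0 := by
          intro σ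
          obtain ⟨h, h1', h2'⟩ := hgrp σ
          have h3 : θ σ = (h : Ω →+* Ω) (θ 1) := by
            rw [hθ]; simp only
            rw [map_sum]
            refine Finset.sum_congr rfl fun ι _ => ?_
            rw [map_mul]
            change _ = h (e (C (u ι))) * h (τ ι)
            rw [h1', h2']; rfl
          have h4 : (A.map e).map (h : Ω →+* Ω) = A.map e := by
            rw [map_map]; congr 1; ext1
            · ext x; exact h1' _
            · exact h1' _
          rw [h3, ← h4, eval_map, eval₂_hom, h1, map_zero]
        have h3 : Fintype.card (Gp N) ≤ A.natDegree := by
          rw [← hA.natDegree_map e]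
          have : (Finset.univ.image θ).card = Fintype.card (Gp N) := by
            rw [Finset.card_image_of_injective _ hu]; rfl
          rw [← this]
          refine (Finset.card_le_card ?_).trans ((Multiset.toFinset_card_le _).trans (card_roots' (A.map e)))
          intro z hz
          obtain ⟨σ, -, rfl⟩ := Finset.mem_image.1 hz
          rw [Multiset.mem_toFinset, mem_roots (hA.map e).ne_zero]
          exact h2 σ
        have h4 := hA.natDegree_mul hB
        rw [hAB, hdeg] at h4
        omega
      have h0 : ((A * B).map e).eval (θ 1) = 0 := by
        rw [hAB, hmap, eval_prod]
        exact Finset.prod_eq_zero (Finset.mem_univ 1) (by simp)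
      rw [Polynomial.map_mul, eval_mul, mul_eq_zero] at h0
      rcases h0 with h0 | h0
      · exact Or.inr (key A B hA hB hAB h0)
      · exact Or.inl (key B A hB hA (by rw [mul_comm, hAB]) h0)
  · intro h0
    have hs : (∏ σ : Gp N, (X - C (θ σ))).Separable := separable_prod_X_sub_C_iff.2 hu
    have h1 : (∏ σ : Gp N, (X - C (θ σ))).eval (θ 1) = 0 := by
      rw [eval_prod]
      exact Finset.prod_eq_zero (Finset.mem_univ 1) (by simp)
    have h2 := hs.aeval_derivative_ne_zero (x := θ 1) (by rw [coe_aeval_eq_eval]; exact h1)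
    apply h2
    rw [← hmap, derivative_map, h0]; simp

lemma exists_generic (k : Type) [Field k] : ∃ (Ω : Type) (_ : Field Ω) (_ : Algebra k Ω) (_ : IsAlgClosed Ω) (a0 a1 a2 a3 : Ω),
    AlgebraicIndependent k ![a0, a1, a2, a3] ∧ ∀ z : Ω, z ∈ cl k ({a0, a1, a2, a3} : Set Ω) := by
  let R := MvPolynomial (Fin 4) k
  let Q := FractionRing R
  let Ω := AlgebraicClosure Q
  let a : Fin 4 → Ω := fun i => algebraMap R Ω (MvPolynomial.X i)
  have hinj : Function.Injective (algebraMap R Ω) := by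
    rw [IsScalarTower.algebraMap_eq R Q Ω]
    exact (algebraMap Q Ω).injective.comp (IsFractionRing.injective R Q)
  have ha : AlgebraicIndependent k a := by
    have h := (MvPolynomial.algebraicIndependent_X (Fin 4) k)
    exact h.map' (f := IsScalarTower.toAlgHom k R Ω) hinj
  have hav : a = ![a 0, a 1, a 2, a 3] := by
    funext i; fin_cases i <;> rfl
  refine ⟨Ω, inferInstance, inferInstance, inferInstance, a 0, a 1, a 2, a 3, hav ▸ ha, ?_⟩
  intro z
  obtain ⟨S, hS⟩ : ∃ S : Set Ω, S = {a 0, a 1, a 2, a 3} := ⟨_, rfl⟩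
  rw [← hS]
  have haS : ∀ i, a i ∈ cl k S := by
    intro i; apply subset_cl; rw [hS]; fin_cases i <;> simp
  have hR : ∀ r : R, algebraMap R Ω r ∈ cl k S := by
    intro r
    induction r using MvPolynomial.induction_on with
    | C c =>
      have : algebraMap R Ω (MvPolynomial.C c) = algebraMap k Ω c := by
        rw [IsScalarTower.algebraMap_apply k R Ω]; rfl
      rw [this]; exact cst_mem _ _
    | add p q hp hq => rw [map_add]; exact add_mem hp hq
    | mul_X p i hp => rw [map_mul]; exact mul_mem hp (haS i)
  obtain ⟨p, hp, hz⟩ := (Algebra.IsAlgebraic.isAlgebraic (R := Q) z)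
  apply mem_cl_of_root (p := p.map (algebraMap Q Ω)) ((Polynomial.map_ne_zero_iff (algebraMap Q Ω).injective).2 hp)
  · intro m
    rw [coeff_map]
    obtain ⟨x, y, hy, hxy⟩ := IsFractionRing.div_surjective (A := R) (p.coeff m)
    rw [← hxy, map_div₀, ← IsScalarTower.algebraMap_apply, ← IsScalarTower.algebraMap_apply]
    exact div_mem (hR x) (hR y)
  · rw [eval_map]; exact hz

lemma fq_pen {k κ : Type} [Field k] [Field κ] [Algebra k κ] (n : ℕ) (hn : 3 ≤ n) (c : k) (b1 b2 b3 : κ) :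
    ∃ g : Fin n → κ, (∑ j : Fin n, C (g j) * X ^ ((j : ℕ) + 1) : κ[X]) = fq n c 0 b1 b2 b3 := by
  refine ⟨fun j => (fq n c 0 b1 b2 b3).coeff (j + 1), ?_⟩
  have h1 := (fq n c 0 b1 b2 b3).as_sum_range_C_mul_X_pow' (n := n + 1) (Nat.lt_succ_of_le (fq_natDegree n hn c 0 b1 b2 b3))
  conv_rhs => rw [h1]
  rw [Finset.sum_range_succ', Fin.sum_univ_eq_sum_range (fun j => C ((fq n c 0 b1 b2 b3).coeff (j + 1)) * X ^ (j + 1))]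
  have : (fq n c 0 b1 b2 b3).coeff 0 = 0 := by
    rw [coeff_zero_eq_eval_zero, fq_eval]
    simp; right; omega
  rw [this]; simp

theorem res_irr {k : Type} [Field k] [IsAlgClosed k] (G : K → k[X][X]) (hG : ∀ j, (G j).Monic) (hirr : ∀ j, Irreducible (G j))
    (hd : ∀ j, derivative (G j) ≠ 0) (hnd : ∀ i j, G i ∣ G j → i = j)
    (n : ℕ) (hn : 3 ≤ n) (hW : ∀ j, WB n (n * (G j).natDegree) (G j)) (hN : ∀ j, N j = n * (G j).natDegree) :
    ∃ (κ : Type) (_ : Field κ) (_ : IsAlgClosed κ) (i : k →+* κ) (g : Fin n → κ) (u : Lb N → κ),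
      Irreducible (chi i N G g u) ∧ derivative (chi i N G g u) ≠ 0 := by
  classical
  obtain ⟨Ω, _, _, _, a0, a1, a2, a3, hind, hΩ⟩ := exists_generic k
  have hn0 : 1 ≤ n := by omega
  obtain ⟨c, hc⟩ : ∃ c : k, ∀ j, (Lam n (G j)).eval c ≠ 0 := by
    by_contra hcon
    push Not at hcon
    have : (∏ j, Lam n (G j)) = 0 := by
      apply Polynomial.eq_zero_of_infinite_isRoot
      refine Set.Infinite.mono ?_ (Set.infinite_univ (α := k))
      intro c _
      obtain ⟨j, hj⟩ := hcon c
      rw [Set.mem_setOf_eq, IsRoot, eval_prod]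
      exact Finset.prod_eq_zero (Finset.mem_univ j) hj
    rw [Finset.prod_eq_zero_iff] at this
    obtain ⟨j, -, hj⟩ := this
    exact (Lam_monic n hn0 (G j) (hG j)).ne_zero hj
  have hlam : ∀ j, (Lam n (G j)).eval₂ (algebraMap k Ω) ((fq n c a0 a1 a2 a3).coeff n) ≠ 0 := by
    intro j h0
    rw [fq_coeff n hn] at h0
    by_cases h3 : n = 3
    · rw [if_pos h3] at h0
      have hm : a3 + algebraMap k Ω c ∈ cl k (∅ : Set Ω) := by
        apply mem_cl_of_root (p := (Lam n (G j)).map (algebraMap k Ω))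
        · exact ((Lam_monic n hn0 (G j) (hG j)).map _).ne_zero
        · intro m; rw [coeff_map]; exact cst_mem _ _
        · rw [eval_map]; exact h0
      have hm3 : a3 ∈ cl k (∅ : Set Ω) := by
        have := sub_mem hm (cst_mem _ c); simpa using this
      apply cl_rank (m := 3) hind (enc3 a0 a1 a2)
      intro i; fin_cases i
      exacts [subset_cl _ (by simp), subset_cl _ (by simp), subset_cl _ (by simp), cl_mono (Set.empty_subset _) hm3]
    · rw [if_neg h3, zero_add, eval₂_at_apply] at h0
      exact hc j ((algebraMap k Ω).injective (h0.trans (map_zero _).symm))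
  obtain ⟨κ, hκ⟩ : ∃ κ, κ = cl k ({a1, a2, a3} : Set Ω) := ⟨_, rfl⟩
  haveI : IsAlgClosed κ := by rw [hκ]; infer_instance
  have m1 : a1 ∈ κ := by rw [hκ]; exact subset_cl _ (by simp)
  have m2 : a2 ∈ κ := by rw [hκ]; exact subset_cl _ (by simp)
  have m3 : a3 ∈ κ := by rw [hκ]; exact subset_cl _ (by simp)
  have m0 : a0 ∉ κ := by
    rw [hκ] at *
    intro h
    apply cl_rank (m := 3) hind (enc3 a1 a2 a3)
    intro i; fin_cases i <;> assumption
  have he : Function.Injective (eval₂RingHom (algebraMap κ Ω) a0) := by subst hκ; exact cl_trans m0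
  obtain ⟨g, hg⟩ := fq_pen (k := k) (κ := κ) n hn c ⟨a1, m1⟩ ⟨a2, m2⟩ ⟨a3, m3⟩
  have hfg : (pen g).map (eval₂RingHom (algebraMap κ Ω) a0) = fq n c a0 a1 a2 a3 := by
    rw [pen_ev]
    have h1 := congrArg (Polynomial.map (algebraMap κ Ω)) hg
    rw [fq_map (k := k) (algebraMap κ Ω) (fun _ => rfl), Polynomial.map_sum] at h1
    simp only [Polynomial.map_mul, map_C, Polynomial.map_pow, map_X] at h1
    rw [h1, fq, fq, map_zero, C_0, zero_add]
    simp only [← add_assoc]; rfl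
  obtain ⟨lam, hlamd⟩ : ∃ lam : K → Ω, lam = lmb (algebraMap k Ω) n G (fq n c a0 a1 a2 a3) := ⟨_, rfl⟩
  have hlam' : ∀ kk, lam kk ≠ 0 := by rw [hlamd]; exact hlam
  have hlamκ : ∀ kk, lam kk ∈ κ := by
    intro kk
    rw [hlamd, lmb, eval₂_eq_sum_range]
    refine sum_mem fun j _ => mul_mem (κ.algebraMap_mem _) (pow_mem ?_ _)
    rw [fq_coeff n hn]
    refine add_mem ?_ (κ.algebraMap_mem _)
    split_ifs
    exacts [m3, zero_mem _]
  have hlab : ∃ t : Lb N → Ω, ∀ kk, Pf (algebraMap k Ω) (G kk) (fq n c a0 a1 a2 a3) = C (lam kk) * ∏ j, (X - C (t ⟨kk, j⟩)) := by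
    obtain ⟨τ, hτ⟩ := exists_labs (cc (algebraMap k Ω) n N G (fq n c a0 a1 a2 a3))
    refine ⟨fun ι => (lam ι.1)⁻¹ * τ ι, ?_⟩
    have := (labs_scale (algebraMap k Ω) n hn0 N G hW hN (fq n c a0 a1 a2 a3) (fq_natDegree n hn c a0 a1 a2 a3) hlam (fun ι => (lam ι.1)⁻¹ * τ ι)).1
    rw [← hlamd] at this
    apply this
    convert hτ using 1
    funext ι
    rw [mul_inv_cancel_left₀ (hlam' _)]
  obtain ⟨t, ht⟩ := hlab
  have hroot : ∀ kk z, (Pf (algebraMap k Ω) (G kk) (fq n c a0 a1 a2 a3)).eval z = 0 ↔ ∃ i, t ⟨kk, i⟩ = z := by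
    intro kk z
    rw [ht, eval_mul, eval_C, mul_eq_zero, or_iff_right (hlam' kk), eval_prod, Finset.prod_eq_zero_iff]
    simp only [Finset.mem_univ, true_and, eval_sub, eval_X, eval_C, sub_eq_zero]
    exact exists_congr fun _ => eq_comm
  have hinj : ∀ kk, Function.Injective fun i => t ⟨kk, i⟩ := by
    intro kk
    have : (Pf (algebraMap k Ω) (G kk) (fq n c a0 a1 a2 a3)).Separable := by
      rw [separable_def]
      apply isCoprime_of_irreducible_dvd
      · rintro ⟨h, -⟩
        rw [ht, mul_eq_zero, C_eq_zero] at h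
        rcases h with h | h
        · exact hlam' kk h
        · exact (monic_prod_X_sub_C _ _).ne_zero h
      · intro z hz h1 h2
        obtain ⟨y, hy⟩ := IsAlgClosed.exists_root z (degree_pos_of_irreducible hz).ne'
        refine generic_sep (hG kk) (hirr kk) (hd kk) n c hind y (dbl_iff'.2 ⟨?_, ?_⟩)
        · exact eval_eq_zero_of_dvd_of_eval_eq_zero h1 hy
        · exact eval_eq_zero_of_dvd_of_eval_eq_zero h2 hy
    rw [ht] at this
    exact separable_prod_X_sub_C_iff.1 this.of_mul_right
  have hgrp := full_group G hG hirr hd hnd hind hΩ n hn c hW hlam t hinj hroot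
  have hcomp : (eval₂RingHom (algebraMap κ Ω) a0).comp (C.comp (algebraMap k κ)) = algebraMap k Ω := by
    ext x
    rw [RingHom.comp_apply, RingHom.comp_apply, coe_eval₂RingHom, eval₂_C]; rfl
  obtain ⟨u, hu⟩ := res_irr_abs (eval₂RingHom (algebraMap κ Ω) a0) he (cc (C.comp (algebraMap k κ)) n N G (pen g))
    (fun ι => lam ι.1 * t ι)
    (by
      have := (labs_scale (algebraMap k Ω) n hn0 N G hW hN (fq n c a0 a1 a2 a3) (fq_natDegree n hn c a0 a1 a2 a3) hlam t).2
      rw [← hlamd] at this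
      convert this ht using 1
      funext ι
      rw [cc_map, hfg, hcomp])
    (by
      intro kk i j h
      exact hinj kk (mul_left_cancel₀ (hlam' kk) h))
    (by
      intro σ
      obtain ⟨h, h1, h2, h3⟩ := hgrp σ
      rw [← hκ] at h1
      refine ⟨h, ?_, ?_⟩
      · intro z
        have : (h : Ω →+* Ω).comp (eval₂RingHom (algebraMap κ Ω) a0) = eval₂RingHom (algebraMap κ Ω) a0 := by
          apply Polynomial.ringHom_ext
          · intro a
            rw [RingHom.comp_apply, coe_eval₂RingHom, eval₂_C]
            exact h1 _ a.2
          · rw [RingHom.comp_apply, coe_eval₂RingHom, eval₂_X]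
            exact h2
        exact congrArg (fun f => f z) this
      · intro ι
        rw [map_mul, h1 _ (hlamκ _), h3]; rfl)
  exact ⟨κ, inferInstance, inferInstance, algebraMap k κ, g, u, hu⟩
end
end BH

open Polynomial
namespace BH
section
variable {K : Type} [Fintype K] [DecidableEq K] {N : K → ℕ}

lemma eval₂_fil {k A : Type} [CommRing k] [CommRing A] {Fil : ℕ → A → Prop} (h : IsFil Fil) (i : k →+* A) (hi : ∀ c, Fil 0 (i c))
    (p : k[X]) (s : ℕ) (hp : p.natDegree ≤ s) {D : ℕ} {a : A} (ha : Fil D a) : Fil (s * D) (p.eval₂ i a) := by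
  rw [eval₂_eq_sum_range]
  apply h.sum
  intro j hj
  rw [Finset.mem_range] at hj
  refine h.mono ?_ (h.mul (hi _) (h.pow ha j))
  rw [zero_add]; exact Nat.mul_le_mul_right _ (by omega)

/-- degree bound for `cc` -/
def Dn (N : K → ℕ) : ℕ := ∑ kk, (N kk * N kk + 2 * N kk) + 1

lemma cc_fil {k A : Type} [CommRing k] [CommRing A] {Fil : ℕ → A → Prop} (h : IsFil Fil) (i : k →+* A) (hi : ∀ c, Fil 0 (i c))
    (n : ℕ) (hn : 1 ≤ n) (G : K → k[X][X]) (hW : ∀ j, WB n (n * (G j).natDegree) (G j)) (hN : ∀ j, N j = n * (G j).natDegree)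
    (f : A[X]) (hf : f.natDegree ≤ n) (hfc : ∀ m, Fil 1 (f.coeff m)) (ι : Lb N) : Fil (Dn N) (cc i n N G f ι) := by
  have hs : (G ι.1).natDegree ≤ N ι.1 := by rw [hN]; exact Nat.le_mul_of_pos_left _ (by omega)
  have h1 : Fil (N ι.1) (lmb i n G f ι.1) := by
    have := eval₂_fil h i hi (Lam n (G ι.1)) _ ((Lam_natDegree n hn (G ι.1)).trans hs) (hfc n)
    rwa [mul_one] at this
  have h2 : FilX Fil (2 * N ι.1) (Pf i (G ι.1) f) := by
    rw [Pf, eval₂_eq_sum_range]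
    apply h.X.sum
    intro j hj
    rw [Finset.mem_range] at hj
    have e1 : FilX Fil (N ι.1) ((mapRingHom i) ((G ι.1).coeff j)) := by
      constructor
      · refine natDegree_map_le.trans ?_
        rw [natDegree_le_iff_coeff_eq_zero]
        intro m hm
        by_contra hcon
        have := hW ι.1 j m hcon
        rw [← hN] at this
        omega
      · intro m
        rw [coe_mapRingHom, coeff_map]; exact h.mono (Nat.zero_le _) (hi _)
    have e2 : FilX Fil n f := ⟨hf, fun m => h.mono hn (hfc m)⟩
    refine h.X.mono ?_ (h.X.mul e1 (h.X.pow e2 j))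
    have : j * n ≤ N ι.1 := by rw [hN, mul_comm]; exact Nat.mul_le_mul_left _ (by omega)
    omega
  refine h.mono ?_ (h.mul (h.pow h1 _) (h2.2 ι.2))
  have h3 : N ι.1 * N ι.1 + 2 * N ι.1 ≤ ∑ kk, (N kk * N kk + 2 * N kk) :=
    Finset.single_le_sum (f := fun kk => N kk * N kk + 2 * N kk) (fun _ _ => Nat.zero_le _) (Finset.mem_univ ι.1)
  have h4 : (N ι.1 - 1 - (ι.2 : ℕ)) * N ι.1 ≤ N ι.1 * N ι.1 := Nat.mul_le_mul_right _ (by omega)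
  rw [Dn]; omega

lemma pen_natDegree {n : ℕ} (hn : 1 ≤ n) {B : Type} [CommRing B] (g : Fin n → B) : (pen g).natDegree ≤ n := by
  rw [pen]
  refine (natDegree_add_le _ _).trans (max_le (by simp) (natDegree_sum_le_of_forall_le _ _ fun j _ => ?_))
  exact (natDegree_C_mul_X_pow_le _ _).trans (by omega)

lemma pen_fil {n : ℕ} {A : Type} [CommRing A] {Fil : ℕ → A → Prop} (h : IsFil Fil) (g : Fin n → A) (hg : ∀ j, Fil 1 (g j)) (m : ℕ) :
    FilX Fil 1 ((pen g).coeff m) := by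
  rw [pen, coeff_add, finset_sum_coeff]
  apply h.X.add
  · rw [coeff_C]; split_ifs
    exacts [FilX.X h le_rfl, h.X.zero _]
  · apply h.X.sum
    intro j _
    rw [coeff_C_mul, coeff_X_pow]
    split_ifs
    · rw [mul_one]; exact FilX.C h (hg j)
    · rw [mul_zero]; exact h.X.zero _

/-- degree bound for `chi` -/
noncomputable def Rn (N : K → ℕ) : ℕ := (rsq N).totalDegree * Dn N

lemma chi_fil {k A : Type} [CommRing k] [CommRing A] {Fil : ℕ → A → Prop} (h : IsFil Fil) (i : k →+* A) (hi : ∀ c, Fil 0 (i c))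
    (n : ℕ) (hn : 1 ≤ n) (G : K → k[X][X]) (hW : ∀ j, WB n (n * (G j).natDegree) (G j)) (hN : ∀ j, N j = n * (G j).natDegree)
    (g : Fin n → A) (hg : ∀ j, Fil 1 (g j)) (u : Lb N → A) (hu : ∀ ι, Fil 1 (u ι)) : FilX (FilX Fil) (Rn N) (chi i N G g u) := by
  apply resv_fil h.X
  · rw [Dn]; omega
  · exact cc_fil h.X (C.comp i) (fun c => FilX.C h (hi c)) n hn G hW hN (pen g) (pen_natDegree hn g) (pen_fil h g hg)
  · intro ι
    exact FilX.C h (h.mono (by rw [Dn]; omega) (hu ι))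

lemma mp_eq_chi {k A : Type} [CommRing k] [CommRing A] [IsDomain A] (i : k →+* A) 
    (n : ℕ) (hn : 1 ≤ n) (G : K → k[X][X]) (hW : ∀ j, WB n (n * (G j).natDegree) (G j)) (hN : ∀ j, N j = n * (G j).natDegree)
    (g : Fin n → A) (u : Lb N → A) :
    chi i N G g u = mp (fun x : Fin (Fintype.card (Gp N)) × Fin (Rn N + 1) => ((chi i N G g u).coeff x.1).coeff x.2) := by
  obtain ⟨h1, h2⟩ := resv_monic (cc (C.comp i) n N G (pen g)) (fun ι => C (u ι))
  exact eq_mp _ h1 h2 (fun m => ((chi_fil (isFil_true A) i (fun _ => trivial) n hn G hW hN g (fun _ => trivial) u (fun _ => trivial)).2 m).1)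

/-- coefficient family of `chi` -/
noncomputable def cfc {k : Type} [CommRing k] {n : ℕ} (N : K → ℕ) (G : K → k[X][X]) (A : Type) [CommRing A] (i : k →+* A) (g : Fin n → A) (u : Lb N → A)
    (x : Fin (Fintype.card (Gp N)) × Fin (Rn N + 1)) : A := ((chi i N G g u).coeff x.1).coeff x.2

theorem good_g (n : ℕ) (hn : 3 ≤ n) (N : K → ℕ) : ∃ E : ℕ, ∀ (k : Type) [Field k] [IsAlgClosed k] (G : K → k[X][X]), (∀ j, (G j).Monic) →
    (∀ j, Irreducible (G j)) → (∀ j, derivative (G j) ≠ 0) → (∀ i j, G i ∣ G j → i = j) → (∀ j, WB n (n * (G j).natDegree) (G j)) →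
    (∀ j, N j = n * (G j).natDegree) →
    ∃ (u : Lb N → k) (H : MvPolynomial (Fin n) k), H ≠ 0 ∧ H.totalDegree ≤ E ∧ ∀ g : Fin n → k, MvPolynomial.eval g H ≠ 0 →
      Irreducible (chi (RingHom.id k) N G g u) ∧ derivative (chi (RingHom.id k) N G g u) ≠ 0 ∧
      (∀ kk, (Lam n (G kk)).eval (g ⟨n - 1, by omega⟩) ≠ 0) ∧ g ⟨n - 1, by omega⟩ ≠ 0 := by
  have hn0 : 1 ≤ n := by omega
  obtain ⟨T, hT⟩ := irr_forms (Fintype.card (Gp N)) (Rn N) Fintype.card_pos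
  refine ⟨(∑ ν ∈ T, ν.totalDegree * Rn N) + ∑ kk, N kk + 1, ?_⟩
  intro k _ _ G hG hirr hd hnd hW hN
  obtain ⟨κ, _, _, i, g0, u0, h0⟩ := res_irr G hG hirr hd hnd n hn hW hN
  rw [mp_eq_chi i n hn0 G hW hN g0 u0, hT] at h0
  obtain ⟨ν, hνT, hν⟩ := h0
  have hcfm : ∀ (A A' : Type) [CommRing A] [CommRing A'] (r : A →+* A') (i : k →+* A) (g : Fin n → A) (u : Lb N → A) ,
      r (zev (cfc N G A i g u) ν) = zev (cfc N G A' (r.comp i) (fun j => r (g j)) (fun ι => r (u ι))) ν := by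
    intro A A' _ _ r i g u
    rw [zev_map]
    congr 2
    funext x
    simp only [cfc]
    rw [← chi_map, coeff_map, coe_mapRingHom, coeff_map]
  -- universal element
  have hU : ∃ (g1 : Fin n → k) (u1 : Lb N → k), zev (cfc N G k (RingHom.id k) g1 u1) ν ≠ 0 := by
    obtain ⟨hu, hhu⟩ : ∃ hu : MvPolynomial (Fin n ⊕ Lb N) k, hu = zev (cfc N G _ MvPolynomial.C (fun j => MvPolynomial.X (Sum.inl j)) (fun ι => MvPolynomial.X (Sum.inr ι))) ν := ⟨_, rfl⟩
    have hne : hu ≠ 0 := by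
      intro h
      apply hν
      have h1 := congrArg (MvPolynomial.eval₂Hom i (Sum.elim g0 u0)) h
      rw [hhu, hcfm, map_zero] at h1
      convert h1 using 2
      have e1 : (MvPolynomial.eval₂Hom i (Sum.elim g0 u0)).comp MvPolynomial.C = i := by ext x; simp
      simp only [e1, MvPolynomial.eval₂Hom_X', Sum.elim_inl, Sum.elim_inr]
      rfl
    by_contra hcon
    push Not at hcon
    apply hne
    apply MvPolynomial.funext
    intro v
    rw [hhu, map_zero]
    have h2 := hcfm _ _ (MvPolynomial.eval v) MvPolynomial.C (fun j => MvPolynomial.X (Sum.inl j)) (fun ι => MvPolynomial.X (Sum.inr ι))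
    rw [h2]
    have e1 : (MvPolynomial.eval v).comp MvPolynomial.C = RingHom.id k := by ext x; simp
    rw [e1]
    exact hcon _ _
  obtain ⟨g1, u1, h1⟩ := hU
  obtain ⟨H1, hH1⟩ : ∃ H1 : MvPolynomial (Fin n) k, H1 = zev (cfc N G _ MvPolynomial.C MvPolynomial.X (fun ι => MvPolynomial.C (u1 ι))) ν := ⟨_, rfl⟩
  have hH1e : ∀ g, MvPolynomial.eval g H1 = zev (cfc N G k (RingHom.id k) g u1) ν := by
    intro g
    rw [hH1, hcfm]
    have e1 : (MvPolynomial.eval g).comp MvPolynomial.C = RingHom.id k := by ext x; simp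
    rw [e1]; simp
  obtain ⟨l, hl⟩ : ∃ l : Fin n, l = ⟨n - 1, by omega⟩ := ⟨_, rfl⟩
  simp only [← hl]
  obtain ⟨H2, hH2⟩ : ∃ H2 : K → MvPolynomial (Fin n) k, H2 = fun kk => (Lam n (G kk)).eval₂ MvPolynomial.C (MvPolynomial.X l) := ⟨_, rfl⟩
  have hH2e : ∀ kk g, MvPolynomial.eval g (H2 kk) = (Lam n (G kk)).eval (g l) := by
    intro kk g
    rw [hH2]; simp only
    rw [hom_eval₂]
    have e1 : (MvPolynomial.eval g).comp MvPolynomial.C = RingHom.id k := by ext x; simp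
    rw [e1, MvPolynomial.eval_X, eval₂_id]
  have hX : (MvPolynomial.X l : MvPolynomial (Fin n) k).totalDegree ≤ 1 := (MvPolynomial.totalDegree_X _).le
  refine ⟨u1, H1 * (∏ kk, H2 kk) * MvPolynomial.X l, ?_, ?_, ?_⟩
  · refine mul_ne_zero (mul_ne_zero ?_ ?_) (MvPolynomial.X_ne_zero _)
    · intro h
      apply h1
      rw [← hH1e, h, map_zero]
    · rw [Finset.prod_ne_zero_iff]
      intro kk _ h
      apply (Lam_monic n hn0 (G kk) (hG kk)).ne_zero
      apply Polynomial.funext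
      intro x
      have := hH2e kk (fun _ => x)
      rw [h, map_zero] at this
      rw [← this, eval_zero]
  · refine (MvPolynomial.totalDegree_mul _ _).trans (Nat.add_le_add ((MvPolynomial.totalDegree_mul _ _).trans (Nat.add_le_add ?_ ?_)) hX)
    · have : H1.totalDegree ≤ ν.totalDegree * Rn N := by
        rw [hH1]
        apply (isFil_td (Fin n) k).zev
        intro x
        refine ((chi_fil (isFil_td (Fin n) k) MvPolynomial.C (fun c => (MvPolynomial.totalDegree_C c).le) n hn0 G hW hN MvPolynomial.X
          (fun j => (MvPolynomial.totalDegree_X _).le) (fun ι => MvPolynomial.C (u1 ι)) ?_).2 _).2 _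
        intro ι; rw [MvPolynomial.totalDegree_C]; omega
      exact this.trans (Finset.single_le_sum (f := fun ν => MvPolynomial.totalDegree ν * Rn N) (fun _ _ => Nat.zero_le _) hνT)
    · refine (MvPolynomial.totalDegree_finset_prod _ _).trans (Finset.sum_le_sum fun kk _ => ?_)
      rw [hH2]
      have hs : (G kk).natDegree ≤ N kk := by rw [hN]; exact Nat.le_mul_of_pos_left _ (by omega)
      have := eval₂_fil (isFil_td (Fin n) k) MvPolynomial.C (fun c => (MvPolynomial.totalDegree_C c).le) (Lam n (G kk)) _
        ((Lam_natDegree n hn0 (G kk)).trans hs) hX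
      rwa [mul_one] at this
  · intro g hg
    rw [map_mul, map_mul, map_prod, MvPolynomial.eval_X, mul_ne_zero_iff, mul_ne_zero_iff, Finset.prod_ne_zero_iff, hH1e] at hg
    obtain ⟨⟨e1, e2⟩, e3⟩ := hg
    have h3 : Irreducible (chi (RingHom.id k) N G g u1) ∧ derivative (chi (RingHom.id k) N G g u1) ≠ 0 := by
      rw [mp_eq_chi (RingHom.id k) n hn0 G hW hN g u1, hT]
      refine ⟨ν, hνT, ?_⟩
      exact e1
    refine ⟨h3.1, h3.2, fun kk => ?_, e3⟩
    rw [← hH2e]; exact e2 kk (Finset.mem_univ _)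
end
end BH

open Polynomial
namespace BH
section
variable {J : Type} [Fintype J] [DecidableEq J]

/-- blocks -/
abbrev Kb (μ : J → ℕ) : Type := Σ i : J, Fin (μ i)
/-- block sizes -/
abbrev Nb (μ b : J → ℕ) : Kb μ → ℕ := fun kk => b kk.1
/-- rotation of the blocks -/
abbrev rot {μ : J → ℕ} (kk : Kb μ) : Kb μ := ⟨kk.1, finRotate _ kk.2⟩
/-- inverse rotation of the blocks -/
abbrev rotinv {μ : J → ℕ} (kk : Kb μ) : Kb μ := ⟨kk.1, (finRotate _).symm kk.2⟩

lemma rot_rotinv {μ : J → ℕ} (kk : Kb μ) : rot (rotinv kk) = kk := by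
  obtain ⟨i, j⟩ := kk; exact congrArg (Sigma.mk i) ((finRotate _).apply_symm_apply j)
lemma rotinv_rot {μ : J → ℕ} (kk : Kb μ) : rotinv (rot kk) = kk := by
  obtain ⟨i, j⟩ := kk; exact congrArg (Sigma.mk i) ((finRotate _).symm_apply_apply j)

/-- permutation of the labels covering the rotation -/
def stp {μ b : J → ℕ} (s : Gp (Nb μ b)) : Equiv.Perm (Lb (Nb μ b)) where
  toFun ι := ⟨rot ι.1, s ι.1 ι.2⟩
  invFun ι := ⟨rotinv ι.1, (s (rotinv ι.1)).symm ι.2⟩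
  left_inv := by
    rintro ⟨⟨i, j⟩, l⟩
    have : ∀ j' : Fin (μ i), j' = j → (⟨⟨i, j'⟩, (s ⟨i, j'⟩).symm (s ⟨i, j⟩ l)⟩ : Lb (Nb μ b)) = ⟨⟨i, j⟩, l⟩ := by
      rintro _ rfl; simp
    exact this _ ((finRotate _).symm_apply_apply j)
  right_inv := by
    rintro ⟨⟨i, j⟩, l⟩
    have : ∀ j' : Fin (μ i), j' = j → ∀ l' : Fin (b i), l' = l → (⟨⟨i, j'⟩, l'⟩ : Lb (Nb μ b)) = ⟨⟨i, j⟩, l⟩ := by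
      rintro _ rfl _ rfl; rfl
    exact this _ ((finRotate _).apply_symm_apply j) _ (Equiv.apply_symm_apply _ _)

lemma stp_apply {μ b : J → ℕ} (s : Gp (Nb μ b)) (ι : Lb (Nb μ b)) : stp s ι = ⟨rot ι.1, s ι.1 ι.2⟩ := rfl

/-- twisted conjugation -/
def tcj {μ b : J → ℕ} (ρ s : Gp (Nb μ b)) : Gp (Nb μ b) := fun kk =>
  ((ρ kk).trans (s kk)).trans ((ρ (rot kk) : Equiv.Perm (Fin (b kk.1))).symm)

lemma act_stp {μ b : J → ℕ} (ρ s : Gp (Nb μ b)) (ι : Lb (Nb μ b)) : act ρ (stp (tcj ρ s) ι) = stp s (act ρ ι) := by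
  obtain ⟨⟨i, j⟩, l⟩ := ι
  have : (ρ (rot ⟨i, j⟩) : Equiv.Perm (Fin (b i))) ((ρ (rot ⟨i, j⟩) : Equiv.Perm (Fin (b i))).symm (s ⟨i, j⟩ (ρ ⟨i, j⟩ l))) = s ⟨i, j⟩ (ρ ⟨i, j⟩ l) := by
    rw [Equiv.apply_symm_apply]
  show (⟨⟨i, finRotate _ j⟩, _⟩ : Lb (Nb μ b)) = ⟨⟨i, finRotate _ j⟩, _⟩
  congr 1

lemma lmb_frob {k : Type} [Field k] {K : Type} [Fintype K] [DecidableEq K] (φ : k →+* k) (n : ℕ) (hn : 1 ≤ n) (G : K → k[X][X]) (f : k[X]) (hf : f.map φ = f)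
    (kk kk' : K) (hG : (G kk).map (mapRingHom φ) = G kk') :
    φ (lmb (RingHom.id k) n G f kk) = lmb (RingHom.id k) n G f kk' := by
  rw [lmb_map, hf, lmb, lmb, RingHom.comp_id]
  have : Lam n (G kk') = (Lam n (G kk)).map φ := by
    ext j
    rw [coeff_map, Lam_coeff n hn, Lam_coeff n hn, ← hG, natDegree_map_eq_of_injective (map_injective φ φ.injective)]
    split_ifs
    · rw [coeff_map]; simp
    · simp
  rw [this, eval₂_map, RingHom.id_comp]

lemma Pf_frob {k : Type} [Field k] {K : Type} [Fintype K] [DecidableEq K] (φ : k →+* k) (G : K → k[X][X]) (f : k[X]) (hf : f.map φ = f)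
    (kk kk' : K) (hG : (G kk).map (mapRingHom φ) = G kk') :
    (Pf (RingHom.id k) (G kk) f).map φ = Pf (RingHom.id k) (G kk') f := by
  rw [Pf, Pf, ← hG, eval₂_map, ← coe_mapRingHom, hom_eval₂, coe_mapRingHom, hf]
  congr 1
  ext x; simp; simp

lemma frob_perm {k : Type} [Field k] (φ : k →+* k) {μ b : J → ℕ} (n : ℕ) (hn : 1 ≤ n) (G : Kb μ → k[X][X])
    (hG : ∀ kk, (G kk).map (mapRingHom φ) = G (rot kk)) (f : k[X]) (hf : f.map φ = f)
    (hl : ∀ kk, lmb (RingHom.id k) n G f kk ≠ 0) (t : Lb (Nb μ b) → k)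
    (ht : ∀ kk, Pf (RingHom.id k) (G kk) f = C (lmb (RingHom.id k) n G f kk) * ∏ j, (X - C (t ⟨kk, j⟩)))
    (hinj : ∀ kk, Function.Injective fun j => t ⟨kk, j⟩) : ∃ s : Gp (Nb μ b), ∀ ι, φ (t ι) = t (stp s ι) := by
  have h1 : ∀ (kk : Kb μ) (l : Fin (b kk.1)), ∃ l' : Fin (b kk.1), t ⟨rot kk, l'⟩ = φ (t ⟨kk, l⟩) := by
    intro kk l
    have e1 : (Pf (RingHom.id k) (G (rot kk)) f).eval (φ (t ⟨kk, l⟩)) = 0 := by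
      rw [← Pf_frob φ G f hf kk _ (hG kk), eval_map, eval₂_hom, ht kk, eval_mul, eval_prod, Finset.prod_eq_zero (Finset.mem_univ l) (by simp)]
      simp
    rw [ht, eval_mul, eval_C, mul_eq_zero, or_iff_right (hl _), eval_prod, Finset.prod_eq_zero_iff] at e1
    obtain ⟨l', _, h⟩ := e1
    exact ⟨l', by rw [eval_sub, eval_X, eval_C, sub_eq_zero] at h; exact h.symm⟩
  choose r hr using h1
  have hri : ∀ kk, Function.Injective (r kk) := by
    intro kk i j hij
    apply hinj kk
    apply φ.injective
    simp only
    rw [← hr, ← hr, hij]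
  refine ⟨fun kk => Equiv.ofBijective (r kk) (Finite.injective_iff_bijective.1 (hri kk)), ?_⟩
  rintro ⟨kk, i⟩
  exact (hr kk i).symm
end
end BH

open Polynomial
namespace BH
section
variable {J : Type} [Fintype J] [DecidableEq J]

/-- member of the pencil -/
noncomputable def fpen {k : Type} [CommRing k] {n : ℕ} (g : Fin n → k) (α : k) : k[X] := C α + ∑ j : Fin n, C (g j) * X ^ ((j : ℕ) + 1)

lemma fpen_natDegree {k : Type} [CommRing k] {n : ℕ} (hn : 1 ≤ n) (g : Fin n → k) (α : k) : (fpen g α).natDegree ≤ n := by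
  rw [fpen]
  refine (natDegree_add_le _ _).trans (max_le (by simp) (natDegree_sum_le_of_forall_le _ _ fun j _ => ?_))
  exact (natDegree_C_mul_X_pow_le _ _).trans (by omega)

lemma evalEval_chi {k : Type} [Field k] {K : Type} [Fintype K] [DecidableEq K] {N : K → ℕ} {n : ℕ} (G : K → k[X][X]) (g : Fin n → k) (u : Lb N → k) (α η : k) :
    (chi (RingHom.id k) N G g u).evalEval α η = (resv (cc (RingHom.id k) n N G (fpen g α)) u).eval η := by
  rw [← map_evalRingHom_eval]
  congr 1
  exact chi_ev (RingHom.id k) (RingHom.id k) α N G g u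

lemma evalEval_dchi {k : Type} [Field k] {K : Type} [Fintype K] [DecidableEq K] {N : K → ℕ} {n : ℕ} (G : K → k[X][X]) (g : Fin n → k) (u : Lb N → k) (α η : k) :
    (derivative (chi (RingHom.id k) N G g u)).evalEval α η = (derivative (resv (cc (RingHom.id k) n N G (fpen g α)) u)).eval η := by
  rw [← map_evalRingHom_eval, ← derivative_map]
  congr 2
  exact chi_ev (RingHom.id k) (RingHom.id k) α N G g u

/-- the generic `x` polynomial -/
noncomputable def xg {k : Type} [Field k] {K : Type} [Fintype K] [DecidableEq K] (N : K → ℕ) {n : ℕ} (G : K → k[X][X]) (g : Fin n → k) (u u' : Lb N → k) : k[X][X] :=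
  xpol (cc (C.comp (RingHom.id k)) n N G (pen g)) (fun ι => C (u ι)) (fun ι => C (u' ι))

lemma evalEval_xg {k : Type} [Field k] {K : Type} [Fintype K] [DecidableEq K] {N : K → ℕ} {n : ℕ} (G : K → k[X][X]) (g : Fin n → k) (u u' : Lb N → k) (α η : k) :
    (xg N G g u u').evalEval α η = (xpol (cc (RingHom.id k) n N G (fpen g α)) u u').eval η := by
  rw [← map_evalRingHom_eval]
  congr 1
  rw [xg, xpol_map]
  congr 1
  · funext ι
    rw [cc_map]
    have h := pen_ev (RingHom.id k) α g
    have e : (pen g).map (evalRingHom α) = fpen g α := h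
    rw [e]
    congr 1
    ext x; simp
  · funext ι; simp
  · funext ι; simp

lemma xg_fil {k : Type} [Field k] {K : Type} [Fintype K] [DecidableEq K] {N : K → ℕ} {n : ℕ} (hn : 1 ≤ n) (G : K → k[X][X])
    (hW : ∀ j, WB n (n * (G j).natDegree) (G j)) (hN : ∀ j, N j = n * (G j).natDegree) (g : Fin n → k) (u u' : Lb N → k) :
    (xg N G g u u').natDegree ≤ (rsq N).totalDegree * (Dn N + Dn N) ∧ ∀ m, ((xg N G g u u').coeff m).natDegree ≤ (rsq N).totalDegree * (Dn N + Dn N) := by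
  have h := isFil_true k
  have hD : 1 ≤ Dn N := by rw [Dn]; omega
  have := xpol_fil h.X (D := Dn N) hD (cc (C.comp (RingHom.id k)) n N G (pen g)) (fun ι => C (u ι)) (fun ι => C (u' ι))
    (cc_fil h.X (C.comp (RingHom.id k)) (fun c => FilX.C h trivial) n hn G hW hN (pen g) (pen_natDegree hn g) (pen_fil h g (fun _ => trivial)))
    (fun ι => FilX.C h trivial) (fun ι => FilX.C h trivial)
  exact ⟨this.1, fun m => (this.2 m).1⟩

lemma Labs.act {K : Type} [Fintype K] [DecidableEq K] {N : K → ℕ} {B : Type} [CommRing B] {c τ : Lb N → B} (h : Labs c τ) (ρ : Gp N) :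
    Labs c (fun ι => τ (act ρ ι)) := fun kk => (h kk).perm (ρ kk)

lemma step_bound (n : ℕ) (hn : 1 ≤ n) (μ b : J → ℕ) : ∃ C : ℝ, 0 ≤ C ∧ ∀ (k : Type) [Field k] [IsAlgClosed k] (p e : ℕ) [ExpChar k p]
    (G : Kb μ → k[X][X]), (∀ j, WB n (n * (G j).natDegree) (G j)) → (∀ j, Nb μ b j = n * (G j).natDegree) →
    ∀ (g : Fin n → k) (u : Lb (Nb μ b) → k), Irreducible (chi (RingHom.id k) (Nb μ b) G g u) →
    1 < p ^ e →
    ∀ (τ : k → Lb (Nb μ b) → k) (s0 : Gp (Nb μ b)) (S : Finset (k × Gp (Nb μ b))),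
    (∀ x ∈ S, x.1 ^ (p ^ e) = x.1 ∧ Labs (cc (RingHom.id k) n (Nb μ b) G (fpen g x.1)) (τ x.1) ∧
      (∀ η, (resv (cc (RingHom.id k) n (Nb μ b) G (fpen g x.1)) u).eval η = 0 → (derivative (resv (cc (RingHom.id k) n (Nb μ b) G (fpen g x.1)) u)).eval η ≠ 0) ∧
      (∀ ι, (τ x.1 (act x.2 ι)) ^ (p ^ e) = τ x.1 (act x.2 (stp s0 ι)))) →
    (S.card : ℝ) ≤ (p ^ e : ℕ) + C * Real.sqrt (p ^ e : ℕ) := by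
  obtain ⟨C0, hC0, hst⟩ := stepanov_final (Fintype.card (Gp (Nb μ b))) (Rn (Nb μ b)) ((rsq (Nb μ b)).totalDegree * (Dn (Nb μ b) + Dn (Nb μ b))) Fintype.card_pos
  refine ⟨C0, hC0, ?_⟩
  intro k _ _ p e _ G hW hN g u hirr hq τ s0 S hS
  classical
  obtain ⟨N, hNN⟩ : ∃ N, N = Nb μ b := ⟨_, rfl⟩
  obtain ⟨h1, h2⟩ := resv_monic (cc (C.comp (RingHom.id k)) n (Nb μ b) G (pen g)) (fun ι => C (u ι))
  have h3 := (chi_fil (isFil_true k) (RingHom.id k) (fun _ => trivial) n hn G hW hN g (fun _ => trivial) u (fun _ => trivial)).2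
  obtain ⟨u', hu'⟩ : ∃ u' : Lb (Nb μ b) → k, ∀ ι, u' (stp s0 ι) = u ι ^ (p ^ e) := ⟨fun ι => u ((stp s0).symm ι) ^ (p ^ e), fun ι => by simp⟩
  obtain ⟨x1, x2⟩ := xg_fil hn G hW hN g u u'
  obtain ⟨θ, hθ⟩ : ∃ θ : k × Gp (Nb μ b) → k, θ = fun x => ∑ ι, u ι * τ x.1 (act x.2 ι) := ⟨_, rfl⟩
  have key := hst k p e (chi (RingHom.id k) (Nb μ b) G g u) (xg (Nb μ b) G g u u') h1 h2 (fun m => (h3 m).1) hirr x1 x2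
    (S.image fun x => (x.1, θ x)) ?_ hq
  · rwa [Finset.card_image_of_injOn] at key
    rintro ⟨α, ρ⟩ hx ⟨α', ρ'⟩ hy hxy
    simp only [Prod.mk.injEq] at hxy
    obtain ⟨rfl, h⟩ := hxy
    by_contra hne
    have hne' : ρ ≠ ρ' := fun h => hne (by rw [h])
    obtain ⟨-, hl, hs, -⟩ := hS _ hx
    have e1 := resv_eq u hl
    have e2 : (resv (cc (RingHom.id k) n (Nb μ b) G (fpen g α)) u) = (X - C (θ (α, ρ))) * ((X - C (θ (α, ρ))) * ∏ σ ∈ (Finset.univ.erase ρ).erase ρ', (X - C (∑ ι, u ι * τ α (act σ ι)))) := by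
      rw [e1, ← Finset.mul_prod_erase _ _ (Finset.mem_univ ρ), ← Finset.mul_prod_erase _ _ (Finset.mem_erase.2 ⟨hne'.symm, Finset.mem_univ ρ'⟩)]
      nth_rewrite 2 [h]
      rw [hθ]
    apply hs (θ (α, ρ))
    · rw [e2]; simp
    · rw [e2]; simp [derivative_mul]
  · intro y hy
    obtain ⟨x, hx, rfl⟩ := Finset.mem_image.1 hy
    obtain ⟨ha, hl, hs, hf⟩ := hS _ hx
    simp only
    have hl' := hl.act x.2
    have e0 : (resv (cc (RingHom.id k) n (Nb μ b) G (fpen g x.1)) u).eval (θ x) = 0 := by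
      rw [resv_eq u hl', eval_prod]
      apply Finset.prod_eq_zero (Finset.mem_univ 1)
      rw [hθ]; simp only [act_one]; rw [eval_sub, eval_X, eval_C, sub_self]
    have e1 := xpol_eval u u' hl'
    rw [evalEval_chi, evalEval_dchi, evalEval_xg]
    refine ⟨e0, hs _ e0, ha, ?_⟩
    rw [hθ]; simp only
    rw [e1]
    congr 1
    have := map_sum (iterateFrobenius k p e) (fun ι => u ι * τ x.1 (act x.2 ι)) Finset.univ
    rw [iterateFrobenius_def] at this
    rw [this, ← Equiv.sum_comp (stp s0) (fun ι => u' ι * τ x.1 (act x.2 ι))]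
    refine Finset.sum_congr rfl fun ι _ => ?_
    rw [iterateFrobenius_def, mul_pow, hf, hu']
end
end BH

open Polynomial
namespace BH
section
variable {J : Type} [Fintype J] [DecidableEq J]

lemma resv_inj {k : Type} [Field k] {K : Type} [Fintype K] [DecidableEq K] {N : K → ℕ} (c u τ : Lb N → k) (hl : Labs c τ)
    (hs : ∀ η, (resv c u).eval η = 0 → (derivative (resv c u)).eval η ≠ 0) : Function.Injective (fun ρ : Gp N => ∑ ι, u ι * τ (act ρ ι)) := by
  intro ρ ρ' h
  by_contra hne'
  have e1 := resv_eq u hl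
  simp only at h
  obtain ⟨θ, hθ⟩ : ∃ θ, θ = ∑ ι, u ι * τ (act ρ ι) := ⟨_, rfl⟩
  have e2 : (resv c u) = (X - C θ) * ((X - C θ) * ∏ σ ∈ (Finset.univ.erase ρ).erase ρ', (X - C (∑ ι, u ι * τ (act σ ι)))) := by
    rw [e1, ← Finset.mul_prod_erase _ _ (Finset.mem_univ ρ), ← Finset.mul_prod_erase _ _ (Finset.mem_erase.2 ⟨Ne.symm hne', Finset.mem_univ ρ'⟩), ← h, ← hθ]
  apply hs θ
  · rw [e2]; simp
  · rw [e2]; simp [derivative_mul]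

lemma block_inj {k : Type} [Field k] {K : Type} [Fintype K] [DecidableEq K] {N : K → ℕ} (c u τ : Lb N → k) (hl : Labs c τ)
    (hs : ∀ η, (resv c u).eval η = 0 → (derivative (resv c u)).eval η ≠ 0) (kk : K) : Function.Injective (fun j => τ ⟨kk, j⟩) := by
  intro i j hij
  by_contra hne
  have h1 : (Pi.mulSingle kk (Equiv.swap i j) : Gp N) = 1 := by
    apply resv_inj c u τ hl hs
    simp only
    refine Finset.sum_congr rfl fun ι _ => ?_
    congr 1
    obtain ⟨kk', l⟩ := ι
    rw [act_one, act]
    simp only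
    by_cases hk : kk' = kk
    · subst hk
      rw [Pi.mulSingle_eq_same, Equiv.swap_apply_def]
      split_ifs with h h
      · rw [h]; exact hij.symm
      · rw [h]; exact hij
      · rfl
    · rw [Pi.mulSingle_eq_of_ne hk]; rfl
  have h2 := congrFun h1 kk
  rw [Pi.mulSingle_eq_same] at h2
  have h3 := Equiv.congr_fun h2 i
  rw [Equiv.swap_apply_left] at h3
  exact hne h3.symm

lemma ex1 {k : Type} [Field k] [IsAlgClosed k] {K : Type} [Fintype K] [DecidableEq K] {N : K → ℕ} {n : ℕ} (hn : 1 ≤ n) (G : K → k[X][X])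
    (hW : ∀ j, WB n (n * (G j).natDegree) (G j)) (hN : ∀ j, N j = n * (G j).natDegree) (g : Fin n → k) (u : Lb N → k)
    (hirr : Irreducible (chi (RingHom.id k) N G g u)) (hd : derivative (chi (RingHom.id k) N G g u) ≠ 0) (A : Finset k)
    (hA : ∀ α ∈ A, ∃ η, (resv (cc (RingHom.id k) n N G (fpen g α)) u).eval η = 0 ∧ (derivative (resv (cc (RingHom.id k) n N G (fpen g α)) u)).eval η = 0) :
    A.card ≤ Fintype.card (Gp N) * (Rn N + Rn N * Fintype.card (Gp N) + Rn N * Fintype.card (Gp N)) := by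
  classical
  obtain ⟨h1, h2⟩ := resv_monic (cc (C.comp (RingHom.id k)) n N G (pen g)) (fun ι => C (u ι))
  have h3 := (chi_fil (isFil_true k) (RingHom.id k) (fun _ => trivial) n hn G hW hN g (fun _ => trivial) u (fun _ => trivial)).2
  have hh : ∀ α, ∃ η, α ∈ A → (resv (cc (RingHom.id k) n N G (fpen g α)) u).eval η = 0 ∧ (derivative (resv (cc (RingHom.id k) n N G (fpen g α)) u)).eval η = 0 := by
    intro α
    by_cases h : α ∈ A
    · obtain ⟨η, hη⟩ := hA α h; exact ⟨η, fun _ => hη⟩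
    · exact ⟨0, fun h' => absurd h' h⟩
  choose η hη using hh
  have := curve_zeros (chi (RingHom.id k) N G g u) h1 h2 (fun m => (h3 m).1) hirr (derivative (chi (RingHom.id k) N G g u)) (N := Rn N) (B := Fintype.card (Gp N))
    ?_ ?_ ?_ (A.image fun α => (α, η α)) ?_ ?_
  · rwa [Finset.card_image_of_injective] at this
    intro a b hab
    exact (Prod.mk.inj hab).1
  · intro m
    rw [coeff_derivative]
    have := (h3 (m + 1)).1
    refine natDegree_mul_le.trans ?_
    have e : ((m : k[X]) + 1).natDegree = 0 := by rw [← Nat.cast_one, ← Nat.cast_add, natDegree_natCast]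
    rw [e]; exact this
  · exact (natDegree_derivative_le _).trans ((Nat.sub_le _ _).trans h2.le)
  · apply Monic.not_dvd_of_natDegree_lt h1 hd
    apply natDegree_derivative_lt
    show (resv (cc (C.comp (RingHom.id k)) n N G (pen g)) (fun ι => C (u ι))).natDegree ≠ 0
    rw [h2]; exact Fintype.card_pos.ne'
  · intro s hs
    obtain ⟨α, ha, rfl⟩ := Finset.mem_image.1 hs
    rw [evalEval_chi]; exact (hη α ha).1
  · intro s hs
    obtain ⟨α, ha, rfl⟩ := Finset.mem_image.1 hs
    rw [evalEval_dchi]; exact (hη α ha).2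

lemma Pf_evalEval {k : Type} [Field k] (G : k[X][X]) (f : k[X]) (t : k) : (Pf (RingHom.id k) G f).eval t = G.evalEval t (f.eval t) := by
  rw [Pf_eval, ← map_evalRingHom_eval, eval_map]; rfl

lemma ex2 {k : Type} [Field k] [IsAlgClosed k] {n : ℕ} (hn : 1 ≤ n) (G G' : k[X][X]) (hG : G.Monic) (hirr : Irreducible G) (hnd : ¬ G ∣ G')
    (hW : WB n (n * G.natDegree) G) (hW' : WB n (n * G'.natDegree) G') (β : ℕ) (hb : n * G.natDegree ≤ β) (hb' : n * G'.natDegree ≤ β)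
    (g : Fin n → k) (A : Finset k)
    (hA : ∀ α ∈ A, ∃ t, (Pf (RingHom.id k) G (fpen g α)).eval t = 0 ∧ (Pf (RingHom.id k) G' (fpen g α)).eval t = 0) :
    A.card ≤ β * (β + β * β + β * β) := by
  classical
  have hh : ∀ α, ∃ t, α ∈ A → (Pf (RingHom.id k) G (fpen g α)).eval t = 0 ∧ (Pf (RingHom.id k) G' (fpen g α)).eval t = 0 := by
    intro α
    by_cases h : α ∈ A
    · obtain ⟨η, hη⟩ := hA α h; exact ⟨η, fun _ => hη⟩
    · exact ⟨0, fun h' => absurd h' h⟩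
  choose t ht using hh
  have hc : ∀ G : k[X][X], WB n (n * G.natDegree) G → n * G.natDegree ≤ β → ∀ m, (G.coeff m).natDegree ≤ β := by
    intro G hW hb m
    rw [natDegree_le_iff_coeff_eq_zero]
    intro i hi
    by_contra hcon
    have := hW m i hcon
    omega
  have hs : G.natDegree ≤ β := (Nat.le_mul_of_pos_left _ (by omega)).trans hb
  have hs' : G'.natDegree ≤ β := (Nat.le_mul_of_pos_left _ (by omega)).trans hb'
  have := curve_zeros G hG rfl (hc G hW hb) hirr G' (hc G' hW' hb') hs' hnd (A.image fun α => (t α, (fpen g α).eval (t α))) ?_ ?_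
  · rw [Finset.card_image_of_injective] at this
    · exact this.trans (by gcongr)
    · intro a b hab
      obtain ⟨h1, h2⟩ := Prod.mk.inj hab
      rw [h1, fpen, fpen, eval_add, eval_add, eval_C, eval_C] at h2
      exact add_right_cancel h2
  · intro s hs
    obtain ⟨α, ha, rfl⟩ := Finset.mem_image.1 hs
    simp only
    rw [← Pf_evalEval]; exact (ht α ha).1
  · intro s hs
    obtain ⟨α, ha, rfl⟩ := Finset.mem_image.1 hs
    simp only
    rw [← Pf_evalEval]; exact (ht α ha).2

lemma fpen_coeff_n {k : Type} [CommRing k] {n : ℕ} (hn : 1 ≤ n) (g : Fin n → k) (α : k) : (fpen g α).coeff n = g ⟨n - 1, by omega⟩ := by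
  rw [fpen, coeff_add, coeff_C, if_neg (by omega), zero_add, finset_sum_coeff, Finset.sum_eq_single ⟨n - 1, by omega⟩]
  · rw [coeff_C_mul, coeff_X_pow, if_pos (by simp; omega), mul_one]
  · intro j _ hj
    rw [coeff_C_mul, coeff_X_pow, if_neg, mul_zero]
    intro h; apply hj; apply Fin.ext; simp; omega
  · simp

lemma fpen_map {k k' : Type} [CommRing k] [CommRing k'] (φ : k →+* k') {n : ℕ} (g : Fin n → k) (α : k) :
    (fpen g α).map φ = fpen (fun j => φ (g j)) (φ α) := by
  simp [fpen, Polynomial.map_sum]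
end
end BH

open Polynomial
namespace BH
section
variable {J : Type} [Fintype J] [DecidableEq J]

/-- counting from upper bounds for each class -/
lemma count_abs {Γ k : Type} [Fintype Γ] [DecidableEq Γ] (tc : Γ → Γ → Γ) (s : k → Γ) (A' : Finset k) (q B C : ℝ) (hq : 1 ≤ q) (hC : 0 ≤ C) (hB : 0 ≤ B)
    (hA1 : q - B ≤ A'.card) (hA2 : (A'.card : ℝ) ≤ q)
    (hS : ∀ s0, (((A' ×ˢ (Finset.univ : Finset Γ)).filter fun x => tc x.2 (s x.1) = s0).card : ℝ) ≤ q + C * Real.sqrt q)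
    (Q : Γ → Prop) [DecidablePred Q] (hQ : ∀ ρ s, Q (tc ρ s) ↔ Q s) (hM : 1 ≤ Fintype.card Γ) :
    |((A'.filter fun α => Q (s α)).card : ℝ) - ((Finset.univ.filter Q).card : ℝ) / Fintype.card Γ * q| ≤ (B + C) * Real.sqrt q := by
  have hMR : (1 : ℝ) ≤ Fintype.card Γ := by exact_mod_cast hM
  obtain ⟨M, hMe⟩ : ∃ M : ℝ, M = Fintype.card Γ := ⟨_, rfl⟩
  obtain ⟨F, hF⟩ : ∃ F : Γ → ℝ, F = fun s0 => (((A' ×ˢ (Finset.univ : Finset Γ)).filter fun x => tc x.2 (s x.1) = s0).card : ℝ) := ⟨_, rfl⟩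
  have hgen : ∀ (Q : Γ → Prop) [DecidablePred Q], (∀ ρ s, Q (tc ρ s) ↔ Q s) → ((A'.filter fun α => Q (s α)).card : ℝ) * M = ∑ s0 ∈ Finset.univ.filter Q, F s0 := by
    intro Q _ hQ
    have e1 : ((A'.filter fun α => Q (s α)) ×ˢ (Finset.univ : Finset Γ)).card = ∑ s0 ∈ Finset.univ.filter Q, (((A' ×ˢ (Finset.univ : Finset Γ)).filter fun x => tc x.2 (s x.1) = s0).card) := by
      rw [Finset.card_eq_sum_card_fiberwise (f := fun x : k × Γ => tc x.2 (s x.1)) (t := Finset.univ.filter Q)]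
      · refine Finset.sum_congr rfl fun s0 hs0 => ?_
        congr 1
        ext ⟨α, ρ⟩
        rw [Finset.mem_filter] at hs0
        simp only [Finset.mem_filter, Finset.mem_product, Finset.mem_univ, and_true]
        constructor
        · rintro ⟨⟨h1, h2⟩, h3⟩; exact ⟨h1, h3⟩
        · rintro ⟨h1, h3⟩; exact ⟨⟨h1, by rw [← hQ ρ, h3]; exact hs0.2⟩, h3⟩
      · rintro ⟨α, ρ⟩ hx
        simp only [Finset.coe_product, Finset.coe_filter, Finset.coe_univ, Set.mem_prod, Set.mem_setOf_eq, Set.mem_univ, and_true, Finset.mem_univ, true_and] at hx ⊢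
        exact (hQ _ _).2 hx.2
    rw [Finset.card_product, Finset.card_univ] at e1
    rw [hMe, hF, ← Nat.cast_mul, e1]; push_cast; rfl
  have hub : ∀ (Q : Γ → Prop) [DecidablePred Q], ∑ s0 ∈ Finset.univ.filter Q, F s0 ≤ ((Finset.univ.filter Q).card : ℝ) * (q + C * Real.sqrt q) := by
    intro Q _
    rw [← nsmul_eq_mul]
    apply Finset.sum_le_card_nsmul
    intro s0 _
    rw [hF]; exact hS s0
  have htot := hgen (fun _ => True) (fun _ _ => Iff.rfl)
  rw [Finset.filter_true, Finset.filter_true] at htot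
  have hspl : ∑ s0, F s0 = ∑ s0 ∈ Finset.univ.filter Q, F s0 + ∑ s0 ∈ Finset.univ.filter (fun x => ¬ Q x), F s0 := (Finset.sum_filter_add_sum_filter_not _ _ _).symm
  have hcard : ((Finset.univ.filter Q).card : ℝ) + ((Finset.univ.filter (fun x => ¬ Q x)).card : ℝ) = M := by
    rw [hMe, ← Nat.cast_add, Finset.card_filter_add_card_filter_not, Finset.card_univ]
  have hu1 := hub Q
  have hu2 := hub (fun x => ¬ Q x)
  rw [← hgen Q hQ] at hu1 hspl
  rw [← htot] at hspl
  obtain ⟨x, hx⟩ : ∃ x : ℝ, x = ((A'.filter fun α => Q (s α)).card : ℝ) := ⟨_, rfl⟩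
  obtain ⟨a, ha⟩ : ∃ x : ℝ, x = ((Finset.univ.filter Q).card : ℝ) := ⟨_, rfl⟩
  obtain ⟨a', ha'⟩ : ∃ x : ℝ, x = ((Finset.univ.filter (fun x => ¬ Q x)).card : ℝ) := ⟨_, rfl⟩
  have ha0 : 0 ≤ a := by rw [ha]; positivity
  have ha0' : 0 ≤ a' := by rw [ha']; positivity
  rw [← hx, ← ha] at hu1
  rw [← ha'] at hu2
  rw [← ha, ← ha'] at hcard
  rw [← hx] at hspl
  rw [← hx, ← ha, ← hMe]
  rw [← hMe] at hMR
  have hsq : 1 ≤ Real.sqrt q := by rw [Real.one_le_sqrt]; exact hq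
  obtain ⟨r, hr⟩ : ∃ r, r = Real.sqrt q := ⟨_, rfl⟩
  rw [← hr] at hsq hu1 hu2 ⊢
  have hM0 : 0 < M := by linarith
  have e : x - a / M * q = (x * M - a * q) / M := by field_simp
  rw [e, abs_div, abs_of_pos hM0, div_le_iff₀ hM0, abs_le]
  have h1 : M * (q - B) ≤ A'.card * M := by rw [mul_comm]; exact mul_le_mul_of_nonneg_right hA1 hM0.le
  have hCr : 0 ≤ C * r := by positivity
  have hBr : B ≤ B * r := le_mul_of_one_le_right hB hsq
  have h2 : a * (C * r) ≤ M * (C * r) := mul_le_mul_of_nonneg_right (by linarith) hCr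
  have h3 : a' * (C * r) ≤ M * (C * r) := mul_le_mul_of_nonneg_right (by linarith) hCr
  have h4 : B * M ≤ B * r * M := mul_le_mul_of_nonneg_right hBr hM0.le
  have h5 : M = a + a' := hcard.symm
  have h6 : 0 ≤ B * r * M := by positivity
  have h7 : M * q = a * q + a' * q := by rw [h5]; ring
  constructor
  · linarith
  · linarith

theorem per_g (n : ℕ) (hn : 1 ≤ n) (μ b : J → ℕ) : ∃ Cc : ℝ, 0 ≤ Cc ∧ ∀ (k : Type) [Field k] [IsAlgClosed k] (p e : ℕ) [ExpChar k p]
    (G : Kb μ → k[X][X]), (∀ j, (G j).Monic) → (∀ j, Irreducible (G j)) → (∀ i j, G i ∣ G j → i = j) →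
    (∀ j, WB n (n * (G j).natDegree) (G j)) → (∀ j, Nb μ b j = n * (G j).natDegree) →
    (∀ kk, (G kk).map (mapRingHom (iterateFrobenius k p e)) = G (rot kk)) →
    ∀ (g : Fin n → k) (u : Lb (Nb μ b) → k), (∀ j, g j ^ (p ^ e) = g j) → Irreducible (chi (RingHom.id k) (Nb μ b) G g u) →
    derivative (chi (RingHom.id k) (Nb μ b) G g u) ≠ 0 → (∀ kk, (Lam n (G kk)).eval (g ⟨n - 1, by omega⟩) ≠ 0) →
    1 < p ^ e → ∀ A : Finset k, A.card = p ^ e → (∀ α ∈ A, α ^ (p ^ e) = α) →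
    ∃ (A' : Finset k) (t : k → Lb (Nb μ b) → k) (s : k → Gp (Nb μ b)), A' ⊆ A ∧ ((p ^ e : ℕ) : ℝ) ≤ A'.card + Cc ∧ 
      (∀ α ∈ A', (∀ kk, Pf (RingHom.id k) (G kk) (fpen g α) = C (lmb (RingHom.id k) n G (fpen g α) kk) * ∏ j, (X - C (t α ⟨kk, j⟩))) ∧
        (∀ kk, lmb (RingHom.id k) n G (fpen g α) kk ≠ 0) ∧ Function.Injective (t α) ∧ ∀ ι, t α ι ^ (p ^ e) = t α (stp (s α) ι)) ∧
      ∀ (Q : Gp (Nb μ b) → Prop) [DecidablePred Q], (∀ ρ s, Q (tcj ρ s) ↔ Q s) →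
        |((A'.filter fun α => Q (s α)).card : ℝ) - ((Finset.univ.filter Q).card : ℝ) / Fintype.card (Gp (Nb μ b)) * (p ^ e : ℕ)| ≤ Cc * Real.sqrt (p ^ e : ℕ) := by
  classical
  obtain ⟨C0, hC0, hst⟩ := step_bound n hn μ b
  obtain ⟨B1, hB1⟩ : ∃ B1, B1 = Fintype.card (Gp (Nb μ b)) * (Rn (Nb μ b) + Rn (Nb μ b) * Fintype.card (Gp (Nb μ b)) + Rn (Nb μ b) * Fintype.card (Gp (Nb μ b))) := ⟨_, rfl⟩
  obtain ⟨β, hβ⟩ : ∃ β, β = ∑ kk, Nb μ b kk := ⟨_, rfl⟩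
  obtain ⟨B2, hB2⟩ : ∃ B2, B2 = Fintype.card (Kb μ × Kb μ) * (β * (β + β * β + β * β)) := ⟨_, rfl⟩
  refine ⟨((B1 + B2 : ℕ) : ℝ) + C0, by positivity, ?_⟩
  intro k _ _ p e _ G hG hirr hnd hW hN hfrob g u hg hci hcd hLam hq A hA hAq
  obtain ⟨cα, hcα⟩ : ∃ cα : k → Lb (Nb μ b) → k, cα = fun α => cc (RingHom.id k) n (Nb μ b) G (fpen g α) := ⟨_, rfl⟩
  choose τ hτ using fun α => exists_labs (cα α)
  obtain ⟨l, hl⟩ : ∃ l : Kb μ → k, l = fun kk => (Lam n (G kk)).eval (g ⟨n - 1, by omega⟩) := ⟨_, rfl⟩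
  have hlm : ∀ α kk, lmb (RingHom.id k) n G (fpen g α) kk = l kk := by
    intro α kk
    rw [lmb, fpen_coeff_n hn, eval₂_id, hl]
  have hl0 : ∀ kk, l kk ≠ 0 := by rw [hl]; exact hLam
  obtain ⟨t, ht⟩ : ∃ t : k → Lb (Nb μ b) → k, t = fun α ι => (l ι.1)⁻¹ * τ α ι := ⟨_, rfl⟩
  have hτt : ∀ α ι, τ α ι = l ι.1 * t α ι := by
    intro α ι; rw [ht]; simp only; rw [mul_inv_cancel_left₀ (hl0 _)]
  have hfac : ∀ α, ∀ kk, Pf (RingHom.id k) (G kk) (fpen g α) = C (lmb (RingHom.id k) n G (fpen g α) kk) * ∏ j, (X - C (t α ⟨kk, j⟩)) := by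
    intro α
    apply (labs_scale (RingHom.id k) n hn (Nb μ b) G hW hN (fpen g α) (fpen_natDegree hn g α) (fun kk => by rw [hlm]; exact hl0 kk) (t α)).1
    have := hτ α
    rw [hcα] at this
    convert this using 2 with ι
    rw [hlm, hτt]
  -- excluded sets
  obtain ⟨E1, hE1⟩ : ∃ E1, E1 = A.filter fun α => ∃ η, (resv (cα α) u).eval η = 0 ∧ (derivative (resv (cα α) u)).eval η = 0 := ⟨_, rfl⟩
  obtain ⟨E2, hE2⟩ : ∃ E2 : Kb μ × Kb μ → Finset k, E2 = fun x => A.filter fun α => x.1 ≠ x.2 ∧ ∃ t, (Pf (RingHom.id k) (G x.1) (fpen g α)).eval t = 0 ∧ (Pf (RingHom.id k) (G x.2) (fpen g α)).eval t = 0 := ⟨_, rfl⟩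
  have hE1c : E1.card ≤ B1 := by
    rw [hB1]
    apply ex1 hn G hW hN g u hci hcd
    intro α hα
    rw [hE1, hcα] at hα
    exact (Finset.mem_filter.1 hα).2
  have hE2c : ∀ x, (E2 x).card ≤ β * (β + β * β + β * β) := by
    intro x
    by_cases hx : x.1 = x.2
    · have : E2 x = ∅ := by rw [hE2]; simp [hx]
      rw [this]; simp
    · apply ex2 hn (G x.1) (G x.2) (hG _) (hirr _) (fun h => hx (hnd _ _ h)) (hW _) (hW _) β ?_ ?_ g
      · intro α hα
        rw [hE2] at hα
        exact (Finset.mem_filter.1 hα).2.2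
      · rw [← hN, hβ]; exact Finset.single_le_sum (f := Nb μ b) (fun _ _ => Nat.zero_le _) (Finset.mem_univ x.1)
      · rw [← hN, hβ]; exact Finset.single_le_sum (f := Nb μ b) (fun _ _ => Nat.zero_le _) (Finset.mem_univ x.2)
  obtain ⟨Ex, hEx⟩ : ∃ Ex, Ex = E1 ∪ Finset.univ.biUnion E2 := ⟨_, rfl⟩
  have hExc : Ex.card ≤ B1 + B2 := by
    rw [hEx]
    refine (Finset.card_union_le _ _).trans (Nat.add_le_add hE1c ?_)
    rw [hB2]
    refine Finset.card_biUnion_le.trans ?_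
    refine (Finset.sum_le_card_nsmul _ _ _ (fun x _ => hE2c x)).trans ?_
    rw [smul_eq_mul, Finset.card_univ]
  have hsep : ∀ α ∈ A \ Ex, ∀ η, (resv (cα α) u).eval η = 0 → (derivative (resv (cα α) u)).eval η ≠ 0 := by
    intro α hα η h1 h2
    rw [Finset.mem_sdiff] at hα
    apply hα.2
    rw [hEx, Finset.mem_union, hE1, Finset.mem_filter]
    exact Or.inl ⟨hα.1, η, h1, h2⟩
  have hbinj : ∀ α ∈ A \ Ex, ∀ kk, Function.Injective fun j => t α ⟨kk, j⟩ := by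
    intro α hα kk i j hij
    apply block_inj (cα α) u (τ α) (hτ α) (hsep α hα) kk
    simp only at hij ⊢
    rw [hτt, hτt, hij]
  have hinj : ∀ α ∈ A \ Ex, Function.Injective (t α) := by
    rintro α hα ⟨kk, j⟩ ⟨kk', j'⟩ hij
    by_cases hk : kk = kk'
    · subst hk
      have := hbinj α hα kk hij
      rw [this]
    · exfalso
      rw [Finset.mem_sdiff] at hα
      apply hα.2
      rw [hEx, Finset.mem_union]
      right
      rw [Finset.mem_biUnion]
      refine ⟨(kk, kk'), Finset.mem_univ _, ?_⟩
      rw [hE2, Finset.mem_filter]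
      refine ⟨hα.1, hk, t α ⟨kk, j⟩, ?_, ?_⟩
      · rw [hfac, eval_mul, eval_prod, Finset.prod_eq_zero (Finset.mem_univ j) (by simp), mul_zero]
      · rw [hij, hfac, eval_mul, eval_prod, Finset.prod_eq_zero (Finset.mem_univ j') (by simp), mul_zero]
  have hfφ : ∀ α ∈ A, (fpen g α).map (iterateFrobenius k p e) = fpen g α := by
    intro α hα
    rw [fpen_map]
    simp only [iterateFrobenius_def, hg, hAq α hα]
  have hs : ∀ α, ∃ s : Gp (Nb μ b), α ∈ A \ Ex → ∀ ι, t α ι ^ (p ^ e) = t α (stp s ι) := by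
    intro α
    by_cases hα : α ∈ A \ Ex
    · obtain ⟨s, hs⟩ := frob_perm (iterateFrobenius k p e) n hn G hfrob (fpen g α) (hfφ α (Finset.mem_sdiff.1 hα).1) (fun kk => by rw [hlm]; exact hl0 kk) (t α)
        (hfac α) (hbinj α hα)
      refine ⟨s, fun _ ι => ?_⟩
      rw [← hs, iterateFrobenius_def]
    · exact ⟨1, fun h => absurd h hα⟩
  choose s hs using hs
  have hτs : ∀ α ∈ A \ Ex, ∀ ι, τ α ι ^ (p ^ e) = τ α (stp (s α) ι) := by
    intro α hα ι
    have h1 := lmb_frob (iterateFrobenius k p e) n hn G (fpen g α) (hfφ α (Finset.mem_sdiff.1 hα).1) ι.1 _ (hfrob ι.1)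
    rw [hlm, hlm, iterateFrobenius_def] at h1
    rw [hτt, mul_pow, hs α hα, h1, hτt]; rfl
  have hcardA : (A \ Ex).card ≤ p ^ e := by rw [← hA]; exact Finset.card_le_card Finset.sdiff_subset
  have h3 : ((p ^ e : ℕ) : ℝ) ≤ (A \ Ex).card + ((B1 + B2 : ℕ) : ℝ) := by
    have h1 : p ^ e ≤ (A \ Ex).card + Ex.card := by
      rw [← hA, Finset.card_sdiff_add_card]; exact Finset.card_le_card Finset.subset_union_left
    have h2 : p ^ e ≤ (A \ Ex).card + (B1 + B2) := h1.trans (Nat.add_le_add_left hExc _)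
    exact_mod_cast h2
  refine ⟨A \ Ex, t, s, Finset.sdiff_subset, ?_, ?_, ?_⟩
  · linarith
  · intro α hα
    exact ⟨hfac α, fun kk => by rw [hlm]; exact hl0 kk, hinj α hα, hs α hα⟩
  · intro Q _ hQ
    apply count_abs tcj s (A \ Ex) ((p ^ e : ℕ) : ℝ) ((B1 + B2 : ℕ) : ℝ) C0 (by exact_mod_cast hq.le) hC0 (by positivity) ?_ (by exact_mod_cast hcardA) ?_ Q hQ Fintype.card_pos
    · linarith
    · intro s0
      apply hst k p e G hW hN g u hci hq τ s0
      rintro ⟨α, ρ⟩ hx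
      rw [Finset.mem_filter, Finset.mem_product] at hx
      obtain ⟨⟨hα, -⟩, hx⟩ := hx
      simp only at hα hx ⊢
      have e1 := hsep α hα
      have e2 := hτ α
      rw [hcα] at e1 e2
      refine ⟨hAq α (Finset.mem_sdiff.1 hα).1, e2, e1, fun ι => ?_⟩
      rw [← hx, act_stp, hτs α hα]
end
end BH

open Polynomial
namespace BH
section
open Equiv

/-- twisted permutation -/
def tw {μ b : ℕ} (s : Fin μ → Perm (Fin b)) : Perm (Fin μ × Fin b) where
  toFun x := (finRotate μ x.1, s x.1 x.2)
  invFun x := ((finRotate μ).symm x.1, (s ((finRotate μ).symm x.1)).symm x.2)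
  left_inv := by
    rintro ⟨j, l⟩
    simp only [Equiv.symm_apply_apply]
  right_inv := by
    rintro ⟨j, l⟩
    simp only [Equiv.apply_symm_apply]

lemma tw_apply {μ b : ℕ} (s : Fin μ → Perm (Fin b)) (j : Fin μ) (l : Fin b) : tw s (j, l) = (finRotate μ j, s j l) := rfl

/-- transitivity -/
def Trn {α : Type} (c : Perm α) : Prop := ∀ x y, c.SameCycle x y

lemma card_trn (b : ℕ) (hb : 2 ≤ b) [DecidablePred (fun c : Perm (Fin b) => Trn c)] : (Finset.univ.filter fun c : Perm (Fin b) => Trn c).card * b = b.factorial := by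
  have h1 : (Finset.univ.filter fun c : Perm (Fin b) => Trn c) = Finset.univ.filter fun c : Perm (Fin b) => c.cycleType = {b} := by
    ext c
    simp only [Finset.mem_filter, Finset.mem_univ, true_and]
    constructor
    · intro h
      have hmv : ∀ x, c x ≠ x := by
        intro x hx
        obtain ⟨y, hy⟩ : ∃ y : Fin b, y ≠ x := by
          haveI : Nontrivial (Fin b) := Fin.nontrivial_iff_two_le.2 hb
          exact exists_ne x
        obtain ⟨i, hi⟩ := (h x y).exists_nat_pow_eq
        apply hy
        rw [← hi]
        exact Perm.pow_apply_eq_self_of_apply_eq_self hx i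
      have hc : c.IsCycle := ⟨⟨0, by omega⟩, hmv _, fun y _ => h _ y⟩
      rw [hc.cycleType]
      have : c.support = Finset.univ := by
        ext x; simp [hmv x]
      rw [this, Finset.card_univ, Fintype.card_fin]
    · intro h x y
      have hc : c.IsCycle := by rw [← Perm.card_cycleType_eq_one, h]; simp
      have hs : c.support = Finset.univ := by
        rw [← Finset.card_eq_iff_eq_univ, ← Perm.sum_cycleType, h]; simp
      exact hc.sameCycle (Perm.mem_support.1 (by rw [hs]; exact Finset.mem_univ _)) (Perm.mem_support.1 (by rw [hs]; exact Finset.mem_univ _))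
  rw [h1, Perm.card_of_cycleType_singleton hb (by simp)]
  simp only [Fintype.card_fin, Nat.choose_self, mul_one]
  rw [mul_comm, Nat.mul_factorial_pred (by omega)]

/-- partial products -/
def pprod {Γ : Type} [Group Γ] (s : ℕ → Γ) : ℕ → Γ
  | 0 => 1
  | j + 1 => s j * pprod s j

lemma pprod_congr {Γ : Type} [Group Γ] (s s' : ℕ → Γ) (m : ℕ) (h : ∀ j < m, s j = s' j) : pprod s m = pprod s' m := by
  induction m with
  | zero => rfl
  | succ m ih => rw [pprod, pprod, ih (fun j hj => h j (by omega)), h m (by omega)]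

/-- extension by one -/
def ext1 {Γ : Type} [Group Γ] {ν : ℕ} (s : Fin ν → Γ) (j : ℕ) : Γ := if h : j < ν then s ⟨j, h⟩ else 1

lemma tw_pow_lt {ν b : ℕ} (s : Fin (ν + 1) → Perm (Fin b)) (l : Fin b) (j : ℕ) (hj : j < ν + 1) :
    ((tw s) ^ j) (0, l) = (⟨j, hj⟩, pprod (ext1 s) j l) := by
  induction j with
  | zero => rfl
  | succ j ih =>
    rw [pow_succ', Perm.mul_apply, ih (by omega), tw_apply, finRotate_of_lt (by omega), pprod, ext1, dif_pos (by omega)]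
    rfl

lemma tw_pow_ret {ν b : ℕ} (s : Fin (ν + 1) → Perm (Fin b)) (l : Fin b) :
    ((tw s) ^ (ν + 1)) (0, l) = (0, pprod (ext1 s) (ν + 1) l) := by
  rw [pow_succ', Perm.mul_apply, tw_pow_lt s l ν (by omega), tw_apply, finRotate_last', pprod, ext1, dif_pos (by omega)]
  rfl

lemma tw_pow {ν b : ℕ} (s : Fin (ν + 1) → Perm (Fin b)) (l : Fin b) (a j : ℕ) (hj : j < ν + 1) :
    ((tw s) ^ (j + (ν + 1) * a)) (0, l) = (⟨j, hj⟩, pprod (ext1 s) j (((pprod (ext1 s) (ν + 1)) ^ a) l)) := by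
  have h : ∀ a, ((tw s) ^ ((ν + 1) * a)) (0, l) = (0, ((pprod (ext1 s) (ν + 1)) ^ a) l) := by
    intro a
    induction a with
    | zero => rfl
    | succ a ih => rw [show (ν+1)*(a+1) = (ν+1) + (ν+1)*a by ring, pow_add, Perm.mul_apply, ih, tw_pow_ret, pow_succ', Perm.mul_apply]
  rw [pow_add, Perm.mul_apply, h, tw_pow_lt s _ j hj]

lemma trn_tw {ν b : ℕ} (s : Fin (ν + 1) → Perm (Fin b)) : Trn (tw s) ↔ Trn (pprod (ext1 s) (ν + 1)) := by
  constructor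
  · intro h l l'
    obtain ⟨m, hm⟩ := (h (0, l) (0, l')).exists_nat_pow_eq
    have hm' : m = m % (ν + 1) + (ν + 1) * (m / (ν + 1)) := (Nat.mod_add_div _ _).symm
    rw [hm', tw_pow s l _ _ (Nat.mod_lt _ (Nat.succ_pos _))] at hm
    obtain ⟨h1, h2⟩ := Prod.mk.inj hm
    have h3 : m % (ν + 1) = 0 := congrArg Fin.val h1
    rw [h3] at h2
    exact ⟨((m / (ν + 1) : ℕ) : ℤ), by rw [zpow_natCast]; exact h2⟩
  · intro h
    have key : ∀ l x, (tw s).SameCycle (0, l) x := by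
      rintro l ⟨j, y⟩
      obtain ⟨a, ha⟩ := (h l ((pprod (ext1 s) j)⁻¹ y)).exists_nat_pow_eq
      refine ⟨((j + (ν + 1) * a : ℕ) : ℤ), ?_⟩
      rw [zpow_natCast, tw_pow s l a j j.2, ha]
      simp
    rintro ⟨j, l⟩ y
    exact (key l (j, l)).symm.trans (key l y)

lemma card_last {Γ : Type} [Fintype Γ] [DecidableEq Γ] (ν : ℕ) (P : Γ → Prop) [DecidablePred P] :
    (Finset.univ.filter fun s : Fin (ν + 1) → Γ => P (s (Fin.last ν))).card = Fintype.card Γ ^ ν * (Finset.univ.filter P).card := by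
  have : (Finset.univ.filter fun s : Fin (ν + 1) → Γ => P (s (Fin.last ν))) = Fintype.piFinset (fun j => if j = Fin.last ν then Finset.univ.filter P else Finset.univ) := by
    ext s
    simp only [Finset.mem_filter, Finset.mem_univ, true_and, Fintype.mem_piFinset]
    constructor
    · intro h j
      split_ifs with hj
      · subst hj; simpa using h
      · exact Finset.mem_univ _
    · intro h
      have := h (Fin.last ν)
      simpa using this
  rw [this, Fintype.card_piFinset, Fin.prod_univ_castSucc, if_pos rfl]
  congr 1
  rw [Finset.prod_congr rfl (g := fun _ => Fintype.card Γ)]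
  · simp
  · intro j _
    rw [if_neg (Fin.castSucc_lt_last j).ne, Finset.card_univ]

lemma card_pprod {Γ : Type} [Fintype Γ] [DecidableEq Γ] [Group Γ] (ν : ℕ) (P : Γ → Prop) [DecidablePred P] :
    (Finset.univ.filter fun s : Fin (ν + 1) → Γ => P (pprod (ext1 s) (ν + 1))).card = Fintype.card Γ ^ ν * (Finset.univ.filter P).card := by
  rw [← card_last]
  have hpp : ∀ (s : Fin (ν + 1) → Γ) x, pprod (ext1 (Function.update s (Fin.last ν) x)) ν = pprod (ext1 s) ν := by
    intro s x
    apply pprod_congr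
    intro j hj
    rw [ext1, ext1, dif_pos (by omega), dif_pos (by omega), Function.update_of_ne]
    intro h
    have := congrArg Fin.val h
    simp at this; omega
  have hlast : ∀ s : Fin (ν + 1) → Γ, pprod (ext1 s) (ν + 1) = s (Fin.last ν) * pprod (ext1 s) ν := by
    intro s
    rw [pprod, ext1, dif_pos (by omega)]; rfl
  refine Finset.card_bij' (fun s _ => Function.update s (Fin.last ν) (s (Fin.last ν) * pprod (ext1 s) ν))
    (fun s _ => Function.update s (Fin.last ν) (s (Fin.last ν) * (pprod (ext1 s) ν)⁻¹)) ?_ ?_ ?_ ?_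
  · intro s hs
    simp only [Finset.mem_filter, Finset.mem_univ, true_and] at hs ⊢
    rw [hlast] at hs
    simpa using hs
  · intro s hs
    simp only [Finset.mem_filter, Finset.mem_univ, true_and] at hs ⊢
    rw [hlast, hpp]
    simpa using hs
  · intro s _
    rw [hpp]; simp
  · intro s _
    rw [hpp]; simp

lemma card_tw (μ b : ℕ) (hμ : 1 ≤ μ) (hb : 2 ≤ b) [DecidablePred (fun s : Fin μ → Perm (Fin b) => Trn (tw s))] :
    (Finset.univ.filter fun s : Fin μ → Perm (Fin b) => Trn (tw s)).card * b = Fintype.card (Fin μ → Perm (Fin b)) := by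
  classical
  obtain ⟨ν, rfl⟩ : ∃ ν, μ = ν + 1 := ⟨μ - 1, by omega⟩
  have : (Finset.univ.filter fun s : Fin (ν + 1) → Perm (Fin b) => Trn (tw s)) = Finset.univ.filter fun s : Fin (ν + 1) → Perm (Fin b) => Trn (pprod (ext1 s) (ν + 1)) := by
    ext s; simp only [Finset.mem_filter, trn_tw]
  rw [this, card_pprod ν (fun c : Perm (Fin b) => Trn c), mul_assoc, card_trn b hb]
  simp [Fintype.card_perm, pow_succ]

variable {J : Type} [Fintype J] [DecidableEq J]

/-- all chains are transitive -/
def QQ {μ b : J → ℕ} (s : Gp (Nb μ b)) : Prop := ∀ i, Trn (tw (fun j => (s ⟨i, j⟩ : Perm (Fin (b i)))))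

lemma QQ_tcj {μ b : J → ℕ} (ρ s : Gp (Nb μ b)) : QQ (tcj ρ s) ↔ QQ s := by
  refine forall_congr' fun i => ?_
  obtain ⟨a, ha⟩ : ∃ a : Perm (Fin (μ i) × Fin (b i)), ∀ j l, a (j, l) = (j, (ρ ⟨i, j⟩ : Perm (Fin (b i))) l) :=
    ⟨⟨fun x => (x.1, (ρ ⟨i, x.1⟩ : Perm (Fin (b i))) x.2), fun x => (x.1, (ρ ⟨i, x.1⟩ : Perm (Fin (b i))).symm x.2), fun x => by simp, fun x => by simp⟩, fun _ _ => rfl⟩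
  have h : tw (fun j => (s ⟨i, j⟩ : Perm (Fin (b i)))) = a * tw (fun j => (tcj ρ s ⟨i, j⟩ : Perm (Fin (b i)))) * a⁻¹ := by
    rw [eq_mul_inv_iff_mul_eq]
    ext1 ⟨j, l⟩
    rw [Perm.mul_apply, Perm.mul_apply, ha, tw_apply, tw_apply, ha]
    congr 1
    exact (Equiv.apply_symm_apply (ρ (rot ⟨i, j⟩) : Equiv.Perm (Fin (b i))) _).symm
  rw [h, Trn, Trn]
  constructor
  · intro h x y
    rw [Perm.sameCycle_conj]; exact h _ _
  · intro h x y
    have := h (a x) (a y)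
    rw [Perm.sameCycle_conj] at this
    simpa using this

lemma card_QQ (μ b : J → ℕ) (hμ : ∀ i, 1 ≤ μ i) (hb : ∀ i, 2 ≤ b i) [DecidablePred (fun s : Gp (Nb μ b) => QQ s)] :
    (Finset.univ.filter fun s : Gp (Nb μ b) => QQ s).card * ∏ i, b i = Fintype.card (Gp (Nb μ b)) := by
  classical
  have e0 : Fintype.card (Gp (Nb μ b)) = ∏ i, Fintype.card (Fin (μ i) → Perm (Fin (b i))) := by
    rw [← Fintype.card_pi]
    exact Fintype.card_congr (Equiv.piCurry (fun i (_ : Fin (μ i)) => Perm (Fin (b i))))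
  have e1 : (Finset.univ.filter fun s : Gp (Nb μ b) => QQ s).card = ∏ i, (Finset.univ.filter fun s : Fin (μ i) → Perm (Fin (b i)) => Trn (tw s)).card := by
    rw [← Fintype.card_piFinset]
    apply Finset.card_bij' (fun s _ => Equiv.piCurry (fun i (_ : Fin (μ i)) => Perm (Fin (b i))) s) (fun s _ => (Equiv.piCurry (fun i (_ : Fin (μ i)) => Perm (Fin (b i)))).symm s)
    · intro s hs
      simp only [Finset.mem_filter, Finset.mem_univ, true_and, Fintype.mem_piFinset] at hs ⊢
      exact hs
    · intro s hs
      simp only [Finset.mem_filter, Finset.mem_univ, true_and, Fintype.mem_piFinset] at hs ⊢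
      exact hs
    · intro s _; rfl
    · intro s _; rfl
  rw [e1, e0, ← Finset.prod_mul_distrib]
  exact Finset.prod_congr rfl fun i _ => card_tw (μ i) (b i) (hμ i) (hb i)
end
end BH

open Polynomial
namespace BH
section
open Equiv

lemma fix_range {Fq k : Type} [Field Fq] [Fintype Fq] [Field k] [Algebra Fq k] (x : k) (hx : x ^ Fintype.card Fq = x) :
    ∃ a : Fq, algebraMap Fq k a = x := by
  classical
  have h2 : 1 < Fintype.card Fq := Fintype.one_lt_card
  have hne : (X ^ Fintype.card Fq - X : k[X]) ≠ 0 := FiniteField.X_pow_card_sub_X_ne_zero k h2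
  have hd : (X ^ Fintype.card Fq - X : k[X]).natDegree = Fintype.card Fq := FiniteField.X_pow_card_sub_X_natDegree_eq k h2
  have hS : Finset.univ.image (algebraMap Fq k) ⊆ (X ^ Fintype.card Fq - X : k[X]).roots.toFinset := by
    intro y hy
    obtain ⟨a, -, rfl⟩ := Finset.mem_image.1 hy
    rw [Multiset.mem_toFinset, mem_roots hne]
    simp only [IsRoot.def, eval_sub, eval_pow, eval_X]
    rw [← map_pow, FiniteField.pow_card, sub_self]
  have hc : (X ^ Fintype.card Fq - X : k[X]).roots.toFinset.card ≤ (Finset.univ.image (algebraMap Fq k)).card := by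
    rw [Finset.card_image_of_injective _ (algebraMap Fq k).injective, Finset.card_univ]
    exact (Multiset.toFinset_card_le _).trans ((card_roots' _).trans hd.le)
  have he := Finset.eq_of_subset_of_card_le hS hc
  have : x ∈ Finset.univ.image (algebraMap Fq k) := by
    rw [he, Multiset.mem_toFinset, mem_roots hne]
    simp [hx]
  obtain ⟨a, -, rfl⟩ := Finset.mem_image.1 this
  exact ⟨a, rfl⟩

lemma lift_poly {R S : Type} [CommRing R] [CommRing S] (i : R →+* S) (φ : S →+* S) (h : ∀ x, φ x = x → ∃ a, i a = x)
    (P : S[X]) (hP : P.map φ = P) : ∃ P' : R[X], P'.map i = P := by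
  have : P ∈ Polynomial.lifts i := by
    rw [Polynomial.lifts_iff_coeff_lifts]
    intro n
    obtain ⟨a, ha⟩ := h (P.coeff n) (by rw [← coeff_map, hP])
    exact ⟨a, ha⟩
  rw [Polynomial.mem_lifts] at this
  exact this

lemma irred_iff {Fq k : Type} [Field Fq] [Fintype Fq] [Field k] [IsAlgClosed k] [Algebra Fq k] {ι : Type} [Fintype ι] [Nonempty ι]
    (φ : k →+* k) (hφ : ∀ x, φ x = x ^ Fintype.card Fq) (P : Fq[X]) (t : ι → k) (ht : Function.Injective t) (c : k) (hc : c ≠ 0) (hP : P.map (algebraMap Fq k) = C c * ∏ x, (X - C (t x)))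
    (σ : Perm ι) (hσ : ∀ x, t x ^ Fintype.card Fq = t (σ x)) : Irreducible P ↔ Trn σ := by
  classical
  have hprod : ∀ s : Finset ι, (∏ x ∈ s, (X - C (t x))).natDegree = s.card := fun s => by
    rw [natDegree_prod_of_monic _ _ (fun x _ => monic_X_sub_C _)]; simp
  have hprodne : (∏ x, (X - C (t x))) ≠ 0 := (monic_prod_of_monic _ _ (fun x _ => monic_X_sub_C _)).ne_zero
  have hdeg : P.natDegree = Fintype.card ι := by
    rw [← natDegree_map (algebraMap Fq k), hP, natDegree_C_mul hc, hprod, Finset.card_univ]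
  have hP0 : P ≠ 0 := by
    rintro rfl
    rw [Polynomial.map_zero] at hP
    exact mul_ne_zero (C_ne_zero.2 hc) hprodne hP.symm
  have hroot : ∀ y, (P.map (algebraMap Fq k)).eval y = 0 → ∃ x, t x = y := by
    intro y hy
    rw [hP, eval_mul, eval_C, eval_prod] at hy
    obtain ⟨x, -, hx⟩ := Finset.prod_eq_zero_iff.1 ((mul_eq_zero.1 hy).resolve_left hc)
    simp [sub_eq_zero] at hx
    exact ⟨x, hx.symm⟩
  have hfq : ∀ a : Fq, φ (algebraMap Fq k a) = algebraMap Fq k a := fun a => by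
    rw [hφ, ← map_pow, FiniteField.pow_card]
  constructor
  · intro hirr x y
    obtain ⟨O, hO⟩ : ∃ O : Finset ι, O = Finset.univ.filter (fun z => σ.SameCycle x z) := ⟨_, rfl⟩
    obtain ⟨R, hR⟩ : ∃ R : k[X], R = ∏ z ∈ O, (X - C (t z)) := ⟨_, rfl⟩
    have hRφ : R.map φ = R := by
      rw [hR, Polynomial.map_prod]
      refine Finset.prod_bij (fun z _ => σ z) ?_ ?_ ?_ ?_
      · intro z hz
        rw [hO] at hz ⊢
        simp only [Finset.mem_filter, Finset.mem_univ, true_and] at hz ⊢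
        exact Perm.sameCycle_apply_right.2 hz
      · intro a _ b _ h; exact σ.injective h
      · intro z hz
        refine ⟨σ.symm z, ?_, by simp⟩
        rw [hO] at hz ⊢
        simp only [Finset.mem_filter, Finset.mem_univ, true_and] at hz ⊢
        exact Perm.sameCycle_apply_right.1 (by simpa using hz)
      · intro z _
        simp [hφ, hσ]
    obtain ⟨R', hR'⟩ := lift_poly (algebraMap Fq k) φ (fun x hx => fix_range x (by rw [← hφ]; exact hx)) R hRφ
    have hdvd : R' ∣ P := by
      rw [← Polynomial.map_dvd_map' (algebraMap Fq k), hR', hP, hR]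
      exact Dvd.dvd.mul_left (Finset.prod_dvd_prod_of_subset _ _ _ (Finset.subset_univ _)) _
    have hxO : x ∈ O := by rw [hO]; simp [Perm.SameCycle.refl]
    have hRd : R'.natDegree = O.card := by rw [← natDegree_map (algebraMap Fq k), hR', hR, hprod]
    have hnu : ¬ IsUnit R' := by
      intro h
      have := natDegree_eq_zero_of_isUnit h
      rw [hRd, Finset.card_eq_zero] at this
      rw [this] at hxO; simp at hxO
    have hassoc : P ∣ R' := (hirr.dvd_iff.1 hdvd).resolve_left hnu |>.dvd
    rw [← Polynomial.map_dvd_map' (algebraMap Fq k), hR'] at hassoc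
    have hy : R.eval (t y) = 0 := by
      refine eval_eq_zero_of_dvd_of_eval_eq_zero hassoc ?_
      rw [hP, eval_mul, eval_prod, Finset.prod_eq_zero (Finset.mem_univ y) (by simp), mul_zero]
    rw [hR, eval_prod] at hy
    obtain ⟨z, hz, hz'⟩ := Finset.prod_eq_zero_iff.1 hy
    simp [sub_eq_zero] at hz'
    have := ht hz'
    rw [this]
    rw [hO] at hz
    simpa using hz
  · intro htr
    have key : ∀ A : Fq[X], A ∣ P → A.natDegree ≠ 0 → A.natDegree = P.natDegree := by
      intro A hA hA0
      apply le_antisymm (natDegree_le_of_dvd hA hP0)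
      have hAne : A ≠ 0 := by rintro rfl; simp at hA0
      have hAm : A.map (algebraMap Fq k) ≠ 0 := by rwa [Ne, Polynomial.map_eq_zero]
      obtain ⟨y, hy⟩ := IsAlgClosed.exists_root (A.map (algebraMap Fq k)) (by
        rw [degree_map]; intro h; exact hA0 (natDegree_eq_of_degree_eq_some h))
      obtain ⟨x, rfl⟩ := hroot y (eval_eq_zero_of_dvd_of_eval_eq_zero ((Polynomial.map_dvd_map' _).2 hA) hy)
      have hst : ∀ z, (A.map (algebraMap Fq k)).eval (t z) = 0 → (A.map (algebraMap Fq k)).eval (t (σ z)) = 0 := by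
        intro z hz
        have h1 : (A.map (algebraMap Fq k)).map φ = A.map (algebraMap Fq k) := by
          ext n; simp [hfq]
        rw [← hσ, ← hφ, ← h1, eval_map_apply, hz, map_zero]
      have hall : ∀ z, (A.map (algebraMap Fq k)).eval (t z) = 0 := by
        intro z
        obtain ⟨m, rfl⟩ := (htr x z).exists_nat_pow_eq
        induction m with
        | zero => exact hy
        | succ m ih => rw [pow_succ', Perm.mul_apply]; exact hst _ ih
      rw [hdeg, ← natDegree_map (algebraMap Fq k) (p := A)]
      calc Fintype.card ι = (Finset.univ.image t).card := by rw [Finset.card_image_of_injective _ ht, Finset.card_univ]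
        _ ≤ (A.map (algebraMap Fq k)).roots.toFinset.card := by
            apply Finset.card_le_card
            intro y hy
            obtain ⟨z, -, rfl⟩ := Finset.mem_image.1 hy
            rw [Multiset.mem_toFinset, mem_roots hAm]; exact hall z
        _ ≤ _ := (Multiset.toFinset_card_le _).trans (card_roots' _)
    have hpos : 0 < P.natDegree := by rw [hdeg]; exact Fintype.card_pos
    refine ⟨fun h => hpos.ne' (natDegree_eq_zero_of_isUnit h), ?_⟩
    intro A B hAB
    have hA : A ≠ 0 := by rintro rfl; exact hP0 (by simpa using hAB)
    have hB : B ≠ 0 := by rintro rfl; exact hP0 (by simpa using hAB)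
    by_cases h0 : A.natDegree = 0
    · left
      rw [natDegree_eq_zero] at h0
      obtain ⟨a, rfl⟩ := h0
      exact isUnit_C.2 (IsUnit.mk0 _ (by rintro rfl; simp at hA))
    · right
      have h1 := key A ⟨B, hAB⟩ h0
      rw [hAB, natDegree_mul hA hB] at h1
      have h0 : B.natDegree = 0 := by omega
      rw [natDegree_eq_zero] at h0
      obtain ⟨a, rfl⟩ := h0
      exact isUnit_C.2 (IsUnit.mk0 _ (by rintro rfl; simp at hB))

variable {J : Type} [Fintype J] [DecidableEq J]

lemma irred_QQ {Fq k : Type} [Field Fq] [Fintype Fq] [Field k] [IsAlgClosed k] [Algebra Fq k] (φ : k →+* k) (hφ : ∀ x, φ x = x ^ Fintype.card Fq)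
    (μ b : J → ℕ) (hμ : ∀ i, 1 ≤ μ i) (hb : ∀ i, 1 ≤ b i) (F : J → Fq[X][X]) (G : Kb μ → k[X][X])
    (hFG : ∀ i, (F i).map (mapRingHom (algebraMap Fq k)) = ∏ j, G ⟨i, j⟩) (f : Fq[X]) (l : Kb μ → k) (hl : ∀ kk, l kk ≠ 0)
    (t : Lb (Nb μ b) → k) (ht : Function.Injective t) (s : Gp (Nb μ b)) (hs : ∀ ι, t ι ^ Fintype.card Fq = t (stp s ι))
    (hP : ∀ kk, Pf (RingHom.id k) (G kk) (f.map (algebraMap Fq k)) = C (l kk) * ∏ j, (X - C (t ⟨kk, j⟩))) :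
    (∀ i, Irreducible ((F i).eval f)) ↔ QQ s := by
  refine forall_congr' fun i => ?_
  haveI : Nonempty (Fin (μ i) × Fin (b i)) := ⟨(⟨0, hμ i⟩, ⟨0, hb i⟩)⟩
  refine irred_iff φ hφ ((F i).eval f) (fun x : Fin (μ i) × Fin (b i) => t ⟨⟨i, x.1⟩, x.2⟩) ?_ (∏ j, l ⟨i, j⟩) ?_ ?_ _ ?_
  · rintro ⟨j, x⟩ ⟨j', x'⟩ h
    have := ht h
    simp only [Sigma.mk.injEq] at this
    obtain ⟨h1, h2⟩ := this
    have h3 : j = j' := by simpa using h1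
    subst h3
    have h4 : x = x' := eq_of_heq h2
    rw [h4]
  · exact Finset.prod_ne_zero_iff.2 fun j _ => hl _
  · have h1 : ((F i).eval f).map (algebraMap Fq k) = ((F i).map (mapRingHom (algebraMap Fq k))).eval (f.map (algebraMap Fq k)) := by
      have := eval_map_apply (mapRingHom (algebraMap Fq k)) (p := F i) f
      rw [coe_mapRingHom] at this
      exact this.symm
    rw [h1, hFG, eval_prod, Fintype.prod_prod_type, map_prod, ← Finset.prod_mul_distrib]
    refine Finset.prod_congr rfl fun j _ => ?_
    have := hP ⟨i, j⟩
    rw [← this, Pf, mapRingHom_id]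
    rfl
  · rintro ⟨j, x⟩
    exact hs _
end
end BH

open Polynomial
namespace BH
section

lemma monic_dvd_eq {R : Type} [CommRing R] [IsDomain R] {A B : R[X]} (hA : A.Monic) (hB : B.Monic) (iA : Irreducible A) (iB : Irreducible B) (h : A ∣ B) : A = B :=
  eq_of_monic_of_associated hA hB ((iB.dvd_iff.1 h).resolve_left iA.not_isUnit).symm

lemma monic_factor {R : Type} [CommRing R] [IsDomain R] [UniqueFactorizationMonoid R] {P : R[X]} (hP : P.Monic) (hd : 0 < P.natDegree) :
    ∃ G : R[X], G.Monic ∧ Irreducible G ∧ G ∣ P := by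
  obtain ⟨G0, hG0, Q, hQ⟩ := WfDvdMonoid.exists_irreducible_factor (a := P) (fun h => by
    have := natDegree_eq_zero_of_isUnit h; omega) hP.ne_zero
  have hu : IsUnit G0.leadingCoeff := by
    apply IsUnit.of_mul_eq_one Q.leadingCoeff
    rw [← leadingCoeff_mul, ← hQ]; exact hP
  obtain ⟨u, hu⟩ := hu
  have hm : (C (↑u⁻¹ : R) * G0).Monic := by
    rw [Monic, leadingCoeff_mul, leadingCoeff_C, ← hu]; simp
  have hass : Associated G0 (C (↑u⁻¹ : R) * G0) := by
    rw [mul_comm]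
    refine ⟨Units.map (C : R →+* R[X]).toMonoidHom u⁻¹, ?_⟩
    simp
  exact ⟨_, hm, hass.irreducible hG0, hass.symm.dvd.trans ⟨Q, hQ⟩⟩

lemma orbit_fac {R : Type} [CommRing R] [IsDomain R] [UniqueFactorizationMonoid R] (ψ : R ≃+* R) (P G : R[X]) (hP : P.Monic)
    (hψ : P.map (ψ : R →+* R) = P) (hG : G.Monic) (iG : Irreducible G) (hGP : G ∣ P) :
    ∃ ν : ℕ, ∃ Gs : ℕ → R[X], Gs 0 = G ∧ (∀ j, (Gs j).Monic ∧ Irreducible (Gs j) ∧ (Gs j).natDegree = G.natDegree ∧ (derivative (Gs j) = 0 → derivative G = 0) ∧ Gs (j + 1) = (Gs j).map (ψ : R →+* R))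
      ∧ Set.InjOn Gs (Set.Iio (ν + 1)) ∧ Gs (ν + 1) = G ∧ (∏ j ∈ Finset.range (ν + 1), Gs j) ∣ P := by
  classical
  obtain ⟨Φ, hΦ⟩ : ∃ Φ : R[X] ≃+* R[X], Φ = mapEquiv ψ := ⟨_, rfl⟩
  have hΦa : ∀ A, Φ A = A.map (ψ : R →+* R) := fun A => by rw [hΦ]; rfl
  obtain ⟨Gs, hGs⟩ : ∃ Gs : ℕ → R[X], Gs = fun j => Φ^[j] G := ⟨_, rfl⟩
  have h0 : Gs 0 = G := by rw [hGs]; rfl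
  have hs : ∀ j, Gs (j + 1) = Φ (Gs j) := fun j => by rw [hGs]; exact Function.iterate_succ_apply' _ _ _
  have hinj : Function.Injective (ψ : R →+* R) := ψ.injective
  have hall : ∀ j, (Gs j).Monic ∧ Irreducible (Gs j) ∧ (Gs j).natDegree = G.natDegree ∧ (derivative (Gs j) = 0 → derivative G = 0) ∧ Gs j ∣ P := by
    intro j
    induction j with
    | zero => rw [h0]; exact ⟨hG, iG, rfl, id, hGP⟩
    | succ j ih =>
      obtain ⟨h1, h2, h3, h4, h5⟩ := ih
      rw [hs]
      refine ⟨?_, (MulEquiv.irreducible_iff Φ).2 h2, ?_, ?_, ?_⟩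
      · rw [hΦa]; exact h1.map _
      · rw [hΦa, natDegree_map_eq_of_injective hinj, h3]
      · rw [hΦa, derivative_map]
        intro h
        exact h4 ((Polynomial.map_eq_zero_iff hinj).1 h)
      · rw [hΦa, ← hψ]; exact Polynomial.map_dvd _ h5
  have hdvd : ∀ s : Finset ℕ, Set.InjOn Gs s → (∏ j ∈ s, Gs j) ∣ P := by
    intro s hs
    refine Finset.prod_dvd_of_isRelPrime ?_ (fun j _ => (hall j).2.2.2.2)
    intro a ha b hb hab
    refine (hall a).2.1.isRelPrime_iff_not_dvd.2 fun h => hab (hs ha hb ?_)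
    exact monic_dvd_eq (hall a).1 (hall b).1 (hall a).2.1 (hall b).2.1 h
  have hGd : 0 < G.natDegree := by
    by_contra h
    have : G = 1 := hG.natDegree_eq_zero.1 (by omega)
    exact iG.not_isUnit (this ▸ isUnit_one)
  have hper : G ∈ Function.periodicPts Φ := by
    by_contra hnp
    have hinjG : Function.Injective Gs := by
      have key : ∀ a b, a < b → Gs a ≠ Gs b := by
        intro a b hab h
        apply hnp
        refine Function.mk_mem_periodicPts (n := b - a) (by omega) ?_
        have : Φ^[a] (Φ^[b - a] G) = Φ^[a] G := by
          rw [← Function.iterate_add_apply]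
          have e : a + (b - a) = b := by omega
          rw [e]; rw [hGs] at h; exact h.symm
        exact (Φ.injective.iterate a) this
      intro a b h
      rcases lt_trichotomy a b with h' | h' | h'
      · exact absurd h (key a b h')
      · exact h'
      · exact absurd h.symm (key b a h')
    have h1 := natDegree_le_of_dvd (hdvd (Finset.range (P.natDegree + 1)) hinjG.injOn) hP.ne_zero
    rw [natDegree_prod_of_monic _ _ (fun j _ => (hall j).1), Finset.sum_congr rfl (fun j _ => (hall j).2.2.1)] at h1
    simp at h1
    nlinarith
  have hpos := Function.minimalPeriod_pos_of_mem_periodicPts hper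
  obtain ⟨ν, hν⟩ : ∃ ν, Function.minimalPeriod Φ G = ν + 1 := ⟨Function.minimalPeriod Φ G - 1, by omega⟩
  have hio : Set.InjOn Gs (Set.Iio (ν + 1)) := by
    rw [← hν, hGs]; exact Function.iterate_injOn_Iio_minimalPeriod
  refine ⟨ν, Gs, h0, fun j => ⟨(hall j).1, (hall j).2.1, (hall j).2.2.1, (hall j).2.2.2.1, by rw [hs, hΦa]⟩, hio, ?_, ?_⟩
  · rw [← hν, hGs]; exact Function.iterate_minimalPeriod
  · exact hdvd _ (by rw [Finset.coe_range]; exact hio)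

lemma decomp {Fq k : Type} [Field Fq] [Fintype Fq] [Field k] [Algebra Fq k] (φ : k ≃+* k) (hφ : ∀ x, φ x = x ^ Fintype.card Fq)
    (F : Fq[X][X]) (hF : F.Monic) (iF : Irreducible F) (dF : derivative F ≠ 0) (hd : 0 < F.natDegree) :
    ∃ μ : ℕ, 1 ≤ μ ∧ μ = Multiset.card (UniqueFactorizationMonoid.factors (F.map (mapRingHom (algebraMap Fq k)))) ∧
      ∃ G : Fin μ → k[X][X], (∀ j, (G j).Monic ∧ Irreducible (G j) ∧ derivative (G j) ≠ 0 ∧ (G j).map (mapRingHom (φ : k →+* k)) = G (finRotate μ j) ∧ F.natDegree = μ * (G j).natDegree) ∧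
        Function.Injective G ∧ F.map (mapRingHom (algebraMap Fq k)) = ∏ j, G j ∧
        ∀ F2 : Fq[X][X], ∀ j, G j ∣ F2.map (mapRingHom (algebraMap Fq k)) → F ∣ F2 := by
  classical
  obtain ⟨i, hi⟩ : ∃ i : Fq[X] →+* k[X], i = mapRingHom (algebraMap Fq k) := ⟨_, rfl⟩
  rw [← hi]
  have hiinj : Function.Injective i := by rw [hi]; exact map_injective _ (algebraMap Fq k).injective
  obtain ⟨ψ, hψ⟩ : ∃ ψ : k[X] ≃+* k[X], ψ = mapEquiv φ := ⟨_, rfl⟩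
  have hψ' : (ψ : k[X] →+* k[X]) = mapRingHom (φ : k →+* k) := by rw [hψ]; rfl
  have hψi : ∀ a, ψ (i a) = i a := by
    intro a
    change (ψ : k[X] →+* k[X]) (i a) = i a
    rw [hψ', hi, coe_mapRingHom, coe_mapRingHom, map_map]
    congr 1
    ext x
    change φ (algebraMap Fq k x) = _
    rw [hφ, ← map_pow, FiniteField.pow_card]
  have hfix : ∀ x : k[X], (ψ : k[X] →+* k[X]) x = x → ∃ a, i a = x := by
    intro x hx
    rw [hψ'] at hx
    obtain ⟨a, ha⟩ := lift_poly (algebraMap Fq k) (φ : k →+* k) (fun y hy => fix_range y (by rw [← hφ]; exact hy)) x hx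
    exact ⟨a, by rw [hi]; exact ha⟩
  have hPm : (F.map i).Monic := hF.map i
  have hPd : (F.map i).natDegree = F.natDegree := natDegree_map_eq_of_injective hiinj F
  obtain ⟨G0, hG0, iG0, dG0⟩ := monic_factor hPm (by omega)
  have hPψ : (F.map i).map (ψ : k[X] →+* k[X]) = F.map i := by
    rw [map_map]; congr 1; exact RingHom.ext hψi
  obtain ⟨ν, Gs, h0, hall, hio, hν, hdvd⟩ := orbit_fac ψ (F.map i) G0 hPm hPψ hG0 iG0 dG0
  obtain ⟨P, hP⟩ : ∃ P, P = ∏ j ∈ Finset.range (ν + 1), Gs j := ⟨_, rfl⟩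
  have hPinv : P.map (ψ : k[X] →+* k[X]) = P := by
    rw [hP, Polynomial.map_prod, Finset.prod_congr rfl (fun j _ => (hall j).2.2.2.2.symm)]
    rw [Finset.prod_range_succ, Finset.prod_range_succ', hν, h0]
  have hPmon : P.Monic := by rw [hP]; exact monic_prod_of_monic _ _ (fun j _ => (hall j).1)
  obtain ⟨P', hP'⟩ := lift_poly i _ hfix P hPinv
  have hP'm : P'.Monic := by
    apply monic_of_injective hiinj
    rw [hP']; exact hPmon
  have hG0d : 0 < G0.natDegree := by
    by_contra h
    have : G0 = 1 := hG0.natDegree_eq_zero.1 (by omega)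
    exact iG0.not_isUnit (this ▸ isUnit_one)
  have hPdeg : P.natDegree = (ν + 1) * G0.natDegree := by
    rw [hP, natDegree_prod_of_monic _ _ (fun j _ => (hall j).1), Finset.sum_congr rfl (fun j _ => (hall j).2.2.1)]
    simp
  have hP'F : P' ∣ F := by
    rw [← map_dvd_map i hiinj hP'm, hP', hP]; exact hdvd
  have hP'nu : ¬ IsUnit P' := by
    intro h
    have h1 := natDegree_eq_zero_of_isUnit h
    rw [← natDegree_map_eq_of_injective hiinj P', hP', hPdeg] at h1
    have : 0 < (ν + 1) * G0.natDegree := by positivity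
    omega
  have hFP : F = P' := eq_of_monic_of_associated hF hP'm ((iF.dvd_iff.1 hP'F).resolve_left hP'nu)
  have hFP2 : F.map i = ∏ j : Fin (ν + 1), Gs j := by
    rw [hFP, hP', hP, Finset.prod_range]
  refine ⟨ν + 1, by omega, ?_, fun j => Gs j, ?_, ?_, hFP2, ?_⟩
  · have h1 := UniqueFactorizationMonoid.factors_unique (f := UniqueFactorizationMonoid.factors (F.map i)) (g := Multiset.map (fun j : Fin (ν + 1) => Gs j) Finset.univ.val)
      (fun x hx => UniqueFactorizationMonoid.irreducible_of_factor x hx)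
      (fun x hx => by
        obtain ⟨j, -, rfl⟩ := Multiset.mem_map.1 hx
        exact (hall j).2.1)
      (by
        refine (UniqueFactorizationMonoid.factors_prod hPm.ne_zero).trans ?_
        rw [hFP2]; rfl)
    rw [Multiset.card_eq_card_of_rel h1]
    simp
  · intro j
    refine ⟨(hall j).1, (hall j).2.1, ?_, ?_, ?_⟩
    · intro h
      apply dF
      have hz : ∀ j', derivative (Gs j') = 0 := by
        have hG := (hall j).2.2.2.1 h
        intro j'
        induction j' with
        | zero => rw [h0]; exact hG
        | succ j' ih => rw [(hall j').2.2.2.2, derivative_map, ih, Polynomial.map_zero]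
      rw [← Polynomial.map_eq_zero_iff hiinj, ← derivative_map, hFP, hP', hP]
      have : ∀ s : Finset ℕ, derivative (∏ j ∈ s, Gs j) = 0 := by
        intro s
        induction s using Finset.induction_on with
        | empty => simp
        | insert a s ha ih => rw [Finset.prod_insert ha, derivative_mul, ih, hz]; simp
      exact this _
    · rw [← hψ', ← (hall j).2.2.2.2]
      by_cases hj : j.1 < ν
      · have := finRotate_of_lt hj
        have e : finRotate (ν + 1) j = ⟨j.1 + 1, by omega⟩ := this
        rw [e]
      · have hjv : j = ⟨ν, by omega⟩ := by ext; simp; omega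
        rw [hjv, finRotate_last']
        simp only
        rw [hν, h0]
    · rw [← hPd, (hall j).2.2.1, ← hPdeg, hFP, hP']
  · intro a b h
    exact Fin.ext (hio a.2 b.2 h)
  · intro F2 j hj
    have hstep : ∀ m, Gs m ∣ F2.map i → Gs (m + 1) ∣ F2.map i := by
      intro m hm
      have e : (F2.map i).map (ψ : k[X] →+* k[X]) = F2.map i := by
        rw [map_map]; congr 1; exact RingHom.ext hψi
      rw [(hall m).2.2.2.2, ← e]
      exact Polynomial.map_dvd _ hm
    have h1 : ∀ m, Gs (j + m) ∣ F2.map i := by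
      intro m
      induction m with
      | zero => exact hj
      | succ m ih => exact hstep _ ih
    have h2 : Gs 0 ∣ F2.map i := by
      have := h1 (ν + 1 - j)
      have e : j.1 + (ν + 1 - j) = ν + 1 := by omega
      rw [e, hν] at this
      rw [h0]; exact this
    have h3 : ∀ m, Gs m ∣ F2.map i := by
      intro m
      induction m with
      | zero => exact h2
      | succ m ih => exact hstep _ ih
    rw [← map_dvd_map i hiinj hF, hFP, hP', hP]
    refine Finset.prod_dvd_of_isRelPrime ?_ (fun j _ => h3 j)
    intro a ha b hb hab
    refine (hall a).2.1.isRelPrime_iff_not_dvd.2 fun h => hab (hio (by simpa using ha) (by simpa using hb) ?_)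
    exact monic_dvd_eq (hall a).1 (hall b).1 (hall a).2.1 (hall b).2.1 h

lemma WB_slope {K : Type} [Field K] (P : K[X][X]) (hP : P.Monic) (n : ℕ) (h : slopeX P ≤ ((n : ℚ) : WithBot ℚ)) :
    WB n (n * P.natDegree) P := by
  intro j i hji
  have hj : j ≤ P.natDegree := by
    by_contra hj
    rw [show P.coeff j = 0 from coeff_eq_zero_of_natDegree_lt (by omega)] at hji
    simp at hji
  rcases hj.lt_or_eq with hj | rfl
  · rw [slopeX, Finset.sup_le_iff] at h
    have h1 := h (P.natDegree - j) (by rw [Finset.mem_Icc]; omega)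
    have e : P.natDegree - (P.natDegree - j) = j := by omega
    rw [e] at h1
    have hne : P.coeff j ≠ 0 := by intro h; rw [h] at hji; simp at hji
    rw [degree_eq_natDegree hne] at h1
    have h2 : (((P.coeff j).natDegree : ℚ) / ((P.natDegree - j : ℕ) : ℚ)) ≤ (n : ℚ) := WithBot.coe_le_coe.1 h1
    rw [div_le_iff₀ (by exact_mod_cast (by omega : 0 < P.natDegree - j))] at h2
    have h3 : (P.coeff j).natDegree ≤ n * (P.natDegree - j) := by exact_mod_cast h2
    have h4 := le_natDegree_of_ne_zero hji
    have h5 : n * (P.natDegree - j) + n * j = n * P.natDegree := by rw [← mul_add]; congr 1; omega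
    omega
  · rw [coeff_natDegree, hP.leadingCoeff, coeff_one] at hji
    have : i = 0 := by by_contra h; rw [if_neg h] at hji; exact hji rfl
    omega
end
end BH

open Polynomial
namespace BH
section
variable {J : Type} [Fintype J] [DecidableEq J]

lemma per_g_fq (n : ℕ) (hn : 1 ≤ n) (μ b : J → ℕ) (hμ : ∀ i, 1 ≤ μ i) (hb : ∀ i, 2 ≤ b i) : ∃ Cc : ℝ, 0 ≤ Cc ∧ ∀ (Fq k : Type) [Field Fq] [Fintype Fq] [Field k] [IsAlgClosed k] [Algebra Fq k]
    (φ : k →+* k), (∀ x, φ x = x ^ Fintype.card Fq) → ∀ (F : J → Fq[X][X]) (G : Kb μ → k[X][X]),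
    (∀ i, (F i).map (mapRingHom (algebraMap Fq k)) = ∏ j, G ⟨i, j⟩) → (∀ j, (G j).Monic) → (∀ j, Irreducible (G j)) → (∀ i j, G i ∣ G j → i = j) →
    (∀ j, WB n (n * (G j).natDegree) (G j)) → (∀ j, Nb μ b j = n * (G j).natDegree) →
    (∀ kk, (G kk).map (mapRingHom φ) = G (rot kk)) →
    ∀ (g : Fin n → Fq) (u : Lb (Nb μ b) → k), Irreducible (chi (RingHom.id k) (Nb μ b) G (algebraMap Fq k ∘ g) u) →
    derivative (chi (RingHom.id k) (Nb μ b) G (algebraMap Fq k ∘ g) u) ≠ 0 → (∀ kk, (Lam n (G kk)).eval (algebraMap Fq k (g ⟨n - 1, by omega⟩)) ≠ 0) →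
    |(Nat.card {α : Fq // ∀ i, Irreducible ((F i).eval (fpen g α))} : ℝ) - (∏ i, ((b i : ℝ))⁻¹) * Fintype.card Fq| ≤ Cc * Real.sqrt (Fintype.card Fq) := by
  classical
  obtain ⟨C0, hC0, hst⟩ := per_g n hn μ b
  refine ⟨2 * C0, by positivity, ?_⟩
  intro Fq k _ _ _ _ _ φ hφ F G hFG hG hirr hnd hW hN hfrob g u hci hcd hLam
  obtain ⟨p, hp⟩ := CharP.exists Fq
  obtain ⟨e, hpp, hq⟩ := FiniteField.card Fq p
  haveI : CharP k p := charP_of_injective_algebraMap (algebraMap Fq k).injective p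
  haveI : ExpChar k p := ExpChar.prime hpp
  have hφe : iterateFrobenius k p e = φ := by
    ext x
    rw [iterateFrobenius_def, hφ, hq]
  have hq1 : 1 < p ^ (e : ℕ) := by rw [← hq]; exact Fintype.one_lt_card
  have hinj := (algebraMap Fq k).injective
  obtain ⟨A', t, s, hA', hcard, hprop, hQ⟩ := hst k p e G hG hirr hnd hW hN (by rw [hφe]; exact hfrob) (algebraMap Fq k ∘ g) u
    (fun j => by simp only [Function.comp]; rw [← hq, ← map_pow, FiniteField.pow_card]) hci hcd hLam hq1 (Finset.univ.image (algebraMap Fq k))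
    (by rw [Finset.card_image_of_injective _ hinj, Finset.card_univ, hq])
    (fun α hα => by
      obtain ⟨a, -, rfl⟩ := Finset.mem_image.1 hα
      rw [← hq, ← map_pow, FiniteField.pow_card])
  have hQ' := hQ QQ QQ_tcj
  have hcq := card_QQ μ b hμ hb
  have hB : 0 < ∏ i, b i := Finset.prod_pos fun i _ => by have := hb i; omega
  have hfrac : ((Finset.univ.filter fun s : Gp (Nb μ b) => QQ s).card : ℝ) / Fintype.card (Gp (Nb μ b)) = ∏ i, ((b i : ℝ))⁻¹ := by
    have h0 : (0:ℝ) < Fintype.card (Gp (Nb μ b)) := by exact_mod_cast Fintype.card_pos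
    have hB' : (0:ℝ) < ∏ i, (b i : ℝ) := by exact_mod_cast hB
    rw [Finset.prod_inv_distrib, div_eq_iff h0.ne', ← hcq]
    push_cast
    field_simp
  rw [hfrac, ← hq] at hQ'
  rw [← hq] at hcard hprop
  have hiff : ∀ α : Fq, algebraMap Fq k α ∈ A' → ((∀ i, Irreducible ((F i).eval (fpen g α))) ↔ QQ (s (algebraMap Fq k α))) := by
    intro α hα
    obtain ⟨h1, h2, h3, h4⟩ := hprop _ hα
    refine irred_QQ φ hφ μ b hμ (fun i => by have := hb i; omega) F G hFG (fpen g α) _ h2 _ h3 _ h4 ?_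
    rw [fpen_map]; exact h1
  obtain ⟨S, hS⟩ : ∃ S : Finset Fq, S = Finset.univ.filter fun α => ∀ i, Irreducible ((F i).eval (fpen g α)) := ⟨_, rfl⟩
  have hSc : Nat.card {α : Fq // ∀ i, Irreducible ((F i).eval (fpen g α))} = S.card := by
    rw [Nat.card_eq_fintype_card, Fintype.card_subtype, hS]
  rw [hSc]
  have hle : (A'.filter fun α => QQ (s α)).card ≤ S.card := by
    rw [← Finset.card_image_of_injective S hinj]
    apply Finset.card_le_card
    intro x hx
    obtain ⟨hx1, hx2⟩ := Finset.mem_filter.1 hx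
    obtain ⟨a, -, rfl⟩ := Finset.mem_image.1 (hA' hx1)
    refine Finset.mem_image_of_mem _ ?_
    rw [hS, Finset.mem_filter]
    exact ⟨Finset.mem_univ _, (hiff a hx1).2 hx2⟩
  have hge : S.card + A'.card ≤ (A'.filter fun α => QQ (s α)).card + Fintype.card Fq := by
    have h1 : S.image (algebraMap Fq k) ⊆ (A'.filter fun α => QQ (s α)) ∪ (Finset.univ.image (algebraMap Fq k) \ A') := by
      intro x hx
      obtain ⟨a, ha, rfl⟩ := Finset.mem_image.1 hx
      rw [Finset.mem_union]
      by_cases h : algebraMap Fq k a ∈ A'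
      · left
        rw [Finset.mem_filter]
        refine ⟨h, (hiff a h).1 ?_⟩
        rw [hS, Finset.mem_filter] at ha
        exact ha.2
      · right
        rw [Finset.mem_sdiff]
        exact ⟨Finset.mem_image_of_mem _ (Finset.mem_univ _), h⟩
    have h2 := (Finset.card_le_card h1).trans (Finset.card_union_le _ _)
    rw [Finset.card_image_of_injective S hinj] at h2
    have h3 := Finset.card_sdiff_add_card_eq_card hA'
    rw [Finset.card_image_of_injective _ hinj, Finset.card_univ] at h3
    omega
  have hle' : ((A'.filter fun α => QQ (s α)).card : ℝ) ≤ S.card := by exact_mod_cast hle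
  have hge' : (S.card : ℝ) + A'.card ≤ (A'.filter fun α => QQ (s α)).card + Fintype.card Fq := by exact_mod_cast hge
  have hsq : 1 ≤ Real.sqrt (Fintype.card Fq) := by
    rw [Real.one_le_sqrt]
    exact_mod_cast Fintype.card_pos
  have hC1 : C0 ≤ C0 * Real.sqrt (Fintype.card Fq) := le_mul_of_one_le_right hC0 hsq
  rw [abs_le] at hQ' ⊢
  constructor
  · linarith [hQ'.1]
  · linarith [hQ'.2]

lemma fpen_nd {K : Type} [Field K] {n : ℕ} (hn : 1 ≤ n) (g : Fin n → K) (α : K) : (fpen g α).degree = (n : ℕ) ↔ g ⟨n - 1, by omega⟩ ≠ 0 := by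
  rw [← fpen_coeff_n hn g α]
  constructor
  · intro h
    exact coeff_ne_zero_of_eq_degree h
  · intro h
    apply le_antisymm
    · exact natDegree_le_iff_degree_le.1 (by have := fpen_natDegree hn g α; omega)
    · exact le_degree_of_ne_zero h

lemma fpen_coeff {K : Type} [Field K] {n : ℕ} (g : Fin n → K) (α : K) (j : Fin n) : (fpen g α).coeff (j + 1) = g j := by
  rw [fpen, coeff_add, coeff_C, if_neg (by omega), zero_add, finset_sum_coeff, Finset.sum_eq_single j]
  · simp
  · intro i _ hij
    rw [coeff_C_mul, coeff_X_pow, if_neg, mul_zero]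
    intro h; apply hij; ext; omega
  · simp

lemma fpen_coeff0 {K : Type} [Field K] {n : ℕ} (g : Fin n → K) (α : K) : (fpen g α).coeff 0 = α := by
  rw [fpen, coeff_add, coeff_C, if_pos rfl, finset_sum_coeff, Finset.sum_eq_zero, add_zero]
  intro i _
  rw [coeff_C_mul, coeff_X_pow, if_neg (by omega), mul_zero]

lemma fpen_surj {K : Type} [Field K] {n : ℕ} (f : K[X]) (hf : f.natDegree ≤ n) : fpen (fun j : Fin n => f.coeff (j + 1)) (f.coeff 0) = f := by
  conv_rhs => rw [f.as_sum_range' (n + 1) (by omega), Finset.sum_range_succ']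
  rw [fpen, add_comm, Finset.sum_range]
  congr 1
  exact Finset.sum_congr rfl fun j _ => by rw [C_mul_X_pow_eq_monomial]

lemma count_split {K : Type} [Field K] [Fintype K] {n : ℕ} (hn : 1 ≤ n) (P : K[X] → Prop) :
    Nat.card {f : K[X] // f.degree = (n : ℕ) ∧ P f} = ∑ g : Fin n → K, Nat.card {α : K // g ⟨n - 1, by omega⟩ ≠ 0 ∧ P (fpen g α)} := by
  classical
  have h1 : Nat.card {f : K[X] // f.degree = (n : ℕ) ∧ P f} = Nat.card (Σ g : Fin n → K, {α : K // g ⟨n - 1, by omega⟩ ≠ 0 ∧ P (fpen g α)}) := by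
    symm
    refine Nat.card_congr (Equiv.ofBijective (fun x => ⟨fpen x.1 x.2.1, (fpen_nd hn _ _).2 x.2.2.1, x.2.2.2⟩) ⟨?_, ?_⟩)
    · rintro ⟨g, α, h⟩ ⟨g', α', h'⟩ hh
      have h0 : fpen g α = fpen g' α' := congrArg Subtype.val hh
      have hg : g = g' := by
        funext j
        rw [← fpen_coeff g α j, h0, fpen_coeff]
      have hα : α = α' := by rw [← fpen_coeff0 g α, h0, fpen_coeff0]
      subst hg; subst hα; rfl
    · rintro ⟨f, hf, hP⟩
      have e := fpen_surj (n := n) f (natDegree_le_of_degree_le hf.le)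
      refine ⟨⟨fun j => f.coeff (j + 1), f.coeff 0, ?_, ?_⟩, ?_⟩
      · exact (fpen_nd hn _ (f.coeff 0)).1 (by rw [e]; exact hf)
      · rw [e]; exact hP
      · exact Subtype.ext e
  rw [h1, Nat.card_sigma]

lemma sz_count {Fq k : Type} [Field Fq] [Fintype Fq] [Field k] [Algebra Fq k] (n E : ℕ) (hn : 1 ≤ n) (H : MvPolynomial (Fin n) k) (hH : H ≠ 0) (hE : H.totalDegree ≤ E)
    [DecidablePred fun g : Fin n → Fq => MvPolynomial.eval (algebraMap Fq k ∘ g) H = 0] :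
    (Finset.univ.filter fun g : Fin n → Fq => MvPolynomial.eval (algebraMap Fq k ∘ g) H = 0).card * Fintype.card Fq ≤ E * Fintype.card Fq ^ n := by
  classical
  have hinj := (algebraMap Fq k).injective
  have hS : (Finset.univ.image (algebraMap Fq k)).card = Fintype.card Fq := by
    rw [Finset.card_image_of_injective _ hinj, Finset.card_univ]
  have h1 := MvPolynomial.schwartz_zippel_totalDegree hH (Finset.univ.image (algebraMap Fq k))
  rw [hS] at h1
  have hq : (0 : ℚ≥0) < Fintype.card Fq := by exact_mod_cast Fintype.card_pos
  rw [div_le_div_iff₀ (by positivity) hq] at h1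
  have h2 : ((Finset.univ.filter fun g : Fin n → Fq => MvPolynomial.eval (algebraMap Fq k ∘ g) H = 0).card)
      ≤ ((Fintype.piFinset fun _ : Fin n => Finset.univ.image (algebraMap Fq k)).filter fun f => MvPolynomial.eval f H = 0).card := by
    refine Finset.card_le_card_of_injOn (fun g => algebraMap Fq k ∘ g) ?_ ?_
    · intro g hg
      have hg' := (Finset.mem_filter.1 hg).2
      refine Finset.mem_coe.2 (Finset.mem_filter.2 ⟨?_, hg'⟩)
      rw [Fintype.mem_piFinset]
      intro j
      exact Finset.mem_image_of_mem _ (Finset.mem_univ _)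
    · intro a _ b _ h
      funext j
      exact hinj (congrFun h j)
  have h3 : ((Fintype.piFinset fun _ : Fin n => Finset.univ.image (algebraMap Fq k)).filter fun f => MvPolynomial.eval f H = 0).card * Fintype.card Fq ≤ H.totalDegree * Fintype.card Fq ^ n := by exact_mod_cast h1
  calc _ ≤ _ := Nat.mul_le_mul_right _ h2
    _ ≤ _ := h3
    _ ≤ _ := Nat.mul_le_mul_right _ hE

theorem count_cfg (n : ℕ) (hn : 3 ≤ n) (μ b : J → ℕ) (hμ : ∀ i, 1 ≤ μ i) (hb : ∀ i, 2 ≤ b i) : ∃ Cc : ℝ, 0 ≤ Cc ∧ ∀ (Fq k : Type) [Field Fq] [Fintype Fq] [Field k] [IsAlgClosed k] [Algebra Fq k]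
    (φ : k →+* k), (∀ x, φ x = x ^ Fintype.card Fq) → ∀ (F : J → Fq[X][X]) (G : Kb μ → k[X][X]),
    (∀ i, (F i).map (mapRingHom (algebraMap Fq k)) = ∏ j, G ⟨i, j⟩) → (∀ j, (G j).Monic) → (∀ j, Irreducible (G j)) → (∀ j, derivative (G j) ≠ 0) → (∀ i j, G i ∣ G j → i = j) →
    (∀ j, WB n (n * (G j).natDegree) (G j)) → (∀ j, Nb μ b j = n * (G j).natDegree) →
    (∀ kk, (G kk).map (mapRingHom φ) = G (rot kk)) →
    |(Nat.card {f : Fq[X] // f.degree = (n : ℕ) ∧ ∀ i, Irreducible ((F i).eval f)} : ℝ) - (∏ i, ((b i : ℝ))⁻¹) * (Fintype.card Fq : ℝ) ^ (n + 1)| ≤ Cc * (Fintype.card Fq : ℝ) ^ n * Real.sqrt (Fintype.card Fq) := by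
  classical
  obtain ⟨C0, hC0, hpg⟩ := per_g_fq n (by omega) μ b hμ hb
  obtain ⟨E, hE⟩ := good_g n hn (Nb μ b)
  refine ⟨C0 + E, by positivity, ?_⟩
  intro Fq k _ _ _ _ _ φ hφ F G hFG hG hirr hd hnd hW hN hfrob
  obtain ⟨u, H, hH, hHE, hgood⟩ := hE k G hG hirr hd hnd hW hN
  have hsz := sz_count (Fq := Fq) n E (by omega) H hH hHE
  rw [count_split (by omega) (fun f : Fq[X] => ∀ i, Irreducible ((F i).eval f))]
  obtain ⟨q, hq⟩ : ∃ q : ℝ, q = (Fintype.card Fq : ℝ) := ⟨_, rfl⟩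
  obtain ⟨β, hβ⟩ : ∃ β : ℝ, β = ∏ i, ((b i : ℝ))⁻¹ := ⟨_, rfl⟩
  have hβ0 : 0 ≤ β := by rw [hβ]; exact Finset.prod_nonneg fun i _ => by positivity
  have hβ1 : β ≤ 1 := by
    rw [hβ]
    refine Finset.prod_le_one (fun i _ => by positivity) fun i _ => ?_
    have h2 : (1:ℝ) ≤ b i := by have := hb i; exact_mod_cast (by omega : 1 ≤ b i)
    exact inv_le_one_of_one_le₀ h2
  have hq1 : 1 ≤ q := by rw [hq]; exact_mod_cast Fintype.card_pos
  obtain ⟨cnt, hcnt⟩ : ∃ cnt : (Fin n → Fq) → ℕ, cnt = fun g => Nat.card {α : Fq // g ⟨n - 1, by omega⟩ ≠ 0 ∧ ∀ i, Irreducible ((F i).eval (fpen g α))} := ⟨_, rfl⟩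
  have hgb : ∀ g : Fin n → Fq, MvPolynomial.eval (algebraMap Fq k ∘ g) H ≠ 0 → |(cnt g : ℝ) - β * q| ≤ C0 * Real.sqrt q := by
    intro g hg
    obtain ⟨h1, h2, h3, h4⟩ := hgood _ hg
    have h5 := hpg Fq k φ hφ F G hFG hG hirr hnd hW hN hfrob g u h1 h2 h3
    have h6 : g ⟨n - 1, by omega⟩ ≠ 0 := by
      intro h; apply h4; simp only [Function.comp]; rw [h, map_zero]
    have h7 : cnt g = Nat.card {α : Fq // ∀ i, Irreducible ((F i).eval (fpen g α))} := by
      rw [hcnt]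
      exact Nat.card_congr (Equiv.subtypeEquivRight fun α => ⟨fun h => h.2, fun h => ⟨h6, h⟩⟩)
    rw [h7, hβ, hq]
    exact h5
  have hbb : ∀ g : Fin n → Fq, |(cnt g : ℝ) - β * q| ≤ q := by
    intro g
    have h1 : cnt g ≤ Fintype.card Fq := by
      rw [hcnt, ← Nat.card_eq_fintype_card]
      exact Nat.card_le_card_of_injective Subtype.val Subtype.val_injective
    have h2 : (cnt g : ℝ) ≤ q := by rw [hq]; exact_mod_cast h1
    have h3 : β * q ≤ q := mul_le_of_le_one_left (by linarith) hβ1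
    have h4 : 0 ≤ β * q := by positivity
    have h5 : (0:ℝ) ≤ cnt g := Nat.cast_nonneg _
    rw [abs_le]; constructor <;> linarith
  have hsum : ((∑ g : Fin n → Fq, cnt g : ℕ) : ℝ) - β * q ^ (n + 1) = ∑ g : Fin n → Fq, ((cnt g : ℝ) - β * q) := by
    rw [Finset.sum_sub_distrib]
    push_cast
    rw [Finset.sum_const, Finset.card_univ, nsmul_eq_mul, Fintype.card_fun, Fintype.card_fin, hq]
    push_cast
    ring
  have hgoal : |((∑ g : Fin n → Fq, cnt g : ℕ) : ℝ) - β * q ^ (n + 1)| ≤ (C0 + E) * q ^ n * Real.sqrt q := by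
    rw [hsum]
    refine (Finset.abs_sum_le_sum_abs _ _).trans ?_
    have h1 : ∀ g : Fin n → Fq, |(cnt g : ℝ) - β * q| ≤ C0 * Real.sqrt q + if MvPolynomial.eval (algebraMap Fq k ∘ g) H = 0 then q else 0 := by
      intro g
      split_ifs with h
      · have := hbb g
        have h0 : 0 ≤ C0 * Real.sqrt q := by positivity
        linarith
      · have := hgb g h
        linarith
    refine (Finset.sum_le_sum fun g _ => h1 g).trans ?_
    rw [Finset.sum_add_distrib, Finset.sum_const, Finset.card_univ, nsmul_eq_mul, Fintype.card_fun, Fintype.card_fin, ← Finset.sum_filter, Finset.sum_const, nsmul_eq_mul]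
    have h2 : ((Finset.univ.filter fun g : Fin n → Fq => MvPolynomial.eval (algebraMap Fq k ∘ g) H = 0).card : ℝ) * q ≤ E * q ^ n := by
      rw [hq]; exact_mod_cast hsz
    have hsq : 1 ≤ Real.sqrt q := Real.one_le_sqrt.2 hq1
    have h3 : (E : ℝ) * q ^ n ≤ E * q ^ n * Real.sqrt q := le_mul_of_one_le_right (by positivity) hsq
    have h4 : ((Fintype.card Fq ^ n : ℕ) : ℝ) = q ^ n := by rw [hq]; push_cast; rfl
    rw [h4]
    have h5 : (C0 + E) * q ^ n * Real.sqrt q = q ^ n * (C0 * Real.sqrt q) + E * q ^ n * Real.sqrt q := by ring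
    linarith
  rw [hcnt, hβ, hq] at hgoal
  exact hgoal
end
end BH

open Polynomial

/-- the Bateman–Horn statistics for F_q[t], monic case.  For all
`m ≥ 1`, total degrees `d₁,…,d_m` and `n ≥ 3` there is a constant `C` such that for
every finite field `F_q` and all pairwise non-associate irreducible polynomials
`F₁,…,F_m ∈ F_q[t][x]` with `deg F_i = d_i`, `deg_x F_i = r_i > 0`, monic in `x`,
separable over `F_q(t)` (i.e. `F_i ∉ F_q[t][x^p]`), and with `n ≥ sl F_i`, setting
`N_i = r_i n` and letting `μ_i` be the number of irreducible factors of `F_i` over the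
algebraic closure of `F_q`, one has
`|#{f : deg f = n, all F_i(t,f) irreducible} − (∏ μ_i/N_i) q^{n+1}| ≤ C q^{n+1/2}`. -/
theorem bateman_horn_monic (m : ℕ) (hm : 1 ≤ m) (d : Fin m → ℕ) (n : ℕ) (hn : 3 ≤ n) :
    ∃ C : ℝ, ∀ (Fq : Type) [Field Fq] [Fintype Fq],
      ∀ F : Fin m → Polynomial (Polynomial Fq),
        (∀ i, totalDeg (F i) = d i) →
        (∀ i, 0 < (F i).natDegree) →
        (∀ i j, i ≠ j → ¬ Associated (F i) (F j)) →
        (∀ i, Irreducible (F i)) →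
        (∀ i, (F i).Monic) →
        (∀ i, ∀ G : Polynomial (Polynomial Fq),
          F i ≠ G.comp (Polynomial.X ^ ringChar Fq)) →
        (∀ i, slopeX (F i) ≤ ((n : ℚ) : WithBot ℚ)) →
        |(Nat.card {f : Polynomial Fq //
              f.degree = (n : ℕ) ∧ ∀ i, Irreducible (Polynomial.eval f (F i))} : ℝ)
            - (∏ i, ((Multiset.card (UniqueFactorizationMonoid.factors
                  ((F i).map (Polynomial.mapRingHom
                    (algebraMap Fq (AlgebraicClosure Fq)))))) : ℝ) /
                (((F i).natDegree * n : ℕ) : ℝ)) *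
              (Fintype.card Fq : ℝ) ^ (n + 1)|
          ≤ C * (Fintype.card Fq : ℝ) ^ n * Real.sqrt (Fintype.card Fq) := by
  classical
  have hcfg : ∀ x : (Fin m → ℕ) × (Fin m → ℕ), ∃ Cc : ℝ, 0 ≤ Cc ∧ ((∀ i, 1 ≤ x.1 i) → (∀ i, 2 ≤ x.2 i) → ∀ (Fq k : Type) [Field Fq] [Fintype Fq] [Field k] [IsAlgClosed k] [Algebra Fq k]
    (φ : k →+* k), (∀ x, φ x = x ^ Fintype.card Fq) → ∀ (F : Fin m → Fq[X][X]) (G : BH.Kb x.1 → k[X][X]),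
    (∀ i, (F i).map (mapRingHom (algebraMap Fq k)) = ∏ j, G ⟨i, j⟩) → (∀ j, (G j).Monic) → (∀ j, Irreducible (G j)) → (∀ j, derivative (G j) ≠ 0) → (∀ i j, G i ∣ G j → i = j) →
    (∀ j, BH.WB n (n * (G j).natDegree) (G j)) → (∀ j, BH.Nb x.1 x.2 j = n * (G j).natDegree) →
    (∀ kk, (G kk).map (mapRingHom φ) = G (BH.rot kk)) →
    |(Nat.card {f : Fq[X] // f.degree = (n : ℕ) ∧ ∀ i, Irreducible ((F i).eval f)} : ℝ) - (∏ i, ((x.2 i : ℝ))⁻¹) * (Fintype.card Fq : ℝ) ^ (n + 1)| ≤ Cc * (Fintype.card Fq : ℝ) ^ n * Real.sqrt (Fintype.card Fq)) := by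
    intro x
    by_cases h : (∀ i, 1 ≤ x.1 i) ∧ (∀ i, 2 ≤ x.2 i)
    · obtain ⟨Cc, h0, h1⟩ := BH.count_cfg n hn x.1 x.2 h.1 h.2
      exact ⟨Cc, h0, fun _ _ => h1⟩
    · exact ⟨0, le_rfl, fun h1 h2 => absurd ⟨h1, h2⟩ h⟩
  choose Cf hCf0 hCf using hcfg
  obtain ⟨S, hS⟩ : ∃ S : Finset ((Fin m → ℕ) × (Fin m → ℕ)), S = (Fintype.piFinset fun i => Finset.range (d i + 1)) ×ˢ (Fintype.piFinset fun i => Finset.range (n * d i + 1)) := ⟨_, rfl⟩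
  refine ⟨∑ x ∈ S, Cf x, ?_⟩
  intro Fq _ _ F htd hnd0 hna hirr hmon hsep hsl
  obtain ⟨p, hp⟩ := CharP.exists Fq
  obtain ⟨e, hpp, hq⟩ := FiniteField.card Fq p
  haveI : CharP (AlgebraicClosure Fq) p := charP_of_injective_algebraMap (algebraMap Fq (AlgebraicClosure Fq)).injective p
  haveI : ExpChar (AlgebraicClosure Fq) p := ExpChar.prime hpp
  obtain ⟨φ, hφ⟩ : ∃ φ : AlgebraicClosure Fq ≃+* AlgebraicClosure Fq, ∀ x, φ x = x ^ Fintype.card Fq := by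
    refine ⟨RingEquiv.ofBijective (iterateFrobenius (AlgebraicClosure Fq) p e) ⟨(iterateFrobenius (AlgebraicClosure Fq) p e).injective, ?_⟩, ?_⟩
    · intro y
      obtain ⟨z, hz⟩ := IsAlgClosed.exists_pow_nat_eq y (n := Fintype.card Fq) Fintype.card_pos
      exact ⟨z, by rw [iterateFrobenius_def, ← hq, hz]⟩
    · intro x
      change iterateFrobenius (AlgebraicClosure Fq) p e x = _
      rw [iterateFrobenius_def, hq]
  have hder : ∀ i, derivative (F i) ≠ 0 := by
    intro i h
    haveI : CharP Fq (ringChar Fq) := ringChar.charP Fq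
    have hr : ringChar Fq ≠ 0 := by
      rw [CharP.eq Fq (ringChar.charP Fq) hp]; exact hpp.ne_zero
    refine hsep i (contract (ringChar Fq) (F i)) ?_
    rw [← expand_eq_comp_X_pow, expand_contract (ringChar Fq) h hr]
  have hdec := fun i => BH.decomp φ hφ (F i) (hmon i) (hirr i) (hder i) (hnd0 i)
  choose μ hμ1 hμc G hG hGinj hGprod hGdvd using hdec
  have hj0 : ∀ i, ∃ s, ∀ j, (G i j).natDegree = s := by
    intro i
    refine ⟨(G i ⟨0, hμ1 i⟩).natDegree, fun j => ?_⟩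
    have h1 := (hG i j).2.2.2.2
    have h2 := (hG i ⟨0, hμ1 i⟩).2.2.2.2
    have h3 : μ i * (G i j).natDegree = μ i * (G i ⟨0, hμ1 i⟩).natDegree := by rw [← h1, ← h2]
    exact Nat.eq_of_mul_eq_mul_left (hμ1 i) h3
  choose s hs using hj0
  have hrs : ∀ i, (F i).natDegree = μ i * s i := fun i => by
    have := (hG i ⟨0, hμ1 i⟩).2.2.2.2
    rwa [hs] at this
  have hs1 : ∀ i, 1 ≤ s i := by
    intro i
    by_contra h
    have h0 : s i = 0 := by omega
    have := hnd0 i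
    rw [hrs, h0] at this
    omega
  have hrd : ∀ i, (F i).natDegree ≤ d i := by
    intro i
    rw [← htd i, totalDeg]
    have := Finset.le_sup (f := fun j => j + ((F i).coeff j).natDegree) (Finset.self_mem_range_succ (F i).natDegree)
    omega
  have hmem : ((μ, fun i => n * s i) : (Fin m → ℕ) × (Fin m → ℕ)) ∈ S := by
    rw [hS, Finset.mem_product, Fintype.mem_piFinset, Fintype.mem_piFinset]
    constructor
    · intro i
      rw [Finset.mem_range]
      have h1 := hrd i
      rw [hrs] at h1
      have h2 : μ i * 1 ≤ μ i * s i := Nat.mul_le_mul_left _ (hs1 i)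
      change μ i < _
      omega
    · intro i
      rw [Finset.mem_range]
      have h1 := hrd i
      rw [hrs] at h1
      have h2 : 1 * s i ≤ μ i * s i := Nat.mul_le_mul_right _ (hμ1 i)
      have h3 : n * s i ≤ n * d i := Nat.mul_le_mul_left _ (by omega)
      change n * s i < _
      omega
  have hiinj : Function.Injective (mapRingHom (algebraMap Fq (AlgebraicClosure Fq))) := map_injective _ (algebraMap Fq (AlgebraicClosure Fq)).injective
  have hdF : ∀ i j, G i j ∣ (F i).map (mapRingHom (algebraMap Fq (AlgebraicClosure Fq))) := by
    intro i j
    rw [hGprod i]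
    exact Finset.dvd_prod_of_mem _ (Finset.mem_univ j)
  have main := hCf (μ, fun i => n * s i) hμ1 (fun i => by
      change 2 ≤ n * s i
      have : 3 * 1 ≤ n * s i := Nat.mul_le_mul hn (hs1 i)
      omega) Fq (AlgebraicClosure Fq) (φ : AlgebraicClosure Fq →+* AlgebraicClosure Fq) hφ F (fun kk => G kk.1 kk.2) hGprod (fun kk => (hG kk.1 kk.2).1) (fun kk => (hG kk.1 kk.2).2.1)
      (fun kk => (hG kk.1 kk.2).2.2.1) ?_ ?_ (fun kk => by
        change n * s kk.1 = _
        rw [hs]) (fun kk => (hG kk.1 kk.2).2.2.2.1)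
  · have hprod : (∏ i, ((Multiset.card (UniqueFactorizationMonoid.factors
                  ((F i).map (Polynomial.mapRingHom
                    (algebraMap Fq (AlgebraicClosure Fq)))))) : ℝ) /
                (((F i).natDegree * n : ℕ) : ℝ)) = ∏ i, (((n * s i : ℕ) : ℝ))⁻¹ := by
      refine Finset.prod_congr rfl fun i _ => ?_
      rw [← hμc i, hrs i]
      have h1 : (0:ℝ) < μ i := by exact_mod_cast hμ1 i
      have h2 : (0:ℝ) < s i := by exact_mod_cast hs1 i
      have h3 : (0:ℝ) < n := by exact_mod_cast (by omega : 0 < n)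
      push_cast
      field_simp
    rw [hprod]
    refine main.trans ?_
    refine mul_le_mul_of_nonneg_right (mul_le_mul_of_nonneg_right ?_ (by positivity)) (Real.sqrt_nonneg _)
    exact Finset.single_le_sum (fun x _ => hCf0 x) hmem
  · rintro ⟨i, j⟩ ⟨i', j'⟩ h
    have hij : F i ∣ F i' := hGdvd i (F i') j (h.trans (hdF i' j'))
    have hii : i = i' := by
      by_contra hne
      exact hna i i' hne (((hirr i').dvd_iff.1 hij).resolve_left (hirr i).not_isUnit).symm
    subst hii
    have := hGinj i (BH.monic_dvd_eq (hG i j).1 (hG i j').1 (hG i j).2.1 (hG i j').2.1 h)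
    rw [this]
  · rintro ⟨i, j⟩
    have hw : BH.WB n (n * ((F i).map (mapRingHom (algebraMap Fq (AlgebraicClosure Fq)))).natDegree) ((F i).map (mapRingHom (algebraMap Fq (AlgebraicClosure Fq)))) := by
      rw [natDegree_map_eq_of_injective hiinj]
      intro a c hac
      refine BH.WB_slope (F i) (hmon i) n (hsl i) a c ?_
      intro h0
      apply hac
      rw [coeff_map, coe_mapRingHom, coeff_map, h0, map_zero]
    have hm' : (∏ j' ∈ Finset.univ.erase j, G i j').Monic := monic_prod_of_monic _ _ (fun j' _ => (hG i j').1)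
    rw [hGprod i, ← Finset.mul_prod_erase Finset.univ (G i) (Finset.mem_univ j)] at hw
    exact BH.WB_of_mul (hG i j).1 hm' hw
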